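/- For every ε > 0 there exists a constant C = C(ε) such that for all real X ≥ 2, the sum of h_3(d)^4 over squarefree integers d with 1 < d < X is at most C · X^{11/6 + ε}. -/

import Mathlib

/-- The real quadratic field `ℚ(√d)`, realized as the subfield of `ℝ`
generated over `ℚ` by `√d`. -/
noncomputable def Kpos (d : ℕ) : IntermediateField ℚ ℝ :=
  IntermediateField.adjoin ℚ {Real.sqrt d}

/-- `hpos g d` is the `g`-part of the class number of `ℚ(√d)`: the number of
ideal classes `c` of the ring of integers of `ℚ(√d)` with `c ^ g = 1`. -/
noncomputable def hpos (g d : ℕ) : ℕ :=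
  Nat.card {c : ClassGroup (NumberField.RingOfIntegers (Kpos d)) // c ^ g = 1}

section

theorem cubRoot_poly_degree {F : Type*} [Field F] :
    (Polynomial.X ^ 2 + Polynomial.X + 1 : Polynomial F).degree ≠ 0 := by
  have : (Polynomial.X ^ 2 + Polynomial.X + 1 : Polynomial F).degree = 2 := by compute_degree!
  rw [this]; decide

/-- A primitive cube root of unity in an algebraic closure of `𝔽_q`. -/
noncomputable def cubRoot (q : ℕ) [Fact q.Prime] : AlgebraicClosure (ZMod q) :=
  (IsAlgClosed.exists_root (Polynomial.X ^ 2 + Polynomial.X + 1 :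
    Polynomial (AlgebraicClosure (ZMod q))) cubRoot_poly_degree).choose

theorem cubRoot_eq (q : ℕ) [Fact q.Prime] : cubRoot q ^ 2 + cubRoot q + 1 = 0 := by
  have := (IsAlgClosed.exists_root (Polynomial.X ^ 2 + Polynomial.X + 1 :
    Polynomial (AlgebraicClosure (ZMod q))) cubRoot_poly_degree).choose_spec
  simpa [Polynomial.IsRoot, cubRoot] using this

theorem cubRoot_pow_three (q : ℕ) [Fact q.Prime] : cubRoot q ^ 3 = 1 := by
  linear_combination (cubRoot q - 1) * cubRoot_eq q

theorem natCast_closure_eq_zero (q n : ℕ) [Fact q.Prime] :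
    (n : AlgebraicClosure (ZMod q)) = 0 ↔ q ∣ n := CharP.cast_eq_zero_iff _ q n

theorem intCast_closure_eq_zero (q : ℕ) [Fact q.Prime] (n : ℤ) :
    (n : AlgebraicClosure (ZMod q)) = 0 ↔ (q : ℤ) ∣ n := CharP.intCast_eq_zero_iff _ q n

theorem three_ne_zero_closure (q : ℕ) [hq : Fact q.Prime] (h3 : q ≠ 3) :
    (3 : AlgebraicClosure (ZMod q)) ≠ 0 := by
  have := (natCast_closure_eq_zero q 3).not
  push_cast at this
  refine this.2 fun h => ?_
  exact h3 ((Nat.prime_dvd_prime_iff_eq hq.out Nat.prime_three).1 h)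

theorem cubRoot_primitive (q : ℕ) [hq : Fact q.Prime] (h3 : q ≠ 3) :
    IsPrimitiveRoot (cubRoot q) 3 := by
  have := Fact.mk Nat.prime_three
  apply IsPrimitiveRoot.of_map_of_injective (f := MonoidHom.id _) _ (fun _ _ h => h)
  rw [MonoidHom.id_apply, ← orderOf_eq_prime (x := cubRoot q) (p := 3) (cubRoot_pow_three q)]
  · exact IsPrimitiveRoot.orderOf _
  · intro h
    have h2 := cubRoot_eq q
    rw [h] at h2
    apply three_ne_zero_closure q h3
    linear_combination h2

/-- The power whose value determines the cubic residue symbol of `A + Bω` at `q`. -/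
noncomputable def cubPow (q : ℕ) [Fact q.Prime] (A B : ℤ) : AlgebraicClosure (ZMod q) :=
  ((A + B * cubRoot q) / (A + B * cubRoot q ^ 2)) ^ ((q + 1) / 3)

open Classical in
/-- The logarithm with respect to `cubRoot q ^ q`. -/
noncomputable def cubLog (q : ℕ) [Fact q.Prime] (t : AlgebraicClosure (ZMod q)) : ZMod 3 :=
  if h : ∃ n : ℕ, t = cubRoot q ^ (q * n) then (h.choose : ZMod 3) else 0

open Classical in
/-- The logarithm of the cubic residue symbol of `(A + Bω) / (A + Bω²)` at the prime `q`. -/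
noncomputable def cubSym (q : ℕ) (A B : ℤ) : ZMod 3 :=
  if h : q.Prime then
    haveI := Fact.mk h
    cubLog q (cubPow q A B)
  else 0

theorem cubRoot_norm (q : ℕ) [Fact q.Prime] (A B : ℤ) :
    ((A : AlgebraicClosure (ZMod q)) + B * cubRoot q) * (A + B * cubRoot q ^ 2)
      = ((A ^ 2 - A * B + B ^ 2 : ℤ) : AlgebraicClosure (ZMod q)) := by
  push_cast
  linear_combination (A * B : AlgebraicClosure (ZMod q)) * cubRoot_eq q +
    (B : AlgebraicClosure (ZMod q)) ^ 2 * cubRoot_pow_three q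

theorem cubRoot_factor_ne_zero (q : ℕ) [Fact q.Prime] {A B : ℤ}
    (h : ¬ (q : ℤ) ∣ A ^ 2 - A * B + B ^ 2) :
    ((A : AlgebraicClosure (ZMod q)) + B * cubRoot q) ≠ 0 ∧
      ((A : AlgebraicClosure (ZMod q)) + B * cubRoot q ^ 2) ≠ 0 := by
  rw [← intCast_closure_eq_zero, ← cubRoot_norm] at h
  exact mul_ne_zero_iff.1 h

theorem add_cubRoot_pow_char (q : ℕ) [Fact q.Prime] (A B : ℤ)
    (z : AlgebraicClosure (ZMod q)) :
    ((A : AlgebraicClosure (ZMod q)) + B * z) ^ q = A + B * z ^ q := by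
  have h : ∀ n : ℤ, (n : AlgebraicClosure (ZMod q)) ^ q = n := fun n => by
    have : ((n : ZMod q)) ^ q = n := ZMod.pow_card _
    have := congrArg (algebraMap (ZMod q) (AlgebraicClosure (ZMod q))) this
    rwa [map_pow, map_intCast] at this
  rw [add_pow_char, mul_pow, h, h]

theorem prime_mod_three {q : ℕ} (hq : q.Prime) (h3 : q ≠ 3) : q % 3 = 1 ∨ q % 3 = 2 := by
  have : ¬ 3 ∣ q := fun h => h3 ((Nat.prime_dvd_prime_iff_eq Nat.prime_three hq).1 h).symm
  omega

theorem cubPow_pow_three (q : ℕ) [hq : Fact q.Prime] (h3 : q ≠ 3) {A B : ℤ}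
    (h : ¬ (q : ℤ) ∣ A ^ 2 - A * B + B ^ 2) : cubPow q A B ^ 3 = 1 := by
  obtain ⟨h1, h2⟩ := cubRoot_factor_ne_zero q h
  have hw := cubRoot_pow_three q
  rw [cubPow, ← pow_mul]
  rcases prime_mod_three hq.out h3 with hm | hm
  · have e1 : cubRoot q ^ q = cubRoot q := by
      rw [pow_eq_pow_mod q hw, hm, pow_one]
    have e2 : (cubRoot q ^ 2) ^ q = cubRoot q ^ 2 := by rw [← pow_mul, mul_comm, pow_mul, e1]
    have : (q + 1) / 3 * 3 + 1 = q := by omega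
    have key : ((A + B * cubRoot q) / (A + B * cubRoot q ^ 2)) ^ q
        = (A + B * cubRoot q) / (A + B * cubRoot q ^ 2) := by
      rw [div_pow, add_cubRoot_pow_char, add_cubRoot_pow_char, e1, e2]
    apply mul_right_cancel₀ (div_ne_zero h1 h2)
    rw [← pow_succ, this, key, one_mul]
  · have e1 : cubRoot q ^ q = cubRoot q ^ 2 := by
      rw [pow_eq_pow_mod q hw, hm]
    have e2 : (cubRoot q ^ 2) ^ q = cubRoot q := by
      rw [← pow_mul, mul_comm, pow_mul, e1]; linear_combination cubRoot q * hw
    have : (q + 1) / 3 * 3 = q + 1 := by omega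
    rw [this, pow_succ, div_pow, add_cubRoot_pow_char, add_cubRoot_pow_char, e1, e2]
    field_simp

theorem cubRoot_pow_eq_pow (q : ℕ) [hq : Fact q.Prime] (h3 : q ≠ 3) {n m : ℕ} :
    cubRoot q ^ n = cubRoot q ^ m ↔ n % 3 = m % 3 := by
  have hw := cubRoot_pow_three q
  rw [pow_eq_pow_mod n hw, pow_eq_pow_mod m hw]
  exact ⟨fun h => (cubRoot_primitive q h3).pow_inj (Nat.mod_lt _ (by norm_num))
    (Nat.mod_lt _ (by norm_num)) h, fun h => by rw [h]⟩

theorem cubRoot_pow_inj (q : ℕ) [hq : Fact q.Prime] (h3 : q ≠ 3) {n m : ℕ} :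
    cubRoot q ^ (q * n) = cubRoot q ^ (q * m) ↔ (n : ZMod 3) = m := by
  rw [cubRoot_pow_eq_pow q h3, ZMod.natCast_eq_natCast_iff']
  rcases prime_mod_three hq.out h3 with hm | hm <;> simp [Nat.mul_mod, hm] <;> omega

theorem cubPow_eq_iff (q : ℕ) [hq : Fact q.Prime] (h3 : q ≠ 3) {A B : ℤ}
    (h : ¬ (q : ℤ) ∣ A ^ 2 - A * B + B ^ 2) (n : ℕ) :
    cubPow q A B = cubRoot q ^ (q * n) ↔ cubSym q A B = n := by
  have hex : ∃ n : ℕ, cubPow q A B = cubRoot q ^ (q * n) := by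
    obtain ⟨i, hi, he⟩ := (cubRoot_primitive q h3).eq_pow_of_pow_eq_one (cubPow_pow_three q h3 h)
    rcases prime_mod_three hq.out h3 with hm | hm
    · refine ⟨i, ?_⟩
      rw [← he, cubRoot_pow_eq_pow q h3]
      simp [Nat.mul_mod, hm]
    · refine ⟨2 * i, ?_⟩
      rw [← he, cubRoot_pow_eq_pow q h3]
      rw [Nat.mul_mod, hm]; omega
  have h1 : cubSym q A B = (hex.choose : ZMod 3) := by
    rw [cubSym, dif_pos hq.out, cubLog, dif_pos hex]
  rw [h1, ← cubRoot_pow_inj q h3]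
  have hc := hex.choose_spec
  generalize hex.choose = m at hc
  rw [hc]

theorem cubSym_mul {q : ℕ} (hq : q.Prime) (h3 : q ≠ 3) {A B C D E F : ℤ}
    (h : ¬ (q : ℤ) ∣ A ^ 2 - A * B + B ^ 2) (h' : ¬ (q : ℤ) ∣ C ^ 2 - C * D + D ^ 2)
    (hE : E = A * C - B * D) (hF : F = A * D + B * C - B * D) :
    cubSym q E F = cubSym q A B + cubSym q C D := by
  have := Fact.mk hq
  subst hE hF
  have hn : ¬ (q : ℤ) ∣ (A * C - B * D) ^ 2 - (A * C - B * D) * (A * D + B * C - B * D) +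
      (A * D + B * C - B * D) ^ 2 := by
    rw [show (A * C - B * D) ^ 2 - (A * C - B * D) * (A * D + B * C - B * D) +
      (A * D + B * C - B * D) ^ 2 = (A ^ 2 - A * B + B ^ 2) * (C ^ 2 - C * D + D ^ 2) by ring]
    intro hd
    rcases (Nat.prime_iff_prime_int.1 hq).dvd_or_dvd hd with h1 | h1
    exacts [h h1, h' h1]
  have e1 : cubPow q A B = cubRoot q ^ (q * (cubSym q A B).val) :=
    (cubPow_eq_iff q h3 h _).2 (by simp)
  have e2 : cubPow q C D = cubRoot q ^ (q * (cubSym q C D).val) :=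
    (cubPow_eq_iff q h3 h' _).2 (by simp)
  have := (cubPow_eq_iff q h3 hn ((cubSym q A B).val + (cubSym q C D).val)).1 (by
    rw [mul_add, pow_add, ← e1, ← e2]
    simp only [cubPow, ← mul_pow]
    congr 1
    rw [div_mul_div_comm]
    have hw := cubRoot_eq q
    have hw3 := cubRoot_pow_three q
    congr 1
    · push_cast
      linear_combination -(B * D : AlgebraicClosure (ZMod q)) * hw
    · push_cast
      linear_combination -(B * D : AlgebraicClosure (ZMod q)) * hw -
        (B * D : AlgebraicClosure (ZMod q)) * cubRoot q * hw3)
  rw [this]; simp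

/-- A rational element has trivial symbol. -/
theorem cubSym_of_dvd {q : ℕ} (hq : q.Prime) (h3 : q ≠ 3) {A B : ℤ}
    (h : ¬ (q : ℤ) ∣ A ^ 2 - A * B + B ^ 2) (hB : (q : ℤ) ∣ B) : cubSym q A B = 0 := by
  have := Fact.mk hq
  have := (cubPow_eq_iff q h3 h 0).1 (by
    obtain ⟨h1, h2⟩ := cubRoot_factor_ne_zero q h
    have hB' := (intCast_closure_eq_zero q B).2 hB
    rw [hB'] at h1
    simp only [cubPow, hB']
    simp only [zero_mul, add_zero] at h1 ⊢
    rw [div_self h1]; simp)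
  simpa using this

/-- `A + B√-3 = (A + B) + 2Bω`; a rational multiple of `√-3` has trivial symbol. -/
theorem cubSym_sqrt_neg_three {q : ℕ} (hq : q.Prime) (h3 : q ≠ 3) : cubSym q 1 2 = 0 := by
  have := Fact.mk hq
  have h : ¬ (q : ℤ) ∣ 1 ^ 2 - 1 * 2 + 2 ^ 2 := by
    norm_num
    intro h
    exact h3 ((Nat.prime_dvd_prime_iff_eq hq Nat.prime_three).1 (by exact_mod_cast h))
  have := (cubPow_eq_iff q h3 h 0).1 (by
    obtain ⟨h1, h2⟩ := cubRoot_factor_ne_zero q h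
    have hh := cubPow_pow_three q h3 h
    have hr : (((1 : ℤ) : AlgebraicClosure (ZMod q)) + (2 : ℤ) * cubRoot q) /
        (((1 : ℤ) : AlgebraicClosure (ZMod q)) + (2 : ℤ) * cubRoot q ^ 2) = -1 := by
      rw [div_eq_iff h2]
      push_cast
      linear_combination 2 * cubRoot_eq q
    rw [cubPow, hr] at hh ⊢
    rcases neg_one_pow_eq_or (AlgebraicClosure (ZMod q)) ((q + 1) / 3) with h | h
    · rw [h]; simp
    · rw [h] at hh ⊢
      simpa using (by linear_combination hh : (-1 : AlgebraicClosure (ZMod q)) = 1))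
  simpa using this

theorem cubSym_conj {q : ℕ} (hq : q.Prime) (h3 : q ≠ 3) {A B : ℤ}
    (h : ¬ (q : ℤ) ∣ A ^ 2 - A * B + B ^ 2) : cubSym q (A - B) (-B) = -cubSym q A B := by
  have h' : ¬ (q : ℤ) ∣ (A - B) ^ 2 - (A - B) * (-B) + (-B) ^ 2 := by
    rwa [show (A - B) ^ 2 - (A - B) * (-B) + (-B) ^ 2 = A ^ 2 - A * B + B ^ 2 by ring]
  have e := cubSym_mul hq h3 h h' rfl rfl
  rw [cubSym_of_dvd hq h3 _ ⟨0, by ring⟩] at e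
  · linear_combination -e
  · ring_nf
    intro hd
    have : (q : ℤ) ∣ (A ^ 2 - A * B + B ^ 2) ^ 2 := by convert hd using 1; ring
    exact h ((Nat.prime_iff_prime_int.1 hq).dvd_of_dvd_pow this)

theorem cubSym_congr {q : ℕ} {A B A' B' : ℤ} (hA : (q : ℤ) ∣ A - A') (hB : (q : ℤ) ∣ B - B') :
    cubSym q A B = cubSym q A' B' := by
  by_cases hq : q.Prime
  · have := Fact.mk hq
    have e1 : (A : AlgebraicClosure (ZMod q)) = A' := by
      rw [← sub_eq_zero, ← Int.cast_sub, intCast_closure_eq_zero]; exact hA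
    have e2 : (B : AlgebraicClosure (ZMod q)) = B' := by
      rw [← sub_eq_zero, ← Int.cast_sub, intCast_closure_eq_zero]; exact hB
    have : cubPow q A B = cubPow q A' B' := by simp only [cubPow, e1, e2]
    simp only [cubSym, dif_pos hq, this]
  · simp [cubSym, hq]

end

section

/-- The homomorphism `ℤ/3 → Fˣ` given by a cube root of unity. -/
def rootHom {F : Type*} [Field F] (w : F) (hw : w ^ 2 + w + 1 = 0) :
    Multiplicative (ZMod 3) →* Fˣ where
  toFun k := (Units.mk w (w ^ 2) (by linear_combination (w - 1) * hw)
    (by linear_combination (w - 1) * hw)) ^ (Multiplicative.toAdd k).val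
  map_one' := by simp
  map_mul' x y := by
    rw [toAdd_mul, ZMod.val_add, ← pow_add, ← pow_eq_pow_mod]
    ext; simp; linear_combination (w - 1) * hw

/-- The cubic character with values in `F` attached to a logarithm modulo `3`. -/
noncomputable def cubChar {p : ℕ} {F : Type*} [Field F] (w : F) (hw : w ^ 2 + w + 1 = 0)
    (ℓ : (ZMod p)ˣ →* Multiplicative (ZMod 3)) : MulChar (ZMod p) F :=
  MulChar.ofUnitHom ((rootHom w hw).comp ℓ)

theorem cubChar_unit {p : ℕ} {F : Type*} [Field F] (w : F) (hw : w ^ 2 + w + 1 = 0)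
    (ℓ : (ZMod p)ˣ →* Multiplicative (ZMod 3)) (u : (ZMod p)ˣ) :
    cubChar w hw ℓ u = w ^ (Multiplicative.toAdd (ℓ u)).val := by
  simp [cubChar, rootHom]

theorem sq_root_eq {F : Type*} [Field F] {w : F} (hw : w ^ 2 + w + 1 = 0) :
    (w ^ 2) ^ 2 + w ^ 2 + 1 = 0 := by linear_combination (w ^ 2 - w + 1) * hw

theorem cubChar_sq {p : ℕ} {F : Type*} [Field F] (w : F) (hw : w ^ 2 + w + 1 = 0)
    (ℓ : (ZMod p)ˣ →* Multiplicative (ZMod 3)) :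
    cubChar w hw ℓ ^ 2 = cubChar (w ^ 2) (sq_root_eq hw) ℓ := by
  ext u
  rw [MulChar.pow_apply_coe, cubChar_unit, cubChar_unit, ← pow_mul, ← pow_mul, mul_comm]

theorem cubChar_pow_three {p : ℕ} {F : Type*} [Field F] (w : F) (hw : w ^ 2 + w + 1 = 0)
    (ℓ : (ZMod p)ˣ →* Multiplicative (ZMod 3)) : cubChar w hw ℓ ^ 3 = 1 := by
  ext u
  rw [MulChar.pow_apply_coe, cubChar_unit, ← pow_mul, mul_comm, pow_mul,
    show w ^ 3 = 1 by linear_combination (w - 1) * hw]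
  simp

theorem cubChar_ne_one {p : ℕ} {F : Type*} [Field F] (w : F) (hw : w ^ 2 + w + 1 = 0)
    (h3 : (3 : F) ≠ 0) (ℓ : (ZMod p)ˣ →* Multiplicative (ZMod 3))
    (hℓ : ∃ u, ℓ u = Multiplicative.ofAdd 1) : cubChar w hw ℓ ≠ 1 := by
  intro h
  obtain ⟨u, hu⟩ := hℓ
  have := cubChar_unit w hw ℓ u
  rw [h, hu] at this
  simp [ZMod.val_one] at this
  rw [← this] at hw
  apply h3; linear_combination hw

section Jacobi

variable {p : ℕ} [Fact p.Prime] (ℓ : (ZMod p)ˣ →* Multiplicative (ZMod 3))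

open Classical in
/-- The logarithm of `x (1 - x)`. -/
noncomputable def jacLog (x : ZMod p) : ZMod 3 :=
  if h : IsUnit x ∧ IsUnit (1 - x) then
    Multiplicative.toAdd (ℓ h.1.unit) + Multiplicative.toAdd (ℓ h.2.unit) else 0

open Classical in
/-- First coordinate of the cubic Jacobi sum in the basis `1, ω`. -/
noncomputable def jacFst : ℤ :=
  ∑ x : ZMod p, if IsUnit x ∧ IsUnit (1 - x) then
    (if jacLog ℓ x = 0 then 1 else if jacLog ℓ x = 1 then 0 else -1) else 0

open Classical in
/-- Second coordinate of the cubic Jacobi sum in the basis `1, ω`. -/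
noncomputable def jacSnd : ℤ :=
  ∑ x : ZMod p, if IsUnit x ∧ IsUnit (1 - x) then
    (if jacLog ℓ x = 0 then 0 else if jacLog ℓ x = 1 then 1 else -1) else 0

theorem jacobiSum_cubChar {F : Type*} [Field F] (w : F) (hw : w ^ 2 + w + 1 = 0) :
    jacobiSum (cubChar w hw ℓ) (cubChar w hw ℓ) = jacFst ℓ + jacSnd ℓ * w := by
  rw [jacFst, jacSnd, jacobiSum]
  push_cast
  rw [Finset.sum_mul, ← Finset.sum_add_distrib]
  refine Finset.sum_congr rfl fun x _ => ?_
  by_cases h : IsUnit x ∧ IsUnit (1 - x)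
  · have e : cubChar w hw ℓ x * cubChar w hw ℓ (1 - x) = w ^ (jacLog ℓ x).val := by
      rw [jacLog, dif_pos h, ZMod.val_add, ← pow_eq_pow_mod _
        (show w ^ 3 = 1 by linear_combination (w - 1) * hw), pow_add]
      rw [← cubChar_unit w hw, ← cubChar_unit w hw]
      simp
    rw [e, if_pos h, if_pos h]
    generalize jacLog ℓ x = k
    obtain h | h | h : k = 0 ∨ k = 1 ∨ k = 2 := by decide +revert
    · subst h; simp
    · subst h; simp [ZMod.val_one]
    · subst h
      rw [show (2 : ZMod 3).val = 2 from rfl, if_neg (by decide), if_neg (by decide),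
        if_neg (by decide), if_neg (by decide)]
      push_cast
      linear_combination hw
  · rw [if_neg h, if_neg h]
    rcases not_and_or.1 h with h | h
    · rw [MulChar.map_nonunit _ h]; simp
    · rw [MulChar.map_nonunit _ h]; simp

/-- The Frobenius computation for cubic Gauss sums. -/
theorem jacobi_pow_char {q : ℕ} [hq : Fact q.Prime] (h3 : q ≠ 3) (hqp : q ≠ p)
    {w : AlgebraicClosure (ZMod q)} (hw : w ^ 2 + w + 1 = 0)
    (hℓ : ∃ u, ℓ u = Multiplicative.ofAdd 1) (u : (ZMod p)ˣ) (hu : (u : ZMod p) = q)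
    {ψ : AddChar (ZMod p) (AlgebraicClosure (ZMod q))} (hψ : ψ.IsPrimitive) :
    ((p : AlgebraicClosure (ZMod q)) * (jacFst ℓ + jacSnd ℓ * w)) ^ ((q + 1) / 3) *
      w ^ (q * (Multiplicative.toAdd (ℓ u)).val) = if q % 3 = 1 then 1 else
        gaussSum (cubChar w hw ℓ) ψ * gaussSum (cubChar (w ^ 2) (sq_root_eq hw) ℓ) ψ := by
  set χ := cubChar w hw ℓ with hχ
  have hne : χ ≠ 1 := cubChar_ne_one w hw (three_ne_zero_closure q h3) ℓ hℓ
  have h33 : χ ^ 3 = 1 := cubChar_pow_three w hw ℓ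
  have hw3 : w ^ 3 = 1 := by linear_combination (w - 1) * hw
  have hord : orderOf χ = 3 := by
    have := Fact.mk Nat.prime_three
    exact orderOf_eq_prime h33 hne
  have hneg : χ (-1) = 1 := by
    have : χ (-1) = (χ ^ 3) (-1) := by
      rw [MulChar.pow_apply' _ (by norm_num), ← map_pow]; norm_num
    rw [this, h33, MulChar.one_apply (by simp)]
  have hcube : gaussSum χ ψ ^ 3 = p * (jacFst ℓ + jacSnd ℓ * w) := by
    have := gaussSum_pow_eq_prod_jacobiSum (χ := χ) (by omega) hψ
    rw [hord, hneg, ZMod.card] at this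
    simpa [jacobiSum_cubChar, hχ] using this
  have hpne : (p : AlgebraicClosure (ZMod q)) ≠ 0 := by
    rw [Ne, natCast_closure_eq_zero, Nat.prime_dvd_prime_iff_eq hq.out Fact.out]
    exact hqp
  have hg0 : gaussSum χ ψ ≠ 0 :=
    gaussSum_ne_zero_of_nontrivial (by rw [ZMod.card]; exact hpne) hne hψ
  have hfrob : gaussSum χ ψ ^ q * w ^ (q * (Multiplicative.toAdd (ℓ u)).val) =
      gaussSum (χ ^ q) ψ := by
    rw [gaussSum_frob q, AddChar.pow_mulShift, ← hu, gaussSum_mulShift_eq]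
    have : w ^ (q * (Multiplicative.toAdd (ℓ u)).val) = (χ ^ q) u := by
      rw [MulChar.pow_apply_coe, hχ, cubChar_unit, ← pow_mul, mul_comm]
    rw [this, mul_right_comm, ← MulChar.mul_apply, inv_mul_cancel, MulChar.one_apply u.isUnit,
      one_mul]
  rw [← hcube, ← pow_mul]
  rcases prime_mod_three hq.out h3 with hm | hm
  · rw [if_pos hm]
    have e : χ ^ q = χ := by rw [pow_eq_pow_mod q h33, hm, pow_one]
    rw [e] at hfrob
    apply mul_left_cancel₀ hg0
    rw [← mul_assoc, ← pow_succ', show 3 * ((q + 1) / 3) + 1 = q by omega, hfrob, mul_one]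
  · rw [if_neg (by omega)]
    have e : χ ^ q = cubChar (w ^ 2) (sq_root_eq hw) ℓ := by
      rw [pow_eq_pow_mod q h33, hm, hχ, cubChar_sq]
    rw [e] at hfrob
    rw [show 3 * ((q + 1) / 3) = q + 1 by omega, pow_succ', mul_assoc, hfrob]

theorem cubSym_jacobi {q : ℕ} (hq : q.Prime) (h3 : q ≠ 3) (hqp : q ≠ p)
    (hN : ¬ (q : ℤ) ∣ jacFst ℓ ^ 2 - jacFst ℓ * jacSnd ℓ + jacSnd ℓ ^ 2)
    (hℓ : ∃ u, ℓ u = Multiplicative.ofAdd 1) (u : (ZMod p)ˣ) (hu : (u : ZMod p) = q) :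
    cubSym q (jacFst ℓ) (jacSnd ℓ) = Multiplicative.toAdd (ℓ u) := by
  have := Fact.mk hq
  have hpne : (p : AlgebraicClosure (ZMod q)) ≠ 0 := by
    rw [Ne, natCast_closure_eq_zero, Nat.prime_dvd_prime_iff_eq hq Fact.out]
    exact hqp
  have : NeZero (p : AlgebraicClosure (ZMod q)) := ⟨hpne⟩
  obtain ⟨ζ, hζ⟩ := HasEnoughRootsOfUnity.exists_primitiveRoot (AlgebraicClosure (ZMod q)) p
  have hψ := AddChar.zmodChar_primitive_of_primitive_root p hζ
  set ψ := AddChar.zmodChar p ((IsPrimitiveRoot.iff_def ζ p).mp hζ).left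
  set w := cubRoot q with hwdef
  have hw : w ^ 2 + w + 1 = 0 := cubRoot_eq q
  have hw3 : w ^ 3 = 1 := cubRoot_pow_three q
  have e1 := jacobi_pow_char ℓ h3 hqp hw hℓ u hu hψ
  have e2 := jacobi_pow_char ℓ h3 hqp (sq_root_eq hw) hℓ u hu hψ
  have hw4 : (w ^ 2) ^ 2 = w := by linear_combination w * hw3
  have e3 : gaussSum (cubChar ((w ^ 2) ^ 2) (sq_root_eq (sq_root_eq hw)) ℓ) ψ =
      gaussSum (cubChar w hw ℓ) ψ := by
    congr 1; ext v; simp only [cubChar_unit, hw4]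
  rw [e3, mul_comm (gaussSum (cubChar (w ^ 2) _ ℓ) ψ)] at e2
  obtain ⟨f1, f2⟩ := cubRoot_factor_ne_zero q hN
  have key : cubPow q (jacFst ℓ) (jacSnd ℓ) =
      w ^ (q * (Multiplicative.toAdd (ℓ u)).val) := by
    rw [← e2] at e1
    rw [mul_pow, mul_pow, mul_assoc, mul_assoc] at e1
    have e1 := mul_left_cancel₀ (pow_ne_zero _ hpne) e1
    have hwne : w ≠ 0 := by rintro h; rw [h] at hw3; norm_num at hw3
    rw [cubPow, div_pow, div_eq_iff (pow_ne_zero _ f2)]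
    apply mul_right_cancel₀ (pow_ne_zero (q * (Multiplicative.toAdd (ℓ u)).val) hwne)
    rw [e1, ← pow_mul]
    ring
  rw [(cubPow_eq_iff q h3 hN _).1 key]
  simp

end Jacobi

end

section

theorem exists_cubic_log {p : ℕ} [Fact p.Prime] (h : p % 3 = 1) :
    ∃ ℓ : (ZMod p)ˣ →* Multiplicative (ZMod 3), ∃ u, ℓ u = Multiplicative.ofAdd 1 := by
  obtain ⟨g, hg⟩ := IsCyclic.exists_generator (α := (ZMod p)ˣ)
  have hd : orderOf (Multiplicative.ofAdd (1 : ZMod 3)) ∣ orderOf g := by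
    rw [orderOf_eq_card_of_forall_mem_zpowers hg, Nat.card_eq_fintype_card, ZMod.card_units,
      orderOf_ofAdd_eq_addOrderOf]
    apply addOrderOf_dvd_of_nsmul_eq_zero
    rw [nsmul_one, ZMod.natCast_eq_zero_iff]
    have := (Fact.out : p.Prime).two_le
    omega
  exact ⟨monoidHomOfForallMemZpowers hg hd, g, monoidHomOfForallMemZpowers_apply_gen _ _⟩

theorem eisenstein_coeff_eq {F : Type*} [Field F] [CharZero F] {w : F} (hw : w ^ 2 + w + 1 = 0)
    {a b c d : ℤ} (h : (a : F) + b * w = c + d * w) : a = c ∧ b = d := by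
  have h0 : ((a - c : ℤ) : F) + ((b - d : ℤ) : F) * w = 0 := by push_cast; linear_combination h
  generalize hx : a - c = x at h0
  generalize hy : b - d = y at h0
  have h1 : ((x ^ 2 - x * y + y ^ 2 : ℤ) : F) = 0 := by
    push_cast
    linear_combination (x - y - y * w) * h0 + (y : F) ^ 2 * hw
  have h1 : x ^ 2 - x * y + y ^ 2 = 0 := by exact_mod_cast h1
  have hy0 : y = 0 := by nlinarith [sq_nonneg (2 * x - y), sq_nonneg y]
  have hx0 : x = 0 := by subst hy0; nlinarith
  omega

section Jacobi

variable {p : ℕ} [hp : Fact p.Prime] (ℓ : (ZMod p)ˣ →* Multiplicative (ZMod 3))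

theorem exists_complex_cubRoot : ∃ w : ℂ, w ^ 2 + w + 1 = 0 := by
  simpa [Polynomial.IsRoot] using IsAlgClosed.exists_root (Polynomial.X ^ 2 + Polynomial.X + 1 :
    Polynomial ℂ) cubRoot_poly_degree

theorem jacobi_norm (hℓ : ∃ u, ℓ u = Multiplicative.ofAdd 1) :
    jacFst ℓ ^ 2 - jacFst ℓ * jacSnd ℓ + jacSnd ℓ ^ 2 = p := by
  obtain ⟨w, hw⟩ := exists_complex_cubRoot
  have h3 := cubChar_pow_three w hw ℓ
  have hinv : (cubChar w hw ℓ)⁻¹ = cubChar (w ^ 2) (sq_root_eq hw) ℓ := by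
    rw [← cubChar_sq w hw, inv_eq_iff_mul_eq_one, ← pow_succ', h3]
  have hne := cubChar_ne_one w hw (by norm_num) ℓ hℓ
  have hne2 := cubChar_ne_one _ (sq_root_eq hw) (by norm_num) ℓ hℓ
  have := jacobiSum_mul_jacobiSum_inv (F := ZMod p) (F' := ℂ)
    (by rw [ringChar.eq_zero, ZMod.ringChar_zmod_n]; exact hp.out.ne_zero.symm)
    hne hne (by rw [← pow_two, cubChar_sq]; exact hne2)
  rw [hinv, jacobiSum_cubChar, jacobiSum_cubChar, ZMod.card] at this
  have h : ((jacFst ℓ ^ 2 - jacFst ℓ * jacSnd ℓ + jacSnd ℓ ^ 2 : ℤ) : ℂ) = ((p : ℤ) : ℂ) := by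
    push_cast
    rw [← this]
    linear_combination (-(jacFst ℓ : ℂ) * jacSnd ℓ - (jacSnd ℓ : ℂ) ^ 2 * (w - 1)) * hw
  exact_mod_cast h

theorem jacobi_mod_three (h1 : p % 3 = 1) :
    (3 : ℤ) ∣ jacSnd ℓ ∧ ¬ (3 : ℤ) ∣ jacFst ℓ := by
  obtain ⟨w, hw⟩ := exists_complex_cubRoot
  have h3 := cubChar_pow_three w hw ℓ
  have hw3 : w ^ 3 = 1 := by linear_combination (w - 1) * hw
  have hprim : IsPrimitiveRoot w 3 := by
    have := Fact.mk Nat.prime_three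
    have e := orderOf_eq_prime hw3 (by rintro rfl; norm_num at hw)
    rw [← e]; exact IsPrimitiveRoot.orderOf w
  obtain ⟨z, hz, e⟩ := exists_jacobiSum_eq_neg_one_add (by norm_num) h3 h3
    (by rw [ZMod.card]; omega) hprim
  have hz' : ∃ u v : ℤ, z = u + v * w := by
    clear e
    induction hz using Algebra.adjoin_induction with
    | mem x hx => obtain rfl := Set.mem_singleton_iff.1 hx; exact ⟨0, 1, by simp⟩
    | algebraMap r => exact ⟨r, 0, by simp⟩
    | add x y _ _ hx hy =>
      obtain ⟨a, b, rfl⟩ := hx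
      obtain ⟨c, d, rfl⟩ := hy
      exact ⟨a + c, b + d, by push_cast; ring⟩
    | mul x y _ _ hx hy =>
      obtain ⟨a, b, rfl⟩ := hx
      obtain ⟨c, d, rfl⟩ := hy
      exact ⟨a * c - b * d, a * d + b * c - b * d, by
        push_cast; linear_combination (b : ℂ) * d * hw⟩
  obtain ⟨u, v, rfl⟩ := hz'
  rw [jacobiSum_cubChar] at e
  obtain ⟨ha, hb⟩ := eisenstein_coeff_eq hw (a := jacFst ℓ) (b := jacSnd ℓ)
    (c := -1 + 3 * v) (d := 3 * v - 3 * u) (by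
      rw [e]; push_cast
      linear_combination (u - 3 * (v : ℂ) + v * w) * hw)
  rw [ha, hb]
  exact ⟨⟨v - u, by ring⟩, by omega⟩

end Jacobi

/-- An additive character modulo `N` with values in `ℤ/3`, as a function on the integers. -/
def IsCubicChar (N : ℤ) (X : ℤ → ZMod 3) : Prop :=
  (∀ a b, IsCoprime a N → IsCoprime b N → X (a * b) = X a + X b) ∧
    ∀ a b, N ∣ a - b → X a = X b

theorem IsCubicChar.mono {N M : ℤ} {X : ℤ → ZMod 3} (h : IsCubicChar N X) (hNM : N ∣ M) :
    IsCubicChar M X :=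
  ⟨fun a b ha hb => h.1 a b (ha.of_isCoprime_of_dvd_right hNM) (hb.of_isCoprime_of_dvd_right hNM),
    fun a b hab => h.2 a b (hNM.trans hab)⟩

theorem IsCubicChar.add {N : ℤ} {X Y : ℤ → ZMod 3} (h : IsCubicChar N X) (h' : IsCubicChar N Y) :
    IsCubicChar N (X + Y) :=
  ⟨fun a b ha hb => by simp only [Pi.add_apply]; rw [h.1 a b ha hb, h'.1 a b ha hb]; ring,
    fun a b hab => by simp only [Pi.add_apply]; rw [h.2 a b hab, h'.2 a b hab]⟩

theorem IsCubicChar.neg {N : ℤ} {X : ℤ → ZMod 3} (h : IsCubicChar N X) : IsCubicChar N (-X) :=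
  ⟨fun a b ha hb => by simp only [Pi.neg_apply]; rw [h.1 a b ha hb]; ring,
    fun a b hab => by simp only [Pi.neg_apply]; rw [h.2 a b hab]⟩

theorem IsCubicChar.zero (N : ℤ) : IsCubicChar N 0 := ⟨by simp, by simp⟩

open Classical in
/-- Cubic reciprocity for a primary prime of norm `p`. -/
theorem exists_cubicChar_prime {p : ℕ} (hp : p.Prime) (h1 : p % 3 = 1) :
    ∃ a b : ℤ, a ^ 2 - a * b + b ^ 2 = p ∧ (3 : ℤ) ∣ b ∧ ¬ (3 : ℤ) ∣ a ∧
      ∃ X, IsCubicChar p X ∧ ∀ q : ℕ, q.Prime → q ≠ 3 → q ≠ p → cubSym q a b = X q := by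
  have := Fact.mk hp
  obtain ⟨ℓ, hℓ⟩ := exists_cubic_log h1
  have hn := jacobi_norm ℓ hℓ
  refine ⟨jacFst ℓ, jacSnd ℓ, hn, (jacobi_mod_three ℓ h1).1, (jacobi_mod_three ℓ h1).2,
    fun a => if h : IsUnit (a : ZMod p) then Multiplicative.toAdd (ℓ h.unit) else 0,
    ⟨fun a b ha hb => ?_, fun a b hab => ?_⟩, fun q hq h3 hqp => ?_⟩
  · have hu : ∀ a : ℤ, IsCoprime a p → IsUnit (a : ZMod p) := fun a ha => by
      obtain ⟨x, y, e⟩ := ha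
      refine IsUnit.of_mul_eq_one (x : ZMod p) ?_
      have := congrArg (Int.cast : ℤ → ZMod p) e
      push_cast at this
      rw [mul_comm, ← this]; simp
    have hab := (hu a ha).mul (hu b hb)
    beta_reduce
    rw [dif_pos (hu a ha), dif_pos (hu b hb), dif_pos (by push_cast; exact hab), ← toAdd_mul,
      ← map_mul]
    congr 2; ext; simp
  · have : (a : ZMod p) = b := by
      rw [ZMod.intCast_eq_intCast_iff_dvd_sub]; rw [← dvd_neg, neg_sub]; exact hab
    simp only [this]
  · have hqu : IsUnit ((q : ℤ) : ZMod p) := by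
      rw [isUnit_iff_ne_zero, Int.cast_natCast, Ne, ZMod.natCast_eq_zero_iff,
        Nat.prime_dvd_prime_iff_eq hp hq]
      exact hqp.symm
    beta_reduce
    rw [dif_pos hqu]
    refine cubSym_jacobi ℓ hq h3 hqp ?_ hℓ _ (by simp)
    rw [hn, Int.natCast_dvd_natCast, Nat.prime_dvd_prime_iff_eq hq hp]
    exact hqp

theorem prime_two_mod_three_dvd {p : ℕ} (hp : p.Prime) (h2 : p % 3 = 2) {A B : ℤ}
    (h : (p : ℤ) ∣ A ^ 2 - A * B + B ^ 2) : (p : ℤ) ∣ A ∧ (p : ℤ) ∣ B := by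
  have := Fact.mk hp
  have hB : (B : ZMod p) = 0 := by
    by_contra hB
    have h0 : (A : ZMod p) ^ 2 - A * B + B ^ 2 = 0 := by
      have := (ZMod.intCast_zmod_eq_zero_iff_dvd _ p).2 h
      push_cast at this; exact this
    set t : ZMod p := -(A / B) with ht
    have ht0 : t ^ 2 + t + 1 = 0 := by
      rw [ht]; field_simp; linear_combination h0
    have ht3 : t ^ 3 = 1 := by linear_combination (t - 1) * ht0
    have ht1 : t ≠ 1 := by
      intro h; rw [h] at ht0
      have : ((3 : ℕ) : ZMod p) = 0 := by push_cast; linear_combination ht0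
      rw [ZMod.natCast_eq_zero_iff, Nat.prime_dvd_prime_iff_eq hp Nat.prime_three] at this
      omega
    have htn : t ≠ 0 := by rintro h; rw [h] at ht3; norm_num at ht3
    have e := ZMod.pow_card_sub_one_eq_one htn
    rw [pow_eq_pow_mod _ ht3, show (p - 1) % 3 = 1 by omega, pow_one] at e
    exact ht1 e
  have hB := (ZMod.intCast_zmod_eq_zero_iff_dvd _ p).1 hB
  refine ⟨?_, hB⟩
  apply Int.Prime.dvd_pow' hp (k := 2)
  obtain ⟨c, rfl⟩ := hB
  have : A ^ 2 = (A ^ 2 - A * (p * c) + (p * c) ^ 2) + p * (A * c - p * c ^ 2) := by ring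
  rw [this]
  exact dvd_add h (dvd_mul_right _ _)

/-- Every primary Eisenstein integer of norm `N` satisfies cubic reciprocity for rational primes. -/
theorem exists_cubicChar (n : ℕ) : ∀ A B : ℤ, A ^ 2 - A * B + B ^ 2 = n → n ≠ 0 → (3 : ℤ) ∣ B →
    ¬ (3 : ℤ) ∣ A → ∃ X, IsCubicChar n X ∧
      ∀ q : ℕ, q.Prime → q ≠ 3 → ¬ q ∣ n → cubSym q A B = X q := by
  induction n using Nat.strong_induction_on with
  | _ n ih =>
  intro A B hN hn hB hA
  by_cases hn1 : n = 1
  · have hB0 : B = 0 := by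
      subst hn1
      obtain ⟨c, rfl⟩ := hB
      have : c = 0 := by
        push_cast at hN
        have : c ^ 2 < 1 := by nlinarith [sq_nonneg (2 * A - 3 * c)]
        nlinarith
      simp [this]
    refine ⟨0, IsCubicChar.zero _, fun q hq h3 hqn => ?_⟩
    rw [cubSym_of_dvd hq h3 (by rw [hN]; exact_mod_cast hqn) (by simp [hB0])]
    rfl
  obtain ⟨p, hp, hpn⟩ := Nat.exists_prime_and_dvd hn1
  have hpN : (p : ℤ) ∣ A ^ 2 - A * B + B ^ 2 := by rw [hN]; exact_mod_cast hpn
  have hp0 : (p : ℤ) ≠ 0 := by exact_mod_cast hp.ne_zero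
  have hpp : Prime (p : ℤ) := Nat.prime_iff_prime_int.1 hp
  have hp3 : p ≠ 3 := by
    rintro rfl
    apply hA
    apply Int.Prime.dvd_pow' Nat.prime_three (k := 2)
    obtain ⟨c, rfl⟩ := hB
    have : A ^ 2 = (A ^ 2 - A * (3 * c) + (3 * c) ^ 2) + 3 * (A * c - 3 * c ^ 2) := by ring
    rw [this]
    exact dvd_add hpN (dvd_mul_right _ _)
  rcases prime_mod_three hp hp3 with h1 | h2
  · obtain ⟨a, b, hab, hb3, ha3, X, hX, hXq⟩ := exists_cubicChar_prime hp h1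
    have step : ∀ a b : ℤ, a ^ 2 - a * b + b ^ 2 = p → (3 : ℤ) ∣ b → ¬ (3 : ℤ) ∣ a →
        (∃ X, IsCubicChar p X ∧ ∀ q : ℕ, q.Prime → q ≠ 3 → q ≠ p → cubSym q a b = X q) →
        (p : ℤ) ∣ B * a - A * b → ∃ X, IsCubicChar n X ∧
          ∀ q : ℕ, q.Prime → q ≠ 3 → ¬ q ∣ n → cubSym q A B = X q := by
      rintro a b hab hb3 ha3 ⟨X, hX, hXq⟩ ⟨B', hB'⟩
      obtain ⟨A', hA'⟩ : (p : ℤ) ∣ A * (a - b) + B * b := by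
        apply hpp.dvd_of_dvd_pow (n := 2)
        have : (A * (a - b) + B * b) ^ 2 = (A ^ 2 - A * B + B ^ 2) * (a ^ 2 - a * b + b ^ 2)
          + (B * a - A * b) * ((A * (a - b) + B * b) - (B * a - A * b)) := by ring
        rw [this, hB']
        exact dvd_add (dvd_mul_of_dvd_left hpN _) (dvd_mul_of_dvd_left (dvd_mul_right _ _) _)
      have eA : A = A' * a - B' * b := by
        apply mul_left_cancel₀ hp0
        linear_combination (-A) * hab + a * hA' - b * hB'
      have eB : B = A' * b + B' * a - B' * b := by
        apply mul_left_cancel₀ hp0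
        linear_combination (-B) * hab + b * hA' + (a - b) * hB'
      obtain ⟨m, rfl⟩ := hpn
      have hN' : A' ^ 2 - A' * B' + B' ^ 2 = m := by
        apply mul_left_cancel₀ hp0
        push_cast at hN
        rw [← hN, eA, eB, ← hab]; ring
      have hm0 : m ≠ 0 := by rintro rfl; simp at hn
      have hB3 : (3 : ℤ) ∣ B' := by
        have : (3 : ℤ) ∣ p * B' := by
          rw [← hB']; exact dvd_sub (dvd_mul_of_dvd_left hB _) (dvd_mul_of_dvd_right hb3 _)
        refine (Int.prime_three.dvd_or_dvd this).resolve_left ?_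
        omega
      have hA3 : ¬ (3 : ℤ) ∣ A' := fun h => hA (by
        rw [eA]; exact dvd_sub (dvd_mul_of_dvd_left h _) (dvd_mul_of_dvd_left hB3 _))
      obtain ⟨Y, hY, hYq⟩ := ih m (by
        have := hp.two_le; nlinarith [Nat.pos_of_ne_zero hm0]) A' B' hN' hm0 hB3 hA3
      refine ⟨Y + X, (hY.mono ?_).add (hX.mono ?_), fun q hq h3 hqn => ?_⟩
      · push_cast; exact dvd_mul_left _ _
      · push_cast; exact dvd_mul_right _ _
      · have hqp : q ≠ p := by rintro rfl; exact hqn (dvd_mul_right _ _)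
        have hqm : ¬ q ∣ m := fun h => hqn (h.mul_left _)
        rw [cubSym_mul hq h3 (by rw [hN']; exact_mod_cast hqm) (by
          rw [hab]; norm_cast; rwa [Nat.prime_dvd_prime_iff_eq hq hp]) eA eB, hYq q hq h3 hqm,
          hXq q hq h3 hqp]
        rfl
    have hprod : (p : ℤ) ∣ (B * a - A * b) * (B * (a - b) - A * -b) := by
      have : (B * a - A * b) * (B * (a - b) - A * -b) = B ^ 2 * (a ^ 2 - a * b + b ^ 2)
        - b ^ 2 * (A ^ 2 - A * B + B ^ 2) := by ring
      rw [this, hab]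
      exact dvd_sub (dvd_mul_left _ _) (dvd_mul_of_dvd_right hpN _)
    rcases hpp.dvd_or_dvd hprod with h | h
    · exact step a b hab hb3 ha3 ⟨X, hX, hXq⟩ h
    · refine step (a - b) (-b) (by rw [← hab]; ring) (hb3.neg_right) (by
        intro h; exact ha3 (by simpa using dvd_add h hb3)) ⟨-X, hX.neg, fun q hq h3 hqp => ?_⟩ h
      rw [cubSym_conj hq h3 (by
        rw [hab]; norm_cast; rwa [Nat.prime_dvd_prime_iff_eq hq hp]), hXq q hq h3 hqp]
      rfl
  · obtain ⟨⟨A', rfl⟩, ⟨B', rfl⟩⟩ := prime_two_mod_three_dvd hp h2 hpN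
    obtain ⟨m, rfl⟩ : p ^ 2 ∣ n := by
      zify; rw [← hN]; exact ⟨A' ^ 2 - A' * B' + B' ^ 2, by ring⟩
    have hN' : A' ^ 2 - A' * B' + B' ^ 2 = m := by
      apply mul_left_cancel₀ (pow_ne_zero 2 hp0)
      push_cast at hN
      rw [← hN]; ring
    have hm0 : m ≠ 0 := by rintro rfl; simp at hn
    have hB3 : (3 : ℤ) ∣ B' := by
      refine (Int.prime_three.dvd_or_dvd hB).resolve_left ?_
      omega
    obtain ⟨Y, hY, hYq⟩ := ih m (by
      have : 1 < p ^ 2 := Nat.one_lt_pow two_ne_zero hp.one_lt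
      nlinarith [Nat.pos_of_ne_zero hm0]) A' B' hN' hm0 hB3 (fun h => hA (h.mul_left _))
    refine ⟨Y, hY.mono (by push_cast; exact dvd_mul_left _ _), fun q hq h3 hqn => ?_⟩
    have hqp : ¬ (q : ℤ) ∣ (p : ℤ) ^ 2 - p * 0 + 0 ^ 2 := by
      intro h
      have : (q : ℤ) ∣ (p : ℤ) ^ 2 := by simpa using h
      exact hqn (Dvd.dvd.mul_right (by exact_mod_cast this) _)
    have hqm : ¬ q ∣ m := fun h => hqn (h.mul_left _)
    rw [cubSym_mul (A := p) (B := 0) (C := A') (D := B') hq h3 hqp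
      (by rw [hN']; exact_mod_cast hqm) (by ring) (by ring),
      cubSym_of_dvd hq h3 hqp (by simp), zero_add, hYq q hq h3 hqm]

end

section

theorem IsCubicChar.one {N : ℤ} {X : ℤ → ZMod 3} (h : IsCubicChar N X) : X 1 = 0 := by
  have := h.1 1 1 isCoprime_one_left isCoprime_one_left
  simpa using this

theorem IsCubicChar.neg_one {N : ℤ} {X : ℤ → ZMod 3} (h : IsCubicChar N X) : X (-1) = 0 := by
  have e := h.1 (-1) (-1) isCoprime_one_left.neg_left isCoprime_one_left.neg_left
  norm_num [h.one] at e
  generalize X (-1) = x at e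
  decide +revert

theorem IsCubicChar.cube {N : ℤ} {X : ℤ → ZMod 3} (h : IsCubicChar N X) {a : ℤ}
    (ha : IsCoprime a N) : X (a ^ 3) = 0 := by
  rw [pow_succ, pow_two, h.1 _ _ (ha.mul_left ha) ha, h.1 _ _ ha ha]
  generalize X a = x
  decide +revert

theorem IsCubicChar.natCast {N : ℤ} {X : ℤ → ZMod 3} (h : IsCubicChar N X) {n : ℕ} (hn : n ≠ 0)
    (hnN : IsCoprime (n : ℤ) N) : X n = (n.primeFactorsList.map fun q => X (q : ℕ)).sum := by
  induction n using Nat.recOnMul with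
  | zero => exact absurd rfl hn
  | one => simpa using h.one
  | prime p hp => simp [Nat.primeFactorsList_prime hp]
  | mul a b iha ihb =>
    have ha : a ≠ 0 := by rintro rfl; simp at hn
    have hb : b ≠ 0 := by rintro rfl; simp at hn
    push_cast at hnN
    rw [((Nat.perm_primeFactorsList_mul ha hb).map _).sum_eq, List.map_append, List.sum_append,
      ← iha ha hnN.of_mul_left_left, ← ihb hb hnN.of_mul_left_right, Nat.cast_mul,
      h.1 _ _ hnN.of_mul_left_left hnN.of_mul_left_right]

theorem IsCubicChar.eq_zero {N : ℤ} {X : ℤ → ZMod 3} (h : IsCubicChar N X) {a : ℤ} (ha : a ≠ 0)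
    (haN : IsCoprime a N) (hX : ∀ q : ℕ, q.Prime → (q : ℤ) ∣ a → X q = 0) : X a = 0 := by
  have key : X (a.natAbs : ℤ) = 0 := by
    rw [h.natCast (by simpa using ha) (by simpa [IsCoprime.abs_left_iff] using haN)]
    apply List.sum_eq_zero
    simp only [List.mem_map]
    rintro _ ⟨q, hq, rfl⟩
    exact hX q (Nat.prime_of_mem_primeFactorsList hq)
      (Int.natCast_dvd.2 (Nat.dvd_of_mem_primeFactorsList hq))
  rcases Int.natAbs_eq a with e | e
  · rw [e]; exact key
  · rw [e, ← neg_one_mul, h.1 _ _ isCoprime_one_left.neg_left (by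
      rw [← IsCoprime.neg_left_iff, ← e]; exact haN), h.neg_one, key, add_zero]

theorem exists_cubic_solution {M L : ℕ} (hM : M ∣ 6 ^ L) {a : ℤ} (ha : IsCoprime a 6)
    (c b e t : ℤ) : ∃ x : ℤ, (M : ℤ) ∣ c + a * x + 6 * b * x ^ 2 + 6 * e * x ^ 3 - t := by
  have hM0 : M ≠ 0 := by rintro rfl; simp at hM
  have : NeZero M := ⟨hM0⟩
  let f : ZMod M → ZMod M := fun x => c + a * x + 6 * b * x ^ 2 + 6 * e * x ^ 3
  have hinj : Function.Injective f := by
    intro x x' h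
    obtain ⟨x, rfl⟩ := ZMod.intCast_surjective x
    obtain ⟨x', rfl⟩ := ZMod.intCast_surjective x'
    have h1 : (M : ℤ) ∣ (x - x') * (a + 6 * (b * (x + x') + e * (x ^ 2 + x * x' + x' ^ 2))) := by
      rw [← ZMod.intCast_zmod_eq_zero_iff_dvd]
      have h : f x - f x' = 0 := sub_eq_zero.2 h
      rw [← h]
      simp only [f]
      push_cast
      ring
    have h2 : IsCoprime (M : ℤ) (a + 6 * (b * (x + x') + e * (x ^ 2 + x * x' + x' ^ 2))) := by
      apply IsCoprime.of_isCoprime_of_dvd_left (y := 6 ^ L) _ (by exact_mod_cast hM)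
      apply IsCoprime.pow_left
      exact (IsCoprime.add_mul_left_left ha _).symm
    have h3 := h2.dvd_of_dvd_mul_right h1
    rw [← sub_eq_zero, ← Int.cast_sub]
    exact (ZMod.intCast_zmod_eq_zero_iff_dvd _ _).2 h3
  obtain ⟨x, hx⟩ := Finite.surjective_of_injective hinj t
  obtain ⟨x, rfl⟩ := ZMod.intCast_surjective x
  refine ⟨x, ?_⟩
  rw [← ZMod.intCast_zmod_eq_zero_iff_dvd]
  push_cast
  rw [sub_eq_zero, ← hx]

theorem exists_smooth_mul {v : ℤ} (hv : v ≠ 0) :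
    ∃ (w L : ℕ) (v' : ℤ), v = w * v' ∧ w ∣ 6 ^ L ∧ IsCoprime v' 6 := by
  obtain ⟨i, a, ha, e⟩ := Nat.exists_eq_pow_mul_and_not_dvd (Int.natAbs_ne_zero.2 hv) 2 (by simp)
  have ha0 : a ≠ 0 := by rintro rfl; simp at ha
  obtain ⟨j, b, hb, rfl⟩ := Nat.exists_eq_pow_mul_and_not_dvd ha0 3 (by simp)
  have hb2 : ¬ 2 ∣ b := fun h => ha (h.mul_left _)
  refine ⟨2 ^ i * 3 ^ j, i + j, v.sign * b, ?_, ?_, ?_⟩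
  · conv_lhs => rw [← Int.sign_mul_natAbs v, e]
    push_cast; ring
  · rw [pow_add]
    exact mul_dvd_mul (pow_dvd_pow_of_dvd (by norm_num) _) (pow_dvd_pow_of_dvd (by norm_num) _)
  · have h1 : IsCoprime (b : ℤ) 6 := by
      rw [Int.isCoprime_iff_gcd_eq_one]
      have h2 : Nat.Coprime b 2 := (Nat.prime_two.coprime_iff_not_dvd.2 hb2).symm
      have h3 : Nat.Coprime b 3 := (Nat.prime_three.coprime_iff_not_dvd.2 hb).symm
      exact h2.mul_right h3
    exact IsCoprime.mul_left (by rcases hv.lt_or_gt with h | h <;> simp [Int.sign_eq_neg_one_of_neg, Int.sign_eq_one_of_pos, h, isCoprime_one_left, isCoprime_one_left.neg_left]) h1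

theorem isCoprime_int_iff {a b : ℤ} :
    IsCoprime a b ↔ ∀ q : ℕ, q.Prime → (q : ℤ) ∣ a → ¬ (q : ℤ) ∣ b := by
  rw [Int.isCoprime_iff_gcd_eq_one]
  constructor
  · intro h q hq h1 h2
    have := Int.dvd_coe_gcd h1 h2
    rw [h] at this
    exact hq.one_lt.ne' (by exact_mod_cast Int.eq_one_of_dvd_one (by positivity) this)
  · intro h
    by_contra h1
    obtain ⟨q, hq, h2⟩ := Nat.exists_prime_and_dvd h1
    have h2 : (q : ℤ) ∣ Int.gcd a b := by exact_mod_cast h2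
    exact h q hq (h2.trans (Int.gcd_dvd_left ..)) (h2.trans (Int.gcd_dvd_right ..))

end

section

theorem not_dvd_natAbs {q : ℕ} {N : ℤ} (h : ¬ (q : ℤ) ∣ N) : ¬ q ∣ N.natAbs :=
  fun h' => h (Int.natCast_dvd.2 h')

theorem cubSym_sum_zero_of_factor {d y z P m e D u v v₁ z₁ : ℤ} {n w : ℕ}
    (hP : y ^ 2 - d * z ^ 2 = P ^ 3) (hyz : IsCoprime y z) (hP6 : IsCoprime P 6)
    (hme : m * e = 3) (hD : -3 * d = m ^ 2 * D) (hn : u ^ 2 - D * v ^ 2 = 4 * n)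
    (hn6 : IsCoprime (n : ℤ) 6) (hnP : IsCoprime (n : ℤ) P)
    (huv : ∀ q : ℕ, q.Prime → q ≠ 2 → (q : ℤ) ∣ u → ¬ (q : ℤ) ∣ v)
    (hz : z = 162 * e * w * z₁) (hv : v = w * v₁) (hz6 : IsCoprime z₁ 6) (hv6 : IsCoprime v₁ 6) :
    (n.primeFactorsList.map fun q => cubSym q (y * v - m * z * u) (2 * y * v)).sum = 0 := by
  have hz0 : z₁ ≠ 0 := by rintro rfl; norm_num [isCoprime_zero_left, Int.isUnit_iff] at hz6
  have hv0 : v₁ ≠ 0 := by rintro rfl; norm_num [isCoprime_zero_left, Int.isUnit_iff] at hv6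
  have hP0 : P ≠ 0 := by rintro rfl; norm_num [isCoprime_zero_left, Int.isUnit_iff] at hP6
  have hn0 : n ≠ 0 := by rintro rfl; norm_num [isCoprime_zero_left, Int.isUnit_iff] at hn6
  obtain ⟨v₂, z₂, hg, ev, ez⟩ := Int.exists_gcd_one (Int.gcd_pos_of_ne_zero_left z₁ hv0)
  generalize ((Int.gcd v₁ z₁ : ℕ) : ℤ) = g at ev ez
  subst ev ez
  have hvz : IsCoprime v₂ z₂ := Int.isCoprime_iff_gcd_eq_one.2 hg
  have hz26 := hz6.of_mul_left_left
  have hv26 := hv6.of_mul_left_left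
  have hz20 : z₂ ≠ 0 := left_ne_zero_of_mul hz0
  have hv20 : v₂ ≠ 0 := left_ne_zero_of_mul hv0
  -- primes dividing `n`
  have hnuv : ∀ q : ℕ, q.Prime → (q : ℤ) ∣ n → ¬ (q : ℤ) ∣ v := fun q hq hqn hqv => by
    have hq2 : q ≠ 2 := by
      rintro rfl
      exact isCoprime_int_iff.1 hn6 2 hq hqn (by norm_num)
    refine huv q hq hq2 (Int.Prime.dvd_pow' hq (k := 2) ?_) hqv
    have : u ^ 2 = 4 * n + D * v * v := by linear_combination hn
    rw [this]
    exact dvd_add (hqn.mul_left _) (hqv.mul_left _)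
  have hcop : IsCoprime (v₂ * P) (6 * n * z₂) := by
    have h1 : IsCoprime v₂ (n : ℤ) := isCoprime_int_iff.2 fun q hq h1 h2 =>
      hnuv q hq h2 (hv ▸ (h1.mul_right _).mul_left _)
    have h2 : IsCoprime P z₂ := isCoprime_int_iff.2 fun q hq h1 h2 => by
      have hqz : (q : ℤ) ∣ z := hz ▸ (h2.mul_right _).mul_left _
      refine isCoprime_int_iff.1 hyz q hq (Int.Prime.dvd_pow' hq (k := 2) ?_) hqz
      have : y ^ 2 = P * P ^ 2 + d * z * z := by linear_combination hP
      rw [this]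
      exact dvd_add (h1.mul_right _) (hqz.mul_left _)
    exact ((hv26.mul_right h1).mul_right hvz).mul_left ((hP6.mul_right hnP.symm).mul_right h2)
  set A := y * v₂ + 162 * z₂ * u with hA
  set B := 324 * z₂ * u with hB
  have hN' : A ^ 2 - A * B + B ^ 2 = (y * v₂) ^ 2 + 3 * (162 * z₂ * u) ^ 2 := by
    rw [hA, hB]; ring
  have hN : A ^ 2 - A * B + B ^ 2 = v₂ ^ 2 * P ^ 3 + 2 ^ 4 * (3 ^ 3) ^ 3 * n * z₂ ^ 2 := by
    have hde : - d * e ^ 2 = 3 * D := by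
      have : (3 : ℤ) * (- d * e ^ 2) = 3 * (3 * D) := by
        linear_combination e ^ 2 * hD + D * (m * e + 3) * hme
      omega
    rw [hN', ← hP, hz]
    have e1 : u ^ 2 = 4 * n + D * (w * (v₂ * g)) ^ 2 := by rw [← hv]; linear_combination hn
    linear_combination 3 * 162 ^ 2 * z₂ ^ 2 * e1 -
      162 ^ 2 * z₂ ^ 2 * w ^ 2 * v₂ ^ 2 * g ^ 2 * hde
  set N := A ^ 2 - A * B + B ^ 2 with hNdef
  have hy0 : y ≠ 0 := by
    rintro rfl
    have hzu : IsUnit z := isCoprime_zero_left.1 hyz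
    rw [hz, Int.isUnit_iff] at hzu
    rcases hzu with h | h <;> · rw [show (162 : ℤ) = 2 * 81 by norm_num, mul_assoc, mul_assoc, mul_assoc] at h; omega
  have hNpos : 0 < N := by
    rw [hN']
    have : y * v₂ ≠ 0 := mul_ne_zero hy0 hv20
    positivity
  have hNabs : (N.natAbs : ℤ) = N := Int.natAbs_of_nonneg hNpos.le
  have hc1 : IsCoprime (v₂ * P) N := by
    rw [hN, show v₂ ^ 2 * P ^ 3 + 2 ^ 4 * (3 ^ 3) ^ 3 * n * z₂ ^ 2 =
      2 ^ 4 * (3 ^ 3) ^ 3 * n * z₂ ^ 2 + (v₂ * P) * (v₂ * P ^ 2) by ring]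
    apply IsCoprime.add_mul_left_right
    have h6 := hcop.of_mul_right_left.of_mul_right_left
    have h2 : IsCoprime (v₂ * P) 2 := IsCoprime.of_isCoprime_of_dvd_right h6 (by norm_num)
    have h3 : IsCoprime (v₂ * P) 3 := IsCoprime.of_isCoprime_of_dvd_right h6 (by norm_num)
    exact ((h2.pow_right.mul_right h3.pow_right.pow_right).mul_right
      hcop.of_mul_right_left.of_mul_right_right).mul_right hcop.of_mul_right_right.pow_right
  have hc2 : IsCoprime (6 * n * z₂) N := by
    rw [hN, show v₂ ^ 2 * P ^ 3 + 2 ^ 4 * (3 ^ 3) ^ 3 * n * z₂ ^ 2 =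
      v₂ ^ 2 * P ^ 3 + (6 * n * z₂) * (2 ^ 3 * 3 ^ 8 * z₂) by ring]
    apply IsCoprime.add_mul_left_right
    exact hcop.of_mul_left_left.symm.pow_right.mul_right hcop.of_mul_left_right.symm.pow_right
  have hB3 : (3 : ℤ) ∣ B := ⟨108 * z₂ * u, by rw [hB]; ring⟩
  have hA3 : ¬ (3 : ℤ) ∣ A := by
    intro h
    have : (3 : ℤ) ∣ N := by
      rw [hNdef, show A ^ 2 - A * B + B ^ 2 = A * (A - B) + B * B by ring]
      exact dvd_add (h.mul_right _) (hB3.mul_right _)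
    exact isCoprime_int_iff.1 hc2.of_mul_left_left.of_mul_left_left 3 Nat.prime_three
      (by norm_num) this
  obtain ⟨X, hX, hXq⟩ := exists_cubicChar N.natAbs A B hNabs.symm
    (Int.natAbs_ne_zero.2 hNpos.ne') hB3 hA3
  rw [hNabs] at hX
  have hnN := hc2.of_mul_left_left.of_mul_left_right
  have hzN := hc2.of_mul_left_right
  have h6N := hc2.of_mul_left_left.of_mul_left_left
  have h2N : IsCoprime 2 N := IsCoprime.of_isCoprime_of_dvd_left h6N (by norm_num)
  have h3N : IsCoprime 3 N := IsCoprime.of_isCoprime_of_dvd_left h6N (by norm_num)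
  have hvN := hc1.of_mul_left_left
  have hPN := hc1.of_mul_left_right
  have hX2 : X 2 = 0 := by
    have hd : ¬ ((2 : ℕ) : ℤ) ∣ N := fun h => isCoprime_int_iff.1 h2N 2 Nat.prime_two (by norm_num) h
    have := hXq 2 Nat.prime_two (by norm_num) (not_dvd_natAbs hd)
    rw [cubSym_of_dvd Nat.prime_two (by norm_num) hd ⟨162 * z₂ * u, by rw [hB]; push_cast; ring⟩] at this
    exact_mod_cast this.symm
  have hXz : X z₂ = 0 := hX.eq_zero hz20 hzN fun q hq hqz => by
    have hq3 : q ≠ 3 := by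
      rintro rfl; exact isCoprime_int_iff.1 hz26 3 hq hqz (by norm_num)
    have hd := isCoprime_int_iff.1 hzN q hq hqz
    rw [← hXq q hq hq3 (not_dvd_natAbs hd)]
    exact cubSym_of_dvd hq hq3 hd ((hqz.mul_left _).mul_right _)
  have hXv : X v₂ = 0 := hX.eq_zero hv20 hvN fun q hq hqz => by
    have hq3 : q ≠ 3 := by
      rintro rfl; exact isCoprime_int_iff.1 hv26 3 hq hqz (by norm_num)
    have hd := isCoprime_int_iff.1 hvN q hq hqz
    have hd3 : ¬ (q : ℤ) ∣ 3 * (162 * z₂ * u) ^ 2 := fun h => hd (by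
      rw [hN']
      exact dvd_add (dvd_pow (hqz.mul_left _) two_ne_zero) h)
    rw [← hXq q hq hq3 (not_dvd_natAbs hd), cubSym_congr (A' := 162 * z₂ * u) (B' := B)
      (by rw [hA]; simpa using hqz.mul_left y) (by simp), cubSym_mul (A := 162 * z₂ * u) (B := 0)
      (C := 1) (D := 2) hq hq3 (fun h => hd3 (by simpa using h.mul_left 3))
      (fun h => hd3 (by norm_num at h; exact h.mul_right _)) (by ring) (by rw [hB]; ring),
      cubSym_of_dvd hq hq3 (fun h => hd3 (by simpa using h.mul_left 3)) (by simp),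
      cubSym_sqrt_neg_three hq hq3, add_zero]
  have hXn : X n = 0 := by
    have e1 := hX.2 (2 ^ 4 * (3 ^ 3) ^ 3 * n * z₂ ^ 2) (-1 * v₂ ^ 2 * P ^ 3) (by
      rw [hN]; exact ⟨1, by ring⟩)
    have c2 : IsCoprime ((2 : ℤ) ^ 2) N := h2N.pow_left
    have c9 : IsCoprime (((3 : ℤ) ^ 3) ^ 3) N := h3N.pow_left.pow_left
    have c1 : IsCoprime (-1 : ℤ) N := isCoprime_one_left.neg_left
    have X22 : X (2 ^ 2) = 0 := by rw [pow_two, hX.1 _ _ h2N h2N, hX2, add_zero]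
    have X24 : X (2 ^ 4) = 0 := by
      rw [show (2 : ℤ) ^ 4 = 2 ^ 2 * 2 ^ 2 by norm_num, hX.1 _ _ c2 c2, X22, add_zero]
    rw [hX.1 _ _ ((h2N.pow_left.mul_left c9).mul_left hnN) hzN.pow_left,
      hX.1 _ _ (h2N.pow_left.mul_left c9) hnN, hX.1 _ _ h2N.pow_left c9, X24,
      hX.cube h3N.pow_left, hX.1 _ _ (c1.mul_left hvN.pow_left) hPN.pow_left, hX.cube hPN,
      hX.1 _ _ c1 hvN.pow_left, hX.neg_one, pow_two, pow_two, hX.1 _ _ hzN hzN, hX.1 _ _ hvN hvN,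
      hXz, hXv] at e1
    simpa using e1
  rw [hX.natCast hn0 hnN] at hXn
  rw [← hXn]
  congr 1
  refine List.map_congr_left fun q hq => ?_
  have hqp := Nat.prime_of_mem_primeFactorsList hq
  have hqn : (q : ℤ) ∣ n := Int.natCast_dvd_natCast.2 (Nat.dvd_of_mem_primeFactorsList hq)
  have hq3 : q ≠ 3 := by
    rintro rfl; exact isCoprime_int_iff.1 hn6 3 hqp hqn (by norm_num)
  have hd := isCoprime_int_iff.1 hnN q hqp hqn
  have hqv := hnuv q hqp hqn
  have hqwg : ¬ (q : ℤ) ∣ ((w : ℤ) * g) ^ 2 - w * g * 0 + 0 ^ 2 := fun h => hqv (by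
    have : (q : ℤ) ∣ (w * g) := Int.Prime.dvd_pow' hqp (k := 2) (by simpa using h)
    rw [hv, show (w : ℤ) * (v₂ * g) = w * g * v₂ by ring]
    exact this.mul_right _)
  have hq3' : ¬ (q : ℤ) ∣ 1 ^ 2 - 1 * 2 + 2 ^ 2 := by
    norm_num
    intro h
    exact hq3 ((Nat.prime_dvd_prime_iff_eq hqp Nat.prime_three).1 (by exact_mod_cast h))
  have hmz : m * z = 486 * w * (z₂ * g) := by
    rw [hz]; linear_combination 162 * w * (z₂ * g) * hme
  rw [← hXq q hqp hq3 (not_dvd_natAbs hd), hmz,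
    cubSym_mul (A := w * g) (B := 0) (C := y * v₂ - 486 * z₂ * u) (D := 2 * y * v₂) hqp hq3 hqwg ?_
      (by rw [hv]; ring) (by rw [hv]; ring), cubSym_of_dvd hqp hq3 hqwg (by simp), zero_add,
    cubSym_mul (A := 1) (B := 2) (C := A) (D := B) hqp hq3 hq3' hd (by rw [hA, hB]; ring)
      (by rw [hA, hB]; ring), cubSym_sqrt_neg_three hqp hq3, zero_add]
  have : (y * v₂ - 486 * z₂ * u) ^ 2 - (y * v₂ - 486 * z₂ * u) * (2 * y * v₂) + (2 * y * v₂) ^ 2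
      = 3 * N := by rw [hN']; ring
  rw [this]
  intro h
  rcases (Nat.prime_iff_prime_int.1 hqp).dvd_or_dvd h with h | h
  · exact hq3' (by norm_num; exact h)
  · exact hd h

end

section

/-- Vanishing on principal ideals of the cubic residue character attached to `y + z√d`. -/
theorem cubSym_sum_zero {d y z P m e D u v : ℤ} {n : ℕ}
    (hP : y ^ 2 - d * z ^ 2 = P ^ 3) (hyz : IsCoprime y z) (hP6 : IsCoprime P 6)
    (hme : m * e = 3) (he : e = 1 ∨ e = 3) (hD : -3 * d = m ^ 2 * D)
    (hn : u ^ 2 - D * v ^ 2 = 4 * n) (hn6 : IsCoprime (n : ℤ) 6) (hnP : IsCoprime (n : ℤ) P)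
    (huv : ∀ q : ℕ, q.Prime → q ≠ 2 → (q : ℤ) ∣ u → ¬ (q : ℤ) ∣ v) (hz : (18 : ℤ) ∣ z) :
    (n.primeFactorsList.map fun q => cubSym q (y * v - m * z * u) (2 * y * v)).sum = 0 := by
  by_cases hv0 : v = 0
  · subst hv0
    apply List.sum_eq_zero
    simp only [List.mem_map]
    rintro _ ⟨q, hq, rfl⟩
    have hqp := Nat.prime_of_mem_primeFactorsList hq
    have hqn : (q : ℤ) ∣ n := Int.natCast_dvd_natCast.2 (Nat.dvd_of_mem_primeFactorsList hq)
    refine absurd (dvd_zero _) (huv q hqp ?_ (Int.Prime.dvd_pow' hqp (k := 2) ?_))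
    · rintro rfl
      exact isCoprime_int_iff.1 hn6 2 hqp hqn (by norm_num)
    · have : u ^ 2 = 4 * n := by linear_combination hn
      rw [this]; exact hqn.mul_left _
  obtain ⟨w, L, v₁, hv, hw, hv6⟩ := exists_smooth_mul hv0
  obtain ⟨z₀, rfl⟩ := hz
  have hy6 : IsCoprime y 6 := isCoprime_int_iff.2 fun q hq h1 h2 => by
    refine isCoprime_int_iff.1 hP6 q hq (Int.Prime.dvd_pow' hq (k := 3) ?_) h2
    rw [← hP, show d * (18 * z₀) ^ 2 = 6 * (54 * d * z₀ ^ 2) by ring, pow_two]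
    exact dvd_sub (h1.mul_right _) (h2.mul_right _)
  set K : ℤ := P * n with hK
  have hK6 : IsCoprime K 6 := hP6.mul_left hn6
  obtain ⟨e', rfl⟩ : ∃ e' : ℕ, e = e' := ⟨e.toNat, by omega⟩
  have hM : 54 * e' * w ∣ 6 ^ (4 + L) := by
    rw [pow_add]
    refine mul_dvd_mul ?_ hw
    rcases he with h | h
    · rw [show e' = 1 by omega]; norm_num
    · rw [show e' = 3 by omega]; norm_num
  obtain ⟨x, k, hx⟩ := exists_cubic_solution hM (hy6.mul_left hK6) z₀ (18 * d * z₀ * K ^ 2)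
    (2 * y * d * K ^ 3) (9 * e' * w)
  push_cast at hx
  set b := 6 * K * x with hb
  have hy' : ∀ t, t ∣ b → t ∣ (y * (1 + 3 * d * b ^ 2) + 18 * z₀ * d * (3 * b + d * b ^ 3)) - y :=
    fun t ht => ht.trans ⟨y * 3 * d * b + 18 * z₀ * d * (3 + d * b ^ 2), by ring⟩
  have hz' : ∀ t, t ∣ b → t ∣ (18 * z₀ * (1 + 3 * d * b ^ 2) + y * (3 * b + d * b ^ 3)) - 18 * z₀ :=
    fun t ht => ht.trans ⟨18 * z₀ * 3 * d * b + y * (3 + d * b ^ 2), by ring⟩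
  have hPb : P ∣ b := ⟨6 * n * x, by rw [hb, hK]; ring⟩
  have hnb : (n : ℤ) ∣ b := ⟨6 * P * x, by rw [hb, hK]; ring⟩
  have h6b : 6 ∣ b := ⟨K * x, by rw [hb]; ring⟩
  have hdvd : ∀ q : ℕ, q.Prime → (q : ℤ) ∣ b → ¬ (q : ℤ) ∣ 1 - d * b ^ 2 := by
    intro q hq h1 h2
    have : (q : ℤ) ∣ 1 := by
      have := dvd_add h2 (h1.mul_left (d * b))
      rwa [show 1 - d * b ^ 2 + d * b * b = 1 by ring] at this
    exact hq.one_lt.ne' (by exact_mod_cast Int.eq_one_of_dvd_one (by positivity) this)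
  have hn6' : IsCoprime (n : ℤ) (1 - d * b ^ 2) := isCoprime_int_iff.2 fun q hq h1 h2 =>
    hdvd q hq (h1.trans hnb) h2
  have h66' : IsCoprime (1 - d * b ^ 2) 6 := isCoprime_int_iff.2 fun q hq h1 h2 =>
    hdvd q hq (h2.trans h6b) h1
  have key := cubSym_sum_zero_of_factor (d := d)
    (y := y * (1 + 3 * d * b ^ 2) + 18 * z₀ * d * (3 * b + d * b ^ 3))
    (z := 18 * z₀ * (1 + 3 * d * b ^ 2) + y * (3 * b + d * b ^ 3)) (P := P * (1 - d * b ^ 2))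
    (z₁ := 1 + 6 * k) (n := n) (w := w) (by linear_combination (1 - d * b ^ 2) ^ 3 * hP) ?_ (hP6.mul_left h66') hme hD
    hn hn6 (hnP.mul_right hn6') huv (by
      rw [hb]; linear_combination 18 * hx) hv
      (IsCoprime.add_mul_left_left isCoprime_one_left _) hv6
  · rw [← key]
    congr 1
    refine List.map_congr_left fun q hq => ?_
    have hqn : (q : ℤ) ∣ n := Int.natCast_dvd_natCast.2 (Nat.dvd_of_mem_primeFactorsList hq)
    obtain ⟨r, hr⟩ := hy' q (hqn.trans hnb)
    obtain ⟨s, hs⟩ := hz' q (hqn.trans hnb)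
    apply cubSym_congr
    · exact ⟨m * s * u - r * v, by linear_combination m * u * hs - v * hr⟩
    · exact ⟨- 2 * r * v, by linear_combination - 2 * v * hr⟩
  · refine isCoprime_int_iff.2 fun q hq h1 h2 => ?_
    have hqi := Nat.prime_iff_prime_int.1 hq
    have hqP : ¬ (q : ℤ) ∣ P := fun h => by
      have hqb := h.trans hPb
      exact isCoprime_int_iff.1 hyz q hq ((dvd_iff_dvd_of_dvd_sub (hy' q hqb)).1 h1)
        ((dvd_iff_dvd_of_dvd_sub (hz' q hqb)).1 h2)
    have h3 : (q : ℤ) ∣ P * (1 - d * b ^ 2) := by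
      apply hqi.dvd_of_dvd_pow (n := 3)
      rw [mul_pow, ← hP, show (y ^ 2 - d * (18 * z₀) ^ 2) * (1 - d * b ^ 2) ^ 3 =
        (y * (1 + 3 * d * b ^ 2) + 18 * z₀ * d * (3 * b + d * b ^ 3)) ^ 2 -
        d * (18 * z₀ * (1 + 3 * d * b ^ 2) + y * (3 * b + d * b ^ 3)) ^ 2 by ring]
      exact dvd_sub (dvd_pow h1 two_ne_zero) ((dvd_pow h2 two_ne_zero).mul_left _)
    have h4 := (hqi.dvd_or_dvd h3).resolve_left hqP
    have hq2 : ¬ (q : ℤ) ∣ 2 := fun h => hdvd q hq (h.trans ((by norm_num : (2:ℤ) ∣ 6).trans h6b)) h4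
    have h5 : (q : ℤ) ∣ 2 ^ 2 * (18 * z₀ + y * b) := by
      have := dvd_add h2 (h4.mul_right (3 * (18 * z₀) + y * b))
      rwa [show 18 * z₀ * (1 + 3 * d * b ^ 2) + y * (3 * b + d * b ^ 3) +
        (1 - d * b ^ 2) * (3 * (18 * z₀) + y * b) = 2 ^ 2 * (18 * z₀ + y * b) by ring] at this
    have h5 := (hqi.dvd_or_dvd h5).resolve_left fun h => hq2 (hqi.dvd_of_dvd_pow h)
    have h6 : (q : ℤ) ∣ 2 ^ 2 * (y + 18 * z₀ * d * b) := by
      have := dvd_add h1 (h4.mul_right (3 * y + 18 * z₀ * d * b))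
      rwa [show y * (1 + 3 * d * b ^ 2) + 18 * z₀ * d * (3 * b + d * b ^ 3) +
        (1 - d * b ^ 2) * (3 * y + 18 * z₀ * d * b) = 2 ^ 2 * (y + 18 * z₀ * d * b) by ring] at this
    have h6 := (hqi.dvd_or_dvd h6).resolve_left fun h => hq2 (hqi.dvd_of_dvd_pow h)
    -- `y + z√d ≡ 0` at a prime with `√d = -1 / b`
    apply hqP
    apply hqi.dvd_of_dvd_pow (n := 3)
    rw [← hP]
    have : y ^ 2 - d * (18 * z₀) ^ 2 = (y + 18 * z₀ * d * b) * (y - 18 * z₀ * d * b) -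
      d * (18 * z₀) ^ 2 * (1 - d * b ^ 2) := by ring
    rw [this]
    exact dvd_sub (h6.mul_right _) (h4.mul_left _)

end

section

open NumberField

/-- `F` is the quadratic field `ℚ(s)` with `s ^ 2 = D` squarefree. -/
structure IsQuad {F : Type*} [Field F] [NumberField F] (s : F) (D : ℤ) : Prop where
  sq : s ^ 2 = (D : F)
  span : ∀ x : F, ∃ a b : ℚ, x = (a : F) + (b : F) * s
  sqfree : Squarefree D
  ne_one : D ≠ 1

theorem rat_sq_mul_squarefree {D : ℤ} (hD : Squarefree D) {r : ℚ} {N : ℤ}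
    (h : (D : ℚ) * r ^ 2 = N) : ∃ k : ℤ, r = k := by
  have hden : (r.den : ℤ) ^ 2 ∣ D := by
    have h1 : D * r.num ^ 2 = N * (r.den : ℤ) ^ 2 := by
      have h2 : (r.den : ℚ) ≠ 0 := by exact_mod_cast r.den_nz
      have h3 : r = r.num / r.den := (Rat.num_div_den r).symm
      rw [h3] at h
      field_simp at h
      have h4 : D * r.num ^ 2 = (r.den : ℤ) ^ 2 * N := by exact_mod_cast h
      rw [h4]; ring
    have hc : IsCoprime ((r.den : ℤ) ^ 2) (r.num ^ 2) := by
      apply IsCoprime.pow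
      rw [Int.isCoprime_iff_gcd_eq_one, Int.gcd_comm]
      simpa [Int.gcd] using r.reduced
    exact hc.dvd_of_dvd_mul_right ⟨N, by linarith⟩
  have h1 : IsUnit (r.den : ℤ) := hD _ (by rw [← sq]; exact hden)
  have h2 : r.den = 1 := by
    have := Int.isUnit_iff_natAbs_eq.1 h1
    simpa using this
  exact ⟨r.num, by rw [← Rat.num_div_den r, h2]; simp⟩

namespace IsQuad

variable {F : Type*} [Field F] [NumberField F] {s : F} {D : ℤ}

theorem coord_zero (h : IsQuad s D) {a b : ℚ} (hab : (a : F) + b * s = 0) : a = 0 ∧ b = 0 := by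
  have hb : b = 0 := by
    by_contra hb
    have hbF : (b : F) ≠ 0 := by exact_mod_cast hb
    have h1 : s = ((-a / b : ℚ) : F) := by
      push_cast
      field_simp
      linear_combination hab
    have h2 : ((-a / b : ℚ)) ^ 2 = D := by
      have := h.sq
      rw [h1] at this
      exact_mod_cast this
    obtain ⟨k, hk⟩ := rat_sq_mul_squarefree (D := 1) (r := -a / b) (N := D) squarefree_one
      (by rw [h2]; simp)
    rw [hk] at h2
    have h3 : k ^ 2 = D := by exact_mod_cast h2
    have h4 : IsUnit k := h.sqfree k ⟨1, by rw [← h3]; ring⟩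
    apply h.ne_one
    rcases Int.isUnit_iff.1 h4 with h5 | h5 <;> rw [← h3, h5] <;> norm_num
  subst hb
  refine ⟨?_, rfl⟩
  have : (a : F) = 0 := by simpa using hab
  exact_mod_cast this

theorem coord_inj (h : IsQuad s D) {a b a' b' : ℚ} (hab : (a : F) + b * s = a' + b' * s) :
    a = a' ∧ b = b' := by
  have := h.coord_zero (a := a - a') (b := b - b') (by push_cast; linear_combination hab)
  exact ⟨sub_eq_zero.1 this.1, sub_eq_zero.1 this.2⟩


noncomputable def basis (h : IsQuad s D) : Module.Basis (Fin 2) ℚ F :=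
  Module.Basis.mk (v := ![1, s])
    (by
      rw [LinearIndependent.pair_iff]
      intro a b hab
      apply h.coord_zero
      rw [Algebra.smul_def, Algebra.smul_def] at hab
      simpa using hab)
    (by
      rintro x -
      obtain ⟨a, b, rfl⟩ := h.span x
      rw [Matrix.range_cons, Matrix.range_cons, Matrix.range_empty, Set.union_empty]
      refine Submodule.mem_span_pair.2 ⟨a, b, ?_⟩
      rw [Algebra.smul_def, Algebra.smul_def]
      simp)

theorem basis_zero (h : IsQuad s D) : h.basis 0 = 1 := by simp [basis]
theorem basis_one (h : IsQuad s D) : h.basis 1 = s := by simp [basis]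

theorem repr_eq (h : IsQuad s D) (a b : ℚ) :
    h.basis.repr ((a : F) + b * s) = Finsupp.equivFunOnFinite.symm ![a, b] := by
  rw [← LinearEquiv.eq_symm_apply, Module.Basis.repr_symm_apply, Finsupp.linearCombination_apply, Finsupp.sum_fintype _ _ (by simp)]
  simp [h.basis_zero, h.basis_one, Algebra.smul_def]

theorem finrank (h : IsQuad s D) : Module.finrank ℚ F = 2 := by
  rw [Module.finrank_eq_card_basis h.basis]; simp

theorem leftMulMatrix (h : IsQuad s D) (a b : ℚ) :
    Algebra.leftMulMatrix h.basis ((a : F) + b * s) = !![a, D * b; b, a] := by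
  have h1 : ((a : F) + b * s) * s = ((D * b : ℚ) : F) + a * s := by
    push_cast; linear_combination (b : F) * h.sq
  ext i j
  rw [Algebra.leftMulMatrix_eq_repr_mul]
  fin_cases j
  · simp only [Fin.zero_eta, h.basis_zero, mul_one, h.repr_eq]
    fin_cases i <;> simp
  · simp only [Fin.mk_one, h.basis_one, h1, h.repr_eq]
    fin_cases i <;> simp

theorem norm_eq (h : IsQuad s D) (a b : ℚ) :
    Algebra.norm ℚ ((a : F) + b * s) = a ^ 2 - D * b ^ 2 := by
  rw [Algebra.norm_eq_matrix_det h.basis, h.leftMulMatrix, Matrix.det_fin_two_of]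
  ring

theorem trace_eq (h : IsQuad s D) (a b : ℚ) :
    Algebra.trace ℚ F ((a : F) + b * s) = 2 * a := by
  rw [Algebra.trace_eq_matrix_trace h.basis, h.leftMulMatrix, Matrix.trace_fin_two_of]
  ring

theorem exists_int (h : IsQuad s D) (x : 𝓞 F) :
    ∃ u v : ℤ, 2 * (x : F) = u + v * s ∧ u ^ 2 - D * v ^ 2 = 4 * Algebra.norm ℤ x := by
  obtain ⟨a, b, hx⟩ := h.span (x : F)
  have hn := Algebra.coe_norm_int x
  have ht := Algebra.coe_trace_int x
  rw [hx, h.norm_eq] at hn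
  rw [hx, h.trace_eq] at ht
  obtain ⟨k, hk⟩ := rat_sq_mul_squarefree h.sqfree (r := 2 * b)
    (N := (Algebra.trace ℤ (𝓞 F) x) ^ 2 - 4 * Algebra.norm ℤ x) (by
      push_cast; rw [hn, ht]; ring)
  refine ⟨Algebra.trace ℤ (𝓞 F) x, k, ?_, ?_⟩
  · have h1 : ((Algebra.trace ℤ (𝓞 F) x : ℤ) : F) = ((2 * a : ℚ) : F) := by
      rw [← ht]; simp
    have h2 : ((k : ℤ) : F) = ((2 * b : ℚ) : F) := by rw [hk]; simp
    rw [h1, h2, hx]; push_cast; ring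
  · have : (((Algebra.trace ℤ (𝓞 F) x) ^ 2 - D * k ^ 2 : ℤ) : ℚ) = (4 * Algebra.norm ℤ x : ℤ) := by
      push_cast
      rw [hn, ht, ← hk]; ring
    exact_mod_cast this

/-- The square root of `D` as an algebraic integer. -/
def root (h : IsQuad s D) : 𝓞 F :=
  ⟨s, ⟨Polynomial.X ^ 2 - Polynomial.C D, Polynomial.monic_X_pow_sub_C _ two_ne_zero, by
    rw [Polynomial.eval₂_sub, Polynomial.eval₂_pow, Polynomial.eval₂_X, Polynomial.eval₂_C, h.sq]
    simp⟩⟩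

@[simp] theorem coe_root (h : IsQuad s D) : (h.root : F) = s := rfl

theorem root_sq (h : IsQuad s D) : h.root ^ 2 = D := by
  apply RingOfIntegers.ext
  simp [h.sq]

theorem exists_int' (h : IsQuad s D) (x : 𝓞 F) :
    ∃ u v : ℤ, 2 * x = u + v * h.root ∧ u ^ 2 - D * v ^ 2 = 4 * Algebra.norm ℤ x := by
  obtain ⟨u, v, h1, h2⟩ := h.exists_int x
  refine ⟨u, v, RingOfIntegers.ext ?_, h2⟩
  change algebraMap (𝓞 F) F _ = algebraMap (𝓞 F) F _
  rw [map_mul, map_add, map_mul, map_intCast, map_intCast, map_ofNat]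
  exact h1

theorem int_coord_inj (h : IsQuad s D) {a b a' b' : ℤ}
    (hab : (a : 𝓞 F) + b * h.root = a' + b' * h.root) : a = a' ∧ b = b' := by
  have := congrArg (algebraMap (𝓞 F) F) hab
  have h2 := h.coord_inj (a := a) (b := b) (a' := a') (b' := b') (by simpa using this)
  exact ⟨by exact_mod_cast h2.1, by exact_mod_cast h2.2⟩

theorem norm_int (h : IsQuad s D) (u v : ℤ) :
    Algebra.norm ℤ ((u : 𝓞 F) + (v : 𝓞 F) * h.root) = u ^ 2 - D * v ^ 2 := by
  have h1 := Algebra.coe_norm_int ((u : 𝓞 F) + (v : 𝓞 F) * h.root)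
  have h2 := h.norm_eq u v
  have h3 : (((u : 𝓞 F) + (v : 𝓞 F) * h.root : 𝓞 F) : F) = ((u : ℚ) : F) + ((v : ℚ) : F) * s := by simp
  rw [h3, h2] at h1
  exact_mod_cast h1

theorem absNorm_natCast (h : IsQuad s D) (n : ℕ) :
    Ideal.absNorm (Ideal.span {(n : 𝓞 F)}) = n ^ 2 := by
  rw [Ideal.absNorm_span_natCast, RingOfIntegers.rank, h.finrank]

theorem natCast_dvd (h : IsQuad s D) {q : ℕ} (hq : Odd q) {u v : ℤ}
    (hd : (q : 𝓞 F) ∣ u + v * h.root) : (q : ℤ) ∣ u ∧ (q : ℤ) ∣ v := by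
  obtain ⟨x, hx⟩ := hd
  obtain ⟨a, b, h1, -⟩ := h.exists_int' x
  have h2 : ((2 * u : ℤ) : 𝓞 F) + (2 * v : ℤ) * h.root = (q * a : ℤ) + (q * b : ℤ) * h.root := by
    push_cast
    linear_combination 2 * hx + (q : 𝓞 F) * h1
  have h3 := h.int_coord_inj h2
  have hc : IsCoprime (q : ℤ) 2 := by
    rw [Int.isCoprime_iff_gcd_eq_one]
    exact_mod_cast (Nat.coprime_two_right.2 hq)
  exact ⟨hc.dvd_of_dvd_mul_left ⟨a, h3.1⟩, hc.dvd_of_dvd_mul_left ⟨b, h3.2⟩⟩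

/-- The ideal `(q, √D - r)`. -/
def idl (h : IsQuad s D) (q : ℕ) (r : ℤ) : Ideal (𝓞 F) := Ideal.span {(q : 𝓞 F), h.root - r}

theorem idl_mul (h : IsQuad s D) {q : ℕ} (hq : q.Prime) (h2 : q ≠ 2) {r : ℤ}
    (hr : (q : ℤ) ∣ D - r ^ 2) (hD : ¬ (q : ℤ) ∣ D) :
    h.idl q r * h.idl q (-r) = Ideal.span {(q : 𝓞 F)} := by
  obtain ⟨k, hk⟩ := hr
  have hc : IsCoprime (q : ℤ) (2 * r) := by
    have hp := Nat.prime_iff_prime_int.1 hq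
    rw [hp.coprime_iff_not_dvd]
    intro hd
    rcases hp.dvd_or_dvd hd with h3 | h3
    · have : q ∣ 2 := by exact_mod_cast h3
      exact h2 ((Nat.prime_dvd_prime_iff_eq hq Nat.prime_two).1 this)
    · exact hD (by rw [show D = q * k + r ^ 2 by linarith]; exact dvd_add (dvd_mul_right _ _) (dvd_pow h3 two_ne_zero))
  have hmul : (h.root - (r : 𝓞 F)) * (h.root - ((-r : ℤ) : 𝓞 F)) = q * k := by
    have := congrArg (Int.cast : ℤ → 𝓞 F) hk
    push_cast at this ⊢
    linear_combination this + h.root_sq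
  apply le_antisymm
  · rw [idl, idl, Ideal.span_pair_mul_span_pair, Ideal.span_le]
    intro x hx
    simp only [Set.mem_insert_iff, Set.mem_singleton_iff] at hx
    rw [SetLike.mem_coe, Ideal.mem_span_singleton]
    rcases hx with rfl | rfl | rfl | rfl
    · exact dvd_mul_right _ _
    · exact dvd_mul_right _ _
    · exact dvd_mul_left _ _
    · exact ⟨_, hmul⟩
  · rw [Ideal.span_singleton_le_iff_mem]
    obtain ⟨a, b, hab⟩ := hc
    have e : (q : 𝓞 F) = (a : 𝓞 F) * (q * q) + b * (q * (h.root - ((-r : ℤ) : 𝓞 F)) - (h.root - r) * q) := by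
      have := congrArg (Int.cast : ℤ → 𝓞 F) hab
      push_cast at this ⊢
      linear_combination -(q : 𝓞 F) * this
    rw [e]
    have m1 : (q : 𝓞 F) ∈ h.idl q r := Ideal.subset_span (by simp)
    have m2 : (q : 𝓞 F) ∈ h.idl q (-r) := Ideal.subset_span (by simp)
    have m3 : h.root - (r : 𝓞 F) ∈ h.idl q r := Ideal.subset_span (by simp)
    have m4 : h.root - ((-r : ℤ) : 𝓞 F) ∈ h.idl q (-r) := Ideal.subset_span (by simp)
    exact add_mem (Ideal.mul_mem_left _ _ (Ideal.mul_mem_mul m1 m2)) (Ideal.mul_mem_left _ _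
      (sub_mem (Ideal.mul_mem_mul m1 m4) (Ideal.mul_mem_mul m3 m2)))

theorem idl_ne_top (h : IsQuad s D) {q : ℕ} (hq : q.Prime) (h2 : q ≠ 2) {r : ℤ}
    (hr : (q : ℤ) ∣ D - r ^ 2) : h.idl q r ≠ ⊤ := by
  intro ht
  obtain ⟨k, hk⟩ := hr
  have h1 : (1 : 𝓞 F) ∈ h.idl q r := by rw [ht]; trivial
  rw [idl, Ideal.mem_span_pair] at h1
  obtain ⟨a, b, hab⟩ := h1
  have := (h.natCast_dvd (q := q) (hq.odd_of_ne_two h2) (u := r) (v := 1)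
    ⟨a * (r + h.root) + b * k, by
      have hk' := congrArg (Int.cast : ℤ → 𝓞 F) hk
      push_cast at hk' ⊢
      linear_combination -(r + h.root) * hab + b * hk' + b * h.root_sq⟩).2
  have h3 : q ∣ 1 := by exact_mod_cast this
  exact hq.one_lt.ne' (Nat.dvd_one.1 h3)

theorem absNorm_idl (h : IsQuad s D) {q : ℕ} (hq : q.Prime) (h2 : q ≠ 2) {r : ℤ}
    (hr : (q : ℤ) ∣ D - r ^ 2) (hD : ¬ (q : ℤ) ∣ D) : Ideal.absNorm (h.idl q r) = q := by
  have h1 := congrArg Ideal.absNorm (h.idl_mul hq h2 hr hD)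
  rw [map_mul, h.absNorm_natCast] at h1
  have n1 : Ideal.absNorm (h.idl q r) ≠ 1 := by
    rw [Ne, Ideal.absNorm_eq_one_iff]; exact h.idl_ne_top hq h2 hr
  have n2 : Ideal.absNorm (h.idl q (-r)) ≠ 1 := by
    rw [Ne, Ideal.absNorm_eq_one_iff]; exact h.idl_ne_top hq h2 (by simpa using hr)
  exact ((hq.mul_eq_prime_sq_iff n1 n2).1 h1).1

theorem isPrime_idl (h : IsQuad s D) {q : ℕ} (hq : q.Prime) (h2 : q ≠ 2) {r : ℤ}
    (hr : (q : ℤ) ∣ D - r ^ 2) (hD : ¬ (q : ℤ) ∣ D) : (h.idl q r).IsPrime :=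
  Ideal.isPrime_of_irreducible_absNorm (by rw [h.absNorm_idl hq h2 hr hD]; exact hq)

end IsQuad

section PrimeNorm

variable {F : Type*} [Field F] [NumberField F]

theorem intCast_mem_of_absNorm_prime {P : Ideal (𝓞 F)} {q : ℕ} (hq : q.Prime)
    (hP : Ideal.absNorm P = q) (n : ℤ) : (n : 𝓞 F) ∈ P ↔ (q : ℤ) ∣ n := by
  have hqP : (q : 𝓞 F) ∈ P := hP ▸ Ideal.absNorm_mem P
  constructor
  · intro hn
    by_contra hd
    obtain ⟨a, b, hab⟩ := ((Nat.prime_iff_prime_int.1 hq).coprime_iff_not_dvd).2 hd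
    have h1 : (1 : 𝓞 F) ∈ P := by
      have : (1 : 𝓞 F) = a * q + b * n := by exact_mod_cast congrArg (Int.cast : ℤ → 𝓞 F) hab.symm
      rw [this]
      exact add_mem (Ideal.mul_mem_left _ _ hqP) (Ideal.mul_mem_left _ _ hn)
    rw [← Ideal.eq_top_iff_one, ← Ideal.absNorm_eq_one_iff, hP] at h1
    exact hq.one_lt.ne' h1
  · rintro ⟨k, rfl⟩
    push_cast
    exact Ideal.mul_mem_right _ _ hqP

theorem exists_int_sub_mem {P : Ideal (𝓞 F)} {q : ℕ} (hq : q.Prime)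
    (hP : Ideal.absNorm P = q) (x : 𝓞 F) : ∃ r : ℤ, x - r ∈ P := by
  have hc : Nat.card (𝓞 F ⧸ P) = q := by rw [← hP]; rfl
  have : Fact q.Prime := ⟨hq⟩
  have h1 : (1 : 𝓞 F ⧸ P) ≠ 0 := by
    intro h0
    have h1 : (1 : 𝓞 F) ∈ P := Ideal.Quotient.eq_zero_iff_mem.1 (by simpa using h0)
    rw [← Ideal.eq_top_iff_one, ← Ideal.absNorm_eq_one_iff, hP] at h1
    exact hq.one_lt.ne' h1
  have h2 := mem_zmultiples_of_prime_card hc h1 (g' := Ideal.Quotient.mk P x)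
  obtain ⟨r, hr⟩ := AddSubgroup.mem_zmultiples_iff.1 h2
  refine ⟨r, Ideal.Quotient.eq.1 ?_⟩
  rw [← hr]
  simp

theorem IsQuad.eq_idl_of_absNorm {s : F} {D : ℤ} (h : IsQuad s D) {P : Ideal (𝓞 F)} {q : ℕ}
    (hq : q.Prime) (h2 : q ≠ 2) (hD : ¬ (q : ℤ) ∣ D) (hP : Ideal.absNorm P = q) :
    ∃ r : ℤ, (q : ℤ) ∣ D - r ^ 2 ∧ P = h.idl q r := by
  obtain ⟨r, hr⟩ := exists_int_sub_mem hq hP h.root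
  have hd : (q : ℤ) ∣ D - r ^ 2 := by
    rw [← intCast_mem_of_absNorm_prime hq hP]
    have : ((D - r ^ 2 : ℤ) : 𝓞 F) = (h.root + r) * (h.root - r) := by
      push_cast; linear_combination - h.root_sq
    rw [this]
    exact Ideal.mul_mem_left _ _ hr
  refine ⟨r, hd, ?_⟩
  have hle : h.idl q r ≤ P := by
    rw [IsQuad.idl, Ideal.span_le]
    intro x hx
    simp only [Set.mem_insert_iff, Set.mem_singleton_iff] at hx
    rcases hx with rfl | rfl
    · exact hP ▸ Ideal.absNorm_mem P
    · exact hr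
  have hmax : (h.idl q r).IsMaximal := by
    have := h.isPrime_idl hq h2 hd hD
    apply this.isMaximal
    intro hb
    have := h.absNorm_idl hq h2 hd hD
    rw [hb, Ideal.absNorm_bot] at this
    exact hq.ne_zero this.symm
  refine (hmax.eq_of_le ?_ hle).symm
  rw [Ne, ← Ideal.absNorm_eq_one_iff, hP]
  exact hq.one_lt.ne'

end PrimeNorm

end

section

open NumberField

theorem numberField_adjoin_sqrt {L : Type*} [Field L] [CharZero L] {α : L} {D : ℤ}
    (hα : α ^ 2 = D) : NumberField (IntermediateField.adjoin ℚ {α}) where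
  to_finiteDimensional := IntermediateField.adjoin.finiteDimensional
    ⟨Polynomial.X ^ 2 - Polynomial.C (D : ℚ), Polynomial.monic_X_pow_sub_C _ two_ne_zero, by
      rw [Polynomial.eval₂_sub, Polynomial.eval₂_pow, Polynomial.eval₂_X, Polynomial.eval₂_C, hα]
      simp⟩

theorem isQuad_adjoin {L : Type*} [Field L] [CharZero L] {α : L} {D : ℤ}
    [NumberField (IntermediateField.adjoin ℚ {α})]
    (hα : α ^ 2 = D) (hD : Squarefree D) (h1 : D ≠ 1) :
    IsQuad (IntermediateField.AdjoinSimple.gen ℚ α) D where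
  sq := Subtype.ext (by simpa using hα)
  sqfree := hD
  ne_one := h1
  span := by
    have key : ∀ x ∈ IntermediateField.adjoin ℚ {α}, ∃ a b : ℚ, x = (a : L) + (b : L) * α := by
      intro x hx
      induction hx using IntermediateField.adjoin_induction with
      | mem x hx =>
        rw [Set.mem_singleton_iff] at hx
        exact ⟨0, 1, by simp [hx]⟩
      | algebraMap x => exact ⟨x, 0, by simp⟩
      | add x y _ _ hx hy =>
        obtain ⟨a, b, rfl⟩ := hx
        obtain ⟨c, e, rfl⟩ := hy
        exact ⟨a + c, b + e, by push_cast; ring⟩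
      | mul x y _ _ hx hy =>
        obtain ⟨a, b, rfl⟩ := hx
        obtain ⟨c, e, rfl⟩ := hy
        exact ⟨a * c + D * (b * e), a * e + b * c, by
          push_cast; linear_combination (b * e : L) * hα⟩
      | inv x _ hx =>
        obtain ⟨a, b, rfl⟩ := hx
        have hn : ((a : L) + b * α) * (a - b * α) = ((a ^ 2 - D * b ^ 2 : ℚ) : L) := by
          push_cast; linear_combination (-b ^ 2 : L) * hα
        by_cases h0 : a ^ 2 - D * b ^ 2 = 0
        · rw [h0, Rat.cast_zero, mul_eq_zero] at hn
          rcases hn with hn | hn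
          · exact ⟨0, 0, by simp [hn]⟩
          · refine ⟨(2 * a)⁻¹, 0, ?_⟩
            have : (b : L) * α = a := by linear_combination -hn
            rw [this]; push_cast; ring
        · have h0' : ((a ^ 2 - D * b ^ 2 : ℚ) : L) ≠ 0 := by exact_mod_cast h0
          refine ⟨a / (a ^ 2 - D * b ^ 2), -b / (a ^ 2 - D * b ^ 2), ?_⟩
          refine inv_eq_of_mul_eq_one_left ?_
          rw [Rat.cast_div, Rat.cast_div]
          field_simp
          rw [← hn]; push_cast; ring
    intro x
    obtain ⟨a, b, h⟩ := key x x.2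
    exact ⟨a, b, Subtype.ext (by simpa using h)⟩

namespace IsQuad

variable {F : Type*} [Field F] [NumberField F] {s : F} {D : ℤ}

theorem exists_conj (h : IsQuad s D) : ∃ σ : F →+* F, σ s = -s := by
  choose a b hab using h.span
  have hin : ∀ c e : ℚ, a ((c : F) + e * s) = c ∧ b ((c : F) + e * s) = e := fun c e =>
    (h.coord_inj (hab ((c : F) + e * s))).imp Eq.symm Eq.symm
  have hf : ∀ c e : ℚ, (a ((c : F) + e * s) : F) - b ((c : F) + e * s) * s = c - e * s := by
    intro c e; rw [(hin c e).1, (hin c e).2]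
  refine ⟨⟨⟨⟨fun x => a x - b x * s, ?_⟩, ?_⟩, ?_, ?_⟩, ?_⟩
  · have := hf 1 0
    simpa using this
  · intro x y
    have e : x * y = ((a x * a y + D * (b x * b y) : ℚ) : F) + ((a x * b y + b x * a y : ℚ) : F) * s := by
      conv_lhs => rw [hab x, hab y]
      push_cast
      linear_combination (b x * b y : F) * h.sq
    simp only
    rw [e, hf]
    push_cast
    linear_combination (-b x * b y : F) * h.sq
  · have := hf 0 0
    simpa using this
  · intro x y
    have e : x + y = ((a x + a y : ℚ) : F) + ((b x + b y : ℚ) : F) * s := by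
      conv_lhs => rw [hab x, hab y]
      push_cast; ring
    simp only
    rw [e, hf]
    push_cast; ring
  · have := hf 0 1
    simpa using this

/-- The nontrivial automorphism of a quadratic field. -/
noncomputable def conj (h : IsQuad s D) : F →+* F := h.exists_conj.choose

@[simp] theorem conj_root (h : IsQuad s D) : h.conj s = -s := h.exists_conj.choose_spec

theorem conj_apply (h : IsQuad s D) (a b : ℚ) : h.conj ((a : F) + b * s) = a - b * s := by
  rw [map_add, map_mul, map_ratCast, map_ratCast, h.conj_root]; ring

theorem conj_conj (h : IsQuad s D) (x : F) : h.conj (h.conj x) = x := by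
  obtain ⟨a, b, rfl⟩ := h.span x
  rw [h.conj_apply, map_sub, map_mul, map_ratCast, map_ratCast, h.conj_root]; ring

theorem mul_conj (h : IsQuad s D) (x : F) : x * h.conj x = (Algebra.norm ℚ x : ℚ) := by
  obtain ⟨a, b, rfl⟩ := h.span x
  rw [h.conj_apply, h.norm_eq]
  push_cast
  linear_combination (-b ^ 2 : F) * h.sq

end IsQuad

section IdealCount

variable {F : Type*} [Field F] [NumberField F]

theorem natPrime_unique_mem {P : Ideal (𝓞 F)} (hP : P ≠ ⊤) {p q : ℕ} (hp : p.Prime) (hq : q.Prime)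
    (h1 : (p : 𝓞 F) ∈ P) (h2 : (q : 𝓞 F) ∈ P) : p = q := by
  by_contra hne
  obtain ⟨a, b, hab⟩ := (Nat.isCoprime_iff_coprime.2 ((Nat.coprime_primes hp hq).2 hne))
  apply hP
  rw [Ideal.eq_top_iff_one]
  have : (1 : 𝓞 F) = a * p + b * q := by exact_mod_cast congrArg (Int.cast : ℤ → 𝓞 F) hab.symm
  rw [this]
  exact add_mem (Ideal.mul_mem_left _ _ h1) (Ideal.mul_mem_left _ _ h2)

theorem exists_prime_absNorm {P : Ideal (𝓞 F)} (hP : P.IsPrime) (h0 : P ≠ ⊥) :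
    ∃ q f : ℕ, q.Prime ∧ 0 < f ∧ Ideal.absNorm P = q ^ f ∧ (q : 𝓞 F) ∈ P := by
  have hm := hP.isMaximal h0
  obtain ⟨q, f, h1, h2, h3, h4⟩ := Ideal.exists_prime_and_absNorm_eq_pow P
  exact ⟨q, f, h3, h1, h4, h2⟩

theorem dvd_absNorm_iff {P : Ideal (𝓞 F)} (hP : P.IsPrime) (h0 : P ≠ ⊥) {q : ℕ} (hq : q.Prime) :
    q ∣ Ideal.absNorm P ↔ (q : 𝓞 F) ∈ P := by
  obtain ⟨p, f, h1, h2, h3, h4⟩ := exists_prime_absNorm hP h0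
  rw [h3]
  constructor
  · intro hd
    have := (Nat.prime_dvd_prime_iff_eq hq h1).1 (hq.dvd_of_dvd_pow hd)
    rwa [this]
  · intro hd
    rw [natPrime_unique_mem hP.ne_top hq h1 hd h4]
    exact dvd_pow_self _ h2.ne'

theorem absNorm_prod_map (M : Multiset (Ideal (𝓞 F))) :
    Ideal.absNorm M.prod = (M.map Ideal.absNorm).prod := map_multiset_prod _ _

/-- A set of nonzero primes having at most one member over each rational prime. -/
def SepPrimes (T : Ideal (𝓞 F) → Prop) : Prop :=
  (∀ P, T P → P.IsPrime ∧ P ≠ ⊥) ∧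
    ∀ P P' : Ideal (𝓞 F), ∀ q : ℕ, T P → T P' → q.Prime → (q : 𝓞 F) ∈ P → (q : 𝓞 F) ∈ P' → P = P'

theorem SepPrimes.inj {T : Ideal (𝓞 F) → Prop} (hT : SepPrimes T) (M : Multiset (Ideal (𝓞 F))) :
    ∀ M' : Multiset (Ideal (𝓞 F)), (∀ P ∈ M, T P) → (∀ P ∈ M', T P) →
      (M.map Ideal.absNorm).prod = (M'.map Ideal.absNorm).prod → M = M' := by
  have hex : ∀ P : Ideal (𝓞 F), ∀ M' : Multiset (Ideal (𝓞 F)), T P → (∀ P ∈ M', T P) →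
      Ideal.absNorm P ∣ (M'.map Ideal.absNorm).prod → P ∈ M' := by
    intro P M' hP hM' hd
    obtain ⟨q, f, h1, h2, h3, h4⟩ := exists_prime_absNorm (hT.1 P hP).1 (hT.1 P hP).2
    have hq : q ∣ (M'.map Ideal.absNorm).prod := ((dvd_pow_self q h2.ne').trans h3.symm.dvd).trans hd
    obtain ⟨P', hP', hqn⟩ := h1.prime.exists_mem_multiset_map_dvd hq
    have hTP' := hM' P' hP'
    rw [dvd_absNorm_iff (hT.1 _ hTP').1 (hT.1 _ hTP').2 h1] at hqn
    rwa [hT.2 P P' q hP hTP' h1 h4 hqn]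
  induction M using Multiset.induction with
  | empty =>
    intro M' _ hM' he
    by_contra hne
    obtain ⟨P, hP⟩ := Multiset.exists_mem_of_ne_zero (Ne.symm hne)
    have h1 : Ideal.absNorm P ∣ (M'.map Ideal.absNorm).prod :=
      Multiset.dvd_prod (Multiset.mem_map_of_mem _ hP)
    rw [← he, Multiset.map_zero, Multiset.prod_zero, Nat.dvd_one, Ideal.absNorm_eq_one_iff] at h1
    exact (hT.1 P (hM' P hP)).1.ne_top h1
  | cons P M ih =>
    intro M' hM hM' he
    have hTP := hM P (Multiset.mem_cons_self _ _)
    rw [Multiset.map_cons, Multiset.prod_cons] at he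
    have hP := hex P M' hTP hM' ⟨_, he.symm⟩
    obtain ⟨N, rfl⟩ := Multiset.exists_cons_of_mem hP
    rw [Multiset.map_cons, Multiset.prod_cons] at he
    have hn0 : Ideal.absNorm P ≠ 0 := by
      obtain ⟨q, f, h1, h2, h3, h4⟩ := exists_prime_absNorm (hT.1 P hTP).1 (hT.1 P hTP).2
      rw [h3]; exact (pow_pos h1.pos _).ne'
    rw [ih N (fun Q hQ => hM Q (Multiset.mem_cons_of_mem hQ))
      (fun Q hQ => hM' Q (Multiset.mem_cons_of_mem hQ)) (Nat.eq_of_mul_eq_mul_left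
        (Nat.pos_of_ne_zero hn0) he)]

theorem prime_ideals_le_two (h2 : Module.finrank ℚ F = 2) {q : ℕ} (hq : q.Prime)
    {P P' P'' : Ideal (𝓞 F)} (hP : P.IsPrime ∧ P ≠ ⊥) (hP' : P'.IsPrime ∧ P' ≠ ⊥)
    (hP'' : P''.IsPrime ∧ P'' ≠ ⊥) (m : (q : 𝓞 F) ∈ P) (m' : (q : 𝓞 F) ∈ P')
    (m'' : (q : 𝓞 F) ∈ P'') (h12 : P ≠ P') (h13 : P ≠ P'') (h23 : P' ≠ P'') : False := by
  have hne : ∀ {A B : Ideal (𝓞 F)}, A.IsPrime ∧ A ≠ ⊥ → B.IsPrime ∧ B ≠ ⊥ → A ≠ B → ¬ A ∣ B := by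
    intro A B hA hB hAB hd
    exact hAB ((hB.1.isMaximal hB.2).eq_of_le hA.1.ne_top (Ideal.dvd_iff_le.1 hd)).symm
  have hpr : ∀ {A : Ideal (𝓞 F)}, A.IsPrime ∧ A ≠ ⊥ → Prime A := fun hA =>
    (Ideal.prime_iff_isPrime hA.2).2 hA.1
  obtain ⟨J, hJ⟩ : P ∣ Ideal.span {(q : 𝓞 F)} := Ideal.dvd_span_singleton.2 m
  obtain ⟨J', rfl⟩ : P' ∣ J := ((hpr hP').dvd_or_dvd (hJ ▸ Ideal.dvd_span_singleton.2 m')).resolve_left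
    (hne hP' hP h12.symm)
  obtain ⟨J'', rfl⟩ : P'' ∣ J' := (((hpr hP'').dvd_or_dvd
    (hJ ▸ Ideal.dvd_span_singleton.2 m'')).resolve_left (hne hP'' hP h13.symm) |>
      (hpr hP'').dvd_or_dvd).resolve_left (hne hP'' hP' h23.symm)
  have hn := congrArg Ideal.absNorm hJ
  rw [Ideal.absNorm_span_natCast, RingOfIntegers.rank, h2, map_mul, map_mul, map_mul] at hn
  obtain ⟨a, ha⟩ := (dvd_absNorm_iff hP.1 hP.2 hq).2 m
  obtain ⟨b, hb⟩ := (dvd_absNorm_iff hP'.1 hP'.2 hq).2 m'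
  obtain ⟨c, hc⟩ := (dvd_absNorm_iff hP''.1 hP''.2 hq).2 m''
  rw [ha, hb, hc] at hn
  have h3 : q ^ 2 * 1 = q ^ 2 * (q * (a * b * c * Ideal.absNorm J'')) := by
    rw [mul_one]
    exact hn.trans (by ring)
  have h4 := Nat.eq_of_mul_eq_mul_left (pow_pos hq.pos 2) h3
  exact hq.one_lt.ne' (Nat.dvd_one.1 ⟨_, h4⟩)

open UniqueFactorizationMonoid Classical in
/-- Ideals of a quadratic field embed into pairs of products of norms of prime ideals. -/
theorem exists_pair_encoding (h2 : Module.finrank ℚ F = 2) :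
    ∃ f : Ideal (𝓞 F) → ℕ × ℕ, Set.InjOn f {I | I ≠ ⊥} ∧ ∀ I, I ≠ ⊥ →
      (f I).1 * (f I).2 = Ideal.absNorm I ∧
      ∃ M N : Multiset (Ideal (𝓞 F)), (∀ P ∈ M, P.IsPrime ∧ P ≠ ⊥) ∧ (∀ P ∈ N, P.IsPrime ∧ P ≠ ⊥) ∧
        (f I).1 = (M.map Ideal.absNorm).prod ∧ (f I).2 = (N.map Ideal.absNorm).prod := by
  let pr : Ideal (𝓞 F) → Prop := fun P => P.IsPrime ∧ P ≠ ⊥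
  let fst : ℕ → Ideal (𝓞 F) := fun q => if hq : ∃ P, pr P ∧ (q : 𝓞 F) ∈ P then hq.choose else ⊥
  let T : Ideal (𝓞 F) → Prop := fun P => pr P ∧ ∃ q : ℕ, q.Prime ∧ (q : 𝓞 F) ∈ P ∧ P = fst q
  have hT : SepPrimes T := by
    refine ⟨fun P hP => hP.1, ?_⟩
    rintro P P' q ⟨h1, p, hp, hpP, hPf⟩ ⟨h1', p', hp', hpP', hPf'⟩ hq hqP hqP'
    rw [hPf, hPf', natPrime_unique_mem h1.1.ne_top hp hq hpP hqP,
      natPrime_unique_mem h1'.1.ne_top hp' hq hpP' hqP']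
  have hT' : SepPrimes (fun P => pr P ∧ ¬ T P) := by
    refine ⟨fun P hP => hP.1, ?_⟩
    rintro P P' q ⟨h1, h3⟩ ⟨h1', h3'⟩ hq hqP hqP'
    by_contra hne
    have hex : ∃ P, pr P ∧ (q : 𝓞 F) ∈ P := ⟨P, h1, hqP⟩
    have hf : fst q = hex.choose := dif_pos hex
    have hs := hex.choose_spec
    rw [← hf] at hs
    exact prime_ideals_le_two h2 hq h1 h1' hs.1 hqP hqP' hs.2 hne
      (fun he => h3 ⟨h1, q, hq, hqP, he⟩) (fun he => h3' ⟨h1', q, hq, hqP', he⟩)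
  have hfac : ∀ I : Ideal (𝓞 F), ∀ P ∈ normalizedFactors I, pr P := by
    intro I P hP
    have := prime_of_normalized_factor P hP
    exact ⟨Ideal.isPrime_of_prime this, this.ne_zero⟩
  refine ⟨fun I => ((((normalizedFactors I).filter T).map Ideal.absNorm).prod,
    (((normalizedFactors I).filter (fun P => ¬ T P)).map Ideal.absNorm).prod), ?_, ?_⟩
  · intro I hI J hJ he
    rw [Prod.mk.injEq] at he
    have e1 := hT.inj _ _ (fun P hP => (Multiset.mem_filter.1 hP).2)
      (fun P hP => (Multiset.mem_filter.1 hP).2) he.1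
    have e2 := hT'.inj _ _ (fun P hP => ⟨hfac I P (Multiset.mem_filter.1 hP).1, (Multiset.mem_filter.1 hP).2⟩)
      (fun P hP => ⟨hfac J P (Multiset.mem_filter.1 hP).1, (Multiset.mem_filter.1 hP).2⟩) he.2
    rw [← Ideal.prod_normalizedFactors_eq_self hI, ← Ideal.prod_normalizedFactors_eq_self hJ,
      ← Multiset.filter_add_not T (normalizedFactors I), e1, e2, Multiset.filter_add_not]
  · intro I hI
    refine ⟨?_, _, _, fun P hP => hfac I P (Multiset.mem_filter.1 hP).1,
      fun P hP => hfac I P (Multiset.mem_filter.1 hP).1, rfl, rfl⟩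
    rw [← Multiset.prod_add, ← Multiset.map_add, Multiset.filter_add_not, ← absNorm_prod_map,
      Ideal.prod_normalizedFactors_eq_self hI]

end IdealCount

end

section

open NumberField UniqueFactorizationMonoid

/-- The integer data attached to `γ = y + z√d` with `N γ = P ^ 3`, and the field `ℚ(√D)`, where
`-3d = m ^ 2 D`. -/
structure CubeNorm (d y z P m e D : ℤ) : Prop where
  norm : y ^ 2 - d * z ^ 2 = P ^ 3
  coprime : IsCoprime y z
  coprime_six : IsCoprime P 6
  mul : m * e = 3
  cases : e = 1 ∨ e = 3
  disc : -3 * d = m ^ 2 * D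
  dvd : (18 : ℤ) ∣ z

theorem cubSym_mul_int {q : ℕ} (hq : q.Prime) (h3 : q ≠ 3) {A B c : ℤ}
    (h : ¬ (q : ℤ) ∣ A ^ 2 - A * B + B ^ 2) (hc : ¬ (q : ℤ) ∣ c) :
    cubSym q (c * A) (c * B) = cubSym q A B := by
  have hp := Nat.prime_iff_prime_int.1 hq
  have hc' : ¬ (q : ℤ) ∣ c ^ 2 - c * 0 + 0 ^ 2 := by
    intro hd
    exact hc (hp.dvd_of_dvd_pow (n := 2) (by simpa using hd))
  rw [cubSym_mul hq h3 hc' h (E := c * A) (F := c * B) (by ring) (by ring),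
    cubSym_of_dvd hq h3 hc' (dvd_zero _), zero_add]

theorem not_dvd_norm_form {q : ℕ} (hq : q.Prime) (h3 : q ≠ 3) {d y z P m D r : ℤ}
    (hP : y ^ 2 - d * z ^ 2 = P ^ 3) (hD : -3 * d = m ^ 2 * D)
    (hr : (q : ℤ) ∣ D - r ^ 2) (hqP : ¬ (q : ℤ) ∣ P) :
    ¬ (q : ℤ) ∣ (z * m * r + y) ^ 2 - (z * m * r + y) * (2 * y) + (2 * y) ^ 2 := by
  have hp := Nat.prime_iff_prime_int.1 hq
  intro hd
  have h1 : (q : ℤ) ∣ 3 * P ^ 3 := by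
    rw [show 3 * P ^ 3 = ((z * m * r + y) ^ 2 - (z * m * r + y) * (2 * y) + (2 * y) ^ 2) +
      z ^ 2 * m ^ 2 * (D - r ^ 2) by rw [← hP]; linear_combination (z ^ 2) * hD]
    exact dvd_add hd (Dvd.dvd.mul_left hr _)
  rcases hp.dvd_or_dvd h1 with h2 | h2
  · have : q ∣ 3 := by exact_mod_cast h2
    exact h3 ((Nat.prime_dvd_prime_iff_eq hq Nat.prime_three).1 this)
  · exact hqP (hp.dvd_of_dvd_pow h2)

namespace IsQuad

variable {F : Type*} [Field F] [NumberField F] {s : F} {D : ℤ}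

open Classical in
noncomputable def locSym (h : IsQuad s D) (m y z : ℤ) (P : Ideal (𝓞 F)) : ZMod 3 :=
  if hr : ∃ r : ℤ, P = h.idl (Ideal.absNorm P) r then
    cubSym (Ideal.absNorm P) (z * m * hr.choose + y) (2 * y) else 0

noncomputable def idealSym (h : IsQuad s D) (m y z : ℤ) (I : Ideal (𝓞 F)) : ZMod 3 :=
  ((normalizedFactors I).map (h.locSym m y z)).sum

theorem root_sub_mem_idl (h : IsQuad s D) (q : ℕ) (r : ℤ) : h.root - (r : 𝓞 F) ∈ h.idl q r :=
  Ideal.subset_span (by simp)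

theorem locSym_idl (h : IsQuad s D) (m y z : ℤ) {q : ℕ} (hq : q.Prime) (h2 : q ≠ 2) {r : ℤ}
    (hr : (q : ℤ) ∣ D - r ^ 2) (hD : ¬ (q : ℤ) ∣ D) :
    h.locSym m y z (h.idl q r) = cubSym q (z * m * r + y) (2 * y) := by
  have hn := h.absNorm_idl hq h2 hr hD
  have hex : ∃ r' : ℤ, h.idl q r = h.idl (Ideal.absNorm (h.idl q r)) r' := ⟨r, by rw [hn]⟩
  rw [locSym, dif_pos hex]
  have hs := hex.choose_spec
  generalize hex.choose = r' at *
  have m1 := h.root_sub_mem_idl q r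
  have m2 := h.root_sub_mem_idl (Ideal.absNorm (h.idl q r)) r'
  rw [← hs] at m2
  rw [hn]
  have hd : (q : ℤ) ∣ r' - r := by
    rw [← intCast_mem_of_absNorm_prime hq hn]
    have := sub_mem m1 m2
    simpa using this
  apply cubSym_congr _ (by simp)
  rw [show z * m * r' + y - (z * m * r + y) = z * m * (r' - r) by ring]
  exact Dvd.dvd.mul_left hd _

theorem idealSym_mul (h : IsQuad s D) (m y z : ℤ) {I J : Ideal (𝓞 F)} (hI : I ≠ ⊥) (hJ : J ≠ ⊥) :
    h.idealSym m y z (I * J) = h.idealSym m y z I + h.idealSym m y z J := by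
  rw [idealSym, normalizedFactors_mul hI hJ, Multiset.map_add, Multiset.sum_add]; rfl

theorem idealSym_prime (h : IsQuad s D) (m y z : ℤ) {P : Ideal (𝓞 F)} (hP : P.IsPrime)
    (h0 : P ≠ ⊥) : h.idealSym m y z P = h.locSym m y z P := by
  rw [idealSym, normalizedFactors_irreducible ((Ideal.prime_iff_isPrime h0).2 hP).irreducible]
  simp

theorem isPrime_of_locSym_ne_zero (h : IsQuad s D) {m y z : ℤ} {P : Ideal (𝓞 F)}
    (hP : h.locSym m y z P ≠ 0) : (Ideal.absNorm P).Prime := by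
  by_contra hn
  apply hP
  rw [locSym]
  split_ifs
  · rw [cubSym, dif_neg hn]
  · rfl

theorem idealSym_natPrime (h : IsQuad s D) {d m y z P e : ℤ} (hc : CubeNorm d y z P m e D) {q : ℕ}
    (hq : q.Prime) (hB : ¬ (q : ℤ) ∣ 6 * D * P) :
    h.idealSym m y z (Ideal.span {(q : 𝓞 F)}) = 0 := by
  have hp := Nat.prime_iff_prime_int.1 hq
  have h2 : q ≠ 2 := by
    rintro rfl; exact hB ⟨3 * D * P, by push_cast; ring⟩
  have h3 : q ≠ 3 := by
    rintro rfl; exact hB ⟨2 * D * P, by push_cast; ring⟩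
  have hD : ¬ (q : ℤ) ∣ D := fun hd => hB ((hd.mul_left 6).mul_right P)
  have hqP : ¬ (q : ℤ) ∣ P := fun hd => hB (hd.mul_left _)
  by_cases hr : ∃ r : ℤ, (q : ℤ) ∣ D - r ^ 2
  · obtain ⟨r, hr⟩ := hr
    have hr' : (q : ℤ) ∣ D - (-r) ^ 2 := by simpa using hr
    have p1 := h.isPrime_idl hq h2 hr hD
    have p2 := h.isPrime_idl hq h2 hr' hD
    have n1 := h.absNorm_idl hq h2 hr hD
    have n2 := h.absNorm_idl hq h2 hr' hD
    have b1 : h.idl q r ≠ ⊥ := fun hb => hq.ne_zero (by rw [← n1, hb, Ideal.absNorm_bot])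
    have b2 : h.idl q (-r) ≠ ⊥ := fun hb => hq.ne_zero (by rw [← n2, hb, Ideal.absNorm_bot])
    rw [← h.idl_mul hq h2 hr hD, h.idealSym_mul m y z b1 b2, h.idealSym_prime m y z p1 b1,
      h.idealSym_prime m y z p2 b2, h.locSym_idl m y z hq h2 hr hD,
      h.locSym_idl m y z hq h2 hr' hD]
    have hnd := not_dvd_norm_form hq h3 hc.norm hc.disc hr hqP
    have hnd' := not_dvd_norm_form hq h3 hc.norm hc.disc hr' hqP
    have e1 := cubSym_conj hq h3 hnd
    have e2 := cubSym_mul_int hq h3 hnd' (c := -1) (by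
      rw [dvd_neg]; intro hd; exact hq.one_lt.ne' (Nat.dvd_one.1 (by exact_mod_cast hd)))
    rw [show z * m * r + y - 2 * y = -1 * (z * m * -r + y) by ring,
      show -(2 * y) = -1 * (2 * y) by ring, e2] at e1
    rw [e1]; ring
  · rw [idealSym]
    apply Multiset.sum_eq_zero
    intro x hx
    obtain ⟨Q, hQ, rfl⟩ := Multiset.mem_map.1 hx
    by_contra hne
    have hQp := h.isPrime_of_locSym_ne_zero hne
    have hQ1 := prime_of_normalized_factor Q hQ
    have hqQ : (q : 𝓞 F) ∈ Q := Ideal.dvd_span_singleton.1 (dvd_of_mem_normalizedFactors hQ)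
    have he := natPrime_unique_mem (Ideal.isPrime_of_prime hQ1).ne_top hQp hq (Ideal.absNorm_mem Q) hqQ
    obtain ⟨r, hr1, -⟩ := h.eq_idl_of_absNorm hq h2 hD he
    exact hr ⟨r, hr1⟩

/-- A prime divisor of an element `(u + v√D)/2` not dividing `v` has prime norm and residue `-u/v`. -/
theorem eq_idl_of_dvd_primitive (h : IsQuad s D) {x : 𝓞 F} {u v : ℤ}
    (hx : 2 * x = u + v * h.root) (huv : u ^ 2 - D * v ^ 2 = 4 * Algebra.norm ℤ x)
    {Q : Ideal (𝓞 F)} (hQ : Q.IsPrime) (h0 : Q ≠ ⊥) (hxQ : x ∈ Q) {q : ℕ} (hq : q.Prime) (h2 : q ≠ 2)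
    (hqQ : (q : 𝓞 F) ∈ Q) (hD : ¬ (q : ℤ) ∣ D) (hprim : (q : ℤ) ∣ u → ¬ (q : ℤ) ∣ v) :
    ∃ r : ℤ, (q : ℤ) ∣ D - r ^ 2 ∧ Q = h.idl q r ∧ (q : ℤ) ∣ u + v * r ∧ ¬ (q : ℤ) ∣ v := by
  have hp := Nat.prime_iff_prime_int.1 hq
  have h_isInt : ∀ n : ℤ, (n : 𝓞 F) ∈ Q → (q : ℤ) ∣ n := by
    intro n hn
    by_contra hd
    obtain ⟨a, b, hab⟩ := (hp.coprime_iff_not_dvd).2 hd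
    apply hQ.ne_top
    rw [Ideal.eq_top_iff_one]
    have : (1 : 𝓞 F) = a * q + b * n := by exact_mod_cast congrArg (Int.cast : ℤ → 𝓞 F) hab.symm
    rw [this]
    exact add_mem (Ideal.mul_mem_left _ _ hqQ) (Ideal.mul_mem_left _ _ hn)
  have hm : (u : 𝓞 F) + v * h.root ∈ Q := hx ▸ Ideal.mul_mem_left _ _ hxQ
  have hdn : (q : ℤ) ∣ u ^ 2 - D * v ^ 2 := by
    apply h_isInt
    have : ((u ^ 2 - D * v ^ 2 : ℤ) : 𝓞 F) = (u - v * h.root) * (u + v * h.root) := by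
      push_cast; linear_combination (v : 𝓞 F) ^ 2 * h.root_sq
    rw [this]
    exact Ideal.mul_mem_left _ _ hm
  have hv : ¬ (q : ℤ) ∣ v := by
    intro hv
    refine hprim (hp.dvd_of_dvd_pow (n := 2) ?_) hv
    rw [show u ^ 2 = (u ^ 2 - D * v ^ 2) + D * v * v by ring]
    exact dvd_add hdn (hv.mul_left _)
  obtain ⟨a, w, haw⟩ := (hp.coprime_iff_not_dvd).2 hv
  have hur : (q : ℤ) ∣ u + v * (-u * w) := ⟨u * a, by linear_combination (-u) * haw⟩
  have hr : (q : ℤ) ∣ D - (-u * w) ^ 2 := by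
    have : (q : ℤ) ∣ v ^ 2 * (D - (-u * w) ^ 2) := by
      rw [show v ^ 2 * (D - (-u * w) ^ 2) = -(u ^ 2 - D * v ^ 2) + (u + v * (-u * w)) * (u - v * (-u * w)) by ring]
      exact dvd_add (hdn.neg_right) (hur.mul_right _)
    exact (hp.dvd_or_dvd this).resolve_left (fun hd => hv (hp.dvd_of_dvd_pow hd))
  refine ⟨-u * w, hr, ?_, hur, hv⟩
  have hpr := h.isPrime_idl hq h2 hr hD
  have hb : h.idl q (-u * w) ≠ ⊥ := fun hb => hq.ne_zero (by
    rw [← h.absNorm_idl hq h2 hr hD, hb, Ideal.absNorm_bot])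
  refine ((hpr.isMaximal hb).eq_of_le hQ.ne_top ?_).symm
  rw [idl, Ideal.span_le]
  intro t ht
  simp only [Set.mem_insert_iff, Set.mem_singleton_iff] at ht
  rcases ht with rfl | rfl
  · exact hqQ
  · have haw' := congrArg (Int.cast : ℤ → 𝓞 F) haw
    have e : h.root - ((-u * w : ℤ) : 𝓞 F) = w * (u + v * h.root) + (a * h.root) * q := by
      push_cast at haw' ⊢
      linear_combination (-h.root) * haw'
    rw [e]
    exact add_mem (Ideal.mul_mem_left _ _ hm) (Ideal.mul_mem_left _ _ hqQ)

theorem norm_nonneg (h : IsQuad s D) (hD0 : D < 0) (x : 𝓞 F) : 0 ≤ Algebra.norm ℤ x := by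
  obtain ⟨u, v, -, h2⟩ := h.exists_int' x
  nlinarith [sq_nonneg u, sq_nonneg v]

theorem idealSym_primitive (h : IsQuad s D) (hD0 : D < 0) {d m y z P e : ℤ}
    (hc : CubeNorm d y z P m e D) {x : 𝓞 F} (hx0 : x ≠ 0) {u v : ℤ}
    (hx : 2 * x = u + v * h.root) (huv : u ^ 2 - D * v ^ 2 = 4 * Algebra.norm ℤ x)
    (hB : IsCoprime (Algebra.norm ℤ x) (6 * D * P))
    (hprim : ∀ q : ℕ, q.Prime → q ≠ 2 → (q : ℤ) ∣ u → ¬ (q : ℤ) ∣ v) :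
    h.idealSym m y z (Ideal.span {x}) = 0 := by
  set n := (Algebra.norm ℤ x).natAbs with hn
  have hnn : (n : ℤ) = Algebra.norm ℤ x := by
    rw [hn, Int.natAbs_of_nonneg (h.norm_nonneg hD0 x)]
  have hI0 : Ideal.span {x} ≠ ⊥ := by simpa using hx0
  have hnI : Ideal.absNorm (Ideal.span {x}) = n := Ideal.absNorm_span_singleton x
  have hn0 : n ≠ 0 := by
    rw [← hnI, Ne, Ideal.absNorm_eq_zero_iff]; exact hI0
  rw [← hnn] at hB huv
  have hloc : ∀ Q ∈ normalizedFactors (Ideal.span {x}), (Ideal.absNorm Q).Prime ∧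
      h.locSym m y z Q = cubSym (Ideal.absNorm Q) (y * v - m * z * u) (2 * y * v) := by
    intro Q hQ
    have hQ1 := prime_of_normalized_factor Q hQ
    have hQp := Ideal.isPrime_of_prime hQ1
    have hdvd := dvd_of_mem_normalizedFactors hQ
    obtain ⟨q, f, hq, hf, hqf, hqQ⟩ := exists_prime_absNorm hQp hQ1.ne_zero
    have hqn : (q : ℤ) ∣ n := by
      have h1 : Ideal.absNorm Q ∣ n := by
        rw [← hnI]; exact Ideal.absNorm_dvd_absNorm_of_le (Ideal.dvd_iff_le.1 hdvd)
      rw [hqf] at h1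
      exact_mod_cast (dvd_pow_self q hf.ne').trans h1
    have hqB : ¬ (q : ℤ) ∣ 6 * D * P := (isCoprime_int_iff.1 hB) q hq hqn
    have h2 : q ≠ 2 := by
      rintro rfl; exact hqB ⟨3 * D * P, by push_cast; ring⟩
    have h3 : q ≠ 3 := by
      rintro rfl; exact hqB ⟨2 * D * P, by push_cast; ring⟩
    have hD : ¬ (q : ℤ) ∣ D := fun hd => hqB ((hd.mul_left 6).mul_right P)
    have hqP : ¬ (q : ℤ) ∣ P := fun hd => hqB (hd.mul_left _)
    obtain ⟨r, hr, rfl, hur, hv⟩ := h.eq_idl_of_dvd_primitive hx (by rw [huv, hnn]) hQp hQ1.ne_zero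
      (Ideal.dvd_span_singleton.1 hdvd) hq h2 hqQ hD (hprim q hq h2)
    rw [h.absNorm_idl hq h2 hr hD]
    refine ⟨hq, ?_⟩
    rw [h.locSym_idl m y z hq h2 hr hD,
      ← cubSym_mul_int hq h3 (not_dvd_norm_form hq h3 hc.norm hc.disc hr hqP) hv]
    refine cubSym_congr ?_ (by rw [show v * (2 * y) - 2 * y * v = 0 by ring]; exact dvd_zero _)
    rw [show v * (z * m * r + y) - (y * v - m * z * u) = m * z * (u + v * r) by ring]
    exact hur.mul_left _
  have e1 : (normalizedFactors (Ideal.span {x})).map (h.locSym m y z) =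
      ((normalizedFactors (Ideal.span {x})).map Ideal.absNorm).map
        (fun q => cubSym q (y * v - m * z * u) (2 * y * v)) := by
    rw [Multiset.map_map]
    exact Multiset.map_congr rfl (fun Q hQ => (hloc Q hQ).2)
  have e2 : (normalizedFactors (Ideal.span {x})).map Ideal.absNorm = (n.primeFactorsList : Multiset ℕ) := by
    obtain ⟨l, hl⟩ := Quot.exists_rep ((normalizedFactors (Ideal.span {x})).map Ideal.absNorm)
    rw [← hl]
    apply Quot.sound
    have hl' : (l : Multiset ℕ) = (normalizedFactors (Ideal.span {x})).map Ideal.absNorm := hl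
    apply Nat.primeFactorsList_unique
    · rw [← Multiset.prod_coe, hl', ← absNorm_prod_map, Ideal.prod_normalizedFactors_eq_self hI0, hnI]
    · intro p hp
      have : p ∈ (l : Multiset ℕ) := hp
      rw [hl', Multiset.mem_map] at this
      obtain ⟨Q, hQ, rfl⟩ := this
      exact (hloc Q hQ).1
  rw [idealSym, e1, e2, Multiset.map_coe, Multiset.sum_coe]
  have hB6 : IsCoprime (n : ℤ) 6 := hB.of_isCoprime_of_dvd_right ⟨D * P, by ring⟩
  exact cubSym_sum_zero hc.norm hc.coprime hc.coprime_six hc.mul hc.cases hc.disc huv hB6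
    (hB.of_isCoprime_of_dvd_right ⟨6 * D, by ring⟩) hprim hc.dvd

theorem idealSym_principal (h : IsQuad s D) (hD0 : D < 0) {d m y z P e : ℤ}
    (hc : CubeNorm d y z P m e D) : ∀ (N : ℕ) (x : 𝓞 F), x ≠ 0 → (Algebra.norm ℤ x).natAbs = N →
    IsCoprime (Algebra.norm ℤ x) (6 * D * P) → h.idealSym m y z (Ideal.span {x}) = 0 := by
  intro N
  induction N using Nat.strong_induction_on with
  | _ N ih =>
    intro x hx0 hN hB
    obtain ⟨u, v, hx, huv⟩ := h.exists_int' x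
    by_cases hprim : ∀ q : ℕ, q.Prime → q ≠ 2 → (q : ℤ) ∣ u → ¬ (q : ℤ) ∣ v
    · exact h.idealSym_primitive hD0 hc hx0 hx huv hB hprim
    · push Not at hprim
      obtain ⟨q, hq, h2, ⟨a, ha⟩, ⟨b, hb⟩⟩ := hprim
      obtain ⟨k, hk⟩ := hq.odd_of_ne_two h2
      obtain ⟨x', rfl⟩ : (q : 𝓞 F) ∣ x := by
        refine ⟨(k + 1) * (a + b * h.root) - x, ?_⟩
        have hk' : (q : 𝓞 F) = 2 * k + 1 := by exact_mod_cast congrArg (Nat.cast : ℕ → 𝓞 F) hk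
        have : 2 * x = q * (a + b * h.root) := by
          rw [hx, ha, hb]; push_cast; ring
        linear_combination x * hk' + (k + 1 : 𝓞 F) * this
      have hx'0 : x' ≠ 0 := right_ne_zero_of_mul hx0
      have hnq : Algebra.norm ℤ (q : 𝓞 F) = q ^ 2 := by
        have := h.norm_int (q : ℤ) 0
        simpa using this
      rw [map_mul, hnq] at hN hB
      have hqB : ¬ (q : ℤ) ∣ 6 * D * P :=
        (isCoprime_int_iff.1 hB) q hq ((dvd_pow_self _ two_ne_zero).mul_right _)
      rw [← Ideal.span_singleton_mul_span_singleton, h.idealSym_mul m y z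
        (by simpa using hq.ne_zero) (by simpa using hx'0), h.idealSym_natPrime hc hq hqB, zero_add]
      refine ih _ ?_ x' hx'0 rfl (IsCoprime.of_mul_left_right hB)
      rw [← hN, Int.natAbs_mul]
      have h1 : 0 < (Algebra.norm ℤ x').natAbs := Int.natAbs_pos.2 (by
        rw [Ne, Algebra.norm_eq_zero_iff]; exact hx'0)
      have h3 : ((q : ℤ) ^ 2).natAbs = q ^ 2 := by rw [Int.natAbs_pow, Int.natAbs_natCast]
      rw [h3]
      exact (Nat.lt_mul_iff_one_lt_left h1).2 (Nat.one_lt_pow two_ne_zero hq.one_lt)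

end IsQuad

end

section

open NumberField UniqueFactorizationMonoid nonZeroDivisors

section CoprimeRep

variable {F : Type*} [Field F] [NumberField F]

theorem coprime_absNorm_of_sup_eq_top {I : Ideal (𝓞 F)} (hI : I ≠ ⊥) {B : ℤ}
    (h : I ⊔ Ideal.span {(B : 𝓞 F)} = ⊤) : IsCoprime (Ideal.absNorm I : ℤ) B := by
  rw [isCoprime_int_iff]
  intro q hq hd hB
  have hd' : q ∣ Ideal.absNorm I := by exact_mod_cast hd
  rw [← Ideal.prod_normalizedFactors_eq_self hI, absNorm_prod_map] at hd'
  obtain ⟨Q, hQ, hqQ⟩ := hq.prime.exists_mem_multiset_map_dvd hd'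
  have hQ1 := prime_of_normalized_factor Q hQ
  have hQp := Ideal.isPrime_of_prime hQ1
  rw [dvd_absNorm_iff hQp hQ1.ne_zero hq] at hqQ
  apply hQp.ne_top
  rw [eq_top_iff, ← h, sup_le_iff]
  refine ⟨Ideal.dvd_iff_le.1 (dvd_of_mem_normalizedFactors hQ), ?_⟩
  rw [Ideal.span_singleton_le_iff_mem]
  obtain ⟨k, hk⟩ := hB
  rw [hk]; push_cast
  exact Ideal.mul_mem_right _ _ hqQ

/-- Every ideal class contains an integral ideal of norm coprime to a given integer. -/
theorem exists_coprime_rep (c : ClassGroup (𝓞 F)) {B : ℤ} (hB : B ≠ 0) :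
    ∃ I : (Ideal (𝓞 F))⁰, ClassGroup.mk0 I = c ∧ IsCoprime (Ideal.absNorm (I : Ideal (𝓞 F)) : ℤ) B := by
  obtain ⟨J, hJ⟩ := ClassGroup.mk0_surjective c⁻¹
  have hJ0 : (J : Ideal (𝓞 F)) ≠ ⊥ := nonZeroDivisors.coe_ne_zero J
  have hB0 : Ideal.span {(B : 𝓞 F)} ≠ ⊥ := by simpa using hB
  obtain ⟨a, ha⟩ := IsDedekindDomain.exists_sup_span_eq
    (I := (J : Ideal (𝓞 F)) * Ideal.span {(B : 𝓞 F)}) (J := J) Ideal.mul_le_left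
    (mul_ne_zero hJ0 hB0)
  obtain ⟨I, hI⟩ : (J : Ideal (𝓞 F)) ∣ Ideal.span {a} := by
    rw [Ideal.dvd_iff_le, ← ha]; exact le_sup_right
  have hsup : I ⊔ Ideal.span {(B : 𝓞 F)} = ⊤ := by
    have h1 : (J : Ideal (𝓞 F)) * (I ⊔ Ideal.span {(B : 𝓞 F)}) = J * ⊤ := by
      rw [Ideal.mul_sup, ← hI, sup_comm, ha, Ideal.mul_top]
    exact mul_left_cancel₀ hJ0 h1
  by_cases hI0 : I = ⊥
  · rw [hI0, bot_sup_eq] at hsup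
    have hBu' : IsUnit B := by
      rw [Int.isUnit_iff_natAbs_eq]
      have h3 := Ideal.absNorm_eq_one_iff.2 hsup
      have h4 : Algebra.norm ℤ (B : 𝓞 F) = B ^ Module.finrank ℤ (𝓞 F) := by
        have := Algebra.norm_algebraMap (R := ℤ) (S := 𝓞 F) B
        simpa using this
      rw [Ideal.absNorm_span_singleton, h4, Int.natAbs_pow] at h3
      have h5 : Module.finrank ℤ (𝓞 F) ≠ 0 := by
        rw [RingOfIntegers.rank]; exact Module.finrank_pos.ne'
      exact (Nat.pow_eq_one.1 h3).resolve_right h5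
    obtain ⟨I', hI'⟩ := ClassGroup.mk0_surjective c
    exact ⟨I', hI', by
      rcases Int.isUnit_iff.1 hBu' with h6 | h6 <;> rw [h6]
      · exact isCoprime_one_right
      · exact (IsCoprime.neg_right_iff _ _).2 isCoprime_one_right⟩
  · refine ⟨⟨I, mem_nonZeroDivisors_of_ne_zero hI0⟩, ?_, coprime_absNorm_of_sup_eq_top hI0 hsup⟩
    have h1 : ClassGroup.mk0 (J * ⟨I, mem_nonZeroDivisors_of_ne_zero hI0⟩) = 1 := by
      rw [ClassGroup.mk0_eq_one_iff]
      exact ⟨⟨a, by simpa using hI.symm⟩⟩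
    rw [map_mul, hJ, inv_mul_eq_one] at h1
    exact h1.symm

end CoprimeRep

namespace IsQuad

variable {F : Type*} [Field F] [NumberField F] {s : F} {D : ℤ}

theorem idealSym_of_class_one (h : IsQuad s D) (hD0 : D < 0) {d m y z P e : ℤ}
    (hc : CubeNorm d y z P m e D) (I : (Ideal (𝓞 F))⁰) (h1 : ClassGroup.mk0 I = 1)
    (hI : IsCoprime (Ideal.absNorm (I : Ideal (𝓞 F)) : ℤ) (6 * D * P)) :
    h.idealSym m y z I = 0 := by
  rw [ClassGroup.mk0_eq_one_iff] at h1
  obtain ⟨⟨a, ha⟩⟩ := h1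
  have ha' : (I : Ideal (𝓞 F)) = Ideal.span {a} := ha
  have hI0 : (I : Ideal (𝓞 F)) ≠ ⊥ := nonZeroDivisors.coe_ne_zero I
  rw [ha'] at hI hI0 ⊢
  rw [Ideal.absNorm_span_singleton, Int.natCast_natAbs] at hI
  refine h.idealSym_principal hD0 hc _ a (by simpa using hI0) rfl ?_
  rcases abs_choice (Algebra.norm ℤ a) with h2 | h2 <;> rw [h2] at hI
  · exact hI
  · exact (IsCoprime.neg_left_iff _ _).1 hI

theorem exists_classGroup_char (h : IsQuad s D) (hD0 : D < 0) {d m y z P e : ℤ}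
    (hc : CubeNorm d y z P m e D) (hP : P ≠ 0) :
    ∃ χ : ClassGroup (𝓞 F) →* Multiplicative (ZMod 3), ∀ (q : ℕ) (r : ℤ) (I : (Ideal (𝓞 F))⁰),
      q.Prime → ¬ (q : ℤ) ∣ 6 * D * P → (q : ℤ) ∣ D - r ^ 2 → (I : Ideal (𝓞 F)) = h.idl q r →
      χ (ClassGroup.mk0 I) = Multiplicative.ofAdd (cubSym q (z * m * r + y) (2 * y)) := by
  have hB : 6 * D * P ≠ 0 := mul_ne_zero (mul_ne_zero (by norm_num) hD0.ne) hP
  choose R hR1 hR2 using fun c : ClassGroup (𝓞 F) => exists_coprime_rep c hB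
  have hmul : ∀ I J : (Ideal (𝓞 F))⁰, h.idealSym m y z ((I * J : (Ideal (𝓞 F))⁰) : Ideal (𝓞 F)) =
      h.idealSym m y z I + h.idealSym m y z J := fun I J => by
    rw [Submonoid.coe_mul]
    exact h.idealSym_mul m y z (nonZeroDivisors.coe_ne_zero I) (nonZeroDivisors.coe_ne_zero J)
  have hcop : ∀ I J : (Ideal (𝓞 F))⁰, IsCoprime (Ideal.absNorm (I : Ideal (𝓞 F)) : ℤ) (6 * D * P) →
      IsCoprime (Ideal.absNorm (J : Ideal (𝓞 F)) : ℤ) (6 * D * P) →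
      IsCoprime (Ideal.absNorm ((I * J : (Ideal (𝓞 F))⁰) : Ideal (𝓞 F)) : ℤ) (6 * D * P) := by
    intro I J hI hJ
    rw [Submonoid.coe_mul, map_mul]
    push_cast
    exact hI.mul_left hJ
  have hwd : ∀ I J : (Ideal (𝓞 F))⁰, ClassGroup.mk0 I = ClassGroup.mk0 J →
      IsCoprime (Ideal.absNorm (I : Ideal (𝓞 F)) : ℤ) (6 * D * P) →
      IsCoprime (Ideal.absNorm (J : Ideal (𝓞 F)) : ℤ) (6 * D * P) →
      h.idealSym m y z I = h.idealSym m y z J := by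
    intro I J hIJ hI hJ
    have e1 := h.idealSym_of_class_one hD0 hc (I * R (ClassGroup.mk0 I)⁻¹)
      (by rw [map_mul, hR1, mul_inv_cancel]) (hcop _ _ hI (hR2 _))
    have e2 := h.idealSym_of_class_one hD0 hc (J * R (ClassGroup.mk0 I)⁻¹)
      (by rw [map_mul, hR1, hIJ, mul_inv_cancel]) (hcop _ _ hJ (hR2 _))
    rw [hmul] at e1 e2
    exact add_right_cancel (e1.trans e2.symm)
  have hone : h.idealSym m y z ((R 1 : (Ideal (𝓞 F))⁰) : Ideal (𝓞 F)) = 0 :=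
    h.idealSym_of_class_one hD0 hc _ (hR1 1) (hR2 1)
  refine ⟨⟨⟨fun c => Multiplicative.ofAdd (h.idealSym m y z (R c)), ?_⟩, ?_⟩, ?_⟩
  · simp [hone]
  · intro a b
    simp only
    rw [← ofAdd_add, ← hmul]
    congr 1
    exact hwd _ _ (by rw [map_mul, hR1, hR1, hR1]) (hR2 _) (hcop _ _ (hR2 _) (hR2 _))
  · intro q r I hq hqB hr hI
    have h2 : q ≠ 2 := by
      rintro rfl; exact hqB ⟨3 * D * P, by push_cast; ring⟩
    have hD : ¬ (q : ℤ) ∣ D := fun hd => hqB ((hd.mul_left 6).mul_right P)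
    have hn := h.absNorm_idl hq h2 hr hD
    change Multiplicative.ofAdd (h.idealSym m y z (R (ClassGroup.mk0 I))) = _
    rw [hwd _ I (hR1 _) (hR2 _) (by
      rw [hI, hn]
      exact ((Nat.prime_iff_prime_int.1 hq).coprime_iff_not_dvd).2 hqB), hI,
      h.idealSym_prime m y z (h.isPrime_idl hq h2 hr hD) (fun hb => hq.ne_zero (by
        rw [← hn, hb, Ideal.absNorm_bot])), h.locSym_idl m y z hq h2 hr hD]

end IsQuad

theorem card_hom_zmod_three (G : Type*) [CommGroup G] [Finite G] :
    Nat.card (G →* Multiplicative (ZMod 3)) ≤ Nat.card {c : G // c ^ 3 = 1} := by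
  obtain ⟨w, hw⟩ : ∃ w : ℂ, IsPrimitiveRoot w 3 := ⟨_, Complex.isPrimitiveRoot_exp 3 (by norm_num)⟩
  have : NeZero (Monoid.exponent G) := ⟨Monoid.exponent_ne_zero_of_finite⟩
  obtain ⟨e⟩ := CommGroup.monoidHom_mulEquiv_of_hasEnoughRootsOfUnity G ℂ
  let w' : ℂˣ := (hw.isUnit (by norm_num)).unit
  have hw' : IsPrimitiveRoot w' 3 := by
    rw [← IsPrimitiveRoot.coe_units_iff]; exact hw
  let f : Multiplicative (ZMod 3) → ℂˣ := fun a => w' ^ (a.toAdd).val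
  have hf1 : f 1 = 1 := by simp [f]
  have hfm : ∀ a b, f (a * b) = f a * f b := by
    intro a b
    simp only [f, toAdd_mul, ZMod.val_add, ← pow_add]
    exact (pow_eq_pow_mod _ hw'.pow_eq_one).symm
  have hfi : Function.Injective f := by
    intro a b hab
    have := hw'.pow_inj (ZMod.val_lt _) (ZMod.val_lt _) hab
    exact ZMod.val_injective 3 this
  let g : Multiplicative (ZMod 3) →* ℂˣ := ⟨⟨f, hf1⟩, hfm⟩
  refine Nat.card_le_card_of_injective
    (fun φ : G →* Multiplicative (ZMod 3) => (⟨e (g.comp φ), ?_⟩ : {c : G // c ^ 3 = 1})) ?_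
  · rw [← map_pow, ← map_one e]
    congr 1
    ext x
    have h1 : (φ x) ^ 3 = 1 := by
      rw [← toAdd_eq_zero, toAdd_pow]
      generalize (φ x).toAdd = t
      revert t; decide
    simp [← map_pow, h1]
  · intro φ ψ h
    have h1 := e.injective (Subtype.mk.inj h)
    ext x
    exact hfi (DFunLike.congr_fun h1 x)

end

section

open NumberField nonZeroDivisors Filter Topology

section IdealHarmonic

variable (F : Type*) [Field F] [NumberField F]

theorem finite_setOf_ne_bot_absNorm_le (n : ℕ) :
    {I : Ideal (𝓞 F) | I ≠ ⊥ ∧ Ideal.absNorm I ≤ n}.Finite :=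
  (Ideal.finite_setOfPred_absNorm_le (S := 𝓞 F) n).subset fun _ h ↦ h.2

/-- The nonzero integral ideals of norm at most `n`. -/
noncomputable def idealsLE (n : ℕ) : Finset (Ideal (𝓞 F)) :=
  (finite_setOf_ne_bot_absNorm_le F n).toFinset

variable {F} in
theorem mem_idealsLE {n : ℕ} {I : Ideal (𝓞 F)} :
    I ∈ idealsLE F n ↔ I ≠ ⊥ ∧ Ideal.absNorm I ≤ n := by
  rw [idealsLE, Set.Finite.mem_toFinset]; rfl

theorem idealsLE_mono {m n : ℕ} (h : m ≤ n) : idealsLE F m ⊆ idealsLE F n := fun I hI ↦ by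
  rw [mem_idealsLE] at *; exact ⟨hI.1, hI.2.trans h⟩

theorem card_idealsLE_tendsto :
    ∃ κ : ℝ, 0 < κ ∧ Tendsto (fun n : ℕ ↦ ((idealsLE F n).card : ℝ) / n) atTop (𝓝 κ) := by
  refine ⟨_, ?_, ((NumberField.Ideal.tendsto_norm_le_div_atTop₀ F).comp
    tendsto_natCast_atTop_atTop).congr fun n ↦ ?_⟩
  · have := NumberField.dedekindZeta_residue_pos F
    simpa [NumberField.dedekindZeta_residue_def] using this
  · simp only [Function.comp]
    congr 2
    rw [← Nat.card_eq_finsetCard]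
    refine Nat.card_congr ⟨fun I ↦ ⟨I.1, mem_idealsLE.2 ⟨nonZeroDivisors.coe_ne_zero _, ?_⟩⟩,
      fun I ↦ ⟨⟨I.1, mem_nonZeroDivisors_of_ne_zero (mem_idealsLE.1 I.2).1⟩, ?_⟩,
      fun _ ↦ rfl, fun _ ↦ rfl⟩
    · exact_mod_cast I.2
    · exact_mod_cast (mem_idealsLE.1 I.2).2

/-- The sum of the inverse norms of the nonzero integral ideals of norm at most `n`. -/
noncomputable def idealHarm (n : ℕ) : ℝ := ∑ I ∈ idealsLE F n, (Ideal.absNorm I : ℝ)⁻¹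

theorem idealHarm_mono {m n : ℕ} (h : m ≤ n) : idealHarm F m ≤ idealHarm F n :=
  Finset.sum_le_sum_of_subset_of_nonneg (idealsLE_mono F h) fun _ _ _ ↦ by positivity

theorem idealHarm_sub_mem_Icc {m n : ℕ} (hm : 0 < m) (h : m ≤ n) :
    ((idealsLE F n).card - (idealsLE F m).card : ℝ) / n ≤ idealHarm F n - idealHarm F m ∧
    idealHarm F n - idealHarm F m ≤ ((idealsLE F n).card : ℝ) / m := by
  classical
  have hs := idealsLE_mono F h
  have e : idealHarm F n - idealHarm F m =
      ∑ I ∈ idealsLE F n \ idealsLE F m, (Ideal.absNorm I : ℝ)⁻¹ := by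
    rw [idealHarm, idealHarm, ← Finset.sum_sdiff hs]; ring
  have hc : ((idealsLE F n).card - (idealsLE F m).card : ℝ) =
      (idealsLE F n \ idealsLE F m).card := by
    rw [Finset.card_sdiff_of_subset hs, Nat.cast_sub (Finset.card_le_card hs)]
  rw [e, hc]
  have key : ∀ I ∈ idealsLE F n \ idealsLE F m, m ≤ Ideal.absNorm I ∧ Ideal.absNorm I ≤ n := by
    intro I hI
    rw [Finset.mem_sdiff, mem_idealsLE, mem_idealsLE] at hI
    have := hI.2
    push Not at this
    exact ⟨(this hI.1.1).le, hI.1.2⟩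
  constructor
  · rw [div_eq_mul_inv, ← nsmul_eq_mul]
    refine Finset.card_nsmul_le_sum _ _ _ fun I hI ↦ ?_
    have := key I hI
    have h1 : (0:ℝ) < Ideal.absNorm I := by exact_mod_cast hm.trans_le this.1
    gcongr
    exact_mod_cast this.2
  · refine (Finset.sum_le_card_nsmul _ _ (m : ℝ)⁻¹ fun I hI ↦ ?_).trans ?_
    · have := key I hI
      have : (0:ℝ) < m := by exact_mod_cast hm
      gcongr
      exact_mod_cast (key I hI).1
    · rw [nsmul_eq_mul, div_eq_mul_inv]
      gcongr
      exact Finset.sdiff_subset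

theorem idealHarm_bounds : ∃ c C : ℝ, 0 < c ∧ 0 < C ∧ ∃ j₀ : ℕ, ∀ J : ℕ,
    c * (J - j₀) ≤ idealHarm F (3 ^ J) ∧ idealHarm F (3 ^ J) ≤ C * (J + 1) := by
  obtain ⟨κ, hκ, ht⟩ := card_idealsLE_tendsto F
  have h1 := ht.eventually (lt_mem_nhds (show 3 / 4 * κ < κ by linarith))
  have h2 := ht.eventually (gt_mem_nhds (show κ < 3 / 2 * κ by linarith))
  obtain ⟨j₀, hj⟩ := eventually_atTop.1 (h1.and h2)
  have step : ∀ j, j₀ ≤ j → κ / 4 ≤ idealHarm F (3 ^ (j + 1)) - idealHarm F (3 ^ j) ∧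
      idealHarm F (3 ^ (j + 1)) - idealHarm F (3 ^ j) ≤ 9 / 2 * κ := by
    intro j hjj
    have hp : (0:ℝ) < 3 ^ j := by positivity
    have a := (hj (3 ^ j) (hjj.trans (Nat.lt_pow_self (by norm_num)).le)).2
    have b := hj (3 ^ (j + 1)) (hjj.trans ((Nat.le_succ _).trans (Nat.lt_pow_self (by norm_num)).le))
    have b1 := b.1
    have b2 := b.2
    push_cast at a b1 b2
    rw [div_lt_iff₀ (by positivity)] at a b2
    rw [lt_div_iff₀ (by positivity)] at b1
    have := idealHarm_sub_mem_Icc F (m := 3 ^ j) (n := 3 ^ (j + 1)) (by positivity)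
      (Nat.pow_le_pow_right (by norm_num) (Nat.le_succ _))
    push_cast at this
    have e3 : (3:ℝ) ^ (j + 1) = 3 ^ j * 3 := pow_succ _ _
    rw [e3] at b1 b2
    refine ⟨le_trans ?_ this.1, this.2.trans ?_⟩
    · rw [le_div_iff₀ (by positivity), e3]
      linarith
    · rw [div_le_iff₀ hp]
      linarith
  have nn : ∀ n, 0 ≤ idealHarm F n := fun n ↦ Finset.sum_nonneg fun _ _ ↦ by positivity
  have main : ∀ i : ℕ, κ / 4 * i ≤ idealHarm F (3 ^ (j₀ + i)) ∧
      idealHarm F (3 ^ (j₀ + i)) ≤ idealHarm F (3 ^ j₀) + 9 / 2 * κ * i := by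
    intro i
    induction i with
    | zero => simpa using nn _
    | succ i ih =>
      have := step (j₀ + i) (Nat.le_add_right _ _)
      rw [← add_assoc]
      push_cast
      constructor <;> linarith
  refine ⟨κ / 4, idealHarm F (3 ^ j₀) + 9 / 2 * κ, by positivity, ?_, j₀, fun J ↦ ?_⟩
  · have := nn (3 ^ j₀); positivity
  rcases le_total j₀ J with h | h
  · obtain ⟨i, rfl⟩ := Nat.exists_eq_add_of_le h
    have := main i
    push_cast
    have h3 := nn (3 ^ j₀)
    refine ⟨by linarith, this.2.trans ?_⟩
    have : (0:ℝ) ≤ j₀ := Nat.cast_nonneg _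
    have : (0:ℝ) ≤ i := Nat.cast_nonneg _
    nlinarith [mul_nonneg h3 (add_nonneg ‹(0:ℝ) ≤ j₀› this), mul_nonneg hκ.le ‹(0:ℝ) ≤ j₀›]
  · have hc : (J:ℝ) ≤ j₀ := by exact_mod_cast h
    constructor
    · refine le_trans ?_ (nn _)
      nlinarith
    · have := idealHarm_mono F (Nat.pow_le_pow_right (show 0 < 3 by norm_num) h)
      have h3 := nn (3 ^ j₀)
      have : (0:ℝ) ≤ J := Nat.cast_nonneg _
      nlinarith [mul_nonneg h3 this, mul_nonneg hκ.le this]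

end IdealHarmonic

end

section

open Polynomial in
theorem exists_intCast_eq_of_pow_eq {L : Type*} [Field L] {q : ℕ} [hq : Fact q.Prime] [CharP L q]
    [Algebra (ZMod q) L] {t : L} (ht : t ^ q = t) : ∃ n : ℤ, t = n := by
  classical
  have h0 : (X ^ q - X : L[X]) ≠ 0 := FiniteField.X_pow_card_sub_X_ne_zero L hq.out.one_lt
  have hsub : Finset.univ.image (algebraMap (ZMod q) L) ⊆ (X ^ q - X : L[X]).roots.toFinset := by
    intro x hx
    obtain ⟨a, -, rfl⟩ := Finset.mem_image.1 hx
    rw [Multiset.mem_toFinset, mem_roots h0, IsRoot, eval_sub, eval_pow, eval_X, ← map_pow,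
      ZMod.pow_card, sub_self]
  have hcard : (X ^ q - X : L[X]).roots.toFinset.card ≤
      (Finset.univ.image (algebraMap (ZMod q) L)).card := by
    rw [Finset.card_image_of_injective _ (algebraMap (ZMod q) L).injective, Finset.card_univ,
      ZMod.card]
    exact (Multiset.toFinset_card_le _).trans ((card_roots' _).trans_eq
      (FiniteField.X_pow_card_sub_X_natDegree_eq L hq.out.one_lt))
  have : t ∈ (X ^ q - X : L[X]).roots.toFinset := by
    rw [Multiset.mem_toFinset, mem_roots h0, IsRoot, eval_sub, eval_pow, eval_X, ht, sub_self]
  rw [← Finset.eq_of_subset_of_card_le hsub hcard] at this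
  obtain ⟨a, -, rfl⟩ := Finset.mem_image.1 this
  obtain ⟨n, rfl⟩ := ZMod.intCast_surjective a
  exact ⟨n, map_intCast _ n⟩

section Frob

variable {L : Type*} [Field L] {q e : ℕ} {w g g' P κ : L}

theorem cubic_frob_one (he : Even e) (h1 : q = 3 * e + 1) (hκ : κ ^ 3 = g) (hgg : g * g' = P ^ 3)
    (hP : P ≠ 0) (hge : g ^ e = g' ^ e) (hgq : g ^ q = g) (hPq : P ^ q = P) : κ ^ q = κ := by
  have hg : g ≠ 0 := left_ne_zero_of_mul (hgg ▸ pow_ne_zero 3 hP)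
  rw [h1, pow_succ] at hgq hPq
  have a3 : g ^ (3 * e) = 1 := mul_right_cancel₀ hg (by rw [hgq, one_mul])
  have a2 : P ^ (3 * e) = 1 := mul_right_cancel₀ hP (by rw [hPq, one_mul])
  have a1 : g ^ e * g ^ e = 1 := by
    nth_rewrite 2 [hge]
    rw [← mul_pow, hgg, ← pow_mul, a2]
  have a0 : g ^ e = 1 := by
    rw [mul_comm, pow_mul] at a3
    linear_combination a3 - g ^ e * a1
  rw [h1, pow_succ, pow_mul, hκ, a0, one_mul]

theorem cubic_frob_two (h1 : q + 1 = 3 * e) (hκ : κ ^ 3 = g) (hgg : g * g' = P ^ 3)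
    (hP : P ≠ 0) (hge : g ^ e = g' ^ e) (hgq : g ^ q = g') (hPq : P ^ q = P) :
    κ ^ q * κ = P := by
  have a1 : g ^ e * g ^ e = P ^ 2 := by
    nth_rewrite 2 [hge]
    rw [← mul_pow, hgg, ← pow_mul, ← h1, pow_succ, hPq, sq]
  have a3 : (g ^ e) ^ 3 = P ^ 3 := by
    rw [← pow_mul, mul_comm e, ← h1, pow_succ, hgq, mul_comm, hgg]
  rw [← pow_succ, h1, pow_mul, hκ]
  apply mul_left_cancel₀ (pow_ne_zero 2 hP)
  linear_combination a3 - g ^ e * a1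

theorem cubic_conj_pow [CharP L q] [Fact q.Prime] {u : L} (hu : u ≠ 0) (hPq : P ^ q = P)
    (h : u ^ q = u ∨ u ^ q * u = P) : (u + P / u) ^ q = u + P / u := by
  rw [add_pow_char, div_pow, hPq]
  rcases h with h | h
  · rw [h]
  · have : u ^ q ≠ 0 := pow_ne_zero _ hu
    rw [← h]
    field_simp
    ring

end Frob

theorem exists_cubic_roots {q : ℕ} (hq : q.Prime) (h2 : q ≠ 2) (h3 : q ≠ 3) {d y z P m D r : ℤ}
    (hn : y ^ 2 - d * z ^ 2 = P ^ 3) (hmD : -3 * d = m ^ 2 * D)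
    (hr : (q : ℤ) ∣ D - r ^ 2) (hqP : ¬ (q : ℤ) ∣ P) (hqz : ¬ (q : ℤ) ∣ z) (hqd : ¬ (q : ℤ) ∣ d)
    (hs : cubSym q (z * m * r + y) (2 * y) = 0) :
    ∃ t : Fin 3 → ℤ, (∀ i, (q : ℤ) ∣ t i ^ 3 - 3 * P * t i - 2 * y) ∧
      ∀ i j, i ≠ j → ¬ (q : ℤ) ∣ t i - t j := by
  have hF := Fact.mk hq
  have hnd := not_dvd_norm_form hq h3 hn hmD hr hqP
  have hpow := (cubPow_eq_iff q h3 hnd 0).2 (by simpa using hs)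
  obtain ⟨hA, hB⟩ := cubRoot_factor_ne_zero q hnd
  have hw := cubRoot_eq q
  have hw3 := cubRoot_pow_three q
  have h30 := three_ne_zero_closure q h3
  have hwne : cubRoot q ≠ 0 := fun h ↦ by simp [h] at hw
  have hP0 : (P : AlgebraicClosure (ZMod q)) ≠ 0 := (intCast_closure_eq_zero q P).not.2 hqP
  have hz0 : (z : AlgebraicClosure (ZMod q)) ≠ 0 := (intCast_closure_eq_zero q z).not.2 hqz
  have hd0 : (d : AlgebraicClosure (ZMod q)) ≠ 0 := (intCast_closure_eq_zero q d).not.2 hqd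
  have h20 : (2 : AlgebraicClosure (ZMod q)) ≠ 0 := by
    have := (natCast_closure_eq_zero q 2).not.2 fun h ↦
      h2 ((Nat.prime_dvd_prime_iff_eq hq Nat.prime_two).1 h)
    exact_mod_cast this
  have hDr : (D : AlgebraicClosure (ZMod q)) = r ^ 2 := by
    have := (intCast_closure_eq_zero q _).2 hr
    push_cast at this
    linear_combination this
  have hdm : -3 * (d : AlgebraicClosure (ZMod q)) = m ^ 2 * r ^ 2 := by
    rw [← hDr]; exact_mod_cast congrArg (Int.cast : ℤ → AlgebraicClosure (ZMod q)) hmD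
  have hn' : (y : AlgebraicClosure (ZMod q)) ^ 2 - d * z ^ 2 = P ^ 3 := by
    exact_mod_cast congrArg (Int.cast : ℤ → AlgebraicClosure (ZMod q)) hn
  rw [mul_zero, pow_zero, cubPow] at hpow
  push_cast at hpow hA hB
  have intq : ∀ n : ℤ, (n : AlgebraicClosure (ZMod q)) ^ q = n := fun n ↦ by
    simpa using add_cubRoot_pow_char q n 0 0
  have hprim := cubRoot_primitive q h3
  generalize cubRoot q = w at hprim hw hw3 hwne hpow hA hB
  obtain ⟨S, hS⟩ : ∃ S, S = 1 + 2 * w := ⟨_, rfl⟩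
  have hS2 : S ^ 2 = -3 := by rw [hS]; linear_combination 4 * hw
  have hS0 : S ≠ 0 := fun h ↦ by
    rw [h] at hS2
    exact h30 (by linear_combination hS2)
  obtain ⟨δ, hδ⟩ : ∃ δ, δ = m * r / S := ⟨_, rfl⟩
  have hδS : δ * S = m * r := by rw [hδ]; field_simp
  have hδ2 : δ ^ 2 = d := by
    apply mul_left_cancel₀ (neg_ne_zero.2 h30)
    rw [hdm, ← hS2]; linear_combination (δ * S + m * r) * hδS
  have hδ0 : δ ≠ 0 := fun h ↦ by
    rw [h] at hδ2
    exact hd0 (by linear_combination -hδ2)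
  obtain ⟨g, hg⟩ : ∃ g, g = y + z * δ := ⟨_, rfl⟩
  obtain ⟨g', hg'⟩ : ∃ g', g' = y - z * δ := ⟨_, rfl⟩
  have hgg : g * g' = P ^ 3 := by rw [hg, hg', ← hn', ← hδ2]; ring
  have hgne : g ≠ 0 := left_ne_zero_of_mul (hgg ▸ pow_ne_zero 3 hP0)
  have hg'ne : g' ≠ 0 := right_ne_zero_of_mul (hgg ▸ pow_ne_zero 3 hP0)
  have hev : Even ((q + 1) / 3) := by
    have : q % 2 = 1 := (hq.eq_two_or_odd).resolve_left h2
    rcases prime_mod_three hq h3 with h | h <;> exact Nat.even_iff.2 (by omega)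
  have hge : g ^ ((q + 1) / 3) = g' ^ ((q + 1) / 3) := by
    have e1 : (z * m * r + y + 2 * y * w) = S * g := by
      rw [hg, hS]
      rw [hS] at hδS
      linear_combination (-z) * hδS
    have e2 : (z * m * r + y + 2 * y * w ^ 2) = -(S * g') := by
      rw [hg', hS]
      rw [hS] at hδS
      linear_combination (-z) * hδS + 2 * y * hw
    rw [e1, e2, div_neg, hev.neg_pow, mul_div_mul_left _ _ hS0, div_pow,
      div_eq_one_iff_eq (pow_ne_zero _ hg'ne)] at hpow
    exact hpow
  obtain ⟨κ, hκ⟩ := IsAlgClosed.exists_pow_nat_eq g (n := 3) (by norm_num)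
  have hκ0 : κ ≠ 0 := fun h ↦ hgne (by rw [← hκ, h]; ring)
  have hfrob : ∀ i : ℕ, (κ * w ^ i) ^ q = κ * w ^ i ∨ (κ * w ^ i) ^ q * (κ * w ^ i) = P := by
    intro i
    have e0 : g ^ q = y + z * δ ^ q := by rw [hg, add_cubRoot_pow_char]
    have eS : S ^ q = 1 + 2 * w ^ q := by
      rw [hS]; simpa using add_cubRoot_pow_char q 1 2 w
    have eδ : δ ^ q * S ^ q = m * r := by rw [← mul_pow, hδS, mul_pow, intq, intq]
    have e3 : (w ^ i) ^ 3 = 1 := by rw [← pow_mul, mul_comm, pow_mul, hw3, one_pow]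
    rcases prime_mod_three hq h3 with h | h
    · left
      have ew : w ^ q = w := by rw [pow_eq_pow_mod q hw3, h, pow_one]
      rw [ew, ← hS] at eS
      rw [eS, ← hδS] at eδ
      rw [mul_right_cancel₀ hS0 eδ, ← hg] at e0
      refine cubic_frob_one hev (by omega) (P := (P : AlgebraicClosure (ZMod q))) ?_ hgg hP0 hge e0 (intq P)
      rw [mul_pow, hκ, e3, mul_one]
    · right
      have ew : w ^ q = w ^ 2 := by rw [pow_eq_pow_mod q hw3, h]
      rw [ew] at eS
      have eS' : S ^ q = - S := by rw [eS, hS]; linear_combination 2 * hw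
      rw [eS', ← hδS] at eδ
      have e4 : δ ^ q = - δ := mul_right_cancel₀ hS0 (by linear_combination -eδ)
      rw [e4, mul_neg, ← sub_eq_add_neg, ← hg'] at e0
      refine cubic_frob_two (e := (q + 1) / 3) (by omega) (P := (P : AlgebraicClosure (ZMod q))) ?_ hgg hP0 hge e0 (intq P)
      rw [mul_pow, hκ, e3, mul_one]
  have hu0 : ∀ i : ℕ, κ * w ^ i ≠ 0 := fun i ↦ mul_ne_zero hκ0 (pow_ne_zero _ hwne)
  choose t ht using fun i : ℕ ↦ exists_intCast_eq_of_pow_eq (q := q)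
    (cubic_conj_pow (hu0 i) (intq P) (hfrob i))
  refine ⟨fun i ↦ t i, fun i ↦ ?_, fun i j hij hdvd ↦ ?_⟩
  · rw [← intCast_closure_eq_zero]
    push_cast
    rw [← ht]
    have e3 : (κ * w ^ (i : ℕ)) ^ 3 = g := by
      rw [mul_pow, hκ, ← pow_mul, mul_comm _ 3, pow_mul, hw3, one_pow, mul_one]
    have := hu0 i
    generalize κ * w ^ (i : ℕ) = u at *
    have e5 : (P / u) ^ 3 = g' := by
      rw [div_pow, e3, ← hgg, mul_div_cancel_left₀ _ hgne]
    have e6 : u * (P / u) = P := mul_div_cancel₀ _ this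
    rw [hg] at e3
    rw [hg'] at e5
    linear_combination e3 + e5 + 3 * (u + P / u) * e6
  · rw [← intCast_closure_eq_zero] at hdvd
    push_cast at hdvd
    rw [← ht, ← ht] at hdvd
    have e3 : ∀ i : ℕ, (κ * w ^ i) ^ 3 = g := fun i ↦ by
      rw [mul_pow, hκ, ← pow_mul, mul_comm _ 3, pow_mul, hw3, one_pow, mul_one]
    have ne : κ * w ^ (i : ℕ) ≠ κ * w ^ (j : ℕ) := by
      intro h
      exact hij (Fin.ext (hprim.pow_inj i.2 j.2 (mul_left_cancel₀ hκ0 h)))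
    have hi := e3 i
    have hj := e3 j
    have hi0 := hu0 i
    have hj0 := hu0 j
    generalize κ * w ^ (i : ℕ) = u at *
    generalize κ * w ^ (j : ℕ) = v at *
    have e7 : (u - v) * (u * v - P) = 0 := by
      field_simp at hdvd
      linear_combination hdvd
    have e8 : u * v = P := by
      rcases mul_eq_zero.1 e7 with h | h
      · exact absurd (sub_eq_zero.1 h) ne
      · exact sub_eq_zero.1 h
    have e9 : g * g = g * g' := by
      rw [hgg, ← e8, mul_pow, hi, hj]
    have := mul_left_cancel₀ hgne e9
    rw [hg, hg'] at this
    have : 2 * (z * δ) = 0 := by linear_combination this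
    simp [h20, hz0, hδ0] at this

end

section

open NumberField

theorem Int.dvd_of_eq_of_dvd {q x y : ℤ} (e : x = y) (h : q ∣ y) : q ∣ x := e ▸ h

section CubicIdeals

variable {F : Type*} [Field F] [NumberField F]

theorem exists_ideals_of_cubic_roots (hF : Module.finrank ℚ F = 3) {a b : ℤ} {θ : 𝓞 F}
    (hθ : θ ^ 3 + a * θ + b = 0)
    (hN : ∀ n : ℤ, (Algebra.norm ℤ ((n : 𝓞 F) - θ)) = n ^ 3 + a * n + b)
    {q : ℕ} (hq : q.Prime) {t : Fin 3 → ℤ} (ht : ∀ i, (q : ℤ) ∣ t i ^ 3 + a * t i + b)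
    (hne : ∀ i j, i ≠ j → ¬ (q : ℤ) ∣ t i - t j) :
    ∃ I : Fin 3 → Ideal (𝓞 F), Function.Injective I ∧ ∀ i, Ideal.absNorm (I i) = q := by
  have hp := Nat.prime_iff_prime_int.1 hq
  -- Vieta modulo `q`
  have v1 : ∀ i j k : Fin 3, i ≠ j → j ≠ k → i ≠ k →
      (q : ℤ) ∣ t i ^ 2 + t i * t j + t j ^ 2 + a ∧ (q : ℤ) ∣ t i + t j + t k := by
    have s1 : ∀ i j : Fin 3, i ≠ j → (q : ℤ) ∣ t i ^ 2 + t i * t j + t j ^ 2 + a := by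
      intro i j hij
      refine (hp.dvd_or_dvd ?_).resolve_left (hne i j hij)
      exact Int.dvd_of_eq_of_dvd (by ring) (dvd_sub (ht i) (ht j))
    intro i j k hij hjk hik
    refine ⟨s1 i j hij, (hp.dvd_or_dvd ?_).resolve_left (hne j k hjk)⟩
    exact Int.dvd_of_eq_of_dvd (by ring) (dvd_sub (s1 i j hij) (s1 i k hik))
  have simple : ∀ i, ¬ (q : ℤ) ∣ 3 * t i ^ 2 + a := by
    intro i hd
    obtain ⟨j, k, hij, hjk, hik⟩ : ∃ j k : Fin 3, i ≠ j ∧ j ≠ k ∧ i ≠ k := by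
      fin_cases i
      · exact ⟨1, 2, by decide⟩
      · exact ⟨0, 2, by decide⟩
      · exact ⟨0, 1, by decide⟩
    obtain ⟨e1, e2⟩ := v1 i j k hij hjk hik
    have : (q : ℤ) ∣ (t i - t j) * (t i - t k) := by
      exact Int.dvd_of_eq_of_dvd (by ring) (dvd_sub (dvd_sub hd e1) (dvd_mul_of_dvd_right e2 (t i - t j)))
    rcases hp.dvd_or_dvd this with h | h
    · exact hne i j hij h
    · exact hne i k hik h
  -- choose the residues so that `q` exactly divides the value
  have shift : ∀ i, ∃ s : ℤ, (q : ℤ) ∣ s - t i ∧ (q : ℤ) ∣ s ^ 3 + a * s + b ∧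
      ¬ (q : ℤ) ^ 2 ∣ s ^ 3 + a * s + b := by
    intro i
    by_cases h : (q : ℤ) ^ 2 ∣ t i ^ 3 + a * t i + b
    · refine ⟨t i + q, by simp, ?_, fun h' ↦ simple i ?_⟩
      · exact Int.dvd_of_eq_of_dvd (by ring) (dvd_add (ht i) (dvd_mul_right (q : ℤ) (3 * t i ^ 2 + 3 * t i * q + q ^ 2 + a)))
      · have := dvd_sub (dvd_sub h' h) (dvd_mul_right ((q : ℤ) ^ 2) (3 * t i + q))
        rw [show ((t i + q) ^ 3 + a * (t i + q) + b - (t i ^ 3 + a * t i + b)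
          - (q : ℤ) ^ 2 * (3 * t i + q)) = q * (3 * t i ^ 2 + a) by ring, sq] at this
        exact (mul_dvd_mul_iff_left hp.ne_zero).1 this
    · exact ⟨t i, by simp, ht i, h⟩
  choose s hst hs hs2 using shift
  have cast_dvd : ∀ n : ℤ, (q : ℤ) ∣ n → ((q : ℕ) : 𝓞 F) ∣ (n : 𝓞 F) := fun n hn ↦ by
    simpa using map_dvd (Int.castRingHom (𝓞 F)) hn
  set I : Fin 3 → Ideal (𝓞 F) := fun i ↦ Ideal.span {(q : 𝓞 F), (s i : 𝓞 F) - θ} with hI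
  have hNd : ∀ i, Ideal.absNorm (I i) ∣ q := by
    intro i
    have m1 : (q : 𝓞 F) ∈ I i := Ideal.subset_span (by simp)
    have m2 : (s i : 𝓞 F) - θ ∈ I i := Ideal.subset_span (by simp)
    have d1 : Ideal.absNorm (I i) ∣ q ^ 3 := by
      have := Ideal.absNorm_dvd_absNorm_of_le ((Ideal.span_singleton_le_iff_mem _).2 m1)
      rwa [Ideal.absNorm_span_natCast, RingOfIntegers.rank, hF] at this
    have d2 := Ideal.absNorm_dvd_absNorm_of_le ((Ideal.span_singleton_le_iff_mem _).2 m2)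
    rw [Ideal.absNorm_span_singleton, hN] at d2
    obtain ⟨n, hn, he⟩ := (Nat.dvd_prime_pow hq).1 d1
    rw [he] at d2 ⊢
    have : n < 2 := by
      by_contra hlt
      apply hs2 i
      have := (pow_dvd_pow q (not_lt.1 hlt)).trans d2
      exact_mod_cast Int.natCast_dvd.2 this
    exact (pow_dvd_pow q (show n ≤ 1 by omega)).trans (by simp)
  have hprod : (q : 𝓞 F) ∣ (s 0 - θ) * (s 1 - θ) * (s 2 - θ) := by
    obtain ⟨e1, e2⟩ := v1 0 1 2 (by decide) (by decide) (by decide)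
    have c1 : (q : ℤ) ∣ s 0 + s 1 + s 2 := by
      exact Int.dvd_of_eq_of_dvd (by ring) (dvd_add e2 (dvd_add (dvd_add (hst 0) (hst 1)) (hst 2)))
    have c2 : (q : ℤ) ∣ s 0 * s 1 + s 0 * s 2 + s 1 * s 2 - a := by
      have f1 : (q : ℤ) ∣ s 0 ^ 2 + s 0 * s 1 + s 1 ^ 2 + a := by
        exact Int.dvd_of_eq_of_dvd (by ring) (dvd_add e1 (dvd_add ((hst 0).mul_left (s 0 + t 0 + s 1))
          ((hst 1).mul_left (t 0 + s 1 + t 1))))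
      exact Int.dvd_of_eq_of_dvd (by ring) (dvd_sub (c1.mul_left (s 0 + s 1)) f1)
    have c3 : (q : ℤ) ∣ s 0 * s 1 * s 2 + b := by
      exact Int.dvd_of_eq_of_dvd (by ring) (dvd_add (dvd_sub (hs 0) (c1.mul_left (s 0 ^ 2))) (c2.mul_left (s 0)))
    have := dvd_add (dvd_sub (cast_dvd _ c3) ((cast_dvd _ c2).mul_right θ)) ((cast_dvd _ c1).mul_right (θ ^ 2))
    convert this using 1
    push_cast
    linear_combination -hθ
  have hsub : I 0 * I 1 * I 2 ≤ Ideal.span {(q : 𝓞 F)} := by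
    rw [hI]
    simp only [Ideal.span_mul_span', Ideal.span_le]
    rintro x hx
    simp only [Set.mem_mul, Set.mem_insert_iff, Set.mem_singleton_iff] at hx
    obtain ⟨x1, ⟨x2, h2, x3, h3, rfl⟩, x4, h4, rfl⟩ := hx
    rw [SetLike.mem_coe, Ideal.mem_span_singleton]
    rcases h2 with rfl | rfl
    · exact ((dvd_refl _).mul_right _).mul_right _
    rcases h3 with rfl | rfl
    · exact ((dvd_refl _).mul_left _).mul_right _
    rcases h4 with rfl | rfl
    · exact (dvd_refl _).mul_left _
    exact hprod
  have hN3 : q ^ 3 ∣ Ideal.absNorm (I 0) * Ideal.absNorm (I 1) * Ideal.absNorm (I 2) := by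
    have := Ideal.absNorm_dvd_absNorm_of_le hsub
    rwa [Ideal.absNorm_span_natCast, RingOfIntegers.rank, hF, map_mul, map_mul] at this
  have hval : ∀ i, Ideal.absNorm (I i) = q := by
    have hq3 : ¬ q ^ 3 ∣ q ^ 2 := fun h ↦ by
      have := (Nat.pow_dvd_pow_iff_le_right hq.one_lt).1 h; omega
    intro i
    refine ((Nat.dvd_prime hq).1 (hNd i)).resolve_left fun h1 ↦ hq3 ?_
    have hall : ∀ j, Ideal.absNorm (I j) ∣ q := hNd
    fin_cases i
    · simp only [Fin.zero_eta] at h1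
      rw [h1, one_mul] at hN3
      exact hN3.trans ((mul_dvd_mul (hNd 1) (hNd 2)).trans (by rw [sq]))
    · simp only [Fin.mk_one] at h1
      rw [h1, mul_one] at hN3
      exact hN3.trans ((mul_dvd_mul (hNd 0) (hNd 2)).trans (by rw [sq]))
    · simp only [Fin.reduceFinMk] at h1
      rw [h1, mul_one] at hN3
      exact hN3.trans ((mul_dvd_mul (hNd 0) (hNd 1)).trans (by rw [sq]))
  refine ⟨I, fun i j hij ↦ ?_, hval⟩
  by_contra hne'
  have h1 : ((s i - s j : ℤ) : 𝓞 F) ∈ I i := by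
    have m1 : (s i : 𝓞 F) - θ ∈ I i := Ideal.subset_span (by simp)
    have m2 : (s j : 𝓞 F) - θ ∈ I i := by rw [hij]; exact Ideal.subset_span (by simp)
    have := (I i).sub_mem m1 m2
    push_cast
    convert this using 1; ring
  have h2 := (intCast_mem_of_absNorm_prime hq (hval i) _).1 h1
  apply hne i j hne'
  exact Int.dvd_of_eq_of_dvd (by ring) (dvd_sub (dvd_add h2 (hst j)) (hst i))

open Polynomial in
theorem exists_cubic_norm_form {a b : ℤ} (pb : PowerBasis ℚ F)
    (hm : minpoly ℚ pb.gen = X ^ 3 + C (a : ℚ) * X + C (b : ℚ)) :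
    ∃ θ : 𝓞 F, Module.finrank ℚ F = 3 ∧ θ ^ 3 + a * θ + b = 0 ∧
      ∀ n : ℤ, (Algebra.norm ℤ ((n : 𝓞 F) - θ)) = n ^ 3 + a * n + b := by
  have heval : pb.gen ^ 3 + a * pb.gen + b = 0 := by
    have := minpoly.aeval ℚ pb.gen
    rw [hm] at this
    simpa using this
  have h_isInt : IsIntegral ℤ pb.gen := by
    refine ⟨X ^ 3 + C a * X + C b, by monicity!, ?_⟩
    rw [← aeval_def]
    simpa using heval
  obtain ⟨θ, hθ⟩ : ∃ θ : 𝓞 F, (θ : F) = pb.gen := ⟨⟨pb.gen, h_isInt⟩, rfl⟩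
  refine ⟨θ, ?_, ?_, fun n ↦ ?_⟩
  · rw [pb.finrank, ← pb.natDegree_minpoly, hm]
    compute_degree!
  · apply RingOfIntegers.ext
    simpa [hθ] using heval
  · have hq : (Algebra.norm ℚ ((n : F) - pb.gen)) = n ^ 3 + a * n + b := by
      have e := charpoly_leftMulMatrix pb
      rw [hm] at e
      rw [Algebra.norm_eq_matrix_det pb.basis, map_sub,
        show (n : F) = algebraMap ℚ _ (n : ℚ) by simp]
      have := Matrix.eval_charpoly (Algebra.leftMulMatrix pb.basis pb.gen) (n : ℚ)
      rw [AlgHom.commutes, Matrix.algebraMap_eq_diagonal]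
      rw [e] at this
      simpa [Matrix.scalar_apply, Matrix.diagonal_intCast'] using this.symm
    have := Algebra.coe_norm_int ((n : 𝓞 F) - θ)
    rw [show (((n : 𝓞 F) - θ : 𝓞 F) : F) = n - pb.gen by simp [hθ], hq] at this
    exact_mod_cast this

open Polynomial in
theorem exists_cubicField {a b : ℤ} (h : ∀ x : ℚ, x ^ 3 + a * x + b ≠ 0) :
    ∃ (F : Type) (_ : Field F) (_ : NumberField F) (θ : 𝓞 F), Module.finrank ℚ F = 3 ∧
      θ ^ 3 + a * θ + b = 0 ∧
      ∀ n : ℤ, (Algebra.norm ℤ ((n : 𝓞 F) - θ)) = n ^ 3 + a * n + b := by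
  obtain ⟨f, hf⟩ : ∃ f : ℚ[X], f = X ^ 3 + C (a : ℚ) * X + C (b : ℚ) := ⟨_, rfl⟩
  have hdeg : f.natDegree = 3 := by rw [hf]; compute_degree!
  have hmon : f.Monic := by rw [hf]; monicity!
  have hirr : Irreducible f := by
    rw [Polynomial.irreducible_iff_roots_eq_zero_of_degree_le_three (by omega) (by omega)]
    refine Multiset.eq_zero_of_forall_notMem fun x hx ↦ h x ?_
    have := (mem_roots hmon.ne_zero).1 hx
    simpa [hf] using this
  have : Fact (Irreducible f) := ⟨hirr⟩
  have : FiniteDimensional ℚ (AdjoinRoot f) := (AdjoinRoot.powerBasis hmon.ne_zero).finite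
  have hnf : NumberField (AdjoinRoot f) := { }
  have e := AdjoinRoot.minpoly_root hmon.ne_zero
  rw [hmon.leadingCoeff, inv_one, C_1, mul_one, ← AdjoinRoot.powerBasis_gen hmon.ne_zero] at e
  exact ⟨AdjoinRoot f, inferInstance, hnf,
    exists_cubic_norm_form (AdjoinRoot.powerBasis hmon.ne_zero) (e.trans hf)⟩

end CubicIdeals

end

section

open NumberField UniqueFactorizationMonoid

theorem Finset.sum_le_sum_of_injOn' {α β : Type*} {s : Finset α} {t : Finset β} {f : α → ℝ}
    {g : β → ℝ} (e : α → β) (he : ∀ i ∈ s, e i ∈ t) (hinj : Set.InjOn e s)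
    (hfg : ∀ i ∈ s, f i ≤ g (e i)) (hg : ∀ i ∈ t, 0 ≤ g i) : ∑ i ∈ s, f i ≤ ∑ i ∈ t, g i := by
  classical
  refine (Finset.sum_le_sum hfg).trans ?_
  rw [← Finset.sum_image (f := g) hinj]
  exact Finset.sum_le_sum_of_subset_of_nonneg (Finset.image_subset_iff.2 he) fun i hi _ ↦ hg i hi

section Supported

open Classical in
/-- The positive integers at most `x` all of whose prime factors satisfy `S`. -/
noncomputable def supported (S : ℕ → Prop) (x : ℕ) : Finset ℕ :=
  (Finset.Icc 1 x).filter fun n ↦ ∀ q, q.Prime → q ∣ n → S q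

theorem mem_supported {S : ℕ → Prop} {x n : ℕ} :
    n ∈ supported S x ↔ (1 ≤ n ∧ n ≤ x) ∧ ∀ q, q.Prime → q ∣ n → S q := by
  simp [supported]

noncomputable def suppHarm (S : ℕ → Prop) (x : ℕ) : ℝ := ∑ n ∈ supported S x, (n : ℝ)⁻¹

variable {F : Type*} [Field F] [NumberField F]

/-- If three distinct prime ideals of norm `q` exist for all `q` in `S`, the cube of the harmonic
sum over integers supported on `S` is at most the harmonic sum over ideals. -/
theorem suppHarm_pow_three_le {S : ℕ → Prop} (hS : ∀ q, S q → q.Prime)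
    (hI : ∀ q, S q → ∃ I : Fin 3 → Ideal (𝓞 F), Function.Injective I ∧
      ∀ i, Ideal.absNorm (I i) = q) (x : ℕ) :
    suppHarm S x ^ 3 ≤ idealHarm F (x ^ 3) := by
  classical
  have hI' : ∀ q, ∃ I : Fin 3 → Ideal (𝓞 F), S q → Function.Injective I ∧
      ∀ i, Ideal.absNorm (I i) = q := fun q ↦ by
    by_cases h : S q
    · obtain ⟨I, hI⟩ := hI q h
      exact ⟨I, fun _ ↦ hI⟩
    · exact ⟨fun _ ↦ ⊥, fun h' ↦ absurd h' h⟩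
  choose I hI using hI'
  have hIinj : ∀ q q' i i', S q → S q' → I q i = I q' i' → q = q' ∧ i = i' := by
    intro q q' i i' h h' he
    obtain rfl : q = q' := by rw [← (hI q h).2 i, ← (hI q' h').2 i', he]
    exact ⟨rfl, (hI q h).1 he⟩
  have hIprime : ∀ q i, S q → Prime (I q i) := by
    intro q i h
    have hn := (hI q h).2 i
    have hq := hS q h
    refine Ideal.prime_of_isPrime (fun h0 ↦ ?_) (Ideal.isPrime_of_irreducible_absNorm ?_)
    · rw [h0, Ideal.absNorm_bot] at hn
      exact hq.ne_zero hn.symm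
    · rw [hn]; exact hq
  let M : Fin 3 → ℕ → Multiset (Ideal (𝓞 F)) := fun i n ↦ (n.primeFactorsList : Multiset ℕ).map (I · i)
  have hMem : ∀ i x n, n ∈ supported S x → ∀ p ∈ M i n, Prime p := by
    intro i x n hn p hp
    obtain ⟨q, hq, rfl⟩ := Multiset.mem_map.1 hp
    have hq' := Nat.mem_primeFactorsList'.1 (Multiset.mem_coe.1 hq)
    exact hIprime q i ((mem_supported.1 hn).2 q hq'.1 hq'.2.1)
  have hnorm : ∀ i x n, n ∈ supported S x → Ideal.absNorm (M i n).prod = n := by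
    intro i x n hn
    rw [map_multiset_prod, Multiset.map_map]
    have : (n.primeFactorsList : Multiset ℕ).map (⇑Ideal.absNorm ∘ (I · i)) =
        (n.primeFactorsList : Multiset ℕ).map id := by
      refine Multiset.map_congr rfl fun q hq ↦ ?_
      have hq' := Nat.mem_primeFactorsList'.1 (Multiset.mem_coe.1 hq)
      exact (hI q ((mem_supported.1 hn).2 q hq'.1 hq'.2.1)).2 i
    rw [this, Multiset.map_id, Multiset.prod_coe,
      Nat.prod_primeFactorsList (by have := (mem_supported.1 hn).1; omega)]
  have hcount : ∀ i j x n q, n ∈ supported S x → S q →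
      (M j n).count (I q i) = if i = j then n.primeFactorsList.count q else 0 := by
    intro i j x n q hn hq
    rw [Multiset.count_map]
    have : (n.primeFactorsList : Multiset ℕ).filter (fun a ↦ I q i = I a j) =
        (n.primeFactorsList : Multiset ℕ).filter (fun a ↦ q = a ∧ i = j) := by
      refine Multiset.filter_congr fun a ha ↦ ?_
      have hq' := Nat.mem_primeFactorsList'.1 (Multiset.mem_coe.1 ha)
      have hSa := (mem_supported.1 hn).2 a hq'.1 hq'.2.1
      exact ⟨fun h ↦ hIinj _ _ _ _ hq hSa h, fun h ↦ by rw [h.1, h.2]⟩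
    rw [this]
    split_ifs with h
    · simp only [h, and_true]
      rw [← Multiset.countP_eq_card_filter, ← Multiset.coe_count, Multiset.count]
    · simp [h]
  let T := supported S x
  let e : ℕ × ℕ × ℕ → Ideal (𝓞 F) := fun n ↦ (M 0 n.1 + M 1 n.2.1 + M 2 n.2.2).prod
  have heN : ∀ n ∈ T ×ˢ T ×ˢ T, Ideal.absNorm (e n) = n.1 * (n.2.1 * n.2.2) := by
    intro n hn
    simp only [Finset.mem_product] at hn
    simp only [e, Multiset.prod_add, map_mul]
    rw [hnorm 0 x _ hn.1, hnorm 1 x _ hn.2.1, hnorm 2 x _ hn.2.2, mul_assoc]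
  have hsum : suppHarm S x ^ 3 = ∑ n ∈ T ×ˢ T ×ˢ T, ((n.1 : ℝ) * (n.2.1 * n.2.2))⁻¹ := by
    rw [Finset.sum_product, suppHarm, pow_succ', sq, Finset.sum_mul_sum, Finset.sum_mul]
    refine Finset.sum_congr rfl fun a _ ↦ ?_
    rw [Finset.sum_product, Finset.mul_sum]
    refine Finset.sum_congr rfl fun b _ ↦ ?_
    rw [Finset.mul_sum]
    refine Finset.sum_congr rfl fun c _ ↦ ?_
    simp only [mul_inv]
  rw [hsum, idealHarm]
  refine Finset.sum_le_sum_of_injOn' e (fun n hn ↦ ?_) (fun n hn n' hn' he ↦ ?_)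
    (fun n hn ↦ ?_) (fun _ _ ↦ by positivity)
  · have h1 := heN n hn
    simp only [Finset.mem_product] at hn
    have a1 := (mem_supported.1 hn.1).1
    have a2 := (mem_supported.1 hn.2.1).1
    have a3 := (mem_supported.1 hn.2.2).1
    rw [mem_idealsLE, h1]
    constructor
    · intro h0
      rw [h0, Ideal.absNorm_bot] at h1
      have : 0 < n.1 * (n.2.1 * n.2.2) := Nat.mul_pos a1.1 (Nat.mul_pos a2.1 a3.1)
      omega
    · calc n.1 * (n.2.1 * n.2.2) ≤ x * (x * x) :=
            Nat.mul_le_mul a1.2 (Nat.mul_le_mul a2.2 a3.2)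
        _ = x ^ 3 := by ring
  · simp only [Finset.coe_product, Set.mem_prod, Finset.mem_coe] at hn hn'
    have hpr : ∀ m : ℕ × ℕ × ℕ, m.1 ∈ T ∧ m.2.1 ∈ T ∧ m.2.2 ∈ T →
        ∀ p ∈ M 0 m.1 + M 1 m.2.1 + M 2 m.2.2, Prime p := by
      intro m hm p hp
      rw [Multiset.mem_add, Multiset.mem_add] at hp
      rcases hp with (hp | hp) | hp
      · exact hMem 0 x _ hm.1 p hp
      · exact hMem 1 x _ hm.2.1 p hp
      · exact hMem 2 x _ hm.2.2 p hp
    have hf := congrArg normalizedFactors he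
    simp only [e] at hf
    rw [normalizedFactors_prod_of_prime (hpr n hn), normalizedFactors_prod_of_prime (hpr n' hn')] at hf
    have key : ∀ a b, a ∈ T → b ∈ T → (∀ q, S q → a.primeFactorsList.count q =
        b.primeFactorsList.count q) → a = b := by
      intro a b ha hb hab
      have ha' := mem_supported.1 ha
      have hb' := mem_supported.1 hb
      refine Nat.eq_of_perm_primeFactorsList (by omega) (by omega) (List.perm_iff_count.2 fun q ↦ ?_)
      by_cases hq : S q
      · exact hab q hq
      · rw [List.count_eq_zero_of_not_mem, List.count_eq_zero_of_not_mem]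
        · intro h
          have := Nat.mem_primeFactorsList'.1 h
          exact hq (hb'.2 q this.1 this.2.1)
        · intro h
          have := Nat.mem_primeFactorsList'.1 h
          exact hq (ha'.2 q this.1 this.2.1)
    have hc : ∀ i q, S q → (M 0 n.1 + M 1 n.2.1 + M 2 n.2.2).count (I q i) =
        (M 0 n'.1 + M 1 n'.2.1 + M 2 n'.2.2).count (I q i) := fun i q _ ↦ by rw [hf]
    simp only [Multiset.count_add] at hc
    refine Prod.ext (key _ _ hn.1 hn'.1 fun q hq ↦ ?_) (Prod.ext
      (key _ _ hn.2.1 hn'.2.1 fun q hq ↦ ?_) (key _ _ hn.2.2 hn'.2.2 fun q hq ↦ ?_))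
    · have := hc 0 q hq
      rw [hcount _ _ x _ _ hn.1 hq, hcount _ _ x _ _ hn.2.1 hq, hcount _ _ x _ _ hn.2.2 hq,
        hcount _ _ x _ _ hn'.1 hq, hcount _ _ x _ _ hn'.2.1 hq, hcount _ _ x _ _ hn'.2.2 hq] at this
      simpa using this
    · have := hc 1 q hq
      rw [hcount _ _ x _ _ hn.1 hq, hcount _ _ x _ _ hn.2.1 hq, hcount _ _ x _ _ hn.2.2 hq,
        hcount _ _ x _ _ hn'.1 hq, hcount _ _ x _ _ hn'.2.1 hq, hcount _ _ x _ _ hn'.2.2 hq] at this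
      simpa using this
    · have := hc 2 q hq
      rw [hcount _ _ x _ _ hn.1 hq, hcount _ _ x _ _ hn.2.1 hq, hcount _ _ x _ _ hn.2.2 hq,
        hcount _ _ x _ _ hn'.1 hq, hcount _ _ x _ _ hn'.2.1 hq, hcount _ _ x _ _ hn'.2.2 hq] at this
      simpa using this
  · rw [heN n hn]
    push_cast
    exact le_rfl

end Supported

end

section

open NumberField UniqueFactorizationMonoid

theorem sum_inv_sq_le_two (x : ℕ) : ∑ l ∈ Finset.Icc 1 x, ((l : ℝ) ^ 2)⁻¹ ≤ 2 := by
  rcases Nat.eq_zero_or_pos x with rfl | hx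
  · simp
  rw [Finset.Icc_eq_cons_Ioc hx, Finset.sum_cons]
  have := sum_Ioc_inv_sq_le_sub (α := ℝ) one_ne_zero hx
  have h2 : (0:ℝ) ≤ (x : ℝ)⁻¹ := by positivity
  norm_num at this ⊢
  linarith

section Quad

variable {k : Type*} [Field k] [NumberField k] {s : k} {D : ℤ}

/-- The primes not dividing `B` modulo which `D` is a square. -/
def SplitPrime (D B : ℤ) (q : ℕ) : Prop := q.Prime ∧ ¬ (q : ℤ) ∣ B ∧ ∃ r : ℤ, (q : ℤ) ∣ D - r ^ 2

theorem IsQuad.exists_split_mul_sq (h : IsQuad s D) {B : ℤ} (h2 : (2 : ℤ) ∣ B) (hD : D ∣ B) 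
    (M : Multiset (Ideal (𝓞 k))) (hM : ∀ P ∈ M, P.IsPrime ∧ P ≠ ⊥) :
    ∃ a b l : ℕ, (∀ q, q.Prime → q ∣ a → SplitPrime D B q) ∧ b ∣ B.natAbs ∧
      (M.map Ideal.absNorm).prod = a * b * l ^ 2 := by
  induction M using Multiset.induction_on with
  | empty => 
    refine ⟨1, 1, 1, fun q hq h1 ↦ ?_, one_dvd _, by simp⟩
    exact absurd (Nat.dvd_one.1 h1) hq.one_lt.ne'
  | cons P M ih =>
    obtain ⟨a, b, l, ha, hb, hl⟩ := ih fun Q hQ ↦ hM Q (Multiset.mem_cons_of_mem hQ)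
    obtain ⟨hP, hP0⟩ := hM P (Multiset.mem_cons_self _ _)
    obtain ⟨q, f, hq, hf, hN, hqP⟩ := exists_prime_absNorm hP hP0
    rw [Multiset.map_cons, Multiset.prod_cons, hl, hN]
    have hf2 : f ≤ 2 := by
      have := Ideal.absNorm_dvd_absNorm_of_le ((Ideal.span_singleton_le_iff_mem _).2 hqP)
      rw [Ideal.absNorm_span_natCast, RingOfIntegers.rank, h.finrank, hN] at this
      exact (Nat.pow_dvd_pow_iff_le_right hq.one_lt).1 this
    obtain rfl | rfl : f = 1 ∨ f = 2 := by omega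
    · rw [pow_one] at hN
      by_cases hqB : (q : ℤ) ∣ B
      · by_cases hqb : q ∣ b
        · obtain ⟨b', rfl⟩ := hqb
          exact ⟨a, b', l * q, ha, (dvd_mul_left _ _).trans hb, by ring⟩
        · refine ⟨a, b * q, l, ha, ?_, by ring⟩
          exact Nat.Coprime.mul_dvd_of_dvd_of_dvd ((Nat.Prime.coprime_iff_not_dvd hq).2 hqb).symm hb
            (Int.natCast_dvd.1 hqB)
      · obtain ⟨r, hr, -⟩ := h.eq_idl_of_absNorm hq
          (by rintro rfl; exact hqB h2) (fun h' ↦ hqB (h'.trans hD)) hN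
        refine ⟨a * q, b, l, fun p hp hd ↦ ?_, hb, by ring⟩
        rcases hp.dvd_mul.1 hd with hd | hd
        · exact ha p hp hd
        · rw [(Nat.prime_dvd_prime_iff_eq hp hq).1 hd]
          exact ⟨hq, hqB, r, hr⟩
    · exact ⟨a, b, l * q, ha, hb, by ring⟩

open Classical in
theorem IsQuad.idealHarm_le (h : IsQuad s D) {B : ℤ} (hB : B ≠ 0) (h2 : (2 : ℤ) ∣ B) (hD : D ∣ B)
    (x : ℕ) : idealHarm k x ≤ (suppHarm (SplitPrime D B) x * (B.natAbs.divisors.card * 2)) ^ 2 := by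
  obtain ⟨f, hinj, hf⟩ := exists_pair_encoding (F := k) h.finrank
  let G : Finset ℕ := (Finset.Icc 1 x).filter fun n ↦ ∃ a b l : ℕ,
    (∀ q, q.Prime → q ∣ a → SplitPrime D B q) ∧ b ∣ B.natAbs ∧ n = a * b * l ^ 2
  have hG : idealHarm k x ≤ (∑ n ∈ G, (n : ℝ)⁻¹) ^ 2 := by
    have hP : (∑ n ∈ G, (n : ℝ)⁻¹) ^ 2 = ∑ t ∈ G ×ˢ G, (t.1 : ℝ)⁻¹ * (t.2 : ℝ)⁻¹ := by
      rw [pow_two, Finset.sum_mul_sum, Finset.sum_product]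
    rw [hP, idealHarm]
    refine Finset.sum_le_sum_of_injOn' f (fun I hI ↦ ?_) (fun I hI J hJ he ↦ ?_) (fun I hI ↦ ?_)
      (fun _ _ ↦ by positivity)
    · obtain ⟨hI0, hIx⟩ := mem_idealsLE.1 hI
      obtain ⟨he, M, N, hM, hN, h1, h2'⟩ := hf I hI0
      have hpos : 0 < Ideal.absNorm I := Nat.pos_of_ne_zero fun h0 ↦ hI0 (Ideal.absNorm_eq_zero_iff.1 h0)
      rw [← he] at hpos hIx
      have p1 := Nat.pos_of_mul_pos_right hpos
      have p2 := Nat.pos_of_mul_pos_left hpos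
      simp only [G, Finset.mem_product, Finset.mem_filter, Finset.mem_Icc]
      refine ⟨⟨⟨?_, ?_⟩, ?_⟩, ⟨?_, ?_⟩, ?_⟩
      · omega
      · exact (Nat.le_mul_of_pos_right _ (by omega)).trans hIx
      · rw [h1]; exact h.exists_split_mul_sq h2 hD M hM
      · omega
      · exact (Nat.le_mul_of_pos_left _ (by omega)).trans hIx
      · rw [h2']; exact h.exists_split_mul_sq h2 hD N hN
    · exact hinj (mem_idealsLE.1 hI).1 (mem_idealsLE.1 hJ).1 he
    · rw [← (hf I (mem_idealsLE.1 hI).1).1, Nat.cast_mul, mul_inv]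
  refine hG.trans (pow_le_pow_left₀ (Finset.sum_nonneg fun _ _ ↦ by positivity) ?_ 2)
  have hG2 : ∀ n, ∃ t : ℕ × ℕ × ℕ, n ∈ G → (∀ q, q.Prime → q ∣ t.1 → SplitPrime D B q) ∧
      t.2.1 ∣ B.natAbs ∧ n = t.1 * t.2.1 * t.2.2 ^ 2 := by
    intro n
    by_cases hn : n ∈ G
    · obtain ⟨-, a, b, l, h⟩ := Finset.mem_filter.1 hn
      exact ⟨(a, b, l), fun _ ↦ h⟩
    · exact ⟨(0, 0, 0), fun h ↦ absurd h hn⟩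
  choose t ht using hG2
  calc ∑ n ∈ G, (n : ℝ)⁻¹ ≤ ∑ t ∈ supported (SplitPrime D B) x ×ˢ B.natAbs.divisors ×ˢ Finset.Icc 1 x,
        ((t.1 : ℝ)⁻¹ * (1 * ((t.2.2 : ℝ) ^ 2)⁻¹)) := by
        refine Finset.sum_le_sum_of_injOn' t (fun n hn ↦ ?_) (fun n hn n' hn' he ↦ ?_) (fun n hn ↦ ?_)
          (fun _ _ ↦ by positivity)
        · obtain ⟨h1, h2, h3⟩ := ht n hn
          have hn' := Finset.mem_Icc.1 (Finset.mem_filter.1 hn).1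
          have p0 : 0 < (t n).1 * (t n).2.1 * (t n).2.2 ^ 2 := by omega
          have p12 := Nat.pos_of_mul_pos_right p0
          have p3 := Nat.pos_of_mul_pos_left p0
          have p1 := Nat.pos_of_mul_pos_right p12
          have p2 := Nat.pos_of_mul_pos_left p12
          have p4 : 0 < (t n).2.2 := Nat.pos_of_ne_zero fun h ↦ by simp [h] at p3
          simp only [Finset.mem_product, mem_supported, Nat.mem_divisors, Finset.mem_Icc]
          refine ⟨⟨⟨p1, ?_⟩, h1⟩, ⟨h2, by simpa using hB⟩, p4, ?_⟩
          · refine le_trans ?_ (h3.symm.le.trans hn'.2)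
            rw [mul_assoc]
            exact Nat.le_mul_of_pos_right _ (Nat.mul_pos p2 p3)
          · refine le_trans ?_ (h3.symm.le.trans hn'.2)
            calc (t n).2.2 ≤ (t n).2.2 ^ 2 := Nat.le_self_pow (by norm_num) _
              _ ≤ _ := Nat.le_mul_of_pos_left _ p12
        · rw [(ht n hn).2.2, (ht n' hn').2.2, he]
        · obtain ⟨h1, h2, h3⟩ := ht n hn
          have hn' := Finset.mem_Icc.1 (Finset.mem_filter.1 hn).1
          have p0 : 0 < (t n).1 * (t n).2.1 * (t n).2.2 ^ 2 := by omega
          have p2 := Nat.pos_of_mul_pos_left (Nat.pos_of_mul_pos_right p0)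
          nth_rewrite 1 [h3]
          push_cast
          rw [mul_inv, mul_inv, mul_assoc]
          have : ((t n).2.1 : ℝ)⁻¹ ≤ 1 := inv_le_one_of_one_le₀ (by exact_mod_cast p2)
          gcongr
    _ = suppHarm (SplitPrime D B) x * (B.natAbs.divisors.card * ∑ l ∈ Finset.Icc 1 x, ((l : ℝ) ^ 2)⁻¹) := by
        rw [Finset.sum_product, suppHarm, Finset.sum_mul]
        refine Finset.sum_congr rfl fun a _ ↦ ?_
        dsimp only
        rw [← Finset.mul_sum, Finset.sum_product]
        simp
    _ ≤ _ := by
        have : 0 ≤ suppHarm (SplitPrime D B) x := Finset.sum_nonneg fun _ _ ↦ by positivity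
        gcongr
        exact sum_inv_sq_le_two x

theorem IsQuad.exists_not_three_ideals (h : IsQuad s D) (F : Type*) [Field F] [NumberField F]
    {B : ℤ} (hB : B ≠ 0) (h2 : (2 : ℤ) ∣ B) (hD : D ∣ B) :
    ∃ q, SplitPrime D B q ∧ ¬ ∃ I : Fin 3 → Ideal (𝓞 F), Function.Injective I ∧
      ∀ i, Ideal.absNorm (I i) = q := by
  by_contra! hcon
  obtain ⟨c, C', hc, -, j₀, hk⟩ := idealHarm_bounds k
  obtain ⟨c', C, -, hC, j₁, hF⟩ := idealHarm_bounds F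
  set W : ℝ := B.natAbs.divisors.card * 2 with hW
  have hW0 : 0 ≤ W := by positivity
  have main : ∀ J : ℕ, 2 * j₀ + 1 ≤ J → c ^ 3 * J ≤ W ^ 6 * (128 * C ^ 2) := by
    intro J hJ
    have e1 := (hk J).1.trans (h.idealHarm_le hB h2 hD (3 ^ J))
    have e2 := suppHarm_pow_three_le (F := F) (S := SplitPrime D B) (fun q hq ↦ hq.1)
      (fun q hq ↦ by
        obtain ⟨I, h1, h2⟩ := hcon q hq
        exact ⟨I, h1, h2⟩) (3 ^ J)
    rw [← pow_mul, mul_comm] at e2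
    replace e2 := e2.trans (hF (3 * J)).2
    have hA : 0 ≤ suppHarm (SplitPrime D B) (3 ^ J) := Finset.sum_nonneg fun _ _ ↦ by positivity
    generalize suppHarm (SplitPrime D B) (3 ^ J) = A at *
    have hJ' : (2 * j₀ + 1 : ℝ) ≤ J := by exact_mod_cast hJ
    have hj0 : (0:ℝ) ≤ j₀ := Nat.cast_nonneg _
    rw [mul_comm 3 J] at e2
    push_cast at e2
    have f1 : c * (J / 2) ≤ (A * W) ^ 2 := le_trans (by gcongr; linarith) e1
    have f2 : A ^ 3 ≤ C * (4 * J) := e2.trans (by gcongr; linarith)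
    have hJ0 : (0:ℝ) < J := by linarith
    have f3 : (c * (J / 2)) ^ 3 ≤ W ^ 6 * (C * (4 * J)) ^ 2 := by
      calc (c * (J / 2)) ^ 3 ≤ ((A * W) ^ 2) ^ 3 := by gcongr
        _ = W ^ 6 * (A ^ 3) ^ 2 := by ring
        _ ≤ _ := by gcongr
    have f4 : (c ^ 3 * J) * (J ^ 2 / 8) ≤ (W ^ 6 * (128 * C ^ 2)) * (J ^ 2 / 8) := by
      calc _ = (c * (J / 2)) ^ 3 := by ring
        _ ≤ _ := f3
        _ = _ := by ring
    exact le_of_mul_le_mul_right f4 (by positivity)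
  obtain ⟨n, hn⟩ := exists_nat_gt (W ^ 6 * (128 * C ^ 2) / c ^ 3)
  rw [div_lt_iff₀ (by positivity)] at hn
  have := main (n + (2 * j₀ + 1)) (by omega)
  push_cast at this
  have : 0 ≤ c ^ 3 * (2 * j₀ + 1) := by positivity
  linarith

end Quad

end

section

open NumberField

theorem exists_cube_of_cubic_root {K : Type*} [Field K] [CharZero K] {w : K} {d y z P : ℤ}
    (hw : w ^ 2 = d) (hn : y ^ 2 - d * z ^ 2 = P ^ 3) (hd : d ≠ 0) (hz : z ≠ 0) {x : ℚ}
    (hx : x ^ 3 - 3 * P * x - 2 * y = 0) : ∃ κ : K, κ ^ 3 = y + z * w := by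
  have hn' : (y : ℚ) ^ 2 - d * z ^ 2 = P ^ 3 := by exact_mod_cast hn
  have hxP : x ^ 2 - P ≠ 0 := by
    intro h
    have h1 : (d : ℚ) * z ^ 2 = 0 := by
      have e1 : (P : ℚ) = x ^ 2 := by linarith
      have e2 : (y : ℚ) = -x ^ 3 := by rw [e1] at hx; linarith
      rw [e1, e2] at hn'
      linarith
    simp [hd, hz] at h1
  have hdz : (d : ℚ) * (z / (x ^ 2 - P)) ^ 2 = (x ^ 2 - 4 * P) / 4 := by
    have e2 : (y : ℚ) = (x ^ 3 - 3 * P * x) / 2 := by linarith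
    have : (d : ℚ) * z ^ 2 = y ^ 2 - P ^ 3 := by linarith
    rw [div_pow, ← mul_div_assoc, this, e2]
    field_simp
    ring
  obtain ⟨β, hβ⟩ : ∃ β : ℚ, β = z / (x ^ 2 - P) := ⟨_, rfl⟩
  rw [← hβ] at hdz
  have hz' : (z : ℚ) = β * (x ^ 2 - P) := by rw [hβ]; field_simp
  have hdzK : (d : K) * (β : K) ^ 2 = ((x : K) ^ 2 - 4 * P) / 4 := by exact_mod_cast congrArg (Rat.cast : ℚ → K) hdz
  have hzK : (z : K) = β * ((x : K) ^ 2 - P) := by exact_mod_cast congrArg (Rat.cast : ℚ → K) hz'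
  have hyK : (x : K) ^ 3 - 3 * P * x - 2 * y = 0 := by exact_mod_cast congrArg (Rat.cast : ℚ → K) hx
  refine ⟨x / 2 + β * w, ?_⟩
  have hy2 : (y : K) = ((x : K) ^ 3 - 3 * P * x) / 2 := by linear_combination (-1/2 : K) * hyK
  rw [hzK, hy2]
  linear_combination (3 * (x:K) / 2 * β ^ 2 + β ^ 3 * w) * hw + (3 * (x : K) / 2 + β * w) * hdzK

theorem IsQuad.exists_cube {k : Type*} [Field k] [NumberField k] {s : k} {D : ℤ} (h : IsQuad s D)
    {K : Type*} [Field K] [CharZero K] {w : K} {d y z P m : ℤ}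
    (hw : w ^ 2 = d) (hn : y ^ 2 - d * z ^ 2 = P ^ 3) (hmD : -3 * d = m ^ 2 * D)
    (hd : d ≠ 0) (hz : z ≠ 0) (hP : P ≠ 0)
    (hs : ∀ (q : ℕ) (r : ℤ), q.Prime → ¬ (q : ℤ) ∣ 6 * D * P * z * d → (q : ℤ) ∣ D - r ^ 2 →
      cubSym q (z * m * r + y) (2 * y) = 0) : ∃ κ : K, κ ^ 3 = y + z * w := by
  have hD0 : D ≠ 0 := by
    rintro rfl
    simp [hd] at hmD
  by_cases hx : ∃ x : ℚ, x ^ 3 - 3 * P * x - 2 * y = 0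
  · obtain ⟨x, hx⟩ := hx
    exact exists_cube_of_cubic_root hw hn hd hz hx
  exfalso
  obtain ⟨F, iF, iN, θ, hF, hθ, hN⟩ := exists_cubicField (a := -3 * P) (b := -2 * y) (by
    intro x h0
    refine hx ⟨x, ?_⟩
    push_cast at h0
    linarith)
  obtain ⟨q, ⟨hq, hqB, r, hr⟩, hno⟩ := h.exists_not_three_ideals F (B := 6 * D * P * z * d)
    (by positivity) ⟨3 * D * P * z * d, by ring⟩ ⟨6 * P * z * d, by ring⟩
  refine hno ?_
  have key : ∀ n c : ℤ, 6 * D * P * z * d = n * c → ¬ (q : ℤ) ∣ n := fun n c e h' ↦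
    hqB (e ▸ h'.mul_right c)
  obtain ⟨t, ht, hne⟩ := exists_cubic_roots hq
    (by rintro rfl; exact key 2 (3 * D * P * z * d) (by ring) (dvd_refl _))
    (by rintro rfl; exact key 3 (2 * D * P * z * d) (by ring) (dvd_refl _)) hn hmD hr
    (key P (6 * D * z * d) (by ring)) (key z (6 * D * P * d) (by ring))
    (key d (6 * D * P * z) (by ring)) (hs q r hq hqB hr)
  refine exists_ideals_of_cubic_roots hF hθ hN hq (t := t) (fun i ↦ ?_) hne
  exact Int.dvd_of_eq_of_dvd (by ring) (ht i)

end

section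

open NumberField nonZeroDivisors

namespace IsQuad

variable {K : Type*} [Field K] [NumberField K] {w : K} {d : ℤ}

/-- The Galois conjugation on the ring of integers. -/
noncomputable def conjInt (h : IsQuad w d) : 𝓞 K →+* 𝓞 K := RingOfIntegers.mapRingHom h.conj

theorem coe_conjInt (h : IsQuad w d) (x : 𝓞 K) : (h.conjInt x : K) = h.conj x := rfl

@[simp] theorem conjInt_root (h : IsQuad w d) : h.conjInt h.root = -h.root := by
  apply RingOfIntegers.ext
  rw [coe_conjInt, h.coe_root, h.conj_root]
  exact (map_neg (algebraMap (𝓞 K) K) h.root).symm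

theorem conjInt_conjInt (h : IsQuad w d) (x : 𝓞 K) : h.conjInt (h.conjInt x) = x := by
  apply RingOfIntegers.ext
  rw [coe_conjInt, coe_conjInt, h.conj_conj]

theorem mul_conjInt (h : IsQuad w d) (x : 𝓞 K) : x * h.conjInt x = (Algebra.norm ℤ x : ℤ) := by
  apply RingOfIntegers.ext
  change algebraMap (𝓞 K) K _ = algebraMap (𝓞 K) K _
  rw [map_mul, map_intCast]
  refine (h.mul_conj (x : K)).trans ?_
  rw [← Algebra.coe_norm_int x]
  simp

theorem norm_natCast (h : IsQuad w d) (n : ℕ) : Algebra.norm ℤ (n : 𝓞 K) = (n : ℤ) ^ 2 := by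
  have := h.norm_int n 0
  simpa using this

theorem norm_dvd {x y : 𝓞 K} (hxy : x ∣ y) : Algebra.norm ℤ x ∣ Algebra.norm ℤ y := by
  obtain ⟨z, rfl⟩ := hxy
  exact ⟨_, map_mul _ _ _⟩

theorem dvd_of_dvd_mul_intCast {q : ℕ} {n : ℤ} (hq : q.Prime) (hn : ¬ (q : ℤ) ∣ n) {x : 𝓞 K}
    (hx : (q : 𝓞 K) ∣ n * x) : (q : 𝓞 K) ∣ x := by
  have h1 : IsCoprime (q : ℤ) n :=
    ((Nat.prime_iff_prime_int.1 hq).coprime_iff_not_dvd).2 hn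
  have h2 : IsCoprime (((q : ℤ)) : 𝓞 K) (n : 𝓞 K) := h1.intCast
  rw [Int.cast_natCast] at h2
  exact h2.dvd_of_dvd_mul_left hx

theorem dvd_of_dvd_pow_three (h : IsQuad w d) {q : ℕ} (hq : q.Prime) (h2 : q ≠ 2)
    (hd : ¬ (q : ℤ) ∣ d) {x : 𝓞 K} (hx : (q : 𝓞 K) ∣ x ^ 3) : (q : 𝓞 K) ∣ x := by
  have hp := Nat.prime_iff_prime_int.1 hq
  have hq2 : ¬ (q : ℤ) ∣ 2 := fun h' ↦
    h2 ((Nat.prime_dvd_prime_iff_eq hq Nat.prime_two).1 (by exact_mod_cast h'))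
  have h1 := norm_dvd hx
  rw [h.norm_natCast, map_pow] at h1
  have hN : (q : ℤ) ∣ Algebra.norm ℤ x := hp.dvd_of_dvd_pow ((dvd_pow_self _ two_ne_zero).trans h1)
  obtain ⟨u, v, huv, hn⟩ := h.exists_int' x
  obtain ⟨N, hN'⟩ := hN
  have hr := h.root_sq
  have hnK : ((u : 𝓞 K) ^ 2 - d * v ^ 2) = 4 * (q * N) := by
    rw [hN'] at hn
    exact_mod_cast congrArg (Int.cast : ℤ → 𝓞 K) hn
  have h4 : (4 : 𝓞 K) ≠ 0 := by norm_num
  have hx2 : x ^ 2 = u * x - q * N := by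
    apply mul_left_cancel₀ h4
    linear_combination (2 * x + u + v * h.root - 2 * u) * huv + (v : 𝓞 K) ^ 2 * hr - hnK
  have hx3 : ((u ^ 2 : ℤ) : 𝓞 K) * x = x ^ 3 + q * (N * (u + x)) := by
    push_cast
    linear_combination (-x - u) * hx2
  by_cases hu : (q : ℤ) ∣ u
  · have hv : (q : ℤ) ∣ v := by
      have : (q : ℤ) ∣ d * v ^ 2 := by
        have e : d * v ^ 2 = u ^ 2 - q * (4 * N) := by rw [hN'] at hn; linarith
        rw [e]
        exact dvd_sub (dvd_pow hu two_ne_zero) ⟨_, rfl⟩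
      exact hp.dvd_of_dvd_pow ((hp.dvd_or_dvd this).resolve_left hd)
    obtain ⟨u', rfl⟩ := hu
    obtain ⟨v', rfl⟩ := hv
    refine dvd_of_dvd_mul_intCast hq hq2 ⟨u' + v' * h.root, ?_⟩
    push_cast at huv ⊢
    rw [huv]; ring
  · refine dvd_of_dvd_mul_intCast (n := u ^ 2) hq (fun h' ↦ hu (hp.dvd_of_dvd_pow h')) ?_
    rw [hx3]
    exact dvd_add hx ⟨_, rfl⟩

theorem exists_primitive_rep (h : IsQuad w d) (c : ClassGroup (𝓞 K)) {B : ℤ} (hB : B ≠ 0) :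
    ∃ I : (Ideal (𝓞 K))⁰, ClassGroup.mk0 I = c ∧ IsCoprime (Ideal.absNorm (I : Ideal (𝓞 K)) : ℤ) B ∧
      ∀ q : ℕ, q.Prime → ¬ (I : Ideal (𝓞 K)) ≤ Ideal.span {(q : 𝓞 K)} := by
  obtain ⟨I₀, h1, h2⟩ := exists_coprime_rep c hB
  induction hn : Ideal.absNorm (I₀ : Ideal (𝓞 K)) using Nat.strong_induction_on generalizing I₀ with
  | _ n ih =>
    by_cases hall : ∀ q : ℕ, q.Prime → ¬ (I₀ : Ideal (𝓞 K)) ≤ Ideal.span {(q : 𝓞 K)}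
    · exact ⟨I₀, h1, h2, hall⟩
    push Not at hall
    obtain ⟨q, hq, hle⟩ := hall
    obtain ⟨J, hJ⟩ := Ideal.dvd_iff_le.2 hle
    have hI0 : (I₀ : Ideal (𝓞 K)) ≠ ⊥ := nonZeroDivisors.coe_ne_zero I₀
    have hJ0 : J ≠ ⊥ := by
      rintro rfl
      exact hI0 (by simpa using hJ)
    have hq0 : Ideal.span {(q : 𝓞 K)} ≠ ⊥ := by simpa using hq.ne_zero
    have hnorm := congrArg Ideal.absNorm hJ
    rw [map_mul, h.absNorm_natCast] at hnorm
    have hJn : 0 < Ideal.absNorm J := Nat.pos_of_ne_zero fun h0 ↦ hJ0 (Ideal.absNorm_eq_zero_iff.1 h0)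
    refine ih _ ?_ ⟨J, mem_nonZeroDivisors_of_ne_zero hJ0⟩ ?_ ?_ rfl
    · rw [← hn, hnorm]
      have : 2 ^ 2 ≤ q ^ 2 := Nat.pow_le_pow_left hq.two_le 2
      change Ideal.absNorm J < _
      nlinarith
    · have e : I₀ = ⟨_, mem_nonZeroDivisors_of_ne_zero hq0⟩ * ⟨J, mem_nonZeroDivisors_of_ne_zero hJ0⟩ :=
        Subtype.ext hJ
      rw [← h1, e, map_mul, (ClassGroup.mk0_eq_one_iff _).2 ⟨⟨(q : 𝓞 K), rfl⟩⟩, one_mul]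
    · rw [hnorm] at h2
      push_cast at h2
      exact h2.of_mul_left_right

theorem exists_coprime_family (h : IsQuad w d) {B : ℤ} (hB : B ≠ 0) :
    ∃ I : ClassGroup (𝓞 K) → (Ideal (𝓞 K))⁰, (∀ c, ClassGroup.mk0 (I c) = c ∧
      IsCoprime (Ideal.absNorm (I c : Ideal (𝓞 K)) : ℤ) B ∧
      ∀ q : ℕ, q.Prime → ¬ (I c : Ideal (𝓞 K)) ≤ Ideal.span {(q : 𝓞 K)}) ∧
      ∀ c c', c ≠ c' → IsCoprime (Ideal.absNorm (I c : Ideal (𝓞 K)) : ℤ)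
        (Ideal.absNorm (I c' : Ideal (𝓞 K)) : ℤ) := by
  classical
  suffices H : ∀ S : Finset (ClassGroup (𝓞 K)), ∃ I : ClassGroup (𝓞 K) → (Ideal (𝓞 K))⁰,
      (∀ c, ClassGroup.mk0 (I c) = c ∧ IsCoprime (Ideal.absNorm (I c : Ideal (𝓞 K)) : ℤ) B ∧
      ∀ q : ℕ, q.Prime → ¬ (I c : Ideal (𝓞 K)) ≤ Ideal.span {(q : 𝓞 K)}) ∧
      ∀ c ∈ S, ∀ c' ∈ S, c ≠ c' → IsCoprime (Ideal.absNorm (I c : Ideal (𝓞 K)) : ℤ)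
        (Ideal.absNorm (I c' : Ideal (𝓞 K)) : ℤ) by
    obtain ⟨I, h1, h2⟩ := H Finset.univ
    exact ⟨I, h1, fun c c' ↦ h2 c (Finset.mem_univ _) c' (Finset.mem_univ _)⟩
  intro S
  induction S using Finset.induction_on with
  | empty =>
    choose I hI using fun c : ClassGroup (𝓞 K) ↦ h.exists_primitive_rep c hB
    exact ⟨I, hI, by simp⟩
  | insert a S ha ih =>
    obtain ⟨I, h1, h2⟩ := ih
    have hN : ∀ c, (Ideal.absNorm (I c : Ideal (𝓞 K)) : ℤ) ≠ 0 := fun c h0 ↦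
      nonZeroDivisors.coe_ne_zero (I c) (Ideal.absNorm_eq_zero_iff.1 (by exact_mod_cast h0))
    obtain ⟨J, j1, j2, j3⟩ := h.exists_primitive_rep a
      (B := B * ∏ c ∈ S, (Ideal.absNorm (I c : Ideal (𝓞 K)) : ℤ))
      (mul_ne_zero hB (Finset.prod_ne_zero_iff.2 fun c _ ↦ hN c))
    have j4 : ∀ c ∈ S, IsCoprime (Ideal.absNorm (J : Ideal (𝓞 K)) : ℤ)
        (Ideal.absNorm (I c : Ideal (𝓞 K)) : ℤ) := fun c hc ↦
      j2.of_mul_right_right.of_isCoprime_of_dvd_right (Finset.dvd_prod_of_mem _ hc)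
    refine ⟨Function.update I a J, fun c ↦ ?_, fun c hc c' hc' hne ↦ ?_⟩
    · by_cases hca : c = a
      · subst hca
        simpa using ⟨j1, j2.of_mul_right_left, j3⟩
      · simpa [hca] using h1 c
    · rcases Finset.mem_insert.1 hc with rfl | hcS
      · have hcS' := (Finset.mem_insert.1 hc').resolve_left (Ne.symm hne)
        simpa [hne.symm] using j4 c' hcS'
      · have hca : c ≠ a := fun e ↦ ha (e ▸ hcS)
        rcases Finset.mem_insert.1 hc' with rfl | hcS'
        · simpa [hca] using (j4 c hcS).symm
        · have hca' : c' ≠ a := fun e ↦ ha (e ▸ hcS')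
          simpa [hca, hca'] using h2 c hcS c' hcS' hne

end IsQuad

end

section

open NumberField nonZeroDivisors

theorem cubSym_norm_mul {q : ℕ} (hq : q.Prime) (h3 : q ≠ 3) {d m D r y₁ z₁ P₁ y₂ z₂ P₂ : ℤ}
    (h₁ : y₁ ^ 2 - d * z₁ ^ 2 = P₁ ^ 3) (h₂ : y₂ ^ 2 - d * z₂ ^ 2 = P₂ ^ 3)
    (hmD : -3 * d = m ^ 2 * D) (hr : (q : ℤ) ∣ D - r ^ 2) (hP₁ : ¬ (q : ℤ) ∣ P₁)
    (hP₂ : ¬ (q : ℤ) ∣ P₂) :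
    cubSym q ((y₁ * z₂ + z₁ * y₂) * m * r + (y₁ * y₂ + d * z₁ * z₂)) (2 * (y₁ * y₂ + d * z₁ * z₂)) =
      cubSym q (z₁ * m * r + y₁) (2 * y₁) + cubSym q (z₂ * m * r + y₂) (2 * y₂) := by
  have hp := Nat.prime_iff_prime_int.1 hq
  have n1 := not_dvd_norm_form hq h3 h₁ hmD hr hP₁
  have n2 := not_dvd_norm_form hq h3 h₂ hmD hr hP₂
  have n3 := not_dvd_norm_form hq h3 (y := y₁ * y₂ + d * z₁ * z₂) (z := y₁ * z₂ + z₁ * y₂)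
    (P := P₁ * P₂) (by rw [mul_pow, ← h₁, ← h₂]; ring) hmD hr
    (fun h ↦ (hp.dvd_or_dvd h).elim hP₁ hP₂)
  have n0 : ¬ (q : ℤ) ∣ 1 ^ 2 - 1 * 2 + 2 ^ 2 := by
    norm_num
    intro h
    exact h3 ((Nat.prime_dvd_prime_iff_eq hq Nat.prime_three).1 (by exact_mod_cast h))
  have e1 := cubSym_mul hq h3 n1 n2 rfl rfl
  have e2 := cubSym_mul hq h3 n0 n3 rfl rfl
  rw [cubSym_sqrt_neg_three hq h3, zero_add] at e2
  rw [← e1, ← e2]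
  obtain ⟨k, hk⟩ := hr
  apply cubSym_congr
  · refine ⟨m ^ 2 * z₁ * z₂ * k, ?_⟩
    linear_combination (m ^ 2 * z₁ * z₂) * hk + z₁ * z₂ * hmD
  · exact ⟨0, by ring⟩

theorem IsQuad.exists_cube_mul_sq {k : Type*} [Field k] [NumberField k] {s : k} {D : ℤ}
    (h : IsQuad s D) {K : Type*} [Field K] [CharZero K] {w : K} {d m y₁ z₁ P₁ y₂ z₂ P₂ : ℤ}
    (hw : w ^ 2 = d) (h₁ : y₁ ^ 2 - d * z₁ ^ 2 = P₁ ^ 3) (h₂ : y₂ ^ 2 - d * z₂ ^ 2 = P₂ ^ 3)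
    (hmD : -3 * d = m ^ 2 * D) (hd : d ≠ 0) (hP₁ : P₁ ≠ 0) (hP₂ : P₂ ≠ 0)
    (hs : ∀ (q : ℕ) (r : ℤ), q.Prime → ¬ (q : ℤ) ∣ 6 * D * P₁ * P₂ → (q : ℤ) ∣ D - r ^ 2 →
      cubSym q (z₁ * m * r + y₁) (2 * y₁) = cubSym q (z₂ * m * r + y₂) (2 * y₂)) :
    ∃ κ : K, κ ^ 3 = (y₁ + z₁ * w) * (y₂ + z₂ * w) ^ 2 := by
  obtain ⟨y₃, hy₃⟩ : ∃ y, y = y₁ * y₂ + d * z₁ * z₂ := ⟨_, rfl⟩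
  obtain ⟨z₃, hz₃⟩ : ∃ z, z = y₁ * z₂ + z₁ * y₂ := ⟨_, rfl⟩
  obtain ⟨Y, hY⟩ : ∃ y, y = y₃ * y₂ + d * z₃ * z₂ := ⟨_, rfl⟩
  obtain ⟨Z, hZ⟩ : ∃ z, z = y₃ * z₂ + z₃ * y₂ := ⟨_, rfl⟩
  have h₃ : y₃ ^ 2 - d * z₃ ^ 2 = (P₁ * P₂) ^ 3 := by
    rw [mul_pow, ← h₁, ← h₂, hy₃, hz₃]; ring
  have hn : Y ^ 2 - d * Z ^ 2 = (P₁ * P₂ * P₂) ^ 3 := by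
    rw [mul_pow, ← h₃, ← h₂, hY, hZ]; ring
  have hprod : ((y₁ : K) + z₁ * w) * (y₂ + z₂ * w) ^ 2 = Y + Z * w := by
    rw [hY, hZ, hy₃, hz₃]
    push_cast
    linear_combination (y₁ * z₂ ^ 2 + 2 * y₂ * z₁ * z₂ + z₁ * z₂ ^ 2 * w : K) * hw
  rw [hprod]
  have hP : P₁ * P₂ * P₂ ≠ 0 := mul_ne_zero (mul_ne_zero hP₁ hP₂) hP₂
  by_cases hZ0 : Z = 0
  · rw [hZ0] at hn ⊢
    refine ⟨Y / ((P₁ * P₂ * P₂ : ℤ) : K), ?_⟩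
    have hn' : (Y : K) ^ 2 = ((P₁ * P₂ * P₂ : ℤ) : K) ^ 3 := by
      exact_mod_cast congrArg (Int.cast : ℤ → K) (by linarith : Y ^ 2 = (P₁ * P₂ * P₂) ^ 3)
    have hPK : ((P₁ * P₂ * P₂ : ℤ) : K) ≠ 0 := by exact_mod_cast hP
    rw [div_pow, ← hn']
    have hYK : (Y : K) ≠ 0 := by
      intro h0
      rw [h0] at hn'
      exact hPK (by simpa using hn'.symm)
    field_simp
    simp
  refine h.exists_cube hw hn hmD hd hZ0 hP fun q r hq hqB hr ↦ ?_
  have hp := Nat.prime_iff_prime_int.1 hq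
  have key : ∀ n c : ℤ, 6 * D * (P₁ * P₂ * P₂) * Z * d = n * c → ¬ (q : ℤ) ∣ n := fun n c e h' ↦
    hqB (e ▸ h'.mul_right c)
  have q3 : q ≠ 3 := by
    rintro rfl; exact key 3 (2 * D * (P₁ * P₂ * P₂) * Z * d) (by ring) (dvd_refl _)
  have q1 := key P₁ (6 * D * (P₂ * P₂) * Z * d) (by ring)
  have q2 := key P₂ (6 * D * (P₁ * P₂) * Z * d) (by ring)
  have q12 : ¬ (q : ℤ) ∣ P₁ * P₂ := key (P₁ * P₂) (6 * D * P₂ * Z * d) (by ring)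
  rw [hY, hZ, cubSym_norm_mul hq q3 h₃ h₂ hmD hr q12 q2, hy₃, hz₃,
    cubSym_norm_mul hq q3 h₁ h₂ hmD hr q1 q2,
    hs q r hq (key (6 * D * P₁ * P₂) (P₂ * Z * d) (by ring)) hr]
  generalize cubSym q (z₂ * m * r + y₂) (2 * y₂) = x
  revert x
  decide

namespace IsQuad

variable {K : Type*} [Field K] [NumberField K] {w : K} {d : ℤ}

theorem norm_conjInt (h : IsQuad w d) (x : 𝓞 K) : Algebra.norm ℤ (h.conjInt x) = Algebra.norm ℤ x := by
  have h1 := h.mul_conjInt (h.conjInt x)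
  rw [h.conjInt_conjInt, mul_comm, h.mul_conjInt] at h1
  exact_mod_cast h1.symm

theorem exists_norm_eq_cube {I : Ideal (𝓞 K)} {γ : 𝓞 K} (hγ : I ^ 3 = Ideal.span {γ}) :
    ∃ P : ℤ, Algebra.norm ℤ γ = P ^ 3 ∧ P.natAbs = Ideal.absNorm I := by
  have := congrArg Ideal.absNorm hγ
  rw [map_pow, Ideal.absNorm_span_singleton] at this
  rcases Int.natAbs_eq (Algebra.norm ℤ γ) with e | e
  · exact ⟨Ideal.absNorm I, by rw [e, ← this]; push_cast; ring, by simp⟩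
  · exact ⟨-Ideal.absNorm I, by rw [e, ← this]; push_cast; ring, by simp⟩

theorem not_dvd_of_primitive (h : IsQuad w d) {I : Ideal (𝓞 K)} {γ : 𝓞 K}
    (hγ : I ^ 3 = Ideal.span {γ}) {q : ℕ} (hq : q.Prime) (h2 : q ≠ 2) (hd : ¬ (q : ℤ) ∣ d)
    (hI : ¬ I ≤ Ideal.span {(q : 𝓞 K)}) : ¬ (q : 𝓞 K) ∣ γ := by
  intro hdvd
  apply hI
  intro x hx
  rw [Ideal.mem_span_singleton]
  apply h.dvd_of_dvd_pow_three hq h2 hd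
  have : x ^ 3 ∈ Ideal.span {γ} := hγ ▸ Ideal.pow_mem_pow hx 3
  exact hdvd.trans (Ideal.mem_span_singleton.1 this)

theorem exists_cubeNorm (h : IsQuad w d) {I I' : Ideal (𝓞 K)} {γ γ' : 𝓞 K}
    (hI0 : I ≠ ⊥) (hI0' : I' ≠ ⊥)
    (hγ : I ^ 3 = Ideal.span {γ}) (hγ' : I' ^ 3 = Ideal.span {γ'})
    (hI : ∀ q : ℕ, q.Prime → ¬ I ≤ Ideal.span {(q : 𝓞 K)})
    (hI' : ∀ q : ℕ, q.Prime → ¬ I' ≤ Ideal.span {(q : 𝓞 K)})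
    (hc : IsCoprime (Ideal.absNorm I : ℤ) (6 * d)) (hc' : IsCoprime (Ideal.absNorm I' : ℤ) (6 * d))
    (hcc : IsCoprime (Ideal.absNorm I : ℤ) (Ideal.absNorm I' : ℤ))
    (h72 : (72 : 𝓞 K) ∣ γ - γ') {m e D : ℤ} (hm : m * e = 3) (he : e = 1 ∨ e = 3)
    (hD : -3 * d = m ^ 2 * D) :
    ∃ y z P : ℤ, γ * h.conjInt γ' = y + z * h.root ∧ P ≠ 0 ∧ CubeNorm d y z P m e D := by
  obtain ⟨P, hP, hPn⟩ := exists_norm_eq_cube hγ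
  obtain ⟨P', hP', hPn'⟩ := exists_norm_eq_cube hγ'
  have hPd : ∀ n : ℤ, n ∣ P ↔ n ∣ Ideal.absNorm I := fun n ↦ by rw [← hPn, Int.dvd_natAbs]
  have hPd' : ∀ n : ℤ, n ∣ P' ↔ n ∣ Ideal.absNorm I' := fun n ↦ by rw [← hPn', Int.dvd_natAbs]
  have hP0 : P ≠ 0 := by
    rintro rfl
    exact hI0 (Ideal.absNorm_eq_zero_iff.1 (by simpa using hPn.symm))
  have hP0' : P' ≠ 0 := by
    rintro rfl
    exact hI0' (Ideal.absNorm_eq_zero_iff.1 (by simpa using hPn'.symm))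
  obtain ⟨δ, hδ⟩ := h72
  obtain ⟨u, v, huv, -⟩ := h.exists_int' δ
  obtain ⟨a, b, hab, -⟩ := h.exists_int' (h.conjInt γ')
  have hr := h.root_sq
  obtain ⟨y, hy⟩ : ∃ y : ℤ, y = P' ^ 3 + 18 * (u * a + v * b * d) := ⟨_, rfl⟩
  obtain ⟨z, hz⟩ : ∃ z : ℤ, z = 18 * (u * b + v * a) := ⟨_, rfl⟩
  have hyz : γ * h.conjInt γ' = y + z * h.root := by
    have e1 : γ' * h.conjInt γ' = ((P' ^ 3 : ℤ) : 𝓞 K) := by rw [h.mul_conjInt, hP']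
    rw [hy, hz]
    push_cast at e1 ⊢
    linear_combination h.conjInt γ' * hδ + e1 + 18 * (2 * h.conjInt γ') * huv +
      18 * (u + v * h.root) * hab + 18 * v * b * hr
  have hn : y ^ 2 - d * z ^ 2 = (P * P') ^ 3 := by
    rw [← h.norm_int, ← hyz, map_mul, h.norm_conjInt, hP, hP']; ring
  have hpass : ∀ q : ℕ, q.Prime → IsCoprime (q : ℤ) (6 * d) → q ≠ 2 ∧ ¬ (q : ℤ) ∣ d := by
    intro q hq hco
    have hp := Nat.prime_iff_prime_int.1 hq
    constructor
    · rintro rfl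
      exact hp.not_unit (hco.isUnit_of_dvd' (dvd_refl _) ⟨3 * d, by push_cast; ring⟩)
    · exact fun h' ↦ hp.not_unit (hco.isUnit_of_dvd' (dvd_refl _) (h'.mul_left 6))
  refine ⟨y, z, P * P', hyz, mul_ne_zero hP0 hP0', hn, ?_, ?_, hm, he, hD, hz ▸ ⟨_, rfl⟩⟩
  · rw [isCoprime_int_iff]
    rintro q hq ⟨y', hy'⟩ ⟨z', hz'⟩
    have hp := Nat.prime_iff_prime_int.1 hq
    have hdvd : (q : 𝓞 K) ∣ γ * h.conjInt γ' := by
      refine ⟨y' + z' * h.root, ?_⟩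
      rw [hyz, hy', hz']; push_cast; ring
    have hqP : (q : ℤ) ∣ P * P' := by
      apply hp.dvd_of_dvd_pow (n := 3)
      rw [← hn, hy']
      exact dvd_sub (dvd_pow ⟨_, rfl⟩ two_ne_zero) ((dvd_pow ⟨_, hz'⟩ two_ne_zero).mul_left _)
    by_cases hqP' : (q : ℤ) ∣ P'
    · have h1 : ¬ (q : ℤ) ∣ P := fun h' ↦
        hp.not_unit (hcc.isUnit_of_dvd' ((hPd _).1 h') ((hPd' _).1 hqP'))
      obtain ⟨q2, qd⟩ := hpass q hq (hc'.of_isCoprime_of_dvd_left ((hPd' _).1 hqP'))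
      refine h.not_dvd_of_primitive hγ' hq q2 qd (hI' q hq) ?_
      refine dvd_of_dvd_mul_intCast (n := P ^ 3) hq (fun h' ↦ h1 (hp.dvd_of_dvd_pow h')) ?_
      rw [← hP, ← h.mul_conjInt]
      have := map_dvd h.conjInt hdvd
      rw [map_natCast, map_mul, h.conjInt_conjInt] at this
      rw [mul_assoc]
      exact this.mul_left _
    · obtain ⟨q2, qd⟩ := hpass q hq
        (hc.of_isCoprime_of_dvd_left ((hPd _).1 ((hp.dvd_or_dvd hqP).resolve_right hqP')))
      refine h.not_dvd_of_primitive hγ hq q2 qd (hI q hq) ?_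
      refine dvd_of_dvd_mul_intCast (n := P' ^ 3) hq (fun h' ↦ hqP' (hp.dvd_of_dvd_pow h')) ?_
      rw [← hP', ← h.mul_conjInt, mul_comm, mul_comm γ', ← mul_assoc]
      exact hdvd.mul_right _
  · have c1 : IsCoprime P 6 := hc.of_mul_right_left.of_isCoprime_of_dvd_left ((hPd P).1 dvd_rfl)
    have c2 : IsCoprime P' 6 := hc'.of_mul_right_left.of_isCoprime_of_dvd_left ((hPd' P').1 dvd_rfl)
    exact c1.mul_left c2

theorem mk0_eq_one_of_eq_span {I : (Ideal (𝓞 K))⁰} {x : 𝓞 K}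
    (h : (I : Ideal (𝓞 K)) = Ideal.span {x}) : ClassGroup.mk0 I = 1 := by
  obtain ⟨I, hI⟩ := I
  exact (ClassGroup.mk0_eq_one_iff hI).2 ⟨⟨x, h⟩⟩

/-- If `γ₁ σ(γ₀) (γ₂ σ(γ₀))²` is a cube, the ideal classes of the cube roots of `(γ₁)`, `(γ₂)` agree. -/
theorem classes_eq_of_cube (h : IsQuad w d) {I₁ I₂ : (Ideal (𝓞 K))⁰} {γ₀ γ₁ γ₂ : 𝓞 K}
    (h0 : γ₀ ≠ 0) (h₁ : (I₁ : Ideal (𝓞 K)) ^ 3 = Ideal.span {γ₁})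
    (h₂ : (I₂ : Ideal (𝓞 K)) ^ 3 = Ideal.span {γ₂})
    {κ : K} (hκ : κ ^ 3 = ((γ₁ * h.conjInt γ₀ * (γ₂ * h.conjInt γ₀) ^ 2 : 𝓞 K) : K)) :
    ClassGroup.mk0 I₁ = ClassGroup.mk0 I₂ := by
  have hc0 : (h.conjInt γ₀ : K) ≠ 0 := by
    intro h'
    have : h.conjInt γ₀ = 0 := RingOfIntegers.ext h'
    exact h0 (by rw [← h.conjInt_conjInt γ₀, this, map_zero])
  have hκ' : (κ / (h.conjInt γ₀ : K)) ^ 3 = ((γ₁ * γ₂ ^ 2 : 𝓞 K) : K) := by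
    rw [div_pow, hκ, div_eq_iff (pow_ne_zero 3 hc0)]
    change algebraMap (𝓞 K) K _ = algebraMap (𝓞 K) K _ * (algebraMap (𝓞 K) K _) ^ 3
    rw [← map_pow, ← map_mul]
    congr 1
    ring
  have h_isInt : IsIntegral ℤ (κ / (h.conjInt γ₀ : K)) := by
    apply IsIntegral.of_pow (n := 3) (by norm_num)
    rw [hκ']
    exact RingOfIntegers.isIntegral_coe _
  obtain ⟨x, hx⟩ : ∃ x : 𝓞 K, (x : K) = κ / (h.conjInt γ₀ : K) := ⟨⟨_, h_isInt⟩, rfl⟩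
  have hx3 : x ^ 3 = γ₁ * γ₂ ^ 2 := by
    apply RingOfIntegers.ext
    rw [← hκ', ← hx]
    exact map_pow (algebraMap (𝓞 K) K) x 3
  have hid : ((I₁ : Ideal (𝓞 K)) * (I₂ : Ideal (𝓞 K)) ^ 2) ^ 3 = Ideal.span {x} ^ 3 := by
    rw [Ideal.span_singleton_pow, hx3, ← Ideal.span_singleton_mul_span_singleton,
      ← Ideal.span_singleton_pow, ← h₁, ← h₂]
    ring
  have hid' : (I₁ : Ideal (𝓞 K)) * (I₂ : Ideal (𝓞 K)) ^ 2 = Ideal.span {x} :=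
    dvd_antisymm ((UniqueFactorizationMonoid.pow_dvd_pow_iff_dvd three_ne_zero).1 hid.dvd)
      ((UniqueFactorizationMonoid.pow_dvd_pow_iff_dvd three_ne_zero).1 hid.symm.dvd)
  have hcl : ClassGroup.mk0 (I₁ * I₂ ^ 2) = 1 := mk0_eq_one_of_eq_span hid'
  have hcl2 : ClassGroup.mk0 I₂ ^ 3 = 1 := by
    rw [← map_pow]
    exact mk0_eq_one_of_eq_span h₂
  rw [map_mul, map_pow] at hcl
  calc ClassGroup.mk0 I₁ = ClassGroup.mk0 I₁ * ClassGroup.mk0 I₂ ^ 3 := by rw [hcl2, mul_one]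
    _ = (ClassGroup.mk0 I₁ * ClassGroup.mk0 I₂ ^ 2) * ClassGroup.mk0 I₂ := by rw [pow_succ _ 2, mul_assoc]
    _ = _ := by rw [hcl, one_mul]

end IsQuad

end

section

open NumberField nonZeroDivisors

theorem exists_eq_span_of_mk0_eq_one {K : Type*} [Field K] [NumberField K] {I : (Ideal (𝓞 K))⁰}
    (h : ClassGroup.mk0 I = 1) : ∃ x : 𝓞 K, (I : Ideal (𝓞 K)) = Ideal.span {x} := by
  obtain ⟨I, hI⟩ := I
  exact ((ClassGroup.mk0_eq_one_iff hI).1 h).principal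

/-- Reflection: the 3-torsion of the class group of `ℚ(√d)` is bounded by that of `ℚ(√-3d)`. -/
theorem IsQuad.card_three_torsion_le {K k : Type*} [Field K] [NumberField K] [Field k] [NumberField k]
    {w : K} {s : k} {d D m e : ℤ} (h : IsQuad w d) (hk : IsQuad s D) (hD0 : D < 0) (hd0 : d ≠ 0)
    (hm : m * e = 3) (he : e = 1 ∨ e = 3) (hD : -3 * d = m ^ 2 * D) :
    Nat.card {c : ClassGroup (𝓞 K) // c ^ 3 = 1} ≤
      10368 * Nat.card {c : ClassGroup (𝓞 k) // c ^ 3 = 1} := by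
  classical
  obtain ⟨I, hI, hcop⟩ := h.exists_coprime_family (B := 6 * d) (by positivity)
  have hγ : ∀ c : ClassGroup (𝓞 K), ∃ γ : 𝓞 K, c ^ 3 = 1 →
      (I c : Ideal (𝓞 K)) ^ 3 = Ideal.span {γ} := by
    intro c
    by_cases hc : c ^ 3 = 1
    · rw [← (hI c).1, ← map_pow] at hc
      obtain ⟨γ, hγ⟩ := exists_eq_span_of_mk0_eq_one hc
      exact ⟨γ, fun _ ↦ hγ⟩
    · exact ⟨0, fun h ↦ absurd h hc⟩
  choose γ hγ using hγ
  have h720 : Ideal.span {((72 : ℕ) : 𝓞 K)} ≠ ⊥ := by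
    rw [Ne, Ideal.span_singleton_eq_bot]; norm_num
  have hfin : Finite (𝓞 K ⧸ Ideal.span {((72 : ℕ) : 𝓞 K)}) := Ideal.finiteQuotientOfFreeOfNeBot _ h720
  have := Fintype.ofFinite (𝓞 K ⧸ Ideal.span {((72 : ℕ) : 𝓞 K)})
  have hcard : Fintype.card (𝓞 K ⧸ Ideal.span {((72 : ℕ) : 𝓞 K)}) = 5184 := by
    have := h.absNorm_natCast 72
    rw [Ideal.absNorm_apply, Submodule.cardQuot_apply, Nat.card_eq_fintype_card] at this
    rw [this]; norm_num
  let f : ClassGroup (𝓞 K) → 𝓞 K ⧸ Ideal.span {((72 : ℕ) : 𝓞 K)} := fun c ↦ Ideal.Quotient.mk _ (γ c)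
  set T : Finset (ClassGroup (𝓞 K)) := Finset.univ.filter fun c ↦ c ^ 3 = 1 with hT
  have hTc : Nat.card {c : ClassGroup (𝓞 K) // c ^ 3 = 1} = T.card := by
    rw [Nat.card_eq_fintype_card, Fintype.card_subtype]
  set H := Nat.card {c : ClassGroup (𝓞 k) // c ^ 3 = 1} with hH
  have hH1 : 1 ≤ H := by
    have : Nonempty {c : ClassGroup (𝓞 k) // c ^ 3 = 1} := ⟨⟨1, one_pow 3⟩⟩
    exact Nat.card_pos
  have hHom := card_hom_zmod_three (ClassGroup (𝓞 k))
  have hfinHom : Finite (ClassGroup (𝓞 k) →* Multiplicative (ZMod 3)) :=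
    Finite.of_injective (fun f : ClassGroup (𝓞 k) →* Multiplicative (ZMod 3) ↦
      (f : ClassGroup (𝓞 k) → Multiplicative (ZMod 3))) DFunLike.coe_injective
  have := Fintype.ofFinite (ClassGroup (𝓞 k) →* Multiplicative (ZMod 3))
  rw [Nat.card_eq_fintype_card] at hHom
  have hroot : ∀ x : 𝓞 K, ∀ y z : ℤ, x = y + z * h.root → (x : K) = y + z * w := by
    rintro _ y z rfl
    simp
  have hfib : ∀ b ∈ T.image f, (T.filter fun c ↦ f c = b).card ≤ 2 * H := by
    intro b hb
    obtain ⟨c₀, hc₀, rfl⟩ := Finset.mem_image.1 hb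
    have hc₀' := hγ c₀ (Finset.mem_filter.1 hc₀).2
    have hγ0 : γ c₀ ≠ 0 := by
      intro h0
      rw [h0, Ideal.span_singleton_eq_bot.2 rfl] at hc₀'
      exact nonZeroDivisors.coe_ne_zero (I c₀) (pow_eq_zero_iff (three_ne_zero) |>.1 hc₀')
    have hdata : ∀ c, ∃ (y z P : ℤ) (χ : ClassGroup (𝓞 k) →* Multiplicative (ZMod 3)),
        c ∈ (T.filter fun c ↦ f c = f c₀).erase c₀ →
        (γ c * h.conjInt (γ c₀) = y + z * h.root ∧ P ≠ 0 ∧ y ^ 2 - d * z ^ 2 = P ^ 3 ∧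
        ∀ (q : ℕ) (r : ℤ) (J : (Ideal (𝓞 k))⁰),
        q.Prime → ¬ (q : ℤ) ∣ 6 * D * P → (q : ℤ) ∣ D - r ^ 2 → (J : Ideal (𝓞 k)) = hk.idl q r →
        χ (ClassGroup.mk0 J) = Multiplicative.ofAdd (cubSym q (z * m * r + y) (2 * y))) := by
      intro c
      by_cases hc : c ∈ (T.filter fun c ↦ f c = f c₀).erase c₀
      · obtain ⟨hne, hcm⟩ := Finset.mem_erase.1 hc
        obtain ⟨hcT, hfc⟩ := Finset.mem_filter.1 hcm
        have h72 : (72 : 𝓞 K) ∣ γ c - γ c₀ := by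
          have := Ideal.mem_span_singleton.1 (Ideal.Quotient.eq.1 hfc)
          exact_mod_cast this
        obtain ⟨y, z, P, h1, h2, h3⟩ := h.exists_cubeNorm (nonZeroDivisors.coe_ne_zero (I c))
          (nonZeroDivisors.coe_ne_zero (I c₀)) (hγ c (Finset.mem_filter.1 hcT).2) hc₀' (hI c).2.2
          (hI c₀).2.2 (hI c).2.1 (hI c₀).2.1 (hcop c c₀ hne) h72 hm he hD
        obtain ⟨χ, hχ⟩ := hk.exists_classGroup_char hD0 h3 h2
        exact ⟨y, z, P, χ, fun _ ↦ ⟨h1, h2, h3.norm, hχ⟩⟩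
      · exact ⟨0, 0, 0, 1, fun h' ↦ absurd h' hc⟩
    choose y z P χ hχ using hdata
    have hinj : Set.InjOn χ ((T.filter fun c ↦ f c = f c₀).erase c₀ : Finset _) := by
      intro c hc c' hc' hcc
      obtain ⟨a1, a2, a3, a4⟩ := hχ c hc
      obtain ⟨b1, b2, b3, b4⟩ := hχ c' hc'
      have hT1 : ∀ c ∈ (T.filter fun c ↦ f c = f c₀).erase c₀, c ^ 3 = 1 := fun c hc ↦
        (Finset.mem_filter.1 (Finset.mem_filter.1 (Finset.mem_erase.1 hc).2).1).2
      obtain ⟨κ, hκ⟩ := hk.exists_cube_mul_sq h.sq a3 b3 hD hd0 a2 b2 (by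
        intro q r hq hqB hr
        have hp := Nat.prime_iff_prime_int.1 hq
        have key : ∀ n t : ℤ, 6 * D * P c * P c' = n * t → ¬ (q : ℤ) ∣ n := fun n t e h' ↦
          hqB (e ▸ h'.mul_right t)
        have hJ : hk.idl q r ≠ ⊥ := fun h0 ↦ by
          have h1 : (q : 𝓞 k) ∈ hk.idl q r := Ideal.subset_span (by simp)
          rw [h0, Ideal.mem_bot] at h1
          exact hq.ne_zero (by exact_mod_cast h1)
        have e1 := a4 q r ⟨_, mem_nonZeroDivisors_of_ne_zero hJ⟩ hq (key _ (P c') (by ring)) hr rfl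
        have e2 := b4 q r ⟨_, mem_nonZeroDivisors_of_ne_zero hJ⟩ hq (key _ (P c) (by ring)) hr rfl
        rw [← hcc, e1] at e2
        exact Multiplicative.ofAdd.injective e2)
      rw [← (hI c).1, ← (hI c').1]
      refine h.classes_eq_of_cube (κ := κ) hγ0 (hγ c (hT1 c hc)) (hγ c' (hT1 c' hc')) ?_
      rw [hκ, ← hroot _ _ _ a1, ← hroot _ _ _ b1]
      simp
    have h1 : ((T.filter fun c ↦ f c = f c₀).erase c₀).card ≤
        Fintype.card (ClassGroup (𝓞 k) →* Multiplicative (ZMod 3)) :=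
      Finset.card_le_card_of_injOn χ (fun _ _ ↦ Finset.mem_univ _) hinj
    have h2 := Finset.pred_card_le_card_erase (s := T.filter fun c ↦ f c = f c₀) (a := c₀)
    omega
  rw [hTc]
  calc T.card ≤ 2 * H * (T.image f).card := Finset.card_le_mul_card_image T _ hfib
    _ ≤ 2 * H * 5184 := by
        gcongr
        rw [← hcard]
        exact Finset.card_le_univ _
    _ = _ := by ring

end

section

open NumberField

namespace IsQuad

variable {F : Type*} [Field F] [NumberField F] {s : F} {D : ℤ}

theorem trace_int (h : IsQuad s D) (a b : ℤ) :
    Algebra.trace ℤ (𝓞 F) ((a : 𝓞 F) + (b : 𝓞 F) * h.root) = 2 * a := by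
  have h1 := Algebra.coe_trace_int ((a : 𝓞 F) + (b : 𝓞 F) * h.root)
  have h2 := h.trace_eq (a : ℚ) b
  simp only [Rat.cast_intCast] at h2
  have e : (((a : 𝓞 F) + (b : 𝓞 F) * h.root : 𝓞 F) : F) = (a : F) + b * s := by simp
  rw [e, h2] at h1
  exact_mod_cast h1

theorem abs_discr_le (h : IsQuad s D) : |discr F| ≤ 4 * |D| := by
  have hr : Module.finrank ℤ (𝓞 F) = 2 := by rw [RingOfIntegers.rank, h.finrank]
  let b : Module.Basis (Fin 2) ℤ (𝓞 F) := Module.finBasisOfFinrankEq ℤ (𝓞 F) hr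
  let v : Fin 2 → 𝓞 F := ![1, h.root]
  have h1 := Algebra.discr_of_matrix_vecMul (A := ℤ) b (b.toMatrix v)
  have h2 : Matrix.vecMul (b : Fin 2 → 𝓞 F) ((b.toMatrix v).map (algebraMap ℤ (𝓞 F))) = v := by
    funext j
    rw [← b.sum_toMatrix_smul_self v j]
    simp only [Matrix.vecMul, dotProduct, Matrix.map_apply]
    refine Finset.sum_congr rfl fun i _ ↦ ?_
    rw [Algebra.smul_def, mul_comm]
  rw [h2, discr_eq_discr] at h1
  have hD0 : D ≠ 0 := h.sqfree.ne_zero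
  have t1 : Algebra.trace ℤ (𝓞 F) 1 = 2 := by simpa using h.trace_int 1 0
  have t2 : Algebra.trace ℤ (𝓞 F) h.root = 0 := by simpa using h.trace_int 0 1
  have t3 : Algebra.trace ℤ (𝓞 F) (h.root * h.root) = 2 * D := by
    rw [← pow_two, h.root_sq]; simpa using h.trace_int D 0
  have h3 : Algebra.discr ℤ v = 4 * D := by
    rw [Algebra.discr_def, Matrix.det_fin_two]
    simp only [Algebra.traceMatrix_apply, Algebra.traceForm_apply, v, Matrix.cons_val_zero,
      Matrix.cons_val_one, one_mul, mul_one, t1, t2, t3]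
    ring
  rw [h3] at h1
  set P := (b.toMatrix v).det
  have hP : P ≠ 0 := by
    intro h0
    rw [h0] at h1
    apply hD0
    linarith
  have h4 : 4 * |D| = P ^ 2 * |discr F| := by
    have := congrArg abs h1
    rwa [abs_mul, abs_mul, abs_of_nonneg (sq_nonneg P), abs_of_nonneg (by norm_num : (0:ℤ) ≤ 4)]
      at this
  rw [h4]
  have h5 : 1 ≤ P ^ 2 := by
    have := sq_pos_of_ne_zero hP
    omega
  nlinarith [abs_nonneg (discr F)]

open mixedEmbedding ENNReal NNReal in
theorem exists_mem_ideal_lt (h : IsQuad s D) {I : Ideal (𝓞 F)} (hI : I ≠ ⊥)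
    (f : InfinitePlace F → ℝ≥0)
    (hf : (Ideal.absNorm I : ℝ) * √|(discr F : ℝ)| < ∏ w, (f w : ℝ) ^ w.mult) :
    ∃ a ∈ I, a ≠ 0 ∧ ∀ w : InfinitePlace F, w a < f w := by
  classical
  let J := FractionalIdeal.mk0 F ⟨I, mem_nonZeroDivisors_iff_ne_zero.2 hI⟩
  have key : minkowskiBound F J < MeasureTheory.volume (convexBodyLT F f) := by
    rw [minkowskiBound, convexBodyLT_volume, volume_fundamentalDomain_fractionalIdealLatticeBasis,
      volume_fundamentalDomain_latticeBasis, mixedEmbedding.finrank, h.finrank]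
    have hJ : ((FractionalIdeal.absNorm (J : FractionalIdeal (nonZeroDivisors (𝓞 F)) F) : ℚ) : ℝ)
        = Ideal.absNorm I := by
      simp [J, FractionalIdeal.coeIdeal_absNorm]
    rw [hJ]
    have hcast : ENNReal.ofReal (Ideal.absNorm I : ℝ) = ((Ideal.absNorm I : ℝ≥0) : ℝ≥0∞) := by
      rw [ENNReal.ofReal]; congr 1; simp
    have hhalf : (2⁻¹ : ℝ≥0∞) = ((2⁻¹ : ℝ≥0) : ℝ≥0∞) := by
      rw [ENNReal.coe_inv two_ne_zero]; rfl
    have htwo : (2 : ℝ≥0∞) = ((2 : ℝ≥0) : ℝ≥0∞) := rfl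
    rw [hcast, hhalf, htwo]
    norm_cast
    rw [← NNReal.coe_lt_coe]
    push_cast
    have hn : ‖(discr F : ℤ)‖ = |(discr F : ℝ)| := Int.norm_eq_abs _
    rw [hn]
    have hs : (InfinitePlace.nrRealPlaces F = 2 ∧ InfinitePlace.nrComplexPlaces F = 0) ∨
        (InfinitePlace.nrRealPlaces F = 0 ∧ InfinitePlace.nrComplexPlaces F = 1) := by
      have := InfinitePlace.card_add_two_mul_card_eq_rank F
      rw [h.finrank] at this
      omega
    have hpos : 0 ≤ (Ideal.absNorm I : ℝ) * √|(discr F : ℝ)| := by positivity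
    rcases hs with ⟨h1, h2⟩ | ⟨h1, h2⟩ <;> rw [h1, h2]
    · nlinarith
    · have := Real.pi_gt_three
      norm_num
      nlinarith
  obtain ⟨a, ha, ha0, hlt⟩ := exists_ne_zero_mem_ideal_lt F J key
  simp only [J, FractionalIdeal.coe_mk0, FractionalIdeal.mem_coeIdeal] at ha
  obtain ⟨a, ha, rfl⟩ := ha
  exact ⟨a, ha, by rintro rfl; simp at ha0, hlt⟩

theorem abs_norm_eq_absNorm_span (x : 𝓞 F) :
    ((|Algebra.norm ℚ (x : F)| : ℚ) : ℝ) = Ideal.absNorm (Ideal.span {x}) := by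
  rw [Ideal.absNorm_span_singleton, ← Algebra.coe_norm_int, Nat.cast_natAbs]
  push_cast
  rfl

/-- Given `I ^ 3 = (α)` and an ideal `P`, Minkowski's theorem gives a generator of small size of
the cube of an ideal `b * P` in the class inverse to that of `I`. -/
theorem exists_small_generator (h : IsQuad s D) {I P : Ideal (𝓞 F)} {α : 𝓞 F} (hI : I ≠ ⊥)
    (hP : P ≠ ⊥) (hα : I ^ 3 = Ideal.span {α}) :
    ∃ (θ : 𝓞 F) (b : Ideal (𝓞 F)), b ≠ ⊥ ∧ Ideal.span {θ} = (b * P) ^ 3 ∧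
      (∃ β, I * (b * P) = Ideal.span {β}) ∧ (Ideal.absNorm b : ℝ) ≤ 3 * √|(D : ℝ)| ∧
      ∀ φ : F →+* ℂ, ‖φ θ‖ ^ 2 ≤ (3 * √|(D : ℝ)| * Ideal.absNorm P) ^ 3 := by
  have hD0 : D ≠ 0 := h.sqfree.ne_zero
  have hDpos : 0 < √|(D : ℝ)| := Real.sqrt_pos.2 (abs_pos.2 (by exact_mod_cast hD0))
  have hα0 : α ≠ 0 := by
    rintro rfl
    rw [Ideal.span_singleton_eq_bot.2 rfl] at hα
    exact hI (pow_eq_zero_iff (three_ne_zero) |>.1 hα)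
  have hPn : 0 < Ideal.absNorm P := Nat.pos_of_ne_zero (by rwa [Ne, Ideal.absNorm_eq_zero_iff])
  have hIn : 0 < Ideal.absNorm I := Nat.pos_of_ne_zero (by rwa [Ne, Ideal.absNorm_eq_zero_iff])
  have hPR : (0 : ℝ) < Ideal.absNorm P := by exact_mod_cast hPn
  have hIR : (0 : ℝ) < Ideal.absNorm I := by exact_mod_cast hIn
  set l2 : ℝ := 3 * √|(D : ℝ)| * Ideal.absNorm P with hl2
  have hl2p : 0 < l2 := by positivity
  let f : InfinitePlace F → NNReal := fun w ↦
    ⟨√l2 * (w α) ^ ((1 : ℝ) / 3), by positivity⟩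
  have hf3 : ∀ w, (f w : ℝ) ^ 3 = √l2 ^ 3 * w α := by
    intro w
    change (√l2 * (w α) ^ ((1 : ℝ) / 3)) ^ 3 = _
    rw [mul_pow, ← Real.rpow_natCast ((w α) ^ _), ← Real.rpow_mul (apply_nonneg w _)]
    norm_num
  have hmult : ∏ w : InfinitePlace F, √l2 ^ w.mult = l2 := by
    rw [Finset.prod_pow_eq_pow_sum, InfinitePlace.sum_mult_eq, h.finrank, Real.sq_sqrt hl2p.le]
  have hprod : ∏ w : InfinitePlace F, (f w : ℝ) ^ w.mult = l2 * Ideal.absNorm I := by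
    have h3 : (∏ w : InfinitePlace F, (f w : ℝ) ^ w.mult) ^ 3 = (l2 * Ideal.absNorm I) ^ 3 := by
      rw [← Finset.prod_pow]
      simp_rw [← pow_mul, mul_comm _ 3, pow_mul, hf3, mul_pow, Finset.prod_mul_distrib]
      rw [InfinitePlace.prod_eq_abs_norm, abs_norm_eq_absNorm_span, ← hα, map_pow]
      push_cast
      congr 1
      simp_rw [← pow_mul, mul_comm 3, pow_mul, Finset.prod_pow, hmult]
    exact (pow_left_inj₀ (Finset.prod_nonneg fun w _ ↦ by positivity) (by positivity)
      (by norm_num)).1 h3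
  have hdisc : √|(discr F : ℝ)| ≤ 2 * √|(D : ℝ)| := by
    rw [show (2 : ℝ) * √|(D : ℝ)| = √(4 * |(D : ℝ)|) by
      rw [Real.sqrt_mul (by norm_num), show √(4 : ℝ) = 2 by
        rw [show (4 : ℝ) = 2 ^ 2 by norm_num]; exact Real.sqrt_sq (by norm_num)]]
    apply Real.sqrt_le_sqrt
    exact_mod_cast h.abs_discr_le
  have hIP : I * P ≠ ⊥ := by simpa using ⟨hI, hP⟩
  obtain ⟨β, hβ, hβ0, hlt⟩ := h.exists_mem_ideal_lt hIP f (by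
    rw [hprod, hl2, map_mul]
    push_cast
    calc (Ideal.absNorm I : ℝ) * Ideal.absNorm P * √|(discr F : ℝ)|
        ≤ Ideal.absNorm I * Ideal.absNorm P * (2 * √|(D : ℝ)|) := by gcongr
      _ < _ := by nlinarith [mul_pos (mul_pos hIR hPR) hDpos])
  obtain ⟨b, hb⟩ := Ideal.dvd_iff_le.2 ((Ideal.span_singleton_le_iff_mem _).2 hβ)
  have hβs : Ideal.span {β} ≠ ⊥ := by rwa [Ne, Ideal.span_singleton_eq_bot]
  have hb0 : b ≠ ⊥ := by
    rintro rfl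
    apply hβs
    rw [hb]; simp
  have hb3 : Ideal.span {β ^ 3} = Ideal.span {α} * (b * P) ^ 3 := by
    rw [← Ideal.span_singleton_pow, hb, ← hα]; ring
  obtain ⟨θ, hθ⟩ : α ∣ β ^ 3 := by
    rw [← Ideal.span_singleton_le_span_singleton, hb3]
    exact Ideal.mul_le_right (I := (b * P) ^ 3) |>.trans' (by rw [mul_comm])
  have hθs : Ideal.span {θ} = (b * P) ^ 3 := by
    rw [hθ, ← Ideal.span_singleton_mul_span_singleton] at hb3
    exact mul_left_cancel₀ (by simpa using hα0) hb3
  refine ⟨θ, b, hb0, hθs, ⟨β, by rw [hb]; ring⟩, ?_, ?_⟩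
  · have h1 : (Ideal.absNorm (Ideal.span {β}) : ℝ) ≤ l2 * Ideal.absNorm I := by
      rw [← hprod, ← abs_norm_eq_absNorm_span, ← InfinitePlace.prod_eq_abs_norm]
      exact Finset.prod_le_prod (fun w _ ↦ by positivity)
        fun w _ ↦ pow_le_pow_left₀ (apply_nonneg _ _) (hlt w).le _
    rw [hb, map_mul, map_mul] at h1
    push_cast at h1
    have h2 : (Ideal.absNorm I * Ideal.absNorm P : ℝ) * Ideal.absNorm b ≤
        (Ideal.absNorm I * Ideal.absNorm P : ℝ) * (3 * √|(D : ℝ)|) := by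
      rw [hl2] at h1; linarith
    exact le_of_mul_le_mul_left h2 (by positivity)
  · intro φ
    have hw := hlt (InfinitePlace.mk φ)
    have h3 := hf3 (InfinitePlace.mk φ)
    rw [InfinitePlace.apply] at hw h3
    have hαφ : 0 < ‖φ α‖ := by
      rw [norm_pos_iff, map_ne_zero]
      simpa using hα0
    have h4 : ‖φ β‖ ^ 3 ≤ √l2 ^ 3 * ‖φ α‖ := by
      rw [← h3]
      exact pow_le_pow_left₀ (_root_.norm_nonneg _) hw.le _
    have h5 : ‖φ β‖ ^ 3 = ‖φ α‖ * ‖φ θ‖ := by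
      rw [← norm_pow, ← norm_mul, ← map_pow, ← map_mul]
      congr 2
      have := congrArg (algebraMap (𝓞 F) F) hθ
      simpa using this
    have h6 : ‖φ θ‖ ≤ √l2 ^ 3 := by
      rw [h5, mul_comm] at h4
      exact le_of_mul_le_mul_right h4 hαφ
    calc ‖φ θ‖ ^ 2 ≤ (√l2 ^ 3) ^ 2 := by gcongr
      _ = (√l2 ^ 2) ^ 3 := by ring
      _ = l2 ^ 3 := by rw [Real.sq_sqrt hl2p.le]

end IsQuad

end

section

open NumberField

/-- The odd prime `p` splits in `ℚ(√D)`, with `r` a square root of `D` modulo `p`. -/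
structure SplitAt (D : ℤ) (p : ℕ) (r : ℤ) : Prop where
  prime : p.Prime
  ne_two : p ≠ 2
  dvd : (p : ℤ) ∣ D - r ^ 2
  not_dvd : ¬(p : ℤ) ∣ D

theorem SplitAt.neg {D : ℤ} {p : ℕ} {r : ℤ} (h : SplitAt D p r) : SplitAt D p (-r) :=
  ⟨h.prime, h.ne_two, by simpa using h.dvd, h.not_dvd⟩

namespace IsQuad

variable {F : Type*} [Field F] [NumberField F] {s : F} {D : ℤ}

theorem not_idl_neg_dvd (h : IsQuad s D) {p : ℕ} {r : ℤ} (hp : SplitAt D p r) :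
    ¬h.idl p (-r) ∣ h.idl p r := by
  intro hd
  have hle := Ideal.dvd_iff_le.1 hd
  have h1 : h.root - (r : 𝓞 F) ∈ h.idl p (-r) := hle (Ideal.subset_span (by simp))
  have h2 : h.root - ((-r : ℤ) : 𝓞 F) ∈ h.idl p (-r) := Ideal.subset_span (by simp)
  have h3 : ((2 * r : ℤ) : 𝓞 F) ∈ h.idl p (-r) := by
    have := Ideal.sub_mem _ h2 h1
    convert this using 1
    push_cast; ring
  have hq := hp.neg
  rw [intCast_mem_of_absNorm_prime hp.prime (h.absNorm_idl hq.prime hq.ne_two hq.dvd hq.not_dvd)] at h3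
  have hpp : Prime (p : ℤ) := Nat.prime_iff_prime_int.1 hp.prime
  rcases hpp.dvd_or_dvd h3 with h4 | h4
  · have : p ∣ 2 := by exact_mod_cast h4
    exact hp.ne_two ((Nat.prime_dvd_prime_iff_eq hp.prime Nat.prime_two).1 this)
  · apply hp.not_dvd
    have := (hp.dvd.add (dvd_pow h4 two_ne_zero))
    rwa [sub_add_cancel] at this

theorem not_idl_dvd_of_ne (h : IsQuad s D) {p q : ℕ} {r t : ℤ} (hp : SplitAt D p r)
    (hq : SplitAt D q t) (hpq : p ≠ q) : ¬h.idl p r ∣ h.idl q t := by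
  intro hd
  have := map_dvd (Ideal.absNorm (S := 𝓞 F)) hd
  rw [h.absNorm_idl hp.prime hp.ne_two hp.dvd hp.not_dvd,
    h.absNorm_idl hq.prime hq.ne_two hq.dvd hq.not_dvd] at this
  exact hpq ((Nat.prime_dvd_prime_iff_eq hp.prime hq.prime).1 this)

theorem idl_ne_bot (h : IsQuad s D) {p : ℕ} {r : ℤ} (hp : SplitAt D p r) : h.idl p r ≠ ⊥ := by
  rw [Ne, ← Ideal.absNorm_eq_zero_iff, h.absNorm_idl hp.prime hp.ne_two hp.dvd hp.not_dvd]
  exact hp.prime.ne_zero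

theorem prime_idl (h : IsQuad s D) {p : ℕ} {r : ℤ} (hp : SplitAt D p r) : Prime (h.idl p r) :=
  (Ideal.prime_iff_isPrime (h.idl_ne_bot hp)).2
    (h.isPrime_idl hp.prime hp.ne_two hp.dvd hp.not_dvd)

theorem idl_mul_neg (h : IsQuad s D) {p : ℕ} {r : ℤ} (hp : SplitAt D p r) :
    h.idl p r * h.idl p (-r) = Ideal.span {(p : 𝓞 F)} :=
  h.idl_mul hp.prime hp.ne_two hp.dvd hp.not_dvd

theorem not_natCast_dvd_of_span (h : IsQuad s D) {p q : ℕ} {r t : ℤ} (hp : SplitAt D p r)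
    (hq : SplitAt D q t) (hpq : p ≠ q) {g : 𝓞 F}
    (hg : Ideal.span {g} = (h.idl q (-t) * h.idl p r) ^ 3) :
    ¬(p : 𝓞 F) ∣ g ∧ ¬(q : 𝓞 F) ∣ g := by
  constructor <;> intro hd
  · rw [← Ideal.span_singleton_le_span_singleton, ← Ideal.dvd_iff_le, ← h.idl_mul_neg hp, hg] at hd
    rcases (h.prime_idl hp.neg).dvd_or_dvd
      ((h.prime_idl hp.neg).dvd_of_dvd_pow ((Dvd.intro_left _ rfl).trans hd)) with h1 | h1
    · exact h.not_idl_dvd_of_ne hp.neg hq.neg hpq h1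
    · exact h.not_idl_neg_dvd hp h1
  · rw [← Ideal.span_singleton_le_span_singleton, ← Ideal.dvd_iff_le, ← h.idl_mul_neg hq, hg] at hd
    rcases (h.prime_idl hq).dvd_or_dvd
      ((h.prime_idl hq).dvd_of_dvd_pow ((Dvd.intro _ rfl).trans hd)) with h1 | h1
    · have := h.not_idl_neg_dvd hq.neg
      rw [neg_neg] at this
      exact this h1
    · exact h.not_idl_dvd_of_ne hq hp hpq.symm h1

theorem natCast_dvd_of_two_mul (h : IsQuad s D) {p : ℕ} (hp : p.Prime) (h2 : p ≠ 2) {g : 𝓞 F}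
    {y z : ℤ} (hg : 2 * g = y + (z : 𝓞 F) * h.root) (hy : (p : ℤ) ∣ y) (hz : (p : ℤ) ∣ z) :
    (p : 𝓞 F) ∣ g := by
  obtain ⟨k, hk⟩ := hp.odd_of_ne_two h2
  obtain ⟨a, rfl⟩ := hy
  obtain ⟨b, rfl⟩ := hz
  refine ⟨g - k * (a + b * h.root), ?_⟩
  rw [hk] at hg ⊢
  push_cast at hg ⊢
  linear_combination (-(k : 𝓞 F)) * hg

/-- Two small generators of cubes `(b * P) ^ 3`, `(b * Q) ^ 3` produce an element `y + z√D`. -/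
theorem exists_pair_data (h : IsQuad s D) {p q : ℕ} {r t : ℤ} (hp : SplitAt D p r)
    (hq : SplitAt D q t) (hpq : p ≠ q) {θ θ' : 𝓞 F} {b : Ideal (𝓞 F)} (hb : b ≠ ⊥) {n : ℤ}
    (hn : n ≠ 0)
    (hθ : Ideal.span {θ} = (b * h.idl p r) ^ 3) (hθ' : Ideal.span {θ'} = (b * h.idl q t) ^ 3)
    {e e' : ℤ} (he' : e' ^ 2 = 1)
    (hN : θ * h.conjInt θ = (e * (n * p) ^ 3 : ℤ)) (hN' : θ' * h.conjInt θ' = (e' * (n * q) ^ 3 : ℤ))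
    (φ : F →+* ℂ) (h1 : ‖φ θ‖ ^ 2 * q ^ 3 ≤ 3 * (‖φ θ'‖ ^ 2 * p ^ 3))
    (h2 : ‖φ θ'‖ ^ 2 * p ^ 3 ≤ 3 * (‖φ θ‖ ^ 2 * q ^ 3)) (he : e ^ 2 = 1) :
    ∃ y z : ℤ, 2 * (θ * h.conjInt θ') = n ^ 3 * (y + (z : 𝓞 F) * h.root) ∧ ¬(p : ℤ) ∣ z ∧
      ¬(q : ℤ) ∣ z ∧ y ^ 2 - D * z ^ 2 = 4 * e * e' * (p * q) ^ 3 ∧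
      z ^ 2 * |D| ≤ 12 * (p * q) ^ 3 := by
  have hp0 : (p : ℤ) ≠ 0 := by exact_mod_cast hp.prime.ne_zero
  have hq0 : (q : ℤ) ≠ 0 := by exact_mod_cast hq.prime.ne_zero
  have hnF : (n : 𝓞 F) ≠ 0 := by exact_mod_cast hn
  have hθ0 : θ' ≠ 0 := by
    rintro rfl
    rw [Ideal.span_singleton_eq_bot.2 rfl] at hθ'
    have := pow_eq_zero_iff (three_ne_zero) |>.1 hθ'.symm
    rcases mul_eq_zero.1 this with h3 | h3
    · exact hb h3
    · exact h.idl_ne_bot hq h3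
  have hid : Ideal.span {((q : 𝓞 F)) ^ 3 * θ} =
      Ideal.span {θ'} * (h.idl q (-t) * h.idl p r) ^ 3 := by
    rw [← Ideal.span_singleton_mul_span_singleton, hθ, hθ', ← Ideal.span_singleton_pow,
      ← h.idl_mul_neg hq]
    ring
  obtain ⟨g', hg'⟩ : θ' ∣ (q : 𝓞 F) ^ 3 * θ := by
    rw [← Ideal.span_singleton_le_span_singleton, hid, mul_comm]
    exact Ideal.mul_le_right
  have hgs : Ideal.span {(e' : 𝓞 F) * g'} = (h.idl q (-t) * h.idl p r) ^ 3 := by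
    have hu : IsUnit (e' : 𝓞 F) := by
      refine IsUnit.of_mul_eq_one (e' : 𝓞 F) ?_
      rw [← pow_two]; exact_mod_cast he'
    rw [Ideal.span_singleton_mul_left_unit hu]
    rw [hg', ← Ideal.span_singleton_mul_span_singleton] at hid
    exact mul_left_cancel₀ (by simpa using hθ0) hid
  set g := (e' : 𝓞 F) * g' with hg
  have he'F : (e' : 𝓞 F) ^ 2 = 1 := by exact_mod_cast he'
  have hng : (n : 𝓞 F) ^ 3 * g = θ * h.conjInt θ' := by
    apply mul_left_cancel₀ hθ0
    push_cast at hN'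
    rw [hg]
    linear_combination (-(n : 𝓞 F) ^ 3 * e') * hg' - θ * hN'
  obtain ⟨y, z, hyz, hnorm⟩ := h.exists_int' g
  have hgg : g * h.conjInt g = (e * e' * (p * q) ^ 3 : ℤ) := by
    have hc := congrArg h.conjInt hng
    simp only [map_mul, map_pow, map_intCast, h.conjInt_conjInt] at hc
    apply mul_left_cancel₀ (pow_ne_zero 6 hnF)
    push_cast at hN hN' ⊢
    calc (n : 𝓞 F) ^ 6 * (g * h.conjInt g)
        = ((n : 𝓞 F) ^ 3 * g) * ((n : 𝓞 F) ^ 3 * h.conjInt g) := by ring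
      _ = (θ * h.conjInt θ) * (θ' * h.conjInt θ') := by rw [hng, hc]; ring
      _ = _ := by rw [hN, hN']; ring
  rw [h.mul_conjInt] at hgg
  have hgg' : Algebra.norm ℤ g = e * e' * (p * q) ^ 3 := by exact_mod_cast hgg
  rw [hgg'] at hnorm
  have hnd := h.not_natCast_dvd_of_span hp hq hpq hgs
  have hdy : ∀ l : ℕ, l.Prime → (l : ℤ) ∣ p * q → (l : ℤ) ∣ z → (l : ℤ) ∣ y := by
    intro l hl hlpq hlz
    apply (Nat.prime_iff_prime_int.1 hl).dvd_of_dvd_pow (n := 2)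
    have : y ^ 2 = D * z ^ 2 + 4 * (e * e' * (p * q) ^ 3) := by linarith
    rw [this]
    exact dvd_add (Dvd.dvd.mul_left (dvd_pow hlz two_ne_zero) _)
      (Dvd.dvd.mul_left (Dvd.dvd.mul_left (dvd_pow hlpq three_ne_zero) _) _)
  refine ⟨y, z, by rw [← hng, ← hyz]; ring, fun hz ↦ hnd.1 ?_, fun hz ↦ hnd.2 ?_,
    by rw [hnorm]; ring, ?_⟩
  · exact h.natCast_dvd_of_two_mul hp.prime hp.ne_two hyz (hdy p hp.prime (dvd_mul_right _ _) hz) hz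
  · exact h.natCast_dvd_of_two_mul hq.prime hq.ne_two hyz (hdy q hq.prime (dvd_mul_left _ _) hz) hz
  · -- size
    have hφn : ∀ (x : 𝓞 F) (ε : ℤ) (m : ℕ), ε ^ 2 = 1 → x * h.conjInt x = (ε * (n * m) ^ 3 : ℤ) →
        ‖φ x‖ ^ 2 * ‖φ (h.conjInt x)‖ ^ 2 = ((n : ℝ) * m) ^ 6 := by
      intro x ε m hε hx
      have h3 : φ x * φ (h.conjInt x) = ((ε * (n * m) ^ 3 : ℤ) : ℂ) := by
        rw [← map_mul]
        have := congrArg (fun y : 𝓞 F ↦ φ (y : F)) hx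
        simpa using this
      have h4 := congrArg (fun y : ℂ ↦ ‖y‖ ^ 2) h3
      simp only [norm_mul, mul_pow, Complex.norm_intCast, sq_abs] at h4
      rw [h4]
      have hε' : (ε : ℝ) ^ 2 = 1 := by exact_mod_cast hε
      push_cast
      linear_combination ((n : ℝ) * m) ^ 6 * hε'
    have hA := hφn θ e p he hN
    have hB := hφn θ' e' q he' hN'
    have hpR : (0 : ℝ) < p := by exact_mod_cast hp.prime.pos
    have hqR : (0 : ℝ) < q := by exact_mod_cast hq.prime.pos
    have hnR : (n : ℝ) ≠ 0 := by exact_mod_cast hn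
    have hn6 : (0 : ℝ) < (n : ℝ) ^ 6 := by positivity
    have hφg : (n : ℝ) ^ 6 * ‖φ g‖ ^ 2 = ‖φ θ‖ ^ 2 * ‖φ (h.conjInt θ')‖ ^ 2 := by
      have := congrArg (fun y : 𝓞 F ↦ ‖φ (y : F)‖ ^ 2) hng
      simp only [map_mul, map_pow, map_intCast, norm_mul, norm_pow, mul_pow,
        Complex.norm_intCast] at this
      rw [← this, ← pow_mul]; norm_num
      left
      exact ((show Even 6 by decide).pow_abs (n : ℝ)).symm
    have hφg' : (n : ℝ) ^ 6 * ‖φ (h.conjInt g)‖ ^ 2 = ‖φ (h.conjInt θ)‖ ^ 2 * ‖φ θ'‖ ^ 2 := by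
      have hc := congrArg h.conjInt hng
      simp only [map_mul, map_pow, map_intCast, h.conjInt_conjInt] at hc
      have := congrArg (fun y : 𝓞 F ↦ ‖φ (y : F)‖ ^ 2) hc
      simp only [map_mul, map_pow, map_intCast, norm_mul, norm_pow, mul_pow,
        Complex.norm_intCast] at this
      rw [← this, ← pow_mul]; norm_num
      left
      exact ((show Even 6 by decide).pow_abs (n : ℝ)).symm
    have h6 : (0 : ℝ) < ((n : ℝ) * p) ^ 6 := by positivity
    have h6' : (0 : ℝ) < ((n : ℝ) * q) ^ 6 := by positivity
    have bound : ∀ a a' b b' : ℝ, 0 ≤ a → 0 ≤ a' → 0 ≤ b → 0 ≤ b' → a * a' = ((n : ℝ) * p) ^ 6 →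
        b * b' = ((n : ℝ) * q) ^ 6 → a * q ^ 3 ≤ 3 * (b * p ^ 3) →
        a * b' ≤ n ^ 6 * (3 * (p * q) ^ 3) := by
      intro a a' b b' ha ha' hb hb' haa hbb hab
      have h7 := mul_le_mul_of_nonneg_right hab hb'
      have h8 : (a * b') * (q : ℝ) ^ 3 ≤ (n ^ 6 * (3 * (p * q) ^ 3)) * (q : ℝ) ^ 3 := by
        calc (a * b') * (q : ℝ) ^ 3 = a * q ^ 3 * b' := by ring
          _ ≤ 3 * (b * p ^ 3) * b' := h7
          _ = 3 * p ^ 3 * (b * b') := by ring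
          _ = _ := by rw [hbb]; ring
      exact le_of_mul_le_mul_right h8 (by positivity)
    have hb1 : ‖φ g‖ ^ 2 ≤ 3 * ((p : ℝ) * q) ^ 3 := by
      have := bound _ _ _ _ (by positivity) (by positivity) (by positivity) (by positivity) hA hB h1
      rw [← hφg] at this
      exact le_of_mul_le_mul_left this hn6
    have bound' : ∀ a a' b b' : ℝ, 0 ≤ a → 0 ≤ a' → 0 ≤ b → 0 ≤ b' → a * a' = ((n : ℝ) * p) ^ 6 →
        b * b' = ((n : ℝ) * q) ^ 6 → b * p ^ 3 ≤ 3 * (a * q ^ 3) →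
        a' * b ≤ n ^ 6 * (3 * (p * q) ^ 3) := by
      intro a a' b b' ha ha' hb hb' haa hbb hab
      have h7 := mul_le_mul_of_nonneg_right hab ha'
      have h8 : (a' * b) * (p : ℝ) ^ 3 ≤ (n ^ 6 * (3 * (p * q) ^ 3)) * (p : ℝ) ^ 3 := by
        calc (a' * b) * (p : ℝ) ^ 3 = b * p ^ 3 * a' := by ring
          _ ≤ 3 * (a * q ^ 3) * a' := h7
          _ = 3 * q ^ 3 * (a * a') := by ring
          _ = _ := by rw [haa]; ring
      exact le_of_mul_le_mul_right h8 (by positivity)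
    have hb2 : ‖φ (h.conjInt g)‖ ^ 2 ≤ 3 * ((p : ℝ) * q) ^ 3 := by
      have := bound' _ _ _ _ (by positivity) (by positivity) (by positivity) (by positivity) hA hB h2
      rw [← hφg'] at this
      exact le_of_mul_le_mul_left this hn6
    have hzs : (z : F) * s = g - h.conjInt g := by
      have hc := congrArg h.conjInt hyz
      simp only [map_mul, map_add, map_intCast, map_ofNat, h.conjInt_root] at hc
      have h3 : (2 : 𝓞 F) * (z * h.root) = 2 * (g - h.conjInt g) := by
        linear_combination hc - hyz
      have h4 := mul_left_cancel₀ two_ne_zero h3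
      have := congrArg (fun y : 𝓞 F ↦ (y : F)) h4
      simpa using this
    have hzn : ‖φ ((z : F) * s)‖ ^ 2 = (z : ℝ) ^ 2 * |(D : ℝ)| := by
      have h3 : ‖φ s‖ ^ 2 = |(D : ℝ)| := by
        rw [← norm_pow, ← map_pow, h.sq, map_intCast, Complex.norm_intCast]
      rw [map_mul, norm_mul, mul_pow, h3, map_intCast, Complex.norm_intCast, sq_abs]
    have hfin : (z : ℝ) ^ 2 * |(D : ℝ)| ≤ 12 * ((p : ℝ) * q) ^ 3 := by
      rw [← hzn, hzs, map_sub]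
      have := norm_sub_le (φ g) (φ (h.conjInt g))
      have h0 := _root_.norm_nonneg (φ (g : F) - φ (h.conjInt g : 𝓞 F))
      nlinarith [sq_nonneg (‖φ g‖ - ‖φ (h.conjInt g)‖), _root_.norm_nonneg (φ g),
        _root_.norm_nonneg (φ (h.conjInt g : 𝓞 F))]
    exact_mod_cast hfin

end IsQuad

end

section

open NumberField

/-- The arithmetic data extracted from three primes whose ideals lie in the same bin. -/
def TripleRel (D : ℤ) (p q r : ℕ) : Prop :=
  ∃ e₁ e₂ e₃ a b c y : ℤ, e₁ ^ 2 = 1 ∧ e₂ ^ 2 = 1 ∧ e₃ ^ 2 = 1 ∧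
    (¬(p : ℤ) ∣ a ∧ ¬(p : ℤ) ∣ b) ∧ (¬(q : ℤ) ∣ a ∧ ¬(q : ℤ) ∣ c) ∧ (¬(r : ℤ) ∣ b ∧ ¬(r : ℤ) ∣ c) ∧
    e₃ * r ^ 3 * a ^ 2 = e₁ * p ^ 3 * c ^ 2 + e₂ * q ^ 3 * b ^ 2 + b * c * y ∧
    y ^ 2 - D * a ^ 2 = 4 * e₁ * e₂ * (p * q) ^ 3 ∧
    a ^ 2 * |D| ≤ 12 * (p * q) ^ 3 ∧ b ^ 2 * |D| ≤ 12 * (r * p) ^ 3 ∧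
    c ^ 2 * |D| ≤ 12 * (q * r) ^ 3

theorem IsQuad.tripleRel {F : Type*} [Field F] [NumberField F] {s : F} {D : ℤ} (h : IsQuad s D)
    (φ : F →+* ℂ) {b : Ideal (𝓞 F)} (hb : b ≠ ⊥) {p : Fin 3 → ℕ} (hpi : p.Injective)
    {r : Fin 3 → ℤ} (hp : ∀ i, SplitAt D (p i) (r i)) {θ : Fin 3 → 𝓞 F}
    (hθ : ∀ i, Ideal.span {θ i} = (b * h.idl (p i) (r i)) ^ 3)
    (hbin : ∀ i j, ‖φ (θ i)‖ ^ 2 * p j ^ 3 ≤ 3 * (‖φ (θ j)‖ ^ 2 * p i ^ 3)) :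
    TripleRel D (p 0) (p 1) (p 2) := by
  set n : ℤ := ((Ideal.absNorm b : ℕ) : ℤ) with hn
  have hn0 : n ≠ 0 := by
    rw [hn, Ne, Int.natCast_eq_zero, Ideal.absNorm_eq_zero_iff]; exact hb
  have hN : ∀ i, ∃ e : ℤ, e ^ 2 = 1 ∧
      θ i * h.conjInt (θ i) = (e * (n * p i) ^ 3 : ℤ) := by
    intro i
    have h1 : (Algebra.norm ℤ (θ i)).natAbs = (Ideal.absNorm b * p i) ^ 3 := by
      rw [← Ideal.absNorm_span_singleton, hθ, map_pow, map_mul,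
        h.absNorm_idl (hp i).prime (hp i).ne_two (hp i).dvd (hp i).not_dvd]
    rw [h.mul_conjInt]
    rcases Int.natAbs_eq (Algebra.norm ℤ (θ i)) with h2 | h2
    · refine ⟨1, by norm_num, ?_⟩
      rw [h2, h1, hn]; push_cast; ring
    · refine ⟨-1, by norm_num, ?_⟩
      rw [h2, h1, hn]; push_cast; ring
  choose e he hN using hN
  have hpair : ∀ i j, i ≠ j → ∃ y z : ℤ,
      2 * (θ i * h.conjInt (θ j)) = n ^ 3 * (y + (z : 𝓞 F) * h.root) ∧ ¬(p i : ℤ) ∣ z ∧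
      ¬(p j : ℤ) ∣ z ∧ y ^ 2 - D * z ^ 2 = 4 * e i * e j * (p i * p j) ^ 3 ∧
      z ^ 2 * |D| ≤ 12 * (p i * p j) ^ 3 := fun i j hij ↦
    h.exists_pair_data (hp i) (hp j) (hpi.ne hij) hb hn0 (hθ i) (hθ j) (he j) (hN i) (hN j) φ
      (hbin i j) (hbin j i) (he i)
  obtain ⟨y, a, h1, hpa, hqa, hy, ha⟩ := hpair 0 1 (by decide)
  obtain ⟨y', c, h2, hqc, hrc, -, hc⟩ := hpair 1 2 (by decide)
  obtain ⟨y'', b', h3, hrb, hpb, -, hb'⟩ := hpair 2 0 (by decide)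
  refine ⟨e 0, e 1, e 2, a, b', c, y, he 0, he 1, he 2, ⟨hpa, hpb⟩, ⟨hqa, hqc⟩, ⟨hrb, hrc⟩, ?_, hy,
    ha, hb', hc⟩
  have hnF : (n : 𝓞 F) ≠ 0 := by exact_mod_cast hn0
  have hD0 : D ≠ 0 := h.sqfree.ne_zero
  have hR0 : h.root ≠ 0 := by
    intro h0
    have := h.root_sq
    rw [h0] at this
    apply hD0
    have h4 : (D : 𝓞 F) = 0 := by rw [← this]; norm_num
    exact_mod_cast h4
  have c1 := congrArg h.conjInt h1
  have c2 := congrArg h.conjInt h2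
  have c3 := congrArg h.conjInt h3
  simp only [map_mul, map_add, map_pow, map_intCast, map_ofNat, h.conjInt_root,
    h.conjInt_conjInt] at c1 c2 c3
  have hlin : θ 0 * c + θ 1 * b' + θ 2 * a = 0 := by
    apply mul_left_cancel₀ (mul_ne_zero (mul_ne_zero two_ne_zero (pow_ne_zero 3 hnF)) hR0)
    linear_combination θ 0 * (c2 - h2) + θ 1 * (c3 - h3) + θ 2 * (c1 - h1)
  have hlin' := congrArg h.conjInt hlin
  simp only [map_mul, map_add, map_intCast, map_zero] at hlin'
  have hN0 := hN 0
  have hN1 := hN 1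
  have hN2 := hN 2
  push_cast at hN0 hN1 hN2
  have hfin : (2 : 𝓞 F) * n ^ 3 * (e 2 * p 2 ^ 3 * a ^ 2 : ℤ) =
      (2 : 𝓞 F) * n ^ 3 * (e 0 * p 0 ^ 3 * c ^ 2 + e 1 * p 1 ^ 3 * b' ^ 2 + b' * c * y : ℤ) := by
    push_cast
    linear_combination -2 * (a : 𝓞 F) ^ 2 * hN2 + 2 * (c : 𝓞 F) ^ 2 * hN0 +
      2 * (b' : 𝓞 F) ^ 2 * hN1 + (b' : 𝓞 F) * c * (h1 + c1) +
      2 * (θ 2 * a) * hlin' - 2 * (h.conjInt (θ 0) * c + h.conjInt (θ 1) * b') * hlin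
  have := mul_left_cancel₀ (mul_ne_zero two_ne_zero (pow_ne_zero 3 hnF)) hfin
  exact_mod_cast this

open Classical in
/-- Pigeonhole: if there are few bins, some row has many entries whose bin meets two further
columns. -/
theorem exists_row_of_few_bins {C β : Type*} (T : Finset C) (hT : T.Nonempty) (P : Finset ℕ)
    (Bs : Finset β) (bin : C → ℕ → β) (hbin : ∀ c ∈ T, ∀ p ∈ P, bin c p ∈ Bs)
    (hinj : ∀ p ∈ P, Set.InjOn (fun c ↦ bin c p) T) (hcard : 4 * Bs.card ≤ T.card * P.card) :
    ∃ c ∈ T, ∃ G ⊆ P, P.card ≤ 2 * G.card ∧ ∀ p ∈ G, ∃ c₂ ∈ T, ∃ c₃ ∈ T, ∃ q ∈ P, ∃ r ∈ P,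
      p ≠ q ∧ p ≠ r ∧ q ≠ r ∧ bin c₂ q = bin c p ∧ bin c₃ r = bin c p := by
  by_contra! hcon
  set good : C → ℕ → Prop := fun c p ↦ ∃ c₂ ∈ T, ∃ c₃ ∈ T, ∃ q ∈ P, ∃ r ∈ P,
      p ≠ q ∧ p ≠ r ∧ q ≠ r ∧ bin c₂ q = bin c p ∧ bin c₃ r = bin c p with hgood
  set bad := (T ×ˢ P).filter fun x ↦ ¬good x.1 x.2 with hbad
  have h1 : bad.card ≤ 2 * Bs.card := by
    refine Finset.card_le_mul_card_image_of_maps_to (f := fun x ↦ bin x.1 x.2) ?_ 2 ?_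
    · intro x hx
      have := Finset.mem_product.1 (Finset.mem_filter.1 hx).1
      exact hbin _ this.1 _ this.2
    · intro v _
      by_contra! h3
      obtain ⟨x, y, z, hx, hy, hz, hxy, hxz, hyz⟩ := Finset.two_lt_card_iff.1 h3
      simp only [hbad, Finset.mem_filter, Finset.mem_product] at hx hy hz
      have hne : ∀ x y : C × ℕ, x.1 ∈ T → x.2 ∈ P → y.1 ∈ T → bin x.1 x.2 = bin y.1 y.2 → x ≠ y →
          x.2 ≠ y.2 := by
        intro x y hx hx2 hy hb hxy h2
        apply hxy
        rw [← h2] at hb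
        exact Prod.ext (hinj _ hx2 hx hy hb) h2
      exact hx.1.2 ⟨y.1, hy.1.1.1, z.1, hz.1.1.1, y.2, hy.1.1.2, z.2, hz.1.1.2,
        hne x y hx.1.1.1 hx.1.1.2 hy.1.1.1 (hx.2.trans hy.2.symm) hxy,
        hne x z hx.1.1.1 hx.1.1.2 hz.1.1.1 (hx.2.trans hz.2.symm) hxz,
        hne y z hy.1.1.1 hy.1.1.2 hz.1.1.1 (hy.2.trans hz.2.symm) hyz,
        hy.2.trans hx.2.symm, hz.2.trans hx.2.symm⟩
  have h2 : bad.card = ∑ c ∈ T, (P.filter fun p ↦ ¬good c p).card := by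
    rw [hbad, Finset.card_filter, Finset.sum_product]
    simp only [Finset.card_filter]
  have h3 : ∀ c ∈ T, P.card < 2 * (P.filter fun p ↦ ¬good c p).card := by
    intro c hc
    have : 2 * (P.filter (good c)).card < P.card := by
      by_contra! hle
      obtain ⟨p, hp, hp'⟩ := hcon c hc (P.filter (good c)) (Finset.filter_subset _ _) hle
      obtain ⟨-, c₂, h₂, c₃, h₃, q, hq, r, hr, h4, h5, h6, h7, h8⟩ := Finset.mem_filter.1 hp
      exact hp' c₂ h₂ c₃ h₃ q hq r hr h4 h5 h6 h7 h8
    have h4 := Finset.card_filter_add_card_filter_not (s := P) (good c)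
    omega
  have h5 : ∑ c ∈ T, P.card < ∑ c ∈ T, 2 * (P.filter fun p ↦ ¬good c p).card :=
    Finset.sum_lt_sum_of_nonempty hT h3
  rw [← Finset.mul_sum, ← h2, Finset.sum_const, smul_eq_mul] at h5
  omega

end

section

open NumberField

theorem le_three_mul_of_floor_log_eq {x y : ℝ} (hx : 0 < x) (hy : 0 < y)
    (h : ⌊Real.log x⌋ = ⌊Real.log y⌋) : x ≤ 3 * y := by
  have h1 : Real.log x ≤ Real.log y + 1 := by
    have := Int.lt_floor_add_one (Real.log x)
    have h2 := Int.floor_le (Real.log y)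
    rw [h] at this
    linarith
  calc x = Real.exp (Real.log x) := (Real.exp_log hx).symm
    _ ≤ Real.exp (Real.log y + 1) := Real.exp_le_exp.2 h1
    _ = y * Real.exp 1 := by rw [Real.exp_add, Real.exp_log hy]
    _ ≤ y * 3 := by gcongr; exact Real.exp_one_lt_three.le
    _ = 3 * y := by ring

theorem IsQuad.abs_log_le {F : Type*} [Field F] [NumberField F] {s : F} {D : ℤ}
    (h : IsQuad s D) (φ : F →+* ℂ) {p : ℕ} {r : ℤ} (hsp : SplitAt D p r) {m E x : ℝ} (hEp : 0 < E)
    (hm : 3 * Real.log E ≤ m) {θ : 𝓞 F} {b : Ideal (𝓞 F)} (hb : b ≠ ⊥)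
    (hθ : Ideal.span {θ} = (b * h.idl p r) ^ 3)
    (hφ : ∀ φ : F →+* ℂ, ‖φ θ‖ ^ 2 ≤ (E * p) ^ 3) (hx : x = ‖φ θ‖ ^ 2 / p ^ 3) :
    0 < x ∧ |Real.log x| ≤ m := by
  have hpR : (0 : ℝ) < p := by exact_mod_cast hsp.prime.pos
  have hn1 : (1 : ℝ) ≤ Ideal.absNorm (b) := by
    have : Ideal.absNorm (b) ≠ 0 := by rwa [Ne, Ideal.absNorm_eq_zero_iff]
    exact_mod_cast Nat.one_le_iff_ne_zero.2 this
  have hnat : (Algebra.norm ℤ θ).natAbs = (Ideal.absNorm (b) * p) ^ 3 := by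
    rw [← Ideal.absNorm_span_singleton, hθ, map_pow, map_mul,
      h.absNorm_idl hsp.prime hsp.ne_two hsp.dvd hsp.not_dvd]
  have hmul : ‖φ θ‖ ^ 2 * ‖φ (h.conjInt θ)‖ ^ 2 =
      ((Ideal.absNorm (b) : ℝ) * p) ^ 6 := by
    have h3 : φ θ * φ (h.conjInt θ : 𝓞 F) = ((Algebra.norm ℤ θ : ℤ) : ℂ) := by
      rw [← map_mul]
      have := congrArg (fun y : 𝓞 F ↦ φ (y : F)) (h.mul_conjInt θ)
      simpa using this
    have h4 := congrArg (fun y : ℂ ↦ ‖y‖ ^ 2) h3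
    simp only [norm_mul, mul_pow, Complex.norm_intCast] at h4
    have h5 : |((Algebra.norm ℤ θ : ℤ) : ℝ)| = ((Ideal.absNorm (b) : ℝ) * p) ^ 3 := by
      rw [← Int.cast_abs, Int.abs_eq_natAbs, hnat]
      push_cast; ring
    rw [h4, h5]; ring
  have hup : ‖φ (h.conjInt θ)‖ ^ 2 ≤ (E * p) ^ 3 := by
    have := hφ (φ.comp h.conj)
    rwa [RingHom.comp_apply, ← h.coe_conjInt] at this
  have hlow : (p : ℝ) ^ 3 ≤ ‖φ θ‖ ^ 2 * E ^ 3 := by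
    have h6 : (p : ℝ) ^ 3 * p ^ 3 ≤ (‖φ θ‖ ^ 2 * E ^ 3) * p ^ 3 := by
      calc (p : ℝ) ^ 3 * p ^ 3 = (1 * (p : ℝ)) ^ 6 := by ring
        _ ≤ ((Ideal.absNorm (b) : ℝ) * p) ^ 6 := by gcongr
        _ = ‖φ θ‖ ^ 2 * ‖φ (h.conjInt θ)‖ ^ 2 := hmul.symm
        _ ≤ ‖φ θ‖ ^ 2 * (E * p) ^ 3 := by gcongr
        _ = _ := by ring
    exact le_of_mul_le_mul_right h6 (by positivity)
  have hE3 : Real.log (E ^ 3) = 3 * Real.log E := by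
    rw [Real.log_pow]; norm_num
  have hlo : (E ^ 3)⁻¹ ≤ x := by
    rw [hx, inv_eq_one_div]
    rw [div_le_div_iff₀ (by positivity) (by positivity)]
    linarith
  have hρp : 0 < x := lt_of_lt_of_le (by positivity) hlo
  have hhi : x ≤ E ^ 3 := by
    rw [hx]
    rw [div_le_iff₀ (by positivity), ← mul_pow]
    exact hφ φ
  refine ⟨hρp, (abs_le.2 ⟨?_, ?_⟩)⟩
  · have := Real.log_le_log (by positivity) hlo
    rw [Real.log_inv, hE3] at this
    linarith
  · have := Real.log_le_log hρp hhi
    rw [hE3] at this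
    linarith

/-- If the class group of `ℚ(√D)` has large 3-torsion then many split primes `p` are members of
a triple related by `TripleRel`. -/
theorem IsQuad.exists_tripleRel {F : Type*} [Field F] [NumberField F] {s : F} {D : ℤ}
    (h : IsQuad s D) (φ : F →+* ℂ) (P : Finset ℕ) (hP : ∀ p ∈ P, ∃ r, SplitAt D p r) (m : ℕ)
    (hm : 3 * Real.log (3 * √|(D : ℝ)|) ≤ m)
    (hcard : 4 * ((idealsLE F ⌊3 * √|(D : ℝ)|⌋₊).card * (2 * m + 1)) ≤
      Nat.card {c : ClassGroup (𝓞 F) // c ^ 3 = 1} * P.card) :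
    ∃ G ⊆ P, P.card ≤ 2 * G.card ∧ ∀ p ∈ G, ∃ q ∈ P, ∃ r ∈ P, p ≠ q ∧ p ≠ r ∧ q ≠ r ∧
      TripleRel D p q r := by
  classical
  have hD1 : (1 : ℝ) ≤ √|(D : ℝ)| := by
    rw [Real.one_le_sqrt]
    have := Int.one_le_abs h.sqfree.ne_zero
    exact_mod_cast this
  set E : ℝ := 3 * √|(D : ℝ)| with hE
  have hEp : 0 < E := by positivity
  choose! r hr using hP
  set T : Finset (ClassGroup (𝓞 F)) := Finset.univ.filter fun c ↦ c ^ 3 = 1 with hT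
  have hTc : Nat.card {c : ClassGroup (𝓞 F) // c ^ 3 = 1} = T.card := by
    rw [Nat.card_eq_fintype_card, Fintype.card_subtype]
  rw [hTc] at hcard
  have hTn : T.Nonempty := ⟨1, by simp [hT]⟩
  have hdata : ∀ (c : ClassGroup (𝓞 F)) (p : ℕ), ∃ (θ : 𝓞 F) (b : Ideal (𝓞 F)), c ∈ T → p ∈ P →
      b ≠ ⊥ ∧ Ideal.span {θ} = (b * h.idl p (r p)) ^ 3 ∧
      (∃ J : nonZeroDivisors (Ideal (𝓞 F)), (J : Ideal (𝓞 F)) = b * h.idl p (r p) ∧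
        c * ClassGroup.mk0 J = 1) ∧
      (Ideal.absNorm b : ℝ) ≤ E ∧ ∀ φ : F →+* ℂ, ‖φ θ‖ ^ 2 ≤ (E * p) ^ 3 := by
    intro c p
    by_cases hcp : c ∈ T ∧ p ∈ P
    · obtain ⟨hc, hp⟩ := hcp
      have hsp := hr p hp
      obtain ⟨I, rfl⟩ := ClassGroup.mk0_surjective c
      have hI3 : ClassGroup.mk0 (I ^ 3) = 1 := by
        rw [map_pow]; exact (Finset.mem_filter.1 hc).2
      obtain ⟨α, hα⟩ := exists_eq_span_of_mk0_eq_one hI3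
      have hI0 : (I : Ideal (𝓞 F)) ≠ ⊥ := nonZeroDivisors.coe_ne_zero I
      obtain ⟨θ, b, hb, hθ, ⟨β, hβ⟩, hbn, hφ⟩ :=
        h.exists_small_generator hI0 (h.idl_ne_bot hsp) hα
      rw [h.absNorm_idl hsp.prime hsp.ne_two hsp.dvd hsp.not_dvd] at hφ
      refine ⟨θ, b, fun _ _ ↦ ⟨hb, hθ, ⟨⟨b * h.idl p (r p), ?_⟩, rfl, ?_⟩, hbn, hφ⟩⟩
      · exact mem_nonZeroDivisors_iff_ne_zero.2 (mul_ne_zero hb (h.idl_ne_bot hsp))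
      · rw [← map_mul]
        exact mk0_eq_one_of_eq_span hβ
    · exact ⟨0, ⊥, fun hc hp ↦ absurd ⟨hc, hp⟩ hcp⟩
  choose θ b hdata using hdata
  set ρ : ClassGroup (𝓞 F) → ℕ → ℝ := fun c p ↦ ‖φ (θ c p)‖ ^ 2 / p ^ 3 with hρ
  have hρb : ∀ c ∈ T, ∀ p ∈ P, 0 < ρ c p ∧ |Real.log (ρ c p)| ≤ m := by
    intro c hc p hp
    obtain ⟨hb, hθ, -, hbn, hφ⟩ := hdata c p hc hp
    exact h.abs_log_le φ (hr p hp) hEp hm hb hθ hφ rfl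
  set bin : ClassGroup (𝓞 F) → ℕ → Ideal (𝓞 F) × ℤ := fun c p ↦ (b c p, ⌊Real.log (ρ c p)⌋) with hbin
  obtain ⟨c, hc, G, hGP, hGc, hG⟩ := exists_row_of_few_bins T hTn P
    (idealsLE F ⌊E⌋₊ ×ˢ Finset.Icc (-(m : ℤ)) m) bin (by
      intro c hc p hp
      obtain ⟨hb, hθ, -, hbn, hφ⟩ := hdata c p hc hp
      have h1 := (hρb c hc p hp).2
      rw [abs_le] at h1
      rw [Finset.mem_product, mem_idealsLE, Finset.mem_Icc]
      refine ⟨⟨hb, Nat.le_floor hbn⟩, ?_, ?_⟩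
      · rw [Int.le_floor]; push_cast; exact h1.1
      · have := (Int.floor_le (Real.log (ρ c p))).trans h1.2
        exact_mod_cast this) (by
      intro p hp c hc c' hc' hcc
      have h1 : b c p = b c' p := congrArg Prod.fst hcc
      obtain ⟨-, -, ⟨J, hJ, hcJ⟩, -⟩ := hdata c p hc hp
      obtain ⟨-, -, ⟨J', hJ', hcJ'⟩, -⟩ := hdata c' p hc' hp
      have h2 : J = J' := Subtype.ext (by rw [hJ, hJ', h1])
      rw [← h2] at hcJ'
      exact mul_right_cancel (hcJ.trans hcJ'.symm)) (by
      rw [Finset.card_product, Int.card_Icc]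
      have h1 : (m + 1 - -(m : ℤ)).toNat = 2 * m + 1 := by omega
      rw [h1]
      exact hcard)
  refine ⟨G, hGP, hGc, ?_⟩
  intro p hp
  have hpP := hGP hp
  obtain ⟨c₂, hc₂, c₃, hc₃, q, hq, r', hr', hpq, hpr, hqr, hb2, hb3⟩ := hG p hp
  refine ⟨q, hq, r', hr', hpq, hpr, hqr, ?_⟩
  set cc : Fin 3 → ClassGroup (𝓞 F) := ![c, c₂, c₃] with hcc
  set pp : Fin 3 → ℕ := ![p, q, r'] with hpp
  have hccT : ∀ i, cc i ∈ T := by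
    intro i; fin_cases i <;> simp [hcc, hc, hc₂, hc₃]
  have hppP : ∀ i, pp i ∈ P := by
    intro i; fin_cases i <;> simp [hpp, hpP, hq, hr']
  have hbb : ∀ i, bin (cc i) (pp i) = bin c p := by
    intro i; fin_cases i
    · rfl
    · exact hb2
    · exact hb3
  refine h.tripleRel φ (b := b c p) (p := pp) (r := fun i ↦ r (pp i))
    (θ := fun i ↦ θ (cc i) (pp i)) (hdata c p hc hpP).1 ?_ (fun i ↦ hr _ (hppP i)) ?_ ?_
  · intro i j hij
    fin_cases i <;> fin_cases j <;>
      first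
      | rfl
      | exact absurd hij hpq
      | exact absurd hij hpr
      | exact absurd hij hqr
      | exact absurd hij hpq.symm
      | exact absurd hij hpr.symm
      | exact absurd hij hqr.symm
  · intro i
    have h1 : b (cc i) (pp i) = b c p := congrArg Prod.fst (hbb i)
    have := (hdata (cc i) (pp i) (hccT i) (hppP i)).2.1
    rwa [h1] at this
  · intro i j
    have h1 : ⌊Real.log (ρ (cc i) (pp i))⌋ = ⌊Real.log (ρ (cc j) (pp j))⌋ :=
      congrArg Prod.snd ((hbb i).trans (hbb j).symm)
    have h2 := le_three_mul_of_floor_log_eq (hρb _ (hccT i) _ (hppP i)).1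
      (hρb _ (hccT j) _ (hppP j)).1 h1
    have hi : (0 : ℝ) < pp i := by exact_mod_cast (hr _ (hppP i)).prime.pos
    have hj : (0 : ℝ) < pp j := by exact_mod_cast (hr _ (hppP j)).prime.pos
    simp only [hρ] at h2
    rw [← mul_div_assoc, div_le_div_iff₀ (by positivity) (by positivity), mul_assoc] at h2
    exact h2

end

section

open NumberField

theorem card_divisors_le_rpow {ε : ℝ} (hε : 0 < ε) :
    ∃ C : ℝ, 1 ≤ C ∧ ∀ n : ℕ, n ≠ 0 → (n.divisors.card : ℝ) ≤ C * (n : ℝ) ^ ε := by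
  set L : ℕ := ⌈(2 : ℝ) ^ (1 / ε)⌉₊ with hL
  set c : ℝ := max 1 (1 / (ε * Real.log 2)) with hc
  have hc1 : 1 ≤ c := le_max_left _ _
  have hl2 : 0 < Real.log 2 := Real.log_pos (by norm_num)
  have hc2 : 1 ≤ c * (ε * Real.log 2) := by
    calc (1 : ℝ) = 1 / (ε * Real.log 2) * (ε * Real.log 2) := by field_simp
      _ ≤ _ := by gcongr; exact le_max_right _ _
  refine ⟨c ^ L, one_le_pow₀ hc1, fun n hn ↦ ?_⟩
  rw [Nat.card_divisors hn]
  push_cast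
  have hterm : ∀ p ∈ n.primeFactors, ((n.factorization p : ℝ) + 1) ≤
      (if p < L then c else 1) * ((p ^ n.factorization p : ℕ) : ℝ) ^ ε := by
    intro p hp
    have hpp := Nat.prime_of_mem_primeFactors hp
    set a := n.factorization p
    have h2p : (2 : ℝ) ≤ p := by exact_mod_cast hpp.two_le
    have e1 : ((p ^ a : ℕ) : ℝ) ^ ε = (((p : ℝ)) ^ ε) ^ a := by
      push_cast
      rw [← Real.rpow_natCast, ← Real.rpow_mul (by positivity), mul_comm, Real.rpow_mul (by positivity),
        Real.rpow_natCast]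
    rw [e1]
    split_ifs with hpL
    · have h1 : 1 + ε * Real.log 2 ≤ (p : ℝ) ^ ε := by
        calc 1 + ε * Real.log 2 ≤ Real.exp (ε * Real.log 2) := by
              have := Real.add_one_le_exp (ε * Real.log 2); linarith
          _ = (2 : ℝ) ^ ε := by rw [Real.rpow_def_of_pos (by norm_num), mul_comm]
          _ ≤ _ := Real.rpow_le_rpow (by norm_num) h2p hε.le
      have h2 : 1 + (a : ℝ) * (ε * Real.log 2) ≤ ((p : ℝ) ^ ε) ^ a :=
        (one_add_mul_le_pow (by nlinarith [mul_pos hε hl2]) a).trans (by gcongr)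
      calc (a : ℝ) + 1 ≤ c * (1 + (a : ℝ) * (ε * Real.log 2)) := by
            nlinarith [Nat.cast_nonneg (α := ℝ) a]
        _ ≤ _ := by gcongr
    · have h1 : (2 : ℝ) ≤ (p : ℝ) ^ ε := by
        have h3 : (2 : ℝ) ^ (1 / ε) ≤ p := (Nat.le_ceil _).trans (by exact_mod_cast not_lt.1 hpL)
        calc (2 : ℝ) = ((2 : ℝ) ^ (1 / ε)) ^ ε := by
              rw [← Real.rpow_mul (by norm_num), one_div_mul_cancel hε.ne', Real.rpow_one]
          _ ≤ _ := Real.rpow_le_rpow (by positivity) h3 hε.le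
      rw [one_mul]
      calc (a : ℝ) + 1 ≤ 2 ^ a := by exact_mod_cast Nat.lt_two_pow_self
        _ ≤ _ := by gcongr
  calc ∏ p ∈ n.primeFactors, ((n.factorization p : ℝ) + 1)
      ≤ ∏ p ∈ n.primeFactors, ((if p < L then c else 1) *
          ((p ^ n.factorization p : ℕ) : ℝ) ^ ε) :=
        Finset.prod_le_prod (fun p _ ↦ by positivity) hterm
    _ = (∏ p ∈ n.primeFactors, if p < L then c else 1) * (n : ℝ) ^ ε := by
        rw [Finset.prod_mul_distrib]
        congr 1
        rw [Real.finsetProd_rpow _ _ fun p _ ↦ by positivity]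
        congr 1
        have := Nat.prod_factorization_pow_eq_self hn
        rw [Finsupp.prod, Nat.support_factorization] at this
        exact_mod_cast this
    _ ≤ _ := by
        gcongr
        rw [← Finset.prod_filter, Finset.prod_const]
        apply pow_le_pow_right₀ hc1
        calc _ ≤ (Finset.range L).card := Finset.card_le_card fun p hp ↦ by
              simpa using (Finset.mem_filter.1 hp).2
          _ = L := by simp

theorem card_idealsLE_le {F : Type*} [Field F] [NumberField F] (h2 : Module.finrank ℚ F = 2)
    (n T : ℕ) (hT : ∀ k ∈ Finset.Icc 1 n, k.divisors.card ≤ T) : (idealsLE F n).card ≤ n * T := by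
  classical
  obtain ⟨f, hf, hf'⟩ := exists_pair_encoding (F := F) h2
  calc (idealsLE F n).card ≤ ((Finset.Icc 1 n).biUnion fun k ↦ k.divisorsAntidiagonal).card := by
        refine Finset.card_le_card_of_injOn f ?_ ?_
        · intro I hI
          have hI := mem_idealsLE.1 (Finset.mem_coe.1 hI)
          simp only [Finset.coe_biUnion, Set.mem_iUnion, Finset.mem_coe, Nat.mem_divisorsAntidiagonal,
            Finset.mem_Icc]
          have hn : Ideal.absNorm I ≠ 0 := by rw [Ne, Ideal.absNorm_eq_zero_iff]; exact hI.1
          exact ⟨Ideal.absNorm I, ⟨Nat.one_le_iff_ne_zero.2 hn, hI.2⟩, (hf' I hI.1).1, hn⟩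
        · exact hf.mono fun I hI ↦ (mem_idealsLE.1 (Finset.mem_coe.1 hI)).1
    _ ≤ ∑ k ∈ Finset.Icc 1 n, k.divisorsAntidiagonal.card := Finset.card_biUnion_le
    _ = ∑ k ∈ Finset.Icc 1 n, k.divisors.card := by
        refine Finset.sum_congr rfl fun k _ ↦ ?_
        rw [← Nat.map_div_right_divisors, Finset.card_map]
    _ ≤ ∑ k ∈ Finset.Icc 1 n, T := Finset.sum_le_sum hT
    _ = n * T := by simp

end

section

/-- The nontrivial Dirichlet character modulo `3`, as an arithmetic function. -/
def charThree : ArithmeticFunction ℝ where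
  toFun n := if n % 3 = 1 then 1 else if n % 3 = 2 then -1 else 0
  map_zero' := by rw [Nat.zero_mod, if_neg zero_ne_one, if_neg (by norm_num)]

theorem charThree_apply (n : ℕ) :
    charThree n = if n % 3 = 1 then 1 else if n % 3 = 2 then -1 else 0 := rfl

theorem charThree_mul (m n : ℕ) : charThree (m * n) = charThree m * charThree n := by
  rw [charThree_apply, charThree_apply, charThree_apply, Nat.mul_mod]
  have hm := Nat.mod_lt m (show 3 > 0 by norm_num)
  have hn := Nat.mod_lt n (show 3 > 0 by norm_num)
  generalize m % 3 = a at *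
  generalize n % 3 = b at *
  interval_cases a <;> interval_cases b <;> simp

theorem sum_charThree (n : ℕ) :
    ∑ m ∈ Finset.Ioc 0 n, charThree m = if n % 3 = 1 then 1 else 0 := by
  induction n with
  | zero => simp
  | succ n ih =>
    rw [Finset.sum_Ioc_succ_top (Nat.zero_le n), ih, charThree_apply]
    have hn := Nat.mod_lt n (show 3 > 0 by norm_num)
    rw [Nat.add_mod]
    generalize n % 3 = a at *
    interval_cases a <;> norm_num

theorem sum_charThree_mul_log_le (n : ℕ) :
    ∑ m ∈ Finset.Ioc 0 n, charThree m * Real.log m ≤ if n % 3 = 1 then Real.log n else 0 := by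
  induction n with
  | zero => simp
  | succ n ih =>
    rw [Finset.sum_Ioc_succ_top (Nat.zero_le n), charThree_apply]
    have hn := Nat.mod_lt n (show 3 > 0 by norm_num)
    have hlog : Real.log n ≤ Real.log ((n + 1 : ℕ) : ℝ) := by
      rcases Nat.eq_zero_or_pos n with rfl | h0
      · simp
      · exact Real.log_le_log (by exact_mod_cast h0) (by push_cast; linarith)
    rw [Nat.add_mod]
    generalize n % 3 = a at *
    interval_cases a <;> norm_num at ih hlog ⊢ <;> linarith

/-- The contribution of the residue class `2` modulo `3` to the Chebyshev function. -/
theorem psi_sub_psi_half_le (n : ℕ) :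
    Chebyshev.psi n - Chebyshev.psi (n / 2 : ℕ) - 2 * Real.log n ≤
      2 * ∑ m ∈ (Finset.Ioc 0 n).filter (· % 3 = 2), ArithmeticFunction.vonMangoldt m := by
  rcases Nat.eq_zero_or_pos n with rfl | hn0
  · simp
  set Λ := ArithmeticFunction.vonMangoldt
  have hΛ : ∀ m, 0 ≤ Λ m := fun m ↦ ArithmeticFunction.vonMangoldt_nonneg
  have hmul : ∀ m, (ArithmeticFunction.pmul charThree Λ * charThree) m
      = charThree m * Real.log m := by
    intro m
    rw [ArithmeticFunction.mul_apply, ← ArithmeticFunction.vonMangoldt_sum, Finset.mul_sum,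
      ← Nat.sum_divisorsAntidiagonal (fun i _ ↦ charThree m * Λ i)]
    refine Finset.sum_congr rfl fun x hx ↦ ?_
    rw [← (Nat.mem_divisorsAntidiagonal.mp hx).1, charThree_mul, ArithmeticFunction.pmul_apply]
    ring
  have key := sum_charThree_mul_log_le n
  simp_rw [← hmul] at key
  rw [ArithmeticFunction.sum_Ioc_mul_eq_sum_sum] at key
  simp_rw [sum_charThree, ArithmeticFunction.pmul_apply] at key
  have hlog : (if n % 3 = 1 then Real.log n else 0) ≤ Real.log n := by
    split_ifs
    · exact le_rfl
    · exact Real.log_natCast_nonneg n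
  have hpsi : Chebyshev.psi n - Chebyshev.psi (n / 2 : ℕ) = ∑ m ∈ Finset.Ioc (n / 2) n, Λ m := by
    rw [Chebyshev.psi, Chebyshev.psi, Nat.floor_natCast, Nat.floor_natCast, sub_eq_iff_eq_add',
      Finset.sum_Ioc_consecutive _ (Nat.zero_le _) (Nat.div_le_self _ _)]
  have hthree : ∑ m ∈ (Finset.Ioc (n / 2) n).filter (· % 3 = 0), Λ m ≤ Real.log n := by
    by_cases hex : ∃ m ∈ (Finset.Ioc (n / 2) n).filter (· % 3 = 0), Λ m ≠ 0
    · obtain ⟨m, hm, hm0⟩ := hex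
      have hpow : ∀ j ∈ (Finset.Ioc (n / 2) n).filter (· % 3 = 0), Λ j ≠ 0 → ∃ k, j = 3 ^ k := by
        intro j hj hj0
        obtain ⟨p, k, hp, hk, rfl⟩ := ArithmeticFunction.vonMangoldt_ne_zero_iff.mp hj0
        refine ⟨k, ?_⟩
        have h3 : 3 ∣ p ^ k := Nat.dvd_of_mod_eq_zero (Finset.mem_filter.mp hj).2
        rw [(Nat.prime_dvd_prime_iff_eq Nat.prime_three hp.nat_prime).mp
          (Nat.prime_three.dvd_of_dvd_pow h3)]
      rw [Finset.sum_eq_single_of_mem m hm]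
      · refine (ArithmeticFunction.vonMangoldt_le_log).trans (Real.log_le_log ?_ ?_)
        · have := (Finset.mem_Ioc.mp (Finset.mem_filter.mp hm).1).1
          exact_mod_cast by omega
        · exact_mod_cast (Finset.mem_Ioc.mp (Finset.mem_filter.mp hm).1).2
      · intro j hj hjm
        by_contra hj0
        obtain ⟨k, rfl⟩ := hpow j hj hj0
        obtain ⟨l, rfl⟩ := hpow m hm hm0
        have h1 := Finset.mem_Ioc.mp (Finset.mem_filter.mp hj).1
        have h2 := Finset.mem_Ioc.mp (Finset.mem_filter.mp hm).1
        rcases lt_trichotomy k l with h | h | h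
        · have := Nat.pow_le_pow_right (show 3 > 0 by norm_num) (Nat.succ_le_of_lt h)
          rw [pow_succ] at this
          omega
        · exact hjm (by rw [h])
        · have := Nat.pow_le_pow_right (show 3 > 0 by norm_num) (Nat.succ_le_of_lt h)
          rw [pow_succ] at this
          omega
    · push Not at hex
      rw [Finset.sum_eq_zero hex]
      exact Real.log_natCast_nonneg n
  have hterm : ∑ m ∈ Finset.Ioc 0 n, (if m ∈ Finset.Ioc (n / 2) n then
      (if m % 3 = 0 then 0 else Λ m) else 0) ≤
      ∑ m ∈ Finset.Ioc 0 n, (2 * (if m % 3 = 2 then Λ m else 0) +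
        charThree m * Λ m * (if n / m % 3 = 1 then 1 else 0)) := by
    refine Finset.sum_le_sum fun m hm ↦ ?_
    have hm3 := Nat.mod_lt m (show 3 > 0 by norm_num)
    by_cases hmem : m ∈ Finset.Ioc (n / 2) n
    · have h1 : n / m = 1 := by
        rw [Finset.mem_Ioc] at hmem
        exact Nat.div_eq_of_lt_le (by omega) (by omega)
      rw [if_pos hmem, h1, charThree_apply]
      generalize m % 3 = a at *
      interval_cases a <;> norm_num
      linarith
    · rw [if_neg hmem, charThree_apply]
      have := hΛ m
      generalize m % 3 = a at *
      interval_cases a <;> split_ifs <;> norm_num <;> linarith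
  rw [Finset.sum_add_distrib, ← Finset.mul_sum, ← Finset.sum_filter] at hterm
  have hfil : (Finset.Ioc 0 n).filter (· ∈ Finset.Ioc (n / 2) n) = Finset.Ioc (n / 2) n := by
    ext m
    simp only [Finset.mem_filter, Finset.mem_Ioc]
    omega
  rw [hfil] at hterm
  rw [Finset.sum_filter]
  have hsplit : ∑ m ∈ Finset.Ioc (n / 2) n, Λ m =
      ∑ m ∈ (Finset.Ioc (n / 2) n).filter (· % 3 = 0), Λ m +
      ∑ m ∈ Finset.Ioc (n / 2) n, (if m % 3 = 0 then 0 else Λ m) := by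
    rw [Finset.sum_filter, ← Finset.sum_add_distrib]
    exact Finset.sum_congr rfl fun m _ ↦ by split_ifs <;> simp
  linarith

/-- Primes congruent to `2` modulo `3` up to `n`. -/
def primesTwoModThree (n : ℕ) : Finset ℕ := (Finset.Ioc 0 n).filter fun p ↦ p.Prime ∧ p % 3 = 2

theorem sum_vonMangoldt_le (n : ℕ) (hn : 1 ≤ n) :
    ∑ m ∈ (Finset.Ioc 0 n).filter (· % 3 = 2), ArithmeticFunction.vonMangoldt m ≤
      ((primesTwoModThree n).card + 2 * √(n : ℝ)) * Real.log n := by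
  set Λ := ArithmeticFunction.vonMangoldt
  have h1 := Chebyshev.psi_sub_theta_le (x := n) (by exact_mod_cast hn)
  rw [Chebyshev.psi_sub_theta_eq_sum_not_prime, Nat.floor_natCast] at h1
  have h2 : ∑ m ∈ primesTwoModThree n, Λ m ≤ (primesTwoModThree n).card * Real.log n := by
    rw [← nsmul_eq_mul]
    refine Finset.sum_le_card_nsmul _ _ _ fun p hp ↦ ?_
    rw [primesTwoModThree, Finset.mem_filter, Finset.mem_Ioc] at hp
    exact (ArithmeticFunction.vonMangoldt_le_log).trans
      (Real.log_le_log (by exact_mod_cast hp.1.1) (by exact_mod_cast hp.1.2))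
  have h3 : ∑ m ∈ (Finset.Ioc 0 n).filter (· % 3 = 2), Λ m ≤
      ∑ m ∈ primesTwoModThree n, Λ m + ∑ m ∈ (Finset.Ioc 0 n).filter (¬ Nat.Prime ·), Λ m := by
    rw [primesTwoModThree, Finset.sum_filter, Finset.sum_filter, Finset.sum_filter,
      ← Finset.sum_add_distrib]
    refine Finset.sum_le_sum fun m _ ↦ ?_
    have : 0 ≤ Λ m := ArithmeticFunction.vonMangoldt_nonneg
    split_ifs <;> simp_all
  linarith [h1]

theorem psi_le_of_halving (n : ℕ) (c : ℝ) (k : ℕ) (hn : n < 2 ^ k)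
    (h : ∀ m ≤ n, Chebyshev.psi m - Chebyshev.psi (m / 2 : ℕ) ≤ c) : Chebyshev.psi n ≤ k * c := by
  induction k generalizing n with
  | zero =>
    have : n = 0 := by simpa using hn
    simp [this]
  | succ k ih =>
    have := ih (n / 2) (by rw [pow_succ] at hn; omega) fun m hm ↦ h m (hm.trans (Nat.div_le_self _ _))
    have := h n le_rfl
    push_cast
    linarith

theorem primesTwoModThree_mono {m n : ℕ} (h : m ≤ n) :
    primesTwoModThree m ⊆ primesTwoModThree n := by
  intro p
  simp only [primesTwoModThree, Finset.mem_filter, Finset.mem_Ioc]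
  exact fun hp ↦ ⟨⟨hp.1.1, hp.1.2.trans h⟩, hp.2⟩

theorem psi_le_card_primesTwoModThree (n : ℕ) (hn : 1 ≤ n) :
    Chebyshev.psi n ≤ (Nat.log 2 n + 1) *
      ((2 * ((primesTwoModThree n).card + 2 * √(n : ℝ)) + 2) * Real.log n) := by
  have := psi_le_of_halving n ((2 * ((primesTwoModThree n).card + 2 * √(n : ℝ)) + 2) * Real.log n)
    (Nat.log 2 n + 1) (Nat.lt_pow_succ_log_self (by norm_num) n) ?_
  · exact_mod_cast this
  intro m hm
  rcases Nat.eq_zero_or_pos m with rfl | hm0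
  · simp only [CharP.cast_eq_zero, Nat.zero_div, sub_self]
    have := Real.log_natCast_nonneg n
    positivity
  have h1 := psi_sub_psi_half_le m
  have h2 := sum_vonMangoldt_le m hm0
  have h3 : Real.log m ≤ Real.log n :=
    Real.log_le_log (by exact_mod_cast hm0) (by exact_mod_cast hm)
  have h4 : ((primesTwoModThree m).card : ℝ) ≤ (primesTwoModThree n).card := by
    exact_mod_cast Finset.card_le_card (primesTwoModThree_mono hm)
  have h5 : √(m : ℝ) ≤ √(n : ℝ) := Real.sqrt_le_sqrt (by exact_mod_cast hm)
  have h6 : ((primesTwoModThree m).card + 2 * √(m : ℝ)) * Real.log m ≤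
      ((primesTwoModThree n).card + 2 * √(n : ℝ)) * Real.log n := by
    have := Real.log_natCast_nonneg m
    gcongr
  linarith

theorem eventually_rpow_le_card_primesTwoModThree {δ : ℝ} (hδ : 0 < δ) :
    ∀ᶠ n : ℕ in Filter.atTop, (n : ℝ) ^ (1 - δ) ≤ (primesTwoModThree n).card := by
  wlog hδ2 : δ ≤ 1 / 2 generalizing δ
  · filter_upwards [this (δ := 1 / 2) (by norm_num) le_rfl, Filter.eventually_ge_atTop 1]
      with n hn h1
    exact (Real.rpow_le_rpow_of_exponent_le (by exact_mod_cast h1) (by linarith)).trans hn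
  have hlog : ∀ᶠ n : ℕ in Filter.atTop, Real.log n ≤ (n : ℝ) ^ (δ / 4) := by
    have h := (isLittleO_log_rpow_atTop (show 0 < δ / 4 by positivity)).bound one_pos
    filter_upwards [tendsto_natCast_atTop_atTop.eventually h] with n hn
    rw [one_mul, Real.norm_of_nonneg (Real.log_natCast_nonneg n),
      Real.norm_of_nonneg (by positivity)] at hn
    exact hn
  have hbig : ∀ᶠ n : ℕ in Filter.atTop, (52 : ℝ) < (n : ℝ) ^ (δ / 2) :=
    ((tendsto_rpow_atTop (show 0 < δ / 2 by positivity)).comp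
      tendsto_natCast_atTop_atTop).eventually_gt_atTop 52
  filter_upwards [hlog, hbig, Filter.eventually_ge_atTop 3] with n hlog hbig hn3
  by_contra! hlt
  have hn1 : (1 : ℝ) ≤ n := by exact_mod_cast (by omega : 1 ≤ n)
  have hn0 : (0 : ℝ) < n := by linarith
  have hlog2 := Real.log_two_gt_d9
  have hlogn : 1 ≤ Real.log n := by
    rw [Real.le_log_iff_exp_le hn0]
    have : (3 : ℝ) ≤ n := by exact_mod_cast hn3
    linarith [Real.exp_one_lt_d9]
  set E := (n : ℝ) ^ (1 - δ)
  have hsqrt : √(n : ℝ) ≤ E := by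
    rw [Real.sqrt_eq_rpow]
    exact Real.rpow_le_rpow_of_exponent_le hn1 (by linarith)
  have hE1 : 1 ≤ E := Real.one_le_rpow hn1 (by linarith)
  have hnl : (Nat.log 2 n : ℝ) + 1 ≤ 3 * Real.log n := by
    have h := Real.natLog_le_logb n 2
    rw [Real.logb, le_div_iff₀ (by positivity)] at h
    push_cast at h
    nlinarith
  have hub : Chebyshev.psi n ≤ 24 * (n : ℝ) ^ (1 - δ / 2) := by
    calc Chebyshev.psi n ≤ _ := psi_le_card_primesTwoModThree n (by omega)
      _ ≤ (3 * (n : ℝ) ^ (δ / 4)) * ((8 * E) * (n : ℝ) ^ (δ / 4)) := by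
        have hr : Real.log n ≤ (n : ℝ) ^ (δ / 4) := hlog
        have hX : (Nat.log 2 n : ℝ) + 1 ≤ 3 * (n : ℝ) ^ (δ / 4) := by linarith
        have hY : 2 * ((primesTwoModThree n).card + 2 * √(n : ℝ)) + 2 ≤ 8 * E := by linarith
        gcongr
      _ = 24 * (E * ((n : ℝ) ^ (δ / 4) * (n : ℝ) ^ (δ / 4))) := by ring
      _ = _ := by
        rw [← Real.rpow_add hn0, ← Real.rpow_add hn0]
        congr 2
        ring
  have hlb := Chebyshev.psi_ge n
  have hl : Real.log (n + 1) ≤ 2 * (n : ℝ) ^ (1 - δ / 2) := by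
    have h1 : Real.log ((n : ℝ) + 1) ≤ 2 * Real.log n := by
      have : Real.log ((n : ℝ) ^ 2) = 2 * Real.log n := by rw [Real.log_pow]; norm_num
      rw [← this]
      have : (3 : ℝ) ≤ n := by exact_mod_cast hn3
      exact Real.log_le_log (by positivity) (by nlinarith)
    have h2 : (n : ℝ) ^ (δ / 4) ≤ (n : ℝ) ^ (1 - δ / 2) :=
      Real.rpow_le_rpow_of_exponent_le hn1 (by linarith)
    linarith
  have hpr : (n : ℝ) ^ (1 - δ / 2) * (n : ℝ) ^ (δ / 2) = n := by
    rw [← Real.rpow_add hn0]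
    simp
  have : 0 < (n : ℝ) ^ (1 - δ / 2) := by positivity
  nlinarith

end

section

theorem card_le_of_forall_dvd_sub (S : Finset ℤ) (m L : ℕ) (hm : 0 < m)
    (hL : ∀ x ∈ S, ∀ y ∈ S, x - y ≤ L) (h : ∀ x ∈ S, ∀ y ∈ S, (m : ℤ) ∣ x - y) :
    S.card ≤ L / m + 1 := by
  rcases S.eq_empty_or_nonempty with rfl | hS
  · simp
  set u := S.min' hS
  have hu := S.min'_mem hS
  rw [← Finset.card_range (L / m + 1)]
  refine Finset.card_le_card_of_injOn (fun x ↦ ((x - u) / m).toNat) (fun x hx ↦ ?_) ?_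
  · rw [Finset.coe_range, Set.mem_Iio, Nat.lt_succ_iff]
    have h1 : (x - u) / m ≤ (L : ℤ) / m := Int.ediv_le_ediv (by exact_mod_cast hm) (hL x hx u hu)
    rw [← Int.natCast_div] at h1
    have h2 : (0 : ℤ) ≤ (L / m : ℕ) := by positivity
    simp only
    omega
  · intro x hx y hy hxy
    have hm' : (0 : ℤ) < m := by exact_mod_cast hm
    have hx0 : 0 ≤ (x - u) / m := Int.ediv_nonneg (by linarith [S.min'_le x hx]) hm'.le
    have hy0 : 0 ≤ (y - u) / m := Int.ediv_nonneg (by linarith [S.min'_le y hy]) hm'.le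
    have h1 : (x - u) / m = (y - u) / m := by
      simp only at hxy
      omega
    have h2 := Int.ediv_mul_cancel (h x hx u hu)
    have h3 := Int.ediv_mul_cancel (h y hy u hu)
    rw [h1] at h2
    linarith

theorem exists_cofactor_gcd {m : ℕ} (hm : 0 < m) (t : ℤ) :
    ∃ h : ℕ, m = Int.gcd m t * h ∧ ∀ w : ℤ, (m : ℤ) ∣ t * w → (h : ℤ) ∣ w := by
  have hg : 0 < Int.gcd m t := Int.gcd_pos_of_ne_zero_left _ (by exact_mod_cast hm.ne')
  obtain ⟨h, hh⟩ := Int.natCast_dvd_natCast.mp (Int.gcd_dvd_left (m : ℤ) t)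
  refine ⟨h, hh, fun w hw ↦ ?_⟩
  obtain ⟨a, ha⟩ := Int.gcd_dvd_right (m : ℤ) t
  have hb := Int.gcd_eq_gcd_ab m t
  have hg' : (Int.gcd m t : ℤ) ≠ 0 := by exact_mod_cast hg.ne'
  have hmz : (m : ℤ) = Int.gcd m t * h := by exact_mod_cast hh
  obtain ⟨c, hc⟩ := hw
  refine ⟨w * Int.gcdA m t + c * Int.gcdB m t, mul_left_cancel₀ hg' ?_⟩
  calc (Int.gcd m t : ℤ) * w = (m * Int.gcdA m t + t * Int.gcdB m t) * w := by rw [← hb]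
    _ = m * (w * Int.gcdA m t) + (t * w) * Int.gcdB m t := by ring
    _ = m * (w * Int.gcdA m t + c * Int.gcdB m t) := by rw [hc]; ring
    _ = _ := by rw [← mul_assoc, ← hmz]

theorem card_le_of_forall_dvd_mul (S : Finset ℤ) (g h κ κ' L : ℕ) (t : ℤ) (hg0 : 0 < g)
    (hh0 : 0 < h) (hκ0 : 0 < κ) (hκ0' : 0 < κ') (hL : ∀ x ∈ S, ∀ y ∈ S, x - y ≤ L)
    (hg : ∀ x ∈ S, ∀ y ∈ S, (g : ℤ) ∣ x - y)
    (hh : ∀ x ∈ S, ∀ y ∈ S, (h : ℤ) ∣ (x - y) * (x + y + t))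
    (hκ : ∀ x ∈ S, ∀ y ∈ S, ∀ e : ℕ, e ∣ h → (e : ℤ) ∣ x - y → (e : ℤ) ∣ x + y + t → e ∣ κ)
    (hκ' : Nat.gcd g h ∣ κ') :
    S.card ≤ (κ * κ' * L / (g * h) + 1) * h.divisors.card := by
  rcases S.eq_empty_or_nonempty with rfl | ⟨x₀, hx₀⟩
  · simp
  refine Finset.card_le_mul_card_image_of_maps_to (f := fun x ↦ Int.gcd h (x - x₀))
    (fun x _ ↦ Nat.mem_divisors.mpr ⟨?_, hh0.ne'⟩) _ fun r hr ↦ ?_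
  · exact Int.natCast_dvd_natCast.mp (Int.gcd_dvd_left _ _)
  rcases ({x ∈ S | Int.gcd h (x - x₀) = r}).eq_empty_or_nonempty with he | ⟨x₁, hx₁⟩
  · simp [he]
  obtain ⟨k, hk, -⟩ := exists_cofactor_gcd hh0 (x₁ - x₀)
  have hr1 := (Finset.mem_filter.mp hx₁).2
  rw [hr1] at hk
  have hr0 : 0 < r := Nat.pos_of_ne_zero fun h0 ↦ by simp [h0] at hk; omega
  have hk0 : 0 < k := Nat.pos_of_ne_zero fun h0 ↦ by simp [h0] at hk; omega
  have hmem : ∀ x ∈ {x ∈ S | Int.gcd h (x - x₀) = r}, x ∈ S ∧ (r : ℤ) ∣ x - x₀ ∧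
      (k : ℤ) ∣ x + x₀ + t := by
    intro x hx
    obtain ⟨hxS, hxr⟩ := Finset.mem_filter.mp hx
    obtain ⟨k', hk', hw⟩ := exists_cofactor_gcd hh0 (x - x₀)
    rw [hxr] at hk'
    have : k = k' := Nat.eq_of_mul_eq_mul_left hr0 (hk.symm.trans hk')
    rw [this]
    exact ⟨hxS, hxr ▸ Int.gcd_dvd_right _ _, hw _ (hh x hxS x₀ hx₀)⟩
  set l := Nat.lcm r k
  have hl : h ≤ l * κ := by
    have h1 : Nat.gcd r k ≤ κ := by
      obtain ⟨h1, h2, h3⟩ := hmem x₁ hx₁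
      exact Nat.le_of_dvd hκ0 (hκ x₁ h1 x₀ hx₀ _
        ((Nat.gcd_dvd_left r k).trans (Dvd.intro _ hk.symm))
        ((Int.natCast_dvd_natCast.mpr (Nat.gcd_dvd_left r k)).trans h2)
        ((Int.natCast_dvd_natCast.mpr (Nat.gcd_dvd_right r k)).trans h3))
    rw [hk, ← Nat.gcd_mul_lcm, mul_comm]
    exact Nat.mul_le_mul_left _ h1
  have hlh : l ∣ h := Nat.lcm_dvd (Dvd.intro _ hk.symm) (Dvd.intro_left _ hk.symm)
  have hl0 : 0 < l := Nat.lcm_pos hr0 hk0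
  have hgl : g * l ≤ Nat.lcm g l * κ' := by
    rw [← Nat.gcd_mul_lcm, mul_comm]
    exact Nat.mul_le_mul_left _ (Nat.le_of_dvd hκ0' ((Nat.gcd_dvd_gcd_of_dvd_right g hlh).trans hκ'))
  have hpos : 0 < Nat.lcm g l := Nat.lcm_pos hg0 hl0
  refine (card_le_of_forall_dvd_sub _ (Nat.lcm g l) L hpos
    (fun x hx y hy ↦ hL x (hmem x hx).1 y (hmem y hy).1) fun x hx y hy ↦ ?_).trans ?_
  · exact Int.natCast_dvd.mpr (Nat.lcm_dvd (Int.natCast_dvd.mp (hg x (hmem x hx).1 y (hmem y hy).1))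
      (Nat.lcm_dvd (Int.natCast_dvd.mp (Int.dvd_of_eq_of_dvd (by ring)
        (dvd_sub (hmem x hx).2.1 (hmem y hy).2.1))) (Int.natCast_dvd.mp
        (Int.dvd_of_eq_of_dvd (by ring) (dvd_sub (hmem x hx).2.2 (hmem y hy).2.2)))))
  · refine Nat.add_le_add_right ?_ 1
    rw [Nat.le_div_iff_mul_le (by positivity)]
    calc L / Nat.lcm g l * (g * h) ≤ L / Nat.lcm g l * (g * (l * κ)) := by gcongr
      _ = L / Nat.lcm g l * (g * l) * κ := by ring
      _ ≤ L / Nat.lcm g l * (Nat.lcm g l * κ') * κ := by gcongr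
      _ = (L / Nat.lcm g l * Nat.lcm g l) * (κ' * κ) := by ring
      _ ≤ L * (κ' * κ) := by gcongr; exact Nat.div_mul_le_self _ _
      _ = κ * κ' * L := by ring

theorem card_sq_roots_le (S : Finset ℤ) (m κ L : ℕ) (hm : 0 < m) (hκ0 : 0 < κ)
    (hL : ∀ x ∈ S, ∀ y ∈ S, x - y ≤ L) (h : ∀ x ∈ S, ∀ y ∈ S, (m : ℤ) ∣ x ^ 2 - y ^ 2)
    (hκ : ∀ x ∈ S, ∀ e : ℕ, e ∣ m → (e : ℤ) ∣ 2 * x → e ∣ κ) :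
    S.card ≤ (κ * L / m + 1) * m.divisors.card := by
  have := card_le_of_forall_dvd_mul S 1 m κ 1 L 0 one_pos hm hκ0 one_pos hL (by simp)
    (fun x hx y hy ↦ Int.dvd_of_eq_of_dvd (by ring) (h x hx y hy))
    (fun x hx y hy e he h1 h2 ↦ hκ x hx e he (Int.dvd_of_eq_of_dvd (by ring) (dvd_add h1 h2)))
    (by simp)
  simpa using this

theorem card_cube_roots_le (S : Finset ℤ) (b L : ℕ) (hb : 0 < b)
    (hL : ∀ x ∈ S, ∀ y ∈ S, x - y ≤ L) (h : ∀ x ∈ S, ∀ y ∈ S, (b : ℤ) ∣ x ^ 3 - y ^ 3)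
    (hco : ∀ x ∈ S, IsCoprime x b) :
    S.card ≤ (9 * L / b + 1) * b.divisors.card ^ 2 := by
  rcases S.eq_empty_or_nonempty with rfl | ⟨x₀, hx₀⟩
  · simp
  have hthree : ∀ e : ℕ, e ∣ b → (e : ℤ) ∣ 3 * x₀ ^ 2 → e ∣ 3 := by
    intro e he h3
    have : IsCoprime (e : ℤ) (x₀ ^ 2) :=
      ((hco x₀ hx₀).of_isCoprime_of_dvd_right (Int.natCast_dvd_natCast.mpr he)).symm.pow_right
    exact_mod_cast this.dvd_of_dvd_mul_right h3
  rw [pow_two, ← mul_assoc]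
  refine Finset.card_le_mul_card_image_of_maps_to (f := fun x ↦ Int.gcd b (x - x₀))
    (fun x _ ↦ Nat.mem_divisors.mpr ⟨?_, hb.ne'⟩) _ fun r hr ↦ ?_
  · exact Int.natCast_dvd_natCast.mp (Int.gcd_dvd_left _ _)
  rcases ({x ∈ S | Int.gcd b (x - x₀) = r}).eq_empty_or_nonempty with he | ⟨x₁, hx₁⟩
  · simp [he]
  obtain ⟨k, hk, -⟩ := exists_cofactor_gcd hb (x₁ - x₀)
  rw [(Finset.mem_filter.mp hx₁).2] at hk
  have hr0 : 0 < r := Nat.pos_of_ne_zero fun h0 ↦ by simp [h0] at hk; omega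
  have hk0 : 0 < k := Nat.pos_of_ne_zero fun h0 ↦ by simp [h0] at hk; omega
  have hkb : k ∣ b := Dvd.intro_left _ hk.symm
  have hmem : ∀ x ∈ {x ∈ S | Int.gcd b (x - x₀) = r}, x ∈ S ∧ (r : ℤ) ∣ x - x₀ ∧
      (k : ℤ) ∣ x ^ 2 + x * x₀ + x₀ ^ 2 := by
    intro x hx
    obtain ⟨hxS, hxr⟩ := Finset.mem_filter.mp hx
    obtain ⟨k', hk', hw⟩ := exists_cofactor_gcd hb (x - x₀)
    rw [hxr] at hk'
    have : k = k' := Nat.eq_of_mul_eq_mul_left hr0 (hk.symm.trans hk')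
    rw [this]
    exact ⟨hxS, hxr ▸ Int.gcd_dvd_right _ _,
      hw _ (Int.dvd_of_eq_of_dvd (by ring) (h x hxS x₀ hx₀))⟩
  have hcard := card_le_of_forall_dvd_mul {x ∈ S | Int.gcd b (x - x₀) = r} r k 3 3 L x₀ hr0 hk0
    (by norm_num) (by norm_num) (fun x hx y hy ↦ hL x (hmem x hx).1 y (hmem y hy).1)
    (fun x hx y hy ↦ Int.dvd_of_eq_of_dvd (by ring) (dvd_sub (hmem x hx).2.1 (hmem y hy).2.1))
    (fun x hx y hy ↦ Int.dvd_of_eq_of_dvd (by ring) (dvd_sub (hmem x hx).2.2 (hmem y hy).2.2))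
    (fun x hx y hy e he h1 h2 ↦ ?_) ?_
  · rw [← hk] at hcard
    exact hcard.trans (Nat.mul_le_mul_left _ (Finset.card_le_card
      (Nat.divisors_subset_of_dvd hb.ne' hkb)))
  · refine hthree e (he.trans hkb) ?_
    have h3 := (Int.natCast_dvd_natCast.mpr he).trans (hmem x hx).2.2
    obtain ⟨u, hu⟩ := dvd_add h1 h2
    obtain ⟨v, hv⟩ := h3
    refine ⟨4 * v - u * (2 * x + x₀), ?_⟩
    linear_combination (2 * x + x₀) * hu + 4 * hv - 2 * (2 * x + x₀) * hu
  · obtain ⟨-, h2, h3⟩ := hmem x₁ hx₁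
    refine hthree _ ((Nat.gcd_dvd_right r k).trans hkb) ?_
    obtain ⟨u, hu⟩ := (Int.natCast_dvd_natCast.mpr (Nat.gcd_dvd_left r k)).trans h2
    obtain ⟨v, hv⟩ := (Int.natCast_dvd_natCast.mpr (Nat.gcd_dvd_right r k)).trans h3
    refine ⟨v - u * (x₁ + 2 * x₀), ?_⟩
    linear_combination hv - (x₁ + 2 * x₀) * hu

end

section

/-- The coefficients of a relation `TripleRel D p q r` are at most this bound when `Y ≤ |D|` and
the primes are at most `Z`. -/
def coeffBound (Y Z : ℕ) : ℕ := Nat.sqrt (12 * Z ^ 6 / Y)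

theorem natAbs_le_coeffBound {D a : ℤ} {p q Y Z : ℕ} (hY : 0 < Y) (hD : Y ≤ D.natAbs)
    (hp : p ≤ Z) (hq : q ≤ Z) (h : a ^ 2 * |D| ≤ 12 * ((p : ℤ) * q) ^ 3) :
    a.natAbs ≤ coeffBound Y Z := by
  rw [coeffBound, Nat.le_sqrt', Nat.le_div_iff_mul_le hY]
  have h1 : a.natAbs ^ 2 * D.natAbs ≤ 12 * (p * q) ^ 3 := by
    zify
    rwa [sq_abs]
  calc a.natAbs ^ 2 * Y ≤ a.natAbs ^ 2 * D.natAbs := by gcongr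
    _ ≤ 12 * (p * q) ^ 3 := h1
    _ ≤ 12 * (Z * Z) ^ 3 := by gcongr
    _ = 12 * Z ^ 6 := by ring

theorem natCast_mul_sub_le {x y V n z0 : ℤ} (hx0 : 0 ≤ x) (hy0 : 0 ≤ y) (hz : 0 ≤ z0)
    (hV : 0 ≤ V) (hn : z0 ^ 2 ≤ |n|) (hx : |x ^ 2 - 4 * n| ≤ V) (hy : |y ^ 2 - 4 * n| ≤ V) :
    (x - y) * z0 ≤ 2 * V := by
  rw [abs_le] at hx hy
  rcases le_or_gt x y with h | h
  · nlinarith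
  rcases le_or_gt z0 x with h1 | h1
  · nlinarith
  · rcases abs_cases n with ⟨hn', -⟩ | ⟨hn', -⟩ <;> nlinarith

theorem card_pairs_le {P : Finset ℕ} {Y Z Z₀ W T : ℕ} (hY : 0 < Y) (hZ₀ : 0 < Z₀)
    (hP : ∀ p ∈ P, p.Prime ∧ Z₀ ≤ p ∧ p ≤ Z) (Q : Finset (ℤ × ℕ))
    (hQ : ∀ x ∈ Q, x.2 ∈ P ∧ ∃ q ∈ P, ∃ r, TripleRel x.1 x.2 q r)
    (hD : ∀ x ∈ Q, Y ≤ x.1.natAbs ∧ x.1.natAbs ≤ W)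
    (hT : ∀ z ∈ Finset.Icc 1 (coeffBound Y Z), (z ^ 2).divisors.card ≤ T) :
    Q.card ≤ (32 * W / Z₀ ^ 3 + 1) * T * (P.card * (P.card * (2 * coeffBound Y Z))) := by
  have hdata : ∀ x ∈ Q, ∃ (q : ℕ) (e : ℤ) (z : ℕ) (y : ℤ), q ∈ P ∧ (e = 1 ∨ e = -1) ∧
      z ∈ Finset.Icc 1 (coeffBound Y Z) ∧ 0 ≤ y ∧
      y ^ 2 - x.1 * z ^ 2 = 4 * (e * (x.2 * q) ^ 3) ∧ Nat.Coprime z (x.2 * q) := by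
    intro x hx
    obtain ⟨hp, q, hq, r, e₁, e₂, e₃, a, b, c, y, h1, h2, -, ⟨hpa, -⟩, ⟨hqa, -⟩, -, -, h, ha, -⟩ :=
      hQ x hx
    have ha0 : a ≠ 0 := fun h0 ↦ hpa (h0 ▸ dvd_zero _)
    refine ⟨q, e₁ * e₂, a.natAbs, |y|, hq, ?_, Finset.mem_Icc.mpr ⟨Int.natAbs_pos.mpr ha0,
      natAbs_le_coeffBound hY (hD x hx).1 (hP _ hp).2.2 (hP _ hq).2.2 ha⟩, abs_nonneg y, ?_, ?_⟩
    · exact sq_eq_sq_iff_eq_or_eq_neg.mp (by rw [mul_pow, h1, h2, one_mul, one_pow])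
    · rw [Int.natCast_natAbs, sq_abs, sq_abs, h]
      ring
    · exact Nat.Coprime.mul_right
        (((hP _ hp).1.coprime_iff_not_dvd.mpr fun h ↦ hpa (Int.natCast_dvd.mpr h)).symm)
        (((hP _ hq).1.coprime_iff_not_dvd.mpr fun h ↦ hqa (Int.natCast_dvd.mpr h)).symm)
  choose! q e z y hq he hz hy0 hy hco using hdata
  have hcard : (P ×ˢ P ×ˢ ({1, -1} : Finset ℤ) ×ˢ Finset.Icc 1 (coeffBound Y Z)).card =
      P.card * (P.card * (2 * coeffBound Y Z)) := by
    simp [Finset.card_product]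
  rw [← hcard]
  refine Finset.card_le_mul_card_image_of_maps_to (f := fun x ↦ (x.2, q x, e x, z x))
    (fun x hx ↦ ?_) _ fun i _ ↦ ?_
  · simp only [Finset.mem_product, Finset.mem_insert, Finset.mem_singleton]
    exact ⟨(hQ x hx).1, hq x hx, he x hx, hz x hx⟩
  obtain ⟨p', q', e', z'⟩ := i
  set R := {x ∈ Q | (x.2, q x, e x, z x) = (p', q', e', z')}
  have hmem : ∀ x ∈ R, x ∈ Q ∧ x.2 = p' ∧ q x = q' ∧ e x = e' ∧ z x = z' := by
    intro x hx
    obtain ⟨h1, h2⟩ := Finset.mem_filter.mp hx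
    simp only [Prod.mk.injEq] at h2
    exact ⟨h1, h2⟩
  rcases R.eq_empty_or_nonempty with h0 | ⟨x₀, hx₀⟩
  · simp [h0]
  have hRy : ∀ x ∈ R, y x ^ 2 - x.1 * z' ^ 2 = 4 * (e' * (p' * q') ^ 3) := by
    intro x hx
    obtain ⟨h1, rfl, rfl, rfl, rfl⟩ := hmem x hx
    exact hy x h1
  obtain ⟨hz', hco', hp', hq', he'⟩ : z' ∈ Finset.Icc 1 (coeffBound Y Z) ∧
      Nat.Coprime z' (p' * q') ∧ p' ∈ P ∧ q' ∈ P ∧ (e' = 1 ∨ e' = -1) := by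
    obtain ⟨h1, rfl, rfl, rfl, rfl⟩ := hmem x₀ hx₀
    exact ⟨hz _ h1, hco _ h1, (hQ _ h1).1, hq _ h1, he _ h1⟩
  have hz0 : 0 < z' := (Finset.mem_Icc.mp hz').1
  have hinj : Set.InjOn y R := by
    intro x hx x' hx' hxx
    have h1 := hRy x hx
    have h2 := hRy x' hx'
    rw [hxx] at h1
    have h3 : x.1 * (z' : ℤ) ^ 2 = x'.1 * (z' : ℤ) ^ 2 := by linarith
    refine Prod.ext (mul_right_cancel₀ (by positivity) h3) ?_
    rw [(hmem x hx).2.1, (hmem x' hx').2.1]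
  rw [← Finset.card_image_of_injOn hinj]
  have hbd : ∀ x ∈ R, |y x ^ 2 - 4 * (e' * (p' * q') ^ 3)| ≤ ((W * z' ^ 2 : ℕ) : ℤ) := by
    intro x hx
    rw [show y x ^ 2 - 4 * (e' * ((p' : ℤ) * q') ^ 3) = x.1 * z' ^ 2 by linarith [hRy x hx],
      abs_mul, abs_of_nonneg (by positivity : (0 : ℤ) ≤ (z' : ℤ) ^ 2)]
    push_cast
    have := (hD x (hmem x hx).1).2
    zify at this
    gcongr
  have hn : ((Z₀ : ℤ) ^ 3) ^ 2 ≤ |e' * ((p' : ℤ) * q') ^ 3| := by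
    have h1 : |e'| = 1 := by rcases he' with h | h <;> simp [h]
    rw [abs_mul, h1, one_mul, abs_of_nonneg (by positivity)]
    have h2 := (hP _ hp').2.1
    have h3 := (hP _ hq').2.1
    zify at h2 h3
    calc ((Z₀ : ℤ) ^ 3) ^ 2 = ((Z₀ : ℤ) * Z₀) ^ 3 := by ring
      _ ≤ _ := by gcongr
  refine (card_sq_roots_le (R.image y) (z' ^ 2) 16 (2 * (W * z' ^ 2) / Z₀ ^ 3) (by positivity)
    (by norm_num) ?_ ?_ ?_).trans (Nat.mul_le_mul (Nat.add_le_add_right ?_ 1) (hT z' hz'))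
  · simp only [Finset.forall_mem_image]
    intro x hx x' hx'
    have := natCast_mul_sub_le (hy0 x (hmem x hx).1) (hy0 x' (hmem x' hx').1)
      (by positivity) (by positivity) hn (hbd x hx) (hbd x' hx')
    push_cast
    rw [Int.le_ediv_iff_mul_le (by positivity)]
    exact_mod_cast this
  · simp only [Finset.forall_mem_image]
    intro x hx x' hx'
    refine ⟨x.1 - x'.1, ?_⟩
    push_cast
    linear_combination hRy x hx - hRy x' hx'
  · simp only [Finset.forall_mem_image]
    intro x hx f hf h2
    have h3 : (f : ℤ) ∣ 16 * (e' * ((p' : ℤ) * q') ^ 3) := by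
      obtain ⟨u, hu⟩ := h2
      obtain ⟨v, hv⟩ := hf
      zify at hv
      refine ⟨u * (2 * y x) - 4 * x.1 * v, ?_⟩
      linear_combination (-4) * hRy x hx + (2 * y x) * hu - 4 * x.1 * hv
    have h4 : (f : ℤ) ∣ 16 * ((p' : ℤ) * q') ^ 3 := by
      rcases he' with h | h <;> simpa [h] using h3
    have h5 : f ∣ 16 * (p' * q') ^ 3 := by exact_mod_cast h4
    exact ((hco'.pow_left 2).coprime_dvd_left hf |>.pow_right 3).dvd_of_dvd_mul_right h5
  · have h1 : 16 * (2 * (W * z' ^ 2) / Z₀ ^ 3) ≤ 32 * W * z' ^ 2 / Z₀ ^ 3 := by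
      rw [Nat.le_div_iff_mul_le (by positivity), mul_assoc]
      have := Nat.div_mul_le_self (2 * (W * z' ^ 2)) (Z₀ ^ 3)
      nlinarith
    refine (Nat.div_le_div_right h1).trans_eq ?_
    rw [Nat.div_div_eq_div_mul, Nat.mul_div_mul_right _ _ (by positivity)]

end

section

theorem Squarefree.int_eq_of_mul_sq_eq {D E : ℤ} (hD : Squarefree D) (hE : Squarefree E) {a b : ℤ}
    (ha : a ≠ 0) (h : D * a ^ 2 = E * b ^ 2) : D = E := by
  have hb : b ≠ 0 := by
    rintro rfl
    have : D * a ^ 2 = 0 := by simpa using h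
    rcases mul_eq_zero.mp this with h0 | h0
    · exact hD.ne_zero h0
    · exact ha (pow_eq_zero_iff (by norm_num) |>.mp h0)
  have key : ∀ {D E : ℤ}, Squarefree E → ∀ {a b : ℤ}, a ≠ 0 → D * a ^ 2 = E * b ^ 2 → a ∣ b := by
    intro D E hE a b ha h
    have ha' : (a : ℚ) ≠ 0 := by exact_mod_cast ha
    obtain ⟨k, hk⟩ := rat_sq_mul_squarefree hE (r := b / a) (N := D) (by
      rw [div_pow, ← mul_div_assoc, div_eq_iff (pow_ne_zero 2 ha')]
      exact_mod_cast h.symm)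
    rw [div_eq_iff ha'] at hk
    exact ⟨k, by rw [mul_comm]; exact_mod_cast hk⟩
  obtain ⟨k, rfl⟩ := key hE ha h
  obtain ⟨l, hl⟩ := key hD hb h.symm
  have hkl : k * l = 1 := by
    refine mul_left_cancel₀ ha ?_
    linear_combination -hl
  have hk2 : k ^ 2 = 1 := by
    rcases Int.isUnit_iff.mp (IsUnit.of_mul_eq_one _ hkl) with h | h <;> simp [h]
  refine mul_right_cancel₀ (pow_ne_zero 2 ha) ?_
  rw [h, mul_pow, hk2, mul_one]

/-- A relation `TripleRel` in lowest terms, with all coefficients positive. -/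
def ReducedRel (D : ℤ) (p q r : ℕ) (e₁ e₂ e₃ : ℤ) (a b c : ℕ) (y g : ℤ) : Prop :=
  0 < c ∧ g ≠ 0 ∧ (e₃ * r ^ 3 * a ^ 2 : ℤ) = e₁ * p ^ 3 * c ^ 2 + e₂ * q ^ 3 * b ^ 2 + b * c * y ∧
    y ^ 2 - D * (g * a) ^ 2 = 4 * e₁ * e₂ * (p * q) ^ 3 ∧
    Nat.Coprime c b ∧ Nat.Coprime p b ∧ (e₃ * r ^ 3 * a ^ 2 - e₂ * q ^ 3 * b ^ 2 : ℤ) ≠ 0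

theorem TripleRel.exists_reducedRel {D : ℤ} {p q r Y Z : ℕ} (h : TripleRel D p q r) (hY : 0 < Y)
    (hD : Y ≤ D.natAbs) (hp : p.Prime ∧ p ≤ Z) (hq : q.Prime ∧ q ≤ Z) (hr : r.Prime ∧ r ≤ Z)
    (hqr : q ≠ r) :
    ∃ (e₁ e₂ e₃ : ℤ) (a b c : ℕ) (y g : ℤ), (e₁ = 1 ∨ e₁ = -1) ∧ (e₂ = 1 ∨ e₂ = -1) ∧
      (e₃ = 1 ∨ e₃ = -1) ∧ a ∈ Finset.Icc 1 (coeffBound Y Z) ∧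
      b ∈ Finset.Icc 1 (coeffBound Y Z) ∧ ReducedRel D p q r e₁ e₂ e₃ a b c y g := by
  obtain ⟨e₁, e₂, e₃, a, b, c, y, h1, h2, h3, ⟨hpa, hpb⟩, ⟨hqa, hqc⟩, ⟨hrb, hrc⟩, hR, hS, ha, hb,
    hc⟩ := h
  have ha0 : a ≠ 0 := fun h0 ↦ hpa (h0 ▸ dvd_zero _)
  have hb0 : b ≠ 0 := fun h0 ↦ hpb (h0 ▸ dvd_zero _)
  have hc0 : c ≠ 0 := fun h0 ↦ hqc (h0 ▸ dvd_zero _)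
  have hsign : ∀ {e : ℤ}, e ^ 2 = 1 → e = 1 ∨ e = -1 := fun h ↦
    sq_eq_sq_iff_eq_or_eq_neg.mp (by rw [h, one_pow])
  have habs := natAbs_le_coeffBound hY hD hp.2 hq.2 ha
  have hbbs := natAbs_le_coeffBound hY hD hr.2 hp.2 hb
  obtain ⟨g, hg0, a', b', c', hga, hgb, hgc, hco⟩ : ∃ g : ℕ, 0 < g ∧ ∃ a' b' c' : ℕ,
      a.natAbs = g * a' ∧ b.natAbs = g * b' ∧ c.natAbs = g * c' ∧
        Nat.gcd a' (Nat.gcd b' c') = 1 := by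
    obtain ⟨g, hg⟩ : ∃ g, g = Nat.gcd a.natAbs (Nat.gcd b.natAbs c.natAbs) := ⟨_, rfl⟩
    have hg0 : 0 < g := hg ▸ Nat.gcd_pos_of_pos_left _ (Int.natAbs_pos.mpr ha0)
    obtain ⟨a', ha'⟩ := hg ▸ Nat.gcd_dvd_left a.natAbs (Nat.gcd b.natAbs c.natAbs)
    have hbc := hg ▸ Nat.gcd_dvd_right a.natAbs (Nat.gcd b.natAbs c.natAbs)
    obtain ⟨b', hb'⟩ := hbc.trans (Nat.gcd_dvd_left _ _)
    obtain ⟨c', hc'⟩ := hbc.trans (Nat.gcd_dvd_right _ _)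
    refine ⟨g, hg0, a', b', c', ha', hb', hc', Nat.eq_of_mul_eq_mul_left hg0 ?_⟩
    rw [← Nat.gcd_mul_left, ← Nat.gcd_mul_left, mul_one, ← ha', ← hb', ← hc', hg]
  have hA : a ^ 2 = (g : ℤ) ^ 2 * a' ^ 2 := by rw [← Int.natAbs_sq, hga]; push_cast; ring
  have hB : b ^ 2 = (g : ℤ) ^ 2 * b' ^ 2 := by rw [← Int.natAbs_sq, hgb]; push_cast; ring
  have hC : c ^ 2 = (g : ℤ) ^ 2 * c' ^ 2 := by rw [← Int.natAbs_sq, hgc]; push_cast; ring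
  obtain ⟨s, hs2, hsy⟩ : ∃ s : ℤ, s ^ 2 = 1 ∧ b * c = (g : ℤ) ^ 2 * (b' * c') * s := by
    refine ⟨b.sign * c.sign, ?_, ?_⟩
    · have hs : ∀ {x : ℤ}, x ≠ 0 → x.sign ^ 2 = 1 := fun {x} hx ↦ by
        rcases lt_or_gt_of_ne hx with h | h
        · rw [Int.sign_eq_neg_one_of_neg h]; norm_num
        · rw [Int.sign_eq_one_of_pos h]; norm_num
      rw [mul_pow, hs hb0, hs hc0, one_mul]
    · have h1 : b = g * b' * b.sign := by
        conv_lhs => rw [← Int.sign_mul_natAbs b, hgb]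
        push_cast; ring
      have h2 : c = g * c' * c.sign := by
        conv_lhs => rw [← Int.sign_mul_natAbs c, hgc]
        push_cast; ring
      conv_lhs => rw [h1, h2]
      ring
  have hnd : ∀ {l : ℕ} {x : ℤ} {x' : ℕ}, x.natAbs = g * x' → ¬ (l : ℤ) ∣ x → ¬ l ∣ x' :=
    fun hx hl h ↦ hl (Int.natCast_dvd.mpr (hx ▸ h.mul_left g))
  have hpos : ∀ {x : ℤ} {x' : ℕ}, x.natAbs = g * x' → x ≠ 0 → 0 < x' := fun hx h0 ↦
    Nat.pos_of_ne_zero fun h ↦ h0 (by simpa [h] using hx)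
  have hR' : (e₃ * r ^ 3 * a' ^ 2 : ℤ) = e₁ * p ^ 3 * c' ^ 2 + e₂ * q ^ 3 * b' ^ 2 +
      b' * c' * (s * y) := by
    have hg2 : (g : ℤ) ^ 2 ≠ 0 := by positivity
    refine mul_left_cancel₀ hg2 ?_
    rw [hA, hB, hC, hsy] at hR
    linear_combination hR
  refine ⟨e₁, e₂, e₃, a', b', c', s * y, g, hsign h1, hsign h2, hsign h3,
    Finset.mem_Icc.mpr ⟨hpos hga ha0, le_trans ?_ habs⟩,
    Finset.mem_Icc.mpr ⟨hpos hgb hb0, le_trans ?_ hbbs⟩, hpos hgc hc0, by positivity, hR', ?_, ?_,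
    ?_, ?_⟩
  · rw [hga]; exact Nat.le_mul_of_pos_left _ hg0
  · rw [hgb]; exact Nat.le_mul_of_pos_left _ hg0
  · rw [mul_pow, hs2, mul_pow, ← hA]
    linear_combination hS
  · by_contra hcb
    obtain ⟨l, hl, hlc, hlb⟩ := Nat.Prime.not_coprime_iff_dvd.mp hcb
    have hlr : (l : ℤ) ∣ e₃ * r ^ 3 * a' ^ 2 := by
      rw [hR']
      obtain ⟨u, rfl⟩ := hlc
      obtain ⟨v, rfl⟩ := hlb
      refine ⟨e₁ * p ^ 3 * u * (l * u) + e₂ * q ^ 3 * v * (l * v) + v * (l * u) * (s * y), ?_⟩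
      push_cast
      ring
    have hlr' : l ∣ r ^ 3 * a' ^ 2 := by
      have : (l : ℤ) ∣ r ^ 3 * a' ^ 2 := by rcases hsign h3 with h | h <;> simpa [h] using hlr
      exact_mod_cast this
    rcases hl.dvd_mul.mp hlr' with h | h
    · have := (Nat.prime_dvd_prime_iff_eq hl hr.1).mp (hl.dvd_of_dvd_pow h)
      exact hnd hgb hrb (this ▸ hlb)
    · have := Nat.dvd_gcd (hl.dvd_of_dvd_pow h) (Nat.dvd_gcd hlb hlc)
      rw [hco] at this
      exact hl.one_lt.ne' (Nat.dvd_one.mp this)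
  · exact hp.1.coprime_iff_not_dvd.mpr (hnd hgb hpb)
  · intro h0
    have hq1 : (q : ℤ) ∣ e₃ * r ^ 3 * a' ^ 2 := ⟨e₂ * q ^ 2 * b' ^ 2, by linear_combination h0⟩
    have hq2 : q ∣ r ^ 3 * a' ^ 2 := by
      have : (q : ℤ) ∣ r ^ 3 * a' ^ 2 := by rcases hsign h3 with h | h <;> simpa [h] using hq1
      exact_mod_cast this
    rcases hq.1.dvd_mul.mp hq2 with h | h
    · exact hqr ((Nat.prime_dvd_prime_iff_eq hq.1 hr.1).mp (hq.1.dvd_of_dvd_pow h))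
    · exact hnd hga hqa (hq.1.dvd_of_dvd_pow h)

theorem sum_div_le {A N T : ℕ} (hT : ∀ n ∈ Finset.Icc 1 N, n.divisors.card ≤ T) :
    ∑ b ∈ Finset.Icc 1 A, N / b ≤ N * T := by
  have h1 : ∑ b ∈ Finset.Icc 1 A, N / b ≤ ∑ b ∈ Finset.Ioc 0 N, N / b := by
    refine Finset.sum_le_sum_of_ne_zero fun b hb hne ↦ ?_
    rw [Finset.mem_Icc] at hb
    rw [Finset.mem_Ioc]
    refine ⟨hb.1, ?_⟩
    by_contra! h
    exact hne (Nat.div_eq_of_lt h)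
  refine h1.trans ?_
  rw [← ArithmeticFunction.sum_Ioc_sigma0_eq_sum_div]
  calc _ ≤ (Finset.Ioc 0 N).card • T := Finset.sum_le_card_nsmul _ _ _ fun n hn ↦ by
        rw [ArithmeticFunction.sigma_zero_apply]
        exact hT n (by simpa [Nat.succ_le_iff] using hn)
    _ = N * T := by simp

end

section

theorem natCast_sub_ne_zero_card_divisors {e₂ e₃ : ℤ} {q r a b Z A B T : ℕ}
    (he₂ : e₂ = 1 ∨ e₂ = -1) (he₃ : e₃ = 1 ∨ e₃ = -1) (hq : q ≤ Z) (hr : r ≤ Z) (ha : a ≤ A)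
    (hb : b ≤ A) (hT : ∀ n ∈ Finset.Icc 1 B, n.divisors.card ≤ T) (hB : 2 * Z ^ 3 * A ^ 2 ≤ B)
    (h0 : (e₃ * r ^ 3 * a ^ 2 - e₂ * q ^ 3 * b ^ 2 : ℤ) ≠ 0) :
    (e₃ * r ^ 3 * a ^ 2 - e₂ * q ^ 3 * b ^ 2 : ℤ).natAbs.divisors.card ≤ T := by
  refine hT _ (Finset.mem_Icc.mpr ⟨Int.natAbs_pos.mpr h0, le_trans ?_ hB⟩)
  have h1 : r ^ 3 * a ^ 2 ≤ Z ^ 3 * A ^ 2 := by gcongr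
  have h2 : q ^ 3 * b ^ 2 ≤ Z ^ 3 * A ^ 2 := by gcongr
  have h3 : ∀ {e : ℤ}, e = 1 ∨ e = -1 → e.natAbs = 1 := by rintro e (rfl | rfl) <;> rfl
  refine (Int.natAbs_sub_le _ _).trans ?_
  simp only [Int.natAbs_mul, Int.natAbs_pow, Int.natAbs_natCast, h3 he₂, h3 he₃]
  linarith

/-- Given all other data, a reduced relation has few choices for the prime `p`, and the
discriminant is then determined. -/
theorem card_reducedRel_le {q r a b c Z T : ℕ} {e₁ e₂ e₃ : ℤ} (hb : 0 < b) (ha : 0 < a)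
    (he₁ : e₁ = 1 ∨ e₁ = -1) (hT : b.divisors.card ≤ T) (R : Finset (ℤ × ℕ))
    (hsq : ∀ x ∈ R, Squarefree x.1) (hZ : ∀ x ∈ R, x.2 ≤ Z)
    (hR : ∀ x ∈ R, ∃ y g, ReducedRel x.1 x.2 q r e₁ e₂ e₃ a b c y g) :
    R.card ≤ (9 * Z / b + 1) * T ^ 2 := by
  have hb' : (b : ℤ) ≠ 0 := by exact_mod_cast hb.ne'
  have ha' : (a : ℤ) ≠ 0 := by exact_mod_cast ha.ne'
  have hinj : Set.InjOn (fun x : ℤ × ℕ ↦ (x.2 : ℤ)) R := by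
    rintro ⟨D, p⟩ hx ⟨D', p'⟩ hx' hxx
    obtain rfl : p = p' := by simpa using hxx
    obtain ⟨y, g, hc, hg, h1, h2, -⟩ := hR _ hx
    obtain ⟨y', g', -, -, h1', h2', -⟩ := hR _ hx'
    have hc' : (c : ℤ) ≠ 0 := by exact_mod_cast hc.ne'
    have hy : y = y' := mul_left_cancel₀ (mul_ne_zero hb' hc') (by linear_combination h1' - h1)
    subst hy
    refine Prod.ext ((hsq _ hx).int_eq_of_mul_sq_eq (hsq _ hx') (mul_ne_zero hg ha')
      (b := g' * a) ?_) rfl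
    simp only at h2 h2' ⊢
    linear_combination h2' - h2
  rw [← Finset.card_image_of_injOn hinj]
  refine (card_cube_roots_le _ b Z hb ?_ ?_ ?_).trans
    (Nat.mul_le_mul_left _ (Nat.pow_le_pow_left hT 2))
  · simp only [Finset.forall_mem_image]
    intro x hx x' hx'
    have := hZ x hx
    omega
  · simp only [Finset.forall_mem_image]
    intro x hx x' hx'
    obtain ⟨y, g, hc, hg, h1, h2, hcb, -⟩ := hR _ hx
    obtain ⟨y', g', -, -, h1', h2', -⟩ := hR _ hx'
    have h3 : (b : ℤ) ∣ e₁ * (((x.2 : ℤ) ^ 3 - (x'.2 : ℤ) ^ 3) * c ^ 2) :=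
      ⟨c * y' - c * y, by linear_combination h1' - h1⟩
    have h4 : (b : ℤ) ∣ ((x.2 : ℤ) ^ 3 - (x'.2 : ℤ) ^ 3) * c ^ 2 := by
      rcases he₁ with h | h <;> simpa [h] using h3
    exact (Nat.isCoprime_iff_coprime.mpr hcb).symm.pow_right.dvd_of_dvd_mul_right h4
  · simp only [Finset.forall_mem_image]
    intro x hx
    obtain ⟨y, g, -, -, -, -, -, hpb, -⟩ := hR _ hx
    exact Nat.isCoprime_iff_coprime.mpr hpb

theorem card_triples_le {P : Finset ℕ} {Y Z T B : ℕ} (hY : 0 < Y)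
    (hP : ∀ p ∈ P, p.Prime ∧ p ≤ Z) (Q : Finset (ℤ × ℕ))
    (hQ : ∀ x ∈ Q, x.2 ∈ P ∧ ∃ q ∈ P, ∃ r ∈ P, q ≠ r ∧ TripleRel x.1 x.2 q r)
    (hsq : ∀ x ∈ Q, Squarefree x.1) (hD : ∀ x ∈ Q, Y ≤ x.1.natAbs)
    (hT : ∀ n ∈ Finset.Icc 1 B, n.divisors.card ≤ T) (hB : 9 * Z ≤ B)
    (hB' : 2 * Z ^ 3 * coeffBound Y Z ^ 2 ≤ B) :
    Q.card ≤ (9 * Z * T + coeffBound Y Z) *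
      (T ^ 2 * T * (P.card * (P.card * (2 * (2 * (2 * coeffBound Y Z)))))) := by
  set A := coeffBound Y Z
  have hdata : ∀ x ∈ Q, ∃ (q r : ℕ) (e₁ e₂ e₃ : ℤ) (a b c : ℕ) (y g : ℤ), q ∈ P ∧ r ∈ P ∧
      (e₁ = 1 ∨ e₁ = -1) ∧ (e₂ = 1 ∨ e₂ = -1) ∧ (e₃ = 1 ∨ e₃ = -1) ∧ a ∈ Finset.Icc 1 A ∧
      b ∈ Finset.Icc 1 A ∧ ReducedRel x.1 x.2 q r e₁ e₂ e₃ a b c y g := by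
    intro x hx
    obtain ⟨hp, q, hq, r, hr, hqr, h⟩ := hQ x hx
    obtain ⟨e₁, e₂, e₃, a, b, c, y, g, h⟩ :=
      h.exists_reducedRel hY (hD x hx) (hP _ hp) (hP _ hq) (hP _ hr) hqr
    exact ⟨q, r, e₁, e₂, e₃, a, b, c, y, g, hq, hr, h⟩
  choose! q r e₁ e₂ e₃ a b c y g hq hr he₁ he₂ he₃ ha hb hrel using hdata
  rw [Finset.card_eq_sum_card_fiberwise (f := b) (t := Finset.Icc 1 A) hb]
  have hcard : (P ×ˢ P ×ˢ ({1, -1} : Finset ℤ) ×ˢ ({1, -1} : Finset ℤ) ×ˢ ({1, -1} : Finset ℤ) ×ˢ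
      Finset.Icc 1 A).card = P.card * (P.card * (2 * (2 * (2 * A)))) := by
    simp [Finset.card_product]
  have hsum : ∑ b ∈ Finset.Icc 1 A, (9 * Z / b + 1) ≤ 9 * Z * T + A := by
    rw [Finset.sum_add_distrib]
    refine Nat.add_le_add (sum_div_le fun n hn ↦ hT n ?_) (by simp)
    rw [Finset.mem_Icc] at hn ⊢
    exact ⟨hn.1, hn.2.trans hB⟩
  refine le_trans ?_ (Nat.mul_le_mul_right _ hsum)
  rw [Finset.sum_mul]
  refine Finset.sum_le_sum fun b' hb' ↦ ?_
  rw [← hcard, ← mul_assoc]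
  refine Finset.card_le_mul_card_image_of_maps_to
    (f := fun x ↦ (q x, r x, e₁ x, e₂ x, e₃ x, a x)) (fun x hx ↦ ?_) _ fun i _ ↦ ?_
  · have hx := (Finset.mem_filter.mp hx).1
    simp only [Finset.mem_product, Finset.mem_insert, Finset.mem_singleton]
    exact ⟨hq x hx, hr x hx, he₁ x hx, he₂ x hx, he₃ x hx, ha x hx⟩
  obtain ⟨q', r', f₁, f₂, f₃, a'⟩ := i
  set R := {x ∈ {x ∈ Q | b x = b'} | (q x, r x, e₁ x, e₂ x, e₃ x, a x) = (q', r', f₁, f₂, f₃, a')}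
  have hmem : ∀ x ∈ R, x ∈ Q ∧ b x = b' ∧ q x = q' ∧ r x = r' ∧ e₁ x = f₁ ∧ e₂ x = f₂ ∧
      e₃ x = f₃ ∧ a x = a' := by
    intro x hx
    obtain ⟨h1, h2⟩ := Finset.mem_filter.mp hx
    simp only [Prod.mk.injEq] at h2
    exact ⟨(Finset.mem_filter.mp h1).1, (Finset.mem_filter.mp h1).2, h2⟩
  rcases R.eq_empty_or_nonempty with h0 | ⟨x₀, hx₀⟩
  · simp [h0]
  have hR : ∀ x ∈ R, ReducedRel x.1 x.2 q' r' f₁ f₂ f₃ a' b' (c x) (y x) (g x) := by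
    intro x hx
    obtain ⟨h1, rfl, rfl, rfl, rfl, rfl, rfl, rfl⟩ := hmem x hx
    exact hrel x h1
  obtain ⟨hq', hr', hf₁, hf₂, hf₃, ha'⟩ : q' ∈ P ∧ r' ∈ P ∧ (f₁ = 1 ∨ f₁ = -1) ∧
      (f₂ = 1 ∨ f₂ = -1) ∧ (f₃ = 1 ∨ f₃ = -1) ∧ a' ∈ Finset.Icc 1 A := by
    obtain ⟨h1, -, rfl, rfl, rfl, rfl, rfl, rfl⟩ := hmem x₀ hx₀
    exact ⟨hq _ h1, hr _ h1, he₁ _ h1, he₂ _ h1, he₃ _ h1, ha _ h1⟩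
  rw [Finset.mem_Icc] at ha' hb'
  have hne := (hR x₀ hx₀).2.2.2.2.2.2
  have hW := natCast_sub_ne_zero_card_divisors hf₂ hf₃ (hP _ hq').2 (hP _ hr').2 ha'.2 hb'.2 hT hB'
    hne
  refine le_trans (Finset.card_le_mul_card_image_of_maps_to (f := c)
    (t := (f₃ * r' ^ 3 * a' ^ 2 - f₂ * q' ^ 3 * b' ^ 2 : ℤ).natAbs.divisors) (fun x hx ↦ ?_)
    ((9 * Z / b' + 1) * T ^ 2) fun c' _ ↦ ?_) ((Nat.mul_le_mul_left _ hW).trans_eq (by ring))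
  · rw [Nat.mem_divisors]
    refine ⟨Int.natCast_dvd.mp ⟨f₁ * x.2 ^ 3 * c x + b' * y x, ?_⟩, Int.natAbs_ne_zero.mpr hne⟩
    linear_combination (hR x hx).2.2.1
  · refine card_reducedRel_le (e₁ := f₁) (e₂ := f₂) (e₃ := f₃) (q := q') (r := r') (a := a')
      (c := c') hb'.1 ha'.1 hf₁ (hT b' ?_) _ (fun x hx ↦ ?_) (fun x hx ↦ ?_) fun x hx ↦ ?_
    · refine Finset.mem_Icc.mpr ⟨hb'.1, hb'.2.trans (le_trans ?_ hB')⟩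
      have hZ : 1 ≤ Z := (hP _ hq').1.one_lt.le.trans (hP _ hq').2
      calc A ≤ A * A := Nat.le_mul_self A
        _ ≤ 2 * Z ^ 3 * (A * A) := Nat.le_mul_of_pos_left _ (by positivity)
        _ = _ := by ring
    · exact hsq x (hmem x (Finset.mem_filter.mp hx).1).1
    · exact (hP _ (hQ x (hmem x (Finset.mem_filter.mp hx).1).1).1).2
    · obtain ⟨h1, rfl⟩ := Finset.mem_filter.mp hx
      exact ⟨y x, g x, hR x h1⟩

end

section

open NumberField

theorem not_isSquare_neg_three {p : ℕ} (hp : p.Prime) (h2 : p ≠ 2) (h3 : p % 3 = 2) :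
    ¬ IsSquare ((-3 : ℤ) : ZMod p) := by
  haveI := Fact.mk hp
  rintro ⟨r, hr⟩
  have hn2 : (2 : ZMod p) ≠ 0 := by
    intro h
    have h' : ((2 : ℕ) : ZMod p) = 0 := by exact_mod_cast h
    rw [ZMod.natCast_eq_zero_iff] at h'
    exact h2 ((Nat.prime_dvd_prime_iff_eq hp Nat.prime_two).1 h')
  have hn3 : (3 : ZMod p) ≠ 0 := by
    intro h
    have h' : ((3 : ℕ) : ZMod p) = 0 := by exact_mod_cast h
    rw [ZMod.natCast_eq_zero_iff] at h'
    rw [(Nat.prime_dvd_prime_iff_eq hp Nat.prime_three).1 h'] at h3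
    omega
  push_cast at hr
  set x : ZMod p := (r - 1) / 2 with hx
  have h2x : 2 * x = r - 1 := by rw [hx]; field_simp
  have h0 : x ^ 2 + x + 1 = 0 := by
    have : 2 * 2 * (x ^ 2 + x + 1) = 0 := by
      linear_combination (2 * x + r - 1 + 2) * h2x - hr
    exact (mul_eq_zero.1 this).resolve_left (mul_ne_zero hn2 hn2)
  have h1 : x ^ 3 = 1 := by linear_combination (x - 1) * h0
  have hx1 : x ≠ 1 := by
    intro h
    rw [h] at h0
    exact hn3 (by linear_combination h0)
  have hx0 : x ≠ 0 := by
    intro h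
    rw [h] at h1
    norm_num at h1
  have h4 := orderOf_eq_prime h1 hx1
  have h5 := ZMod.orderOf_dvd_card_sub_one hx0
  rw [h4] at h5
  omega

theorem exists_splitAt_or {p : ℕ} (hp : p.Prime) (h2 : p ≠ 2) (h3 : p % 3 = 2) {d D m : ℤ}
    (hd : ¬(p : ℤ) ∣ d) (hD : -3 * d = m ^ 2 * D) :
    (∃ r, SplitAt d p r) ∨ ∃ r, SplitAt D p r := by
  haveI := Fact.mk hp
  have hpp := Nat.prime_iff_prime_int.1 hp
  have hp3 : ¬(p : ℤ) ∣ -3 := by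
    rw [dvd_neg]
    intro h
    have h' : p ∣ 3 := by exact_mod_cast h
    rw [(Nat.prime_dvd_prime_iff_eq hp Nat.prime_three).1 h'] at h3
    omega
  have hmD : ¬(p : ℤ) ∣ m ^ 2 * D := by
    rw [← hD]
    intro h
    exact (hpp.dvd_or_dvd h).elim hp3 hd
  have hD' : ¬(p : ℤ) ∣ D := fun h ↦ hmD (h.mul_left _)
  have hm' : ¬(p : ℤ) ∣ m := fun h ↦ hmD ((h.pow two_ne_zero).mul_right _)
  have key : ∀ a : ℤ, ¬(p : ℤ) ∣ a → legendreSym p a = 1 → ∃ r, SplitAt a p r := by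
    intro a ha h
    rw [legendreSym.eq_one_iff p (by rwa [Ne, ZMod.intCast_zmod_eq_zero_iff_dvd])] at h
    obtain ⟨x, hx⟩ := h
    obtain ⟨r, rfl⟩ := ZMod.intCast_surjective x
    refine ⟨r, hp, h2, ?_, ha⟩
    rw [← ZMod.intCast_zmod_eq_zero_iff_dvd]
    push_cast
    rw [hx]; ring
  have hz : ∀ a : ℤ, ¬(p : ℤ) ∣ a → (a : ZMod p) ≠ 0 := fun a ha ↦ by
    rwa [Ne, ZMod.intCast_zmod_eq_zero_iff_dvd]
  rcases legendreSym.eq_one_or_neg_one p (hz d hd) with h | h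
  · exact Or.inl (key d hd h)
  rcases legendreSym.eq_one_or_neg_one p (hz D hD') with h' | h'
  · exact Or.inr (key D hD' h')
  exfalso
  have h5 := congrArg (legendreSym p) hD
  rw [legendreSym.mul, legendreSym.mul, h, h', pow_two, legendreSym.mul, ← pow_two,
    legendreSym.sq_one p (hz m hm')] at h5
  have h6 : legendreSym p (-3) = 1 := by linarith
  rw [legendreSym.eq_one_iff p (hz _ hp3)] at h6
  exact not_isSquare_neg_three hp h2 h3 h6

theorem exists_dual {d : ℕ} (hd : Squarefree d) :
    ∃ D m e : ℤ, Squarefree D ∧ D < 0 ∧ m * e = 3 ∧ (e = 1 ∨ e = 3) ∧ -3 * (d : ℤ) = m ^ 2 * D ∧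
      ((d : ℤ) = -3 * D ∨ D = -3 * d) := by
  have hd0 : 0 < d := Nat.pos_of_ne_zero hd.ne_zero
  by_cases h3 : 3 ∣ d
  · obtain ⟨c, rfl⟩ := h3
    refine ⟨-c, 3, 1, ?_, by omega, by norm_num, Or.inl rfl, by push_cast; ring,
      Or.inl (by push_cast; ring)⟩
    rw [← Int.squarefree_natAbs, Int.natAbs_neg, Int.natAbs_natCast]
    exact hd.squarefree_of_dvd (Dvd.intro_left _ rfl)
  · refine ⟨-3 * d, 1, 3, ?_, by omega, by norm_num, Or.inr rfl, by ring, Or.inr rfl⟩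
    rw [← Int.squarefree_natAbs, show (-3 * (d : ℤ)).natAbs = 3 * d by omega]
    exact (Nat.squarefree_mul (Nat.prime_three.coprime_iff_not_dvd.2 h3)).2
      ⟨Nat.prime_three.squarefree, hd⟩

theorem IsQuad.exists_tripleRel_of_bounds {F : Type*} [Field F] [NumberField F] {s : F} {D : ℤ}
    (h : IsQuad s D) (φ : F →+* ℂ) {d m n T : ℕ} (hd : 0 < d) (hD : |(D : ℝ)| ≤ 3 * d)
    {P P' : Finset ℕ} (hP' : P' ⊆ P) (hPP' : P.card ≤ 2 * P'.card)
    (hP : ∀ p ∈ P', ∃ r, SplitAt D p r) (hm : 3 * Real.log (3 * √(3 * d)) ≤ m)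
    (hn : 3 * √(3 * d) ≤ n) (hT : ∀ k ∈ Finset.Icc 1 n, k.divisors.card ≤ T) {H : ℕ}
    (hH : H ≤ 10368 * Nat.card {c : ClassGroup (𝓞 F) // c ^ 3 = 1})
    (hcard : 82944 * (n * T * (2 * m + 1)) ≤ H * P.card) :
    ∃ G ⊆ P, P.card ≤ 4 * G.card ∧
      ∀ p ∈ G, ∃ q ∈ P, ∃ r ∈ P, p ≠ q ∧ p ≠ r ∧ q ≠ r ∧ TripleRel D p q r := by
  have hD0 : (0 : ℝ) < |(D : ℝ)| := by
    rw [abs_pos]; exact_mod_cast h.sqfree.ne_zero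
  have hs : 3 * √|(D : ℝ)| ≤ 3 * √(3 * d) := by gcongr
  have hfl : ⌊3 * √|(D : ℝ)|⌋₊ ≤ n := by
    rw [← Nat.floor_natCast (R := ℝ) n]
    exact Nat.floor_mono (hs.trans hn)
  have hid : (idealsLE F ⌊3 * √|(D : ℝ)|⌋₊).card ≤ n * T :=
    (card_idealsLE_le h.finrank _ T fun k hk ↦ hT k (Finset.Icc_subset_Icc le_rfl hfl hk)).trans
      (Nat.mul_le_mul_right _ hfl)
  obtain ⟨G, hG, hGc, hGt⟩ := h.exists_tripleRel φ P' hP m (by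
    refine le_trans ?_ hm
    have : 0 < √|(D : ℝ)| := Real.sqrt_pos.2 hD0
    gcongr) (by
    have h1 : 82944 * (n * T * (2 * m + 1)) ≤
        (10368 * Nat.card {c : ClassGroup (𝓞 F) // c ^ 3 = 1}) * (2 * P'.card) :=
      hcard.trans (Nat.mul_le_mul hH hPP')
    have h2 : (idealsLE F ⌊3 * √|(D : ℝ)|⌋₊).card * (2 * m + 1) ≤ n * T * (2 * m + 1) :=
      Nat.mul_le_mul_right _ hid
    rw [show (10368 * Nat.card {c : ClassGroup (𝓞 F) // c ^ 3 = 1}) * (2 * P'.card) =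
      20736 * (Nat.card {c : ClassGroup (𝓞 F) // c ^ 3 = 1} * P'.card) by ring] at h1
    omega)
  refine ⟨G, hG.trans hP', by omega, fun p hp ↦ ?_⟩
  obtain ⟨q, hq, r, hr, h1⟩ := hGt p hp
  exact ⟨q, hP' hq, r, hP' hr, h1⟩

open Classical in
theorem exists_tripleRel_of_hpos {d : ℕ} (hd : Squarefree d) (hd1 : 1 < d) {m n T : ℕ}
    {P : Finset ℕ} (hP : ∀ p ∈ P, p.Prime ∧ p ≠ 2 ∧ p % 3 = 2 ∧ ¬p ∣ d)
    (hm : 3 * Real.log (3 * √(3 * d)) ≤ m)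
    (hn : 3 * √(3 * d) ≤ n) (hT : ∀ k ∈ Finset.Icc 1 n, k.divisors.card ≤ T)
    (hcard : 82944 * (n * T * (2 * m + 1)) ≤ hpos 3 d * P.card) :
    ∃ D : ℤ, Squarefree D ∧ ((d : ℤ) = D ∨ (d : ℤ) = -3 * D ∨ D = -3 * d) ∧
      ∃ G ⊆ P, P.card ≤ 4 * G.card ∧
      ∀ p ∈ G, ∃ q ∈ P, ∃ r ∈ P, p ≠ q ∧ p ≠ r ∧ q ≠ r ∧ TripleRel D p q r := by
  have hd0 : 0 < d := by omega
  obtain ⟨D, a, e, hDs, hD0, hae, he, hdD, hdD'⟩ := exists_dual hd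
  have hα : (√(d : ℝ)) ^ 2 = ((d : ℤ) : ℝ) := by
    rw [Real.sq_sqrt (Nat.cast_nonneg d)]; simp
  obtain ⟨β, hβ⟩ : ∃ β : ℂ, β ^ 2 = (D : ℂ) := IsAlgClosed.exists_pow_nat_eq _ two_pos
  haveI : NumberField (IntermediateField.adjoin ℚ {√(d : ℝ)}) := numberField_adjoin_sqrt hα
  haveI := numberField_adjoin_sqrt hβ
  have hK := isQuad_adjoin hα (by rwa [← Int.squarefree_natAbs, Int.natAbs_natCast]) (by omega)
  have hk := isQuad_adjoin hβ hDs (by omega)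
  have hpos_le : hpos 3 d ≤ _ := hK.card_three_torsion_le hk hD0 (by omega) hae he hdD
  have hcov : P ⊆ P.filter (fun p ↦ ∃ r, SplitAt d p r) ∪ P.filter (fun p ↦ ∃ r, SplitAt D p r) := by
    intro p hp
    rw [Finset.mem_union, Finset.mem_filter, Finset.mem_filter]
    obtain ⟨h1, h2, h3, h4⟩ := hP p hp
    exact (exists_splitAt_or h1 h2 h3 (by exact_mod_cast h4) hdD).imp (⟨hp, ·⟩) (⟨hp, ·⟩)
  have hcc := (Finset.card_le_card hcov).trans (Finset.card_union_le _ _)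
  by_cases hhalf : P.card ≤ 2 * (P.filter (fun p ↦ ∃ r, SplitAt d p r)).card
  · refine ⟨d, by rwa [← Int.squarefree_natAbs, Int.natAbs_natCast], Or.inl rfl, ?_⟩
    refine hK.exists_tripleRel_of_bounds
      (Complex.ofRealHom.comp (algebraMap (IntermediateField.adjoin ℚ {√(d : ℝ)}) ℝ)) hd0 ?_
      (Finset.filter_subset _ _) hhalf (fun p hp ↦ (Finset.mem_filter.1 hp).2) hm hn hT
      (H := hpos 3 d) ?_ hcard
    · have : (0 : ℝ) < d := by exact_mod_cast hd0
      rw [Int.cast_natCast, abs_of_pos this]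
      linarith
    · exact Nat.le_mul_of_pos_left _ (by norm_num)
  · refine ⟨D, hDs, Or.inr hdD', ?_⟩
    refine hk.exists_tripleRel_of_bounds
      (algebraMap (IntermediateField.adjoin ℚ {β}) ℂ) hd0 ?_
      (Finset.filter_subset _ _) (by omega) (fun p hp ↦ (Finset.mem_filter.1 hp).2) hm hn hT
      hpos_le hcard
    have : |D| ≤ 3 * (d : ℤ) := by rw [abs_of_neg hD0]; omega
    exact_mod_cast this

end

section

open NumberField

open Classical in
/-- The squarefree `d ∈ [N, 2N)` for which the `3`-part of the class number is at least `h`. -/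
noncomputable def largeClass (N : ℕ) (h : ℝ) : Finset ℕ :=
  (Finset.Ico N (2 * N)).filter fun d ↦ Squarefree d ∧ 1 < d ∧ h ≤ hpos 3 d

open Classical in
theorem exists_pairs_card_largeClass {N m n T M : ℕ} {h : ℝ} {P : Finset ℕ}
    (hP : ∀ p ∈ P, p.Prime ∧ p ≠ 2 ∧ p % 3 = 2)
    (hM : ∀ d ∈ Finset.Ico N (2 * N), 1 < d → M ≤ (P.filter fun p ↦ ¬p ∣ d).card)
    (hm : 3 * Real.log (3 * √(6 * N)) ≤ m) (hn : 3 * √(6 * N) ≤ n)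
    (hT : ∀ k ∈ Finset.Icc 1 n, k.divisors.card ≤ T)
    (hcard : (82944 * (n * T * (2 * m + 1)) : ℝ) ≤ h * M) :
    ∃ Q : Finset (ℤ × ℕ), (∀ x ∈ Q, x.2 ∈ P ∧ ∃ q ∈ P, ∃ r ∈ P, q ≠ r ∧ TripleRel x.1 x.2 q r) ∧
      (∀ x ∈ Q, Squarefree x.1) ∧ (∀ x ∈ Q, N / 3 ≤ x.1.natAbs ∧ x.1.natAbs ≤ 6 * N) ∧
      (largeClass N h).card * M ≤ 12 * Q.card := by
  have hdata : ∀ d ∈ largeClass N h, ∃ D : ℤ, Squarefree D ∧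
      ((d : ℤ) = D ∨ (d : ℤ) = -3 * D ∨ D = -3 * d) ∧
      ∃ G ⊆ P, M ≤ 4 * G.card ∧ ∀ p ∈ G, ∃ q ∈ P, ∃ r ∈ P, q ≠ r ∧ TripleRel D p q r := by
    intro d hd
    obtain ⟨hdN, hds, hd1, hdh⟩ := Finset.mem_filter.1 hd
    have hMd := hM d hdN hd1
    have hd2 : (d : ℝ) ≤ 2 * N := by
      have := (Finset.mem_Ico.1 hdN).2.le
      exact_mod_cast this
    have hd0 : (0 : ℝ) < d := by exact_mod_cast (show 0 < d by omega)
    have hs : 3 * √(3 * d) ≤ 3 * √(6 * N) :=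
      mul_le_mul_of_nonneg_left (Real.sqrt_le_sqrt (by linarith)) (by norm_num)
    have hs0 : 0 < 3 * √(3 * (d : ℝ)) := by positivity
    obtain ⟨D, h1, h2, G, h3, h4, h5⟩ := exists_tripleRel_of_hpos hds hd1 (m := m) (n := n) (T := T)
      (P := P.filter fun p ↦ ¬p ∣ d) (fun p hp ↦ by
        obtain ⟨hp1, hp2⟩ := Finset.mem_filter.1 hp
        exact ⟨(hP p hp1).1, (hP p hp1).2.1, (hP p hp1).2.2, hp2⟩)
      ((mul_le_mul_of_nonneg_left (Real.log_le_log hs0 hs) (by norm_num)).trans hm)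
      (hs.trans hn) hT (by
        have h6 : (82944 * (n * T * (2 * m + 1)) : ℝ) ≤
            hpos 3 d * (P.filter fun p ↦ ¬p ∣ d).card := by
          refine hcard.trans (mul_le_mul hdh (by exact_mod_cast hMd) (by positivity) (by positivity))
        exact_mod_cast h6)
    refine ⟨D, h1, h2, G, h3.trans (Finset.filter_subset _ _), hMd.trans h4, fun p hp ↦ ?_⟩
    obtain ⟨q, hq, r, hr, -, -, hqr, ht⟩ := h5 p hp
    exact ⟨q, (Finset.mem_filter.1 hq).1, r, (Finset.mem_filter.1 hr).1, hqr, ht⟩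
  choose! D hDs hdD G hGP hGc hG using hdata
  let R : ℤ → ℕ → Prop := fun D p ↦ ∃ q ∈ P, ∃ r ∈ P, q ≠ r ∧ TripleRel D p q r
  refine ⟨(((largeClass N h).image D) ×ˢ P).filter fun x ↦ R x.1 x.2, ?_, ?_, ?_, ?_⟩
  · intro x hx
    obtain ⟨h1, h2⟩ := Finset.mem_filter.1 hx
    exact ⟨(Finset.mem_product.1 h1).2, h2⟩
  · intro x hx
    obtain ⟨d, hd, h1⟩ := Finset.mem_image.1 (Finset.mem_product.1 (Finset.mem_filter.1 hx).1).1
    rw [← h1]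
    exact hDs d hd
  · intro x hx
    obtain ⟨d, hd, h1⟩ := Finset.mem_image.1 (Finset.mem_product.1 (Finset.mem_filter.1 hx).1).1
    rw [← h1]
    have h2 := Finset.mem_Ico.1 (Finset.mem_filter.1 hd).1
    have h3 := hdD d hd
    omega
  · have h1 : (largeClass N h).card ≤ 3 * ((largeClass N h).image D).card := by
      refine Finset.card_le_mul_card_image _ _ fun t ht ↦ ?_
      refine (Finset.card_le_card (t := {t.natAbs, (-3 * t).natAbs, (t / -3).natAbs}) ?_).trans
        Finset.card_le_three
      intro d hd
      obtain ⟨hd1, hd2⟩ := Finset.mem_filter.1 hd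
      have h3 := hdD d hd1
      simp only [Finset.mem_insert, Finset.mem_singleton]
      omega
    have h2 : ((largeClass N h).image D).card * M ≤
        4 * ((((largeClass N h).image D) ×ˢ P).filter fun x ↦ R x.1 x.2).card := by
      rw [Finset.card_filter, Finset.sum_product, Finset.mul_sum, ← smul_eq_mul]
      refine Finset.card_nsmul_le_sum _ _ _ fun t ht ↦ ?_
      obtain ⟨d, hd, rfl⟩ := Finset.mem_image.1 ht
      rw [← Finset.card_filter]
      refine (hGc d hd).trans (Nat.mul_le_mul_left _ (Finset.card_le_card fun p hp ↦ ?_))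
      exact Finset.mem_filter.2 ⟨hGP d hd hp, hG d hd p hp⟩
    calc (largeClass N h).card * M ≤ 3 * ((largeClass N h).image D).card * M :=
          Nat.mul_le_mul_right _ h1
      _ = 3 * (((largeClass N h).image D).card * M) := by ring
      _ ≤ 3 * (4 * _) := Nat.mul_le_mul_left _ h2
      _ = _ := by ring

end

section

open NumberField Filter

theorem eventually_const_mul_rpow_le (C : ℝ) {a b : ℝ} (h : a < b) :
    ∀ᶠ N : ℕ in atTop, C * (N : ℝ) ^ a ≤ (N : ℝ) ^ b := by
  filter_upwards [((tendsto_rpow_atTop (sub_pos.2 h)).comp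
    tendsto_natCast_atTop_atTop).eventually_ge_atTop C, eventually_gt_atTop 0] with N hN h0
  have h0' : (0 : ℝ) < N := by exact_mod_cast h0
  calc C * (N : ℝ) ^ a ≤ (N : ℝ) ^ (b - a) * (N : ℝ) ^ a := by gcongr; exact hN
    _ = (N : ℝ) ^ b := by rw [← Real.rpow_add h0', sub_add_cancel]

theorem eventually_card_divisors_le_floor (K : ℕ) {δ : ℝ} (hδ : 0 < δ) :
    ∀ᶠ N : ℕ in atTop, ∀ k ∈ Finset.Icc 1 (N ^ K), k.divisors.card ≤ ⌊(N : ℝ) ^ δ⌋₊ := by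
  obtain ⟨C, hC, h⟩ := card_divisors_le_rpow (ε := δ / (2 * (K + 1))) (by positivity)
  filter_upwards [eventually_const_mul_rpow_le C (half_lt_self hδ), eventually_ge_atTop 1]
    with N hN h1 k hk
  rw [Finset.mem_Icc] at hk
  have h1' : (1 : ℝ) ≤ N := by exact_mod_cast h1
  refine Nat.le_floor ((h k (by omega)).trans (le_trans ?_ hN))
  have hkN : (k : ℝ) ≤ (N : ℝ) ^ (K : ℝ) := by
    rw [Real.rpow_natCast]; exact_mod_cast hk.2
  gcongr
  calc (k : ℝ) ^ (δ / (2 * (K + 1))) ≤ ((N : ℝ) ^ (K : ℝ)) ^ (δ / (2 * (K + 1))) := by gcongr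
    _ = (N : ℝ) ^ (K * (δ / (2 * (K + 1)))) := by rw [← Real.rpow_mul (by positivity)]
    _ ≤ (N : ℝ) ^ (δ / 2) := by
      apply Real.rpow_le_rpow_of_exponent_le h1'
      rw [mul_div_assoc', div_le_div_iff₀ (by positivity) (by positivity)]
      nlinarith

theorem eventually_log_ceil_le {δ : ℝ} (hδ : 0 < δ) :
    ∀ᶠ N : ℕ in atTop, 2 * (⌈3 * Real.log (3 * √(6 * N))⌉₊ : ℝ) + 1 ≤ (N : ℝ) ^ δ := by
  have hlog := (tendsto_natCast_atTop_atTop (R := ℝ)).eventually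
    ((isLittleO_log_rpow_atTop (half_pos hδ)).bound one_pos)
  filter_upwards [eventually_const_mul_rpow_le 9 (half_lt_self hδ), eventually_ge_atTop 54, hlog]
    with N hN h54 hl
  have h54' : (54 : ℝ) ≤ N := by exact_mod_cast h54
  have h1 : 3 * √(6 * (N : ℝ)) ≤ N := by
    have : √(6 * (N : ℝ)) ≤ N / 3 := Real.sqrt_le_iff.2 ⟨by positivity, by nlinarith⟩
    linarith
  have h0 : 1 ≤ 3 * √(6 * (N : ℝ)) := by
    have : 1 ≤ √(6 * (N : ℝ)) := Real.one_le_sqrt.2 (by linarith)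
    linarith
  have h2 := Real.log_le_log (by linarith) h1
  have h3 := (Nat.ceil_lt_add_one (a := 3 * Real.log (3 * √(6 * N)))
    (mul_nonneg (by norm_num) (Real.log_nonneg h0))).le
  have h4 : (1 : ℝ) ≤ (N : ℝ) ^ (δ / 2) := Real.one_le_rpow (by linarith) (by positivity)
  rw [Real.norm_of_nonneg (Real.log_nonneg (by linarith)), Real.norm_of_nonneg (by positivity),
    one_mul] at hl
  linarith

theorem ceil_sqrt_le {N : ℕ} (hN : 1 ≤ N) :
    (⌈3 * √(6 * (N : ℝ))⌉₊ : ℝ) ≤ 10 * (N : ℝ) ^ (1 / 2 : ℝ) := by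
  have h1 := (Nat.ceil_lt_add_one (a := 3 * √(6 * (N : ℝ))) (by positivity)).le
  have h2 : 1 ≤ √(N : ℝ) := Real.one_le_sqrt.2 (by exact_mod_cast hN)
  have h3 : √(6 : ℝ) ≤ 3 := Real.sqrt_le_iff.2 ⟨by norm_num, by norm_num⟩
  rw [Real.sqrt_mul (by norm_num)] at h1
  rw [← Real.sqrt_eq_rpow, Real.sqrt_mul (by norm_num)]
  nlinarith

theorem eventually_rpow_le_card_primes {ζ δ : ℝ} (hδ : 0 < δ) (hδζ : δ < ζ) (hζ : ζ ≤ 1) :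
    ∀ᶠ N : ℕ in atTop, (N : ℝ) ^ (ζ - δ) ≤ (primesTwoModThree ⌊(N : ℝ) ^ ζ⌋₊).card := by
  have hfl : Tendsto (fun N : ℕ ↦ ⌊(N : ℝ) ^ ζ⌋₊) atTop atTop :=
    tendsto_nat_floor_atTop.comp ((tendsto_rpow_atTop (hδ.trans hδζ)).comp
      tendsto_natCast_atTop_atTop)
  filter_upwards [hfl.eventually (eventually_rpow_le_card_primesTwoModThree (half_pos hδ)),
    eventually_const_mul_rpow_le 2 (show ζ - δ / 2 < ζ by linarith), eventually_ge_atTop 1]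
    with N h1 h2 hN
  have hN' : (1 : ℝ) ≤ N := by exact_mod_cast hN
  refine le_trans ?_ h1
  have h3 : (N : ℝ) ^ (ζ - δ / 2) ≤ ⌊(N : ℝ) ^ ζ⌋₊ := by
    have := (Nat.sub_one_lt_floor ((N : ℝ) ^ ζ)).le
    have h4 : (1 : ℝ) ≤ (N : ℝ) ^ (ζ - δ / 2) := Real.one_le_rpow hN' (by linarith)
    linarith
  by_cases hδ2 : δ / 2 ≤ 1
  · calc (N : ℝ) ^ (ζ - δ) ≤ (N : ℝ) ^ ((ζ - δ / 2) * (1 - δ / 2)) :=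
          Real.rpow_le_rpow_of_exponent_le hN' (by nlinarith)
      _ = ((N : ℝ) ^ (ζ - δ / 2)) ^ (1 - δ / 2) := Real.rpow_mul (by positivity) _ _
      _ ≤ _ := Real.rpow_le_rpow (by positivity) h3 (by linarith)
  · linarith

/-- The family of `(D, p)` attached to the discriminants with a large `3`-part in a dyadic block. -/
theorem eventually_exists_pairs {η δ : ℝ} (hδ : 0 < δ) (hδ' : 2 * δ ≤ η) (hη : η < 1 / 2) :
    ∀ᶠ N : ℕ in atTop, ∃ (Z Z₀ T : ℕ) (P : Finset ℕ) (Q : Finset (ℤ × ℕ)),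
      (Z : ℝ) ≤ (N : ℝ) ^ (1 / 2 - η + 2 * δ) ∧ (N : ℝ) ^ (1 / 2 - η + δ) ≤ Z₀ ∧
      (T : ℝ) ≤ (N : ℝ) ^ δ ∧
      (∀ k ∈ Finset.Icc 1 (N ^ 10), k.divisors.card ≤ T) ∧
      (∀ p ∈ P, p.Prime ∧ Z₀ ≤ p ∧ p ≤ Z) ∧
      (∀ x ∈ Q, x.2 ∈ P ∧ ∃ q ∈ P, ∃ r ∈ P, q ≠ r ∧ TripleRel x.1 x.2 q r) ∧
      (∀ x ∈ Q, Squarefree x.1) ∧ (∀ x ∈ Q, N / 3 ≤ x.1.natAbs ∧ x.1.natAbs ≤ 6 * N) ∧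
      (largeClass N ((N : ℝ) ^ η)).card * (N : ℝ) ^ (1 / 2 - η + δ) ≤ 12 * Q.card := by
  set ζ := 1 / 2 - η + 2 * δ with hζ
  have e1 : 1 / 2 - η + δ = ζ - δ := by rw [hζ]; ring
  rw [e1]
  filter_upwards [eventually_card_divisors_le_floor 10 (show 0 < δ / 4 by linarith),
    eventually_log_ceil_le (show 0 < δ / 4 by linarith),
    eventually_rpow_le_card_primes (half_pos hδ) (show δ / 2 < ζ by linarith)
      (show ζ ≤ 1 by linarith),
    eventually_const_mul_rpow_le 6 (show ζ - δ < ζ - δ / 2 by linarith),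
    eventually_const_mul_rpow_le 829440 (show 1 / 2 + δ / 2 < 1 / 2 + δ by linarith),
    eventually_const_mul_rpow_le 10 (show (1 / 2 : ℝ) < 1 by norm_num),
    eventually_ge_atTop 2] with N hT hm hP h5 hbig h10 hN
  have hN1 : 1 ≤ N := by omega
  have hN' : (1 : ℝ) ≤ N := by exact_mod_cast hN1
  have hN0 : (0 : ℝ) < N := by linarith
  set Z := ⌊(N : ℝ) ^ ζ⌋₊ with hZ
  set Z₀ := ⌈(N : ℝ) ^ (ζ - δ)⌉₊ with hZ₀
  set T := ⌊(N : ℝ) ^ (δ / 4)⌋₊ with hTT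
  set n := ⌈3 * √(6 * (N : ℝ))⌉₊ with hn
  have hTle : (T : ℝ) ≤ (N : ℝ) ^ (δ / 4) := Nat.floor_le (by positivity)
  have hnle : (n : ℝ) ≤ 10 * (N : ℝ) ^ (1 / 2 : ℝ) := ceil_sqrt_le hN1
  have hone : (1 : ℝ) ≤ (N : ℝ) ^ (ζ - δ) := Real.one_le_rpow hN' (by linarith)
  have hZ₀le : (Z₀ : ℝ) ≤ 2 * (N : ℝ) ^ (ζ - δ) := by
    have := (Nat.ceil_lt_add_one (a := (N : ℝ) ^ (ζ - δ)) (by positivity)).le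
    linarith
  have hnN : n ≤ N ^ 10 := by
    rw [Real.rpow_one] at h10
    have : n ≤ N := by exact_mod_cast hnle.trans h10
    exact this.trans (Nat.le_self_pow (by norm_num) _)
  obtain ⟨Q, hQ1, hQ2, hQ3, hQ4⟩ := exists_pairs_card_largeClass (N := N)
    (m := ⌈3 * Real.log (3 * √(6 * N))⌉₊) (n := n) (T := T) (M := Z₀) (h := (N : ℝ) ^ η)
    (P := (primesTwoModThree Z).filter fun p ↦ Z₀ < p ∧ p ≠ 2) (fun p hp ↦ by
      simp only [primesTwoModThree, Finset.mem_filter] at hp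
      exact ⟨hp.1.2.1, hp.2.2, hp.1.2.2⟩) (fun d hd hd1 ↦ by
      have hd2 : d.divisors.card ≤ T := hT d (by
        rw [Finset.mem_Ico] at hd
        rw [Finset.mem_Icc]
        have : 2 * N ≤ N ^ 10 := by
          rw [pow_succ, mul_comm]; exact Nat.mul_le_mul (Nat.le_self_pow (by norm_num) N) hN
        omega)
      have hcov : primesTwoModThree Z ⊆
          ((primesTwoModThree Z).filter fun p ↦ Z₀ < p ∧ p ≠ 2).filter (fun p ↦ ¬p ∣ d) ∪
            ((Finset.Icc 1 Z₀ ∪ {2}) ∪ d.divisors) := by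
        intro p hp
        have hpp : p.Prime := by
          simp only [primesTwoModThree, Finset.mem_filter] at hp
          exact hp.2.1
        have := hpp.pos
        simp only [Finset.mem_union, Finset.mem_filter, hp, Finset.mem_Icc, Finset.mem_singleton,
          Nat.mem_divisors, true_and]
        by_cases h1 : p ∣ d
        · exact Or.inr (Or.inr ⟨h1, by omega⟩)
        · by_cases h2 : p = 2
          · exact Or.inr (Or.inl (Or.inr h2))
          · by_cases h3 : Z₀ < p
            · exact Or.inl ⟨⟨h3, h2⟩, h1⟩
            · exact Or.inr (Or.inl (Or.inl ⟨this, by omega⟩))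
      have hc := (Finset.card_le_card hcov).trans ((Finset.card_union_le _ _).trans
        (Nat.add_le_add_left ((Finset.card_union_le _ _).trans
          (Nat.add_le_add_right (Finset.card_union_le _ _) _)) _))
      rw [Nat.card_Icc, Finset.card_singleton, Nat.add_sub_cancel] at hc
      have hTζ : (T : ℝ) + 1 ≤ 2 * (N : ℝ) ^ (ζ - δ) := by
        have : (N : ℝ) ^ (δ / 4) ≤ (N : ℝ) ^ (ζ - δ) :=
          Real.rpow_le_rpow_of_exponent_le hN' (by linarith)
        linarith
      have hc' := (Nat.cast_le (α := ℝ)).2 (hc.trans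
        (Nat.add_le_add_left (Nat.add_le_add_left hd2 _) _))
      push_cast at hc'
      rw [← Nat.cast_le (α := ℝ)]
      linarith) (Nat.le_ceil _) (Nat.le_ceil _)
    (fun k hk ↦ hT k (Finset.Icc_subset_Icc le_rfl hnN hk)) (by
      calc (82944 * (n * T * (2 * (⌈3 * Real.log (3 * √(6 * N))⌉₊ : ℝ) + 1)) : ℝ)
          ≤ 82944 * ((10 * (N : ℝ) ^ (1 / 2 : ℝ)) * (N : ℝ) ^ (δ / 4) * (N : ℝ) ^ (δ / 4)) := by
            gcongr
        _ = 829440 * (N : ℝ) ^ (1 / 2 + δ / 2) := by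
            rw [show 1 / 2 + δ / 2 = 1 / 2 + δ / 4 + δ / 4 by ring, Real.rpow_add hN0,
              Real.rpow_add hN0]; ring
        _ ≤ (N : ℝ) ^ (1 / 2 + δ) := hbig
        _ = (N : ℝ) ^ η * (N : ℝ) ^ (ζ - δ) := by
            rw [← Real.rpow_add hN0, hζ]; congr 1; ring
        _ ≤ (N : ℝ) ^ η * Z₀ := by gcongr; exact Nat.le_ceil _)
  refine ⟨Z, Z₀, T, _, Q, Nat.floor_le (by positivity), Nat.le_ceil _,
    hTle.trans (Real.rpow_le_rpow_of_exponent_le hN' (by linarith)), hT, fun p hp ↦ ?_, hQ1, hQ2,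
    hQ3, ?_⟩
  · simp only [primesTwoModThree, Finset.mem_filter, Finset.mem_Ioc] at hp
    exact ⟨hp.1.2.1, hp.2.1.le, hp.1.1.2⟩
  · calc (largeClass N ((N : ℝ) ^ η)).card * (N : ℝ) ^ (ζ - δ)
        ≤ (largeClass N ((N : ℝ) ^ η)).card * Z₀ := by gcongr; exact Nat.le_ceil _
      _ ≤ 12 * Q.card := by exact_mod_cast hQ4

end

section

open NumberField Filter

theorem coeffBound_le {N Z : ℕ} {ζ : ℝ} (hN : 3 ≤ N) (hZ : (Z : ℝ) ≤ (N : ℝ) ^ ζ) :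
    (coeffBound (N / 3) Z : ℝ) ≤ 9 * (N : ℝ) ^ (3 * ζ - 1 / 2) := by
  have hN0 : (0 : ℝ) < N := by exact_mod_cast (show 0 < N by omega)
  have h1 : coeffBound (N / 3) Z ^ 2 * (N / 3) ≤ 12 * Z ^ 6 :=
    (Nat.mul_le_mul_right _ (Nat.sqrt_le' _)).trans (Nat.div_mul_le_self _ _)
  have h2 : N ≤ 6 * (N / 3) := by omega
  have h3 : coeffBound (N / 3) Z ^ 2 * N ≤ 72 * Z ^ 6 :=
    (Nat.mul_le_mul_left _ h2).trans (by
      rw [show coeffBound (N / 3) Z ^ 2 * (6 * (N / 3)) =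
        6 * (coeffBound (N / 3) Z ^ 2 * (N / 3)) by ring]
      omega)
  have h4 : (coeffBound (N / 3) Z : ℝ) ^ 2 * N ≤ 72 * (Z : ℝ) ^ 6 := by exact_mod_cast h3
  have h5 : ((N : ℝ) ^ ζ) ^ 6 = ((N : ℝ) ^ (3 * ζ - 1 / 2)) ^ 2 * N := by
    rw [← Real.rpow_natCast, ← Real.rpow_natCast, ← Real.rpow_mul hN0.le, ← Real.rpow_mul hN0.le,
      ← Real.rpow_add_one hN0.ne']
    congr 1
    push_cast; ring
  have h6 : (Z : ℝ) ^ 6 ≤ ((N : ℝ) ^ (3 * ζ - 1 / 2)) ^ 2 * N := by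
    rw [← h5]; gcongr
  have h7 : (coeffBound (N / 3) Z : ℝ) ^ 2 ≤ (9 * (N : ℝ) ^ (3 * ζ - 1 / 2)) ^ 2 := by
    refine le_of_mul_le_mul_right ?_ hN0
    have : 0 ≤ ((N : ℝ) ^ (3 * ζ - 1 / 2)) ^ 2 * N := by positivity
    nlinarith
  exact (pow_le_pow_iff_left₀ (by positivity) (by positivity) two_ne_zero).1 h7

theorem two_mul_pow_mul_coeffBound_sq_le {N Z : ℕ} (hN : 24 ≤ N) (hZ : Z ≤ N) :
    2 * Z ^ 3 * coeffBound (N / 3) Z ^ 2 ≤ N ^ 10 := by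
  calc 2 * Z ^ 3 * coeffBound (N / 3) Z ^ 2 ≤ 2 * Z ^ 3 * (12 * Z ^ 6) := by
        gcongr
        exact (Nat.sqrt_le' _).trans (Nat.div_le_self _ _)
    _ = 24 * Z ^ 9 := by ring
    _ ≤ N * N ^ 9 := by gcongr
    _ = N ^ 10 := by ring

theorem coeffBound_sq_le {N Z : ℕ} (hN : 24 ≤ N) (hZ : Z ≤ N) :
    coeffBound (N / 3) Z ^ 2 ≤ N ^ 10 := by
  calc coeffBound (N / 3) Z ^ 2 ≤ 12 * Z ^ 6 := (Nat.sqrt_le' _).trans (Nat.div_le_self _ _)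
    _ ≤ N ^ 4 * N ^ 6 := by
        gcongr
        exact (show 12 ≤ N by omega).trans (Nat.le_self_pow (by norm_num) _)
    _ = N ^ 10 := by ring

theorem card_le_of_forall_prime_le {P : Finset ℕ} {Z : ℕ} (hP : ∀ p ∈ P, p.Prime ∧ p ≤ Z) :
    P.card ≤ Z := by
  have : P ⊆ Finset.Icc 1 Z := fun p hp ↦ Finset.mem_Icc.2 ⟨(hP p hp).1.pos, (hP p hp).2⟩
  simpa using Finset.card_le_card this

theorem eventually_card_largeClass_le_of_pairs {η δ κ : ℝ} (hδ : 0 < δ) (hδ' : 2 * δ ≤ η)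
    (hη : η < 1 / 2) (h1 : 1 - η + 12 * δ ≤ κ) (h2 : 3 / 2 - 4 * η + 12 * δ ≤ κ) :
    ∀ᶠ N : ℕ in atTop, ((largeClass N ((N : ℝ) ^ η)).card : ℝ) ≤ (N : ℝ) ^ κ := by
  filter_upwards [eventually_exists_pairs hδ hδ' hη,
    eventually_const_mul_rpow_le 41688 (show κ - δ < κ by linarith), eventually_ge_atTop 24]
    with N ⟨Z, Z₀, T, P, Q, hZ, hZ₀, hTN, hT, hP, hQ, hsq, hD, hcard⟩ hC hN
  set ζ := 1 / 2 - η + 2 * δ with hζ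
  have hN0 : (0 : ℝ) < N := by exact_mod_cast (show 0 < N by omega)
  have hN1 : (1 : ℝ) ≤ N := by exact_mod_cast (show 1 ≤ N by omega)
  have hZN : Z ≤ N := by
    have := hZ.trans (Real.rpow_le_rpow_of_exponent_le hN1 (show ζ ≤ 1 by linarith))
    rw [Real.rpow_one] at this
    exact_mod_cast this
  have hZ₀' : (0 : ℝ) < Z₀ := (Real.rpow_pos_of_pos hN0 _).trans_le hZ₀
  have hA := coeffBound_le (show 3 ≤ N by omega) hZ
  have hPc : (P.card : ℝ) ≤ (N : ℝ) ^ ζ := le_trans (by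
    exact_mod_cast card_le_of_forall_prime_le fun p hp ↦ ⟨(hP p hp).1, (hP p hp).2.2⟩) hZ
  have hQc := card_pairs_le (show 0 < N / 3 by omega) (by exact_mod_cast hZ₀') hP Q
    (fun x hx ↦ ⟨(hQ x hx).1, (hQ x hx).2.imp fun q h ↦ ⟨h.1, h.2.imp fun r h ↦ h.2.2⟩⟩) hD
    (T := T) (fun z hz ↦ hT _ (by
      rw [Finset.mem_Icc] at hz ⊢
      exact ⟨Nat.one_le_pow _ _ hz.1,
        (Nat.pow_le_pow_left hz.2 2).trans (coeffBound_sq_le hN hZN)⟩))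
  have hdiv : ((32 * (6 * N) / Z₀ ^ 3 : ℕ) : ℝ) ≤ 192 * (N : ℝ) ^ (1 - 3 * (ζ - δ)) := by
    refine Nat.cast_div_le.trans ?_
    rw [Nat.cast_pow, div_le_iff₀ (by positivity)]
    have h5 : ((N : ℝ) ^ (ζ - δ)) ^ 3 ≤ (Z₀ : ℝ) ^ 3 := by
      gcongr
      rwa [show ζ - δ = 1 / 2 - η + δ by rw [hζ]; ring]
    calc ((32 * (6 * N) : ℕ) : ℝ) = 192 * (N : ℝ) ^ (1 - 3 * (ζ - δ)) * ((N : ℝ) ^ (ζ - δ)) ^ 3 := by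
          rw [← Real.rpow_natCast, ← Real.rpow_mul hN0.le, mul_assoc, ← Real.rpow_add hN0]
          push_cast
          rw [show 1 - 3 * (ζ - δ) + (ζ - δ) * 3 = 1 by ring, Real.rpow_one]
          ring
      _ ≤ _ := by gcongr
  have hpos : (0 : ℝ) < (N : ℝ) ^ (1 / 2 - η + δ) := Real.rpow_pos_of_pos hN0 _
  refine le_of_mul_le_mul_right (hcard.trans ?_) hpos
  calc (12 : ℝ) * Q.card ≤ 12 * ((((32 * (6 * N) / Z₀ ^ 3 : ℕ) : ℝ) + 1) * T *
        (P.card * (P.card * (2 * coeffBound (N / 3) Z)))) := by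
        gcongr
        exact_mod_cast hQc
    _ ≤ 12 * ((192 * (N : ℝ) ^ (1 - 3 * (ζ - δ)) + 1) * (N : ℝ) ^ δ *
        ((N : ℝ) ^ ζ * ((N : ℝ) ^ ζ * (2 * (9 * (N : ℝ) ^ (3 * ζ - 1 / 2)))))) := by gcongr
    _ = (41472 * (N : ℝ) ^ (1 - η + 7 * δ) + 216 * (N : ℝ) ^ (3 / 2 - 4 * η + 10 * δ)) *
        (N : ℝ) ^ (1 / 2 - η + δ) := by
        have e1 : (N : ℝ) ^ (1 - 3 * (ζ - δ)) * (N : ℝ) ^ δ * (N : ℝ) ^ ζ * (N : ℝ) ^ ζ *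
            (N : ℝ) ^ (3 * ζ - 1 / 2) = (N : ℝ) ^ (1 - η + 7 * δ) * (N : ℝ) ^ (1 / 2 - η + δ) := by
          simp only [← Real.rpow_add hN0]
          congr 1
          rw [hζ]; ring
        have e2 : (N : ℝ) ^ δ * (N : ℝ) ^ ζ * (N : ℝ) ^ ζ * (N : ℝ) ^ (3 * ζ - 1 / 2) =
            (N : ℝ) ^ (3 / 2 - 4 * η + 10 * δ) * (N : ℝ) ^ (1 / 2 - η + δ) := by
          simp only [← Real.rpow_add hN0]
          congr 1
          rw [hζ]; ring
        linear_combination 41472 * e1 + 216 * e2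
    _ ≤ (41472 * (N : ℝ) ^ (κ - δ) + 216 * (N : ℝ) ^ (κ - δ)) * (N : ℝ) ^ (1 / 2 - η + δ) := by
        gcongr <;> first | exact hN1 | linarith
    _ ≤ (N : ℝ) ^ κ * (N : ℝ) ^ (1 / 2 - η + δ) := by
        gcongr
        linarith

theorem eventually_card_largeClass_le_of_triples {η δ κ : ℝ} (hδ : 0 < δ) (hδ' : 2 * δ ≤ η)
    (hη : η < 1 / 2) (h1 : 2 - 5 * η + 20 * δ ≤ κ) (h2 : 5 / 2 - 7 * η + 20 * δ ≤ κ) :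
    ∀ᶠ N : ℕ in atTop, ((largeClass N ((N : ℝ) ^ η)).card : ℝ) ≤ (N : ℝ) ^ κ ∧
      (1 - 3 * η + 6 * δ < 0 → largeClass N ((N : ℝ) ^ η) = ∅) := by
  have hzero : ∀ᶠ N : ℕ in atTop, 1 - 3 * η + 6 * δ < 0 →
      10 * (N : ℝ) ^ (1 - 3 * η + 6 * δ) ≤ (N : ℝ) ^ (0 : ℝ) := by
    by_cases h : 1 - 3 * η + 6 * δ < 0
    · filter_upwards [eventually_const_mul_rpow_le 10 h] with N hN _ using hN
    · exact Eventually.of_forall fun N h' ↦ absurd h' h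
  filter_upwards [eventually_exists_pairs hδ hδ' hη,
    eventually_const_mul_rpow_le 15552 (show κ - δ < κ by linarith), eventually_ge_atTop 24, hzero]
    with N ⟨Z, Z₀, T, P, Q, hZ, hZ₀, hTN, hT, hP, hQ, hsq, hD, hcard⟩ hC hN hz
  set ζ := 1 / 2 - η + 2 * δ with hζ
  have hN0 : (0 : ℝ) < N := by exact_mod_cast (show 0 < N by omega)
  have hN1 : (1 : ℝ) ≤ N := by exact_mod_cast (show 1 ≤ N by omega)
  have hZN : Z ≤ N := by
    have := hZ.trans (Real.rpow_le_rpow_of_exponent_le hN1 (show ζ ≤ 1 by linarith))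
    rw [Real.rpow_one] at this
    exact_mod_cast this
  have hA := coeffBound_le (show 3 ≤ N by omega) hZ
  have hP' : ∀ p ∈ P, p.Prime ∧ p ≤ Z := fun p hp ↦ ⟨(hP p hp).1, (hP p hp).2.2⟩
  have hPc : (P.card : ℝ) ≤ (N : ℝ) ^ ζ :=
    le_trans (by exact_mod_cast card_le_of_forall_prime_le hP') hZ
  have hQc := card_triples_le (show 0 < N / 3 by omega) hP' Q hQ hsq (fun x hx ↦ (hD x hx).1) hT
    (by
      calc 9 * Z ≤ N * N ^ 9 := Nat.mul_le_mul (by omega)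
            (hZN.trans (Nat.le_self_pow (by norm_num) _))
        _ = N ^ 10 := by ring) (two_mul_pow_mul_coeffBound_sq_le hN hZN)
  have hpos : (0 : ℝ) < (N : ℝ) ^ (1 / 2 - η + δ) := Real.rpow_pos_of_pos hN0 _
  constructor
  · refine le_of_mul_le_mul_right (hcard.trans ?_) hpos
    calc (12 : ℝ) * Q.card ≤ 12 * ((9 * Z * T + coeffBound (N / 3) Z) * (T ^ 2 * T *
          (P.card * (P.card * (2 * (2 * (2 * coeffBound (N / 3) Z))))))) := by
          gcongr
          exact_mod_cast hQc
      _ ≤ 12 * ((9 * (N : ℝ) ^ ζ * (N : ℝ) ^ δ + 9 * (N : ℝ) ^ (3 * ζ - 1 / 2)) *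
          (((N : ℝ) ^ δ) ^ 2 * (N : ℝ) ^ δ * ((N : ℝ) ^ ζ * ((N : ℝ) ^ ζ *
          (2 * (2 * (2 * (9 * (N : ℝ) ^ (3 * ζ - 1 / 2))))))))) := by gcongr
      _ = (7776 * (N : ℝ) ^ (2 - 5 * η + 15 * δ) + 7776 * (N : ℝ) ^ (5 / 2 - 7 * η + 18 * δ)) *
          (N : ℝ) ^ (1 / 2 - η + δ) := by
          have e1 : (N : ℝ) ^ ζ * (N : ℝ) ^ δ * (N : ℝ) ^ δ * (N : ℝ) ^ δ * (N : ℝ) ^ δ *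
              (N : ℝ) ^ ζ * (N : ℝ) ^ ζ * (N : ℝ) ^ (3 * ζ - 1 / 2) =
              (N : ℝ) ^ (2 - 5 * η + 15 * δ) * (N : ℝ) ^ (1 / 2 - η + δ) := by
            simp only [← Real.rpow_add hN0]
            congr 1
            rw [hζ]; ring
          have e2 : (N : ℝ) ^ (3 * ζ - 1 / 2) * (N : ℝ) ^ δ * (N : ℝ) ^ δ * (N : ℝ) ^ δ *
              (N : ℝ) ^ ζ * (N : ℝ) ^ ζ * (N : ℝ) ^ (3 * ζ - 1 / 2) =
              (N : ℝ) ^ (5 / 2 - 7 * η + 18 * δ) * (N : ℝ) ^ (1 / 2 - η + δ) := by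
            simp only [← Real.rpow_add hN0]
            congr 1
            rw [hζ]; ring
          linear_combination 7776 * e1 + 7776 * e2
      _ ≤ (7776 * (N : ℝ) ^ (κ - δ) + 7776 * (N : ℝ) ^ (κ - δ)) *
          (N : ℝ) ^ (1 / 2 - η + δ) := by
          gcongr <;> first | exact hN1 | linarith
      _ ≤ (N : ℝ) ^ κ * (N : ℝ) ^ (1 / 2 - η + δ) := by
          gcongr
          linarith
  · intro hneg
    have h3 := hz hneg
    rw [Real.rpow_zero] at h3
    have h4 : coeffBound (N / 3) Z = 0 := by
      rw [show 3 * ζ - 1 / 2 = 1 - 3 * η + 6 * δ by rw [hζ]; ring] at hA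
      have : (coeffBound (N / 3) Z : ℝ) < 1 := by
        have := Real.rpow_pos_of_pos hN0 (1 - 3 * η + 6 * δ)
        linarith
      exact Nat.lt_one_iff.1 (by exact_mod_cast this)
    rw [h4] at hQc
    simp only [mul_zero, Nat.le_zero] at hQc
    rw [hQc, Nat.cast_zero, mul_zero] at hcard
    have h5 : ((largeClass N ((N : ℝ) ^ η)).card : ℝ) ≤ 0 := by
      by_contra h
      push Not at h
      exact absurd (mul_pos h hpos) (not_lt.2 hcard)
    exact Finset.card_eq_zero.1 (Nat.le_zero.1 (by exact_mod_cast h5))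

end

section

open NumberField Filter

open Classical in
/-- The partial sums of `h₃(d) ^ 4` over squarefree `d`. -/
noncomputable def fourthMoment (n : ℕ) : ℝ :=
  ∑ d ∈ (Finset.range n).filter (fun d ↦ Squarefree d ∧ 1 < d), (hpos 3 d : ℝ) ^ 4

theorem fourthMoment_mono {m n : ℕ} (h : m ≤ n) : fourthMoment m ≤ fourthMoment n := by
  refine Finset.sum_le_sum_of_subset_of_nonneg
    (Finset.filter_subset_filter _ (Finset.range_mono h)) fun d _ _ ↦ by positivity

theorem pow_four_le_of_lt {N : ℕ} {η c : ℝ} {h : ℕ} (hc : 4 * η = c) (hh : (h : ℝ) < (N : ℝ) ^ η) :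
    (h : ℝ) ^ 4 ≤ (N : ℝ) ^ c := by
  rw [← hc, mul_comm, show (4 : ℝ) = ((4 : ℕ) : ℝ) by norm_num, Real.rpow_mul (Nat.cast_nonneg N),
    Real.rpow_natCast]
  gcongr

open Classical in
theorem fourthMoment_two_mul_le {N : ℕ} {a b c d e : ℝ}
    (he : largeClass N ((N : ℝ) ^ e) = ∅) :
    fourthMoment (2 * N) ≤ fourthMoment N + (N * (N : ℝ) ^ (4 * a) +
      (largeClass N ((N : ℝ) ^ a)).card * (N : ℝ) ^ (4 * b) +
      (largeClass N ((N : ℝ) ^ b)).card * (N : ℝ) ^ (4 * c) +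
      (largeClass N ((N : ℝ) ^ c)).card * (N : ℝ) ^ (4 * d) +
      (largeClass N ((N : ℝ) ^ d)).card * (N : ℝ) ^ (4 * e)) := by
  set S := (Finset.Ico N (2 * N)).filter (fun d ↦ Squarefree d ∧ 1 < d) with hS
  have hlarge : ∀ t : ℝ, largeClass N t = S.filter fun d ↦ t ≤ hpos 3 d := by
    intro t
    rw [hS, Finset.filter_filter, largeClass]
    simp only [and_assoc]
  have hsplit : fourthMoment (2 * N) = fourthMoment N + ∑ x ∈ S, (hpos 3 x : ℝ) ^ 4 := by
    rw [fourthMoment, fourthMoment, hS, Finset.sum_filter, Finset.sum_filter, Finset.sum_filter,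
      Finset.sum_range_add_sum_Ico _ (by omega)]
  have hScard : (S.card : ℝ) ≤ N := by
    have : S.card ≤ (Finset.Ico N (2 * N)).card := Finset.card_filter_le _ _
    rw [Nat.card_Ico] at this
    exact_mod_cast (show S.card ≤ N by omega)
  have hcard : ∀ t u : ℝ, (largeClass N t).card * u =
      ∑ x ∈ S, if t ≤ hpos 3 x then u else 0 := by
    intro t u
    rw [hlarge, ← Finset.sum_filter, Finset.sum_const, nsmul_eq_mul]
  rw [hsplit]
  have hN : (S.card : ℝ) * (N : ℝ) ^ (4 * a) ≤ N * (N : ℝ) ^ (4 * a) := by gcongr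
  have hmain : ∑ x ∈ S, (hpos 3 x : ℝ) ^ 4 ≤ S.card * (N : ℝ) ^ (4 * a) +
      (largeClass N ((N : ℝ) ^ a)).card * (N : ℝ) ^ (4 * b) +
      (largeClass N ((N : ℝ) ^ b)).card * (N : ℝ) ^ (4 * c) +
      (largeClass N ((N : ℝ) ^ c)).card * (N : ℝ) ^ (4 * d) +
      (largeClass N ((N : ℝ) ^ d)).card * (N : ℝ) ^ (4 * e) := by
    rw [hcard, hcard, hcard, hcard, ← nsmul_eq_mul, ← Finset.sum_const, ← Finset.sum_add_distrib,
      ← Finset.sum_add_distrib, ← Finset.sum_add_distrib, ← Finset.sum_add_distrib]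
    refine Finset.sum_le_sum fun x hx ↦ ?_
    have hnn : ∀ t u : ℝ, 0 ≤ if t ≤ (hpos 3 x : ℝ) then (N : ℝ) ^ u else 0 := by
      intro t u
      split_ifs <;> positivity
    have hpos1 : (0 : ℝ) ≤ (N : ℝ) ^ (4 * a) := by positivity
    have n1 := hnn ((N : ℝ) ^ a) (4 * b)
    have n2 := hnn ((N : ℝ) ^ b) (4 * c)
    have n3 := hnn ((N : ℝ) ^ c) (4 * d)
    have n4 := hnn ((N : ℝ) ^ d) (4 * e)
    have hlt : (hpos 3 x : ℝ) < (N : ℝ) ^ e := by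
      by_contra hge
      push Not at hge
      have : x ∈ largeClass N ((N : ℝ) ^ e) := by
        rw [hlarge]; exact Finset.mem_filter.2 ⟨hx, hge⟩
      rw [he] at this
      exact Finset.notMem_empty _ this
    by_cases h1 : (hpos 3 x : ℝ) < (N : ℝ) ^ a
    · have := pow_four_le_of_lt rfl h1
      linarith
    by_cases h2 : (hpos 3 x : ℝ) < (N : ℝ) ^ b
    · have := pow_four_le_of_lt rfl h2
      rw [if_pos (not_lt.1 h1)] at n1 ⊢
      linarith
    by_cases h3 : (hpos 3 x : ℝ) < (N : ℝ) ^ c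
    · have := pow_four_le_of_lt rfl h3
      rw [if_pos (not_lt.1 h2)] at n2 ⊢
      linarith
    by_cases h4 : (hpos 3 x : ℝ) < (N : ℝ) ^ d
    · have := pow_four_le_of_lt rfl h4
      rw [if_pos (not_lt.1 h3)] at n3 ⊢
      linarith
    · have := pow_four_le_of_lt rfl hlt
      rw [if_pos (not_lt.1 h4)] at n4 ⊢
      linarith
  linarith

theorem mul_rpow_le_of_le {N : ℕ} (hN : 1 ≤ N) {x κ c μ : ℝ} (hx : x ≤ (N : ℝ) ^ κ)
    (h : κ + c ≤ μ) : x * (N : ℝ) ^ c ≤ (N : ℝ) ^ μ := by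
  have hN1 : (1 : ℝ) ≤ N := by exact_mod_cast hN
  calc x * (N : ℝ) ^ c ≤ (N : ℝ) ^ κ * (N : ℝ) ^ c := by gcongr
    _ = (N : ℝ) ^ (κ + c) := (Real.rpow_add (by linarith) _ _).symm
    _ ≤ _ := Real.rpow_le_rpow_of_exponent_le hN1 h

theorem eventually_fourthMoment_two_mul_le :
    ∀ᶠ N : ℕ in atTop, fourthMoment (2 * N) ≤ fourthMoment N + 5 * (N : ℝ) ^ (11 / 6 : ℝ) := by
  have hδ : (0 : ℝ) < 1 / 100000 := by norm_num
  filter_upwards [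
    eventually_card_largeClass_le_of_pairs (η := 207 / 1000) (κ := 794 / 1000) hδ
      (by norm_num) (by norm_num) (by norm_num) (by norm_num),
    eventually_card_largeClass_le_of_triples (η := 259 / 1000) (κ := 706 / 1000) hδ
      (by norm_num) (by norm_num) (by norm_num) (by norm_num),
    eventually_card_largeClass_le_of_triples (η := 281 / 1000) (κ := 596 / 1000) hδ
      (by norm_num) (by norm_num) (by norm_num) (by norm_num),
    eventually_card_largeClass_le_of_triples (η := 308 / 1000) (κ := 461 / 1000) hδ
      (by norm_num) (by norm_num) (by norm_num) (by norm_num),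
    eventually_card_largeClass_le_of_triples (η := 342 / 1000) (κ := 1) hδ
      (by norm_num) (by norm_num) (by norm_num) (by norm_num), eventually_ge_atTop 1]
    with N h1 h2 h3 h4 h5 hN
  refine (fourthMoment_two_mul_le (a := 207 / 1000) (b := 259 / 1000) (c := 281 / 1000)
    (d := 308 / 1000) (h5.2 (by norm_num))).trans ?_
  have k0 := mul_rpow_le_of_le hN (Real.rpow_one (N : ℝ)).ge
    (show (1 : ℝ) + 4 * (207 / 1000) ≤ 11 / 6 by norm_num)
  have k1 := mul_rpow_le_of_le hN h1 (show (794 / 1000 : ℝ) + 4 * (259 / 1000) ≤ 11 / 6 by norm_num)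
  have k2 := mul_rpow_le_of_le hN h2.1
    (show (706 / 1000 : ℝ) + 4 * (281 / 1000) ≤ 11 / 6 by norm_num)
  have k3 := mul_rpow_le_of_le hN h3.1
    (show (596 / 1000 : ℝ) + 4 * (308 / 1000) ≤ 11 / 6 by norm_num)
  have k4 := mul_rpow_le_of_le hN h4.1
    (show (461 / 1000 : ℝ) + 4 * (342 / 1000) ≤ 11 / 6 by norm_num)
  linarith

theorem exists_fourthMoment_le :
    ∃ C : ℝ, 0 ≤ C ∧ ∀ n : ℕ, fourthMoment n ≤ C + 10 * (n : ℝ) ^ (11 / 6 : ℝ) := by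
  obtain ⟨N₀, hN₀⟩ := eventually_atTop.1 eventually_fourthMoment_two_mul_le
  refine ⟨fourthMoment (2 * N₀ + 3), Finset.sum_nonneg fun d _ ↦ by positivity, fun n ↦ ?_⟩
  induction n using Nat.strong_induction_on with
  | _ n ih =>
  rcases le_or_gt n (2 * N₀ + 3) with h | h
  · have : (0 : ℝ) ≤ (n : ℝ) ^ (11 / 6 : ℝ) := by positivity
    have := fourthMoment_mono h
    linarith
  · have h1 := fourthMoment_mono (show n ≤ 2 * ((n + 1) / 2) by omega)
    have h2 := hN₀ ((n + 1) / 2) (by omega)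
    have h3 := ih ((n + 1) / 2) (by omega)
    have h4 : (((n + 1) / 2 : ℕ) : ℝ) ≤ 2 / 3 * n := by
      have : 3 * ((n + 1) / 2) ≤ 2 * n := by omega
      have : (3 * ((n + 1) / 2 : ℕ) : ℝ) ≤ 2 * n := by exact_mod_cast this
      linarith
    have h5 : (((n + 1) / 2 : ℕ) : ℝ) ^ (11 / 6 : ℝ) ≤ 2 / 3 * (n : ℝ) ^ (11 / 6 : ℝ) := by
      calc (((n + 1) / 2 : ℕ) : ℝ) ^ (11 / 6 : ℝ) ≤ (2 / 3 * (n : ℝ)) ^ (11 / 6 : ℝ) := by gcongr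
        _ = (2 / 3 : ℝ) ^ (11 / 6 : ℝ) * (n : ℝ) ^ (11 / 6 : ℝ) :=
            Real.mul_rpow (by norm_num) (by positivity)
        _ ≤ (2 / 3 : ℝ) ^ (1 : ℝ) * (n : ℝ) ^ (11 / 6 : ℝ) := by
            gcongr ?_ * _
            exact Real.rpow_le_rpow_of_exponent_ge (by norm_num) (by norm_num) (by norm_num)
        _ = _ := by rw [Real.rpow_one]
    linarith

end

/-- For every `ε > 0` there is `C = C(ε)` such that for all `X ≥ 2`,
`∑_{1 < d < X, d squarefree} h_3(d)^4 ≤ C · X^(11/6 + ε)`. -/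
theorem fourth_moment_h3_real_bound (ε : ℝ) (hε : 0 < ε) :
    ∃ C : ℝ, 0 < C ∧ ∀ X : ℝ, 2 ≤ X →
      ∑ d ∈ (Finset.range (⌈X⌉₊ + 1)).filter
          (fun d : ℕ => Squarefree d ∧ 1 < d ∧ (d : ℝ) < X),
        (hpos 3 d : ℝ) ^ 4
      ≤ C * X ^ ((11 : ℝ) / 6 + ε) := by
  obtain ⟨C, hC, h⟩ := exists_fourthMoment_le
  refine ⟨C + 40, by linarith, fun X hX ↦ ?_⟩
  have h1 : ∑ d ∈ (Finset.range (⌈X⌉₊ + 1)).filter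
      (fun d : ℕ => Squarefree d ∧ 1 < d ∧ (d : ℝ) < X), (hpos 3 d : ℝ) ^ 4 ≤
      fourthMoment ⌈X⌉₊ := by
    refine Finset.sum_le_sum_of_subset_of_nonneg (fun d hd ↦ ?_) fun d _ _ ↦ by positivity
    obtain ⟨-, h2, h3, h4⟩ := Finset.mem_filter.1 hd
    exact Finset.mem_filter.2 ⟨Finset.mem_range.2 (Nat.lt_ceil.2 h4), h2, h3⟩
  have h2 : (⌈X⌉₊ : ℝ) ^ (11 / 6 : ℝ) ≤ 4 * X ^ (11 / 6 : ℝ) := by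
    have h3 : (⌈X⌉₊ : ℝ) ≤ 2 * X := by
      have := (Nat.ceil_lt_add_one (show 0 ≤ X by linarith)).le
      linarith
    calc (⌈X⌉₊ : ℝ) ^ (11 / 6 : ℝ) ≤ (2 * X) ^ (11 / 6 : ℝ) := by gcongr
      _ = 2 ^ (11 / 6 : ℝ) * X ^ (11 / 6 : ℝ) := Real.mul_rpow (by norm_num) (by linarith)
      _ ≤ 2 ^ (2 : ℝ) * X ^ (11 / 6 : ℝ) := by gcongr <;> norm_num
      _ = 4 * X ^ (11 / 6 : ℝ) := by norm_num
  have h3 : X ^ (11 / 6 : ℝ) ≤ X ^ (11 / 6 + ε) :=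
    Real.rpow_le_rpow_of_exponent_le (by linarith) (by linarith)
  have h4 : (1 : ℝ) ≤ X ^ (11 / 6 + ε) := Real.one_le_rpow (by linarith) (by linarith)
  nlinarith [h ⌈X⌉₊]
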